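/- Let d ≥ 1, p ∈ (1,2], let L = (1/2)∑_{i,j} a_{ij}(x) ∂²/∂x_i∂x_j + ∑_i b_i(x) ∂/∂x_i with a_{ij}, b_i locally Hölder continuous, a symmetric and strictly elliptic, let α : ℝ^d → ℝ be locally Hölder continuous with α > 0, and let β₁, β₂ : ℝ^d → ℝ be locally Hölder continuous, each bounded from above, with sup_{x∈ℝ^d} |β₁(x) − β₂(x)| < ∞. Then the only nonnegative classical solution of u_t = Lu + β₁(x)u − α(x)u^p on ℝ^d × (0,∞) with u(·,0) = 0 is u ≡ 0 if and only if the only nonnegative classical solution of u_t = Lu + β₂(x)u − α(x)u^p on ℝ^d × (0,∞) with u(·,0) = 0 is u ≡ 0. -/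

import Mathlib

open Set

/-- The `i`-th partial derivative of a function on `ℝ^d`. -/
noncomputable def pd {d : ℕ} (i : Fin d) (f : EuclideanSpace ℝ (Fin d) → ℝ)
    (x : EuclideanSpace ℝ (Fin d)) : ℝ :=
  fderiv ℝ f x (EuclideanSpace.single i 1)

/-- `f` is locally Hölder continuous. -/
def LocHolder {d : ℕ} (f : EuclideanSpace ℝ (Fin d) → ℝ) : Prop :=
  ∀ K : Set (EuclideanSpace ℝ (Fin d)), IsCompact K →
    ∃ κ C : ℝ, 0 < κ ∧ κ ≤ 1 ∧ 0 ≤ C ∧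
      ∀ x ∈ K, ∀ y ∈ K, |f x - f y| ≤ C * ‖x - y‖ ^ κ

/-- The only nonnegative classical solution of `u_t = Lu + βu − αu^p` with zero
initial data (where `L = (1/2)∑ a_{ij}∂_i∂_j + ∑ b_i ∂_i`) is `u ≡ 0`. -/
def UniqueZeroSol {d : ℕ} (a : Fin d → Fin d → EuclideanSpace ℝ (Fin d) → ℝ)
    (b : Fin d → EuclideanSpace ℝ (Fin d) → ℝ)
    (β α : EuclideanSpace ℝ (Fin d) → ℝ) (p : ℝ) : Prop :=
  ∀ u : EuclideanSpace ℝ (Fin d) → ℝ → ℝ,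
    ContinuousOn (fun q : EuclideanSpace ℝ (Fin d) × ℝ => u q.1 q.2)
      (univ ×ˢ Ici (0 : ℝ)) →
    (∀ x t, 0 ≤ t → 0 ≤ u x t) →
    (∀ t : ℝ, 0 < t → ContDiff ℝ 2 (fun x => u x t)) →
    (∀ x, ContDiffOn ℝ 1 (fun s => u x s) (Ioi (0 : ℝ))) →
    (∀ x t, 0 < t →
      deriv (fun s => u x s) t =
        (1 / 2) * ∑ i, ∑ j, a i j x * pd i (pd j (fun y => u y t)) x
          + ∑ i, b i x * pd i (fun y => u y t) x
          + β x * u x t - α x * u x t ^ p) →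
    (∀ x, u x 0 = 0) →
    ∀ x t, 0 ≤ t → u x t = 0

section Calculus

open Filter Topology Metric

variable {E : Type*} [NormedAddCommGroup E] [NormedSpace ℝ E]

theorem norm_bilin_le_of_ball {H : E →L[ℝ] E →L[ℝ] ℝ} {h B : ℝ} (hh : 0 < h) (hB : 0 ≤ B)
    (H1 : ∀ v w, ‖v‖ ≤ h → ‖w‖ ≤ h → |H v w| ≤ B) : ‖H‖ ≤ B / h ^ 2 := by
  have scale : ∀ v : E, v ≠ 0 → ‖(h / ‖v‖) • v‖ ≤ h := by
    intro v hv
    have : 0 < ‖v‖ := norm_pos_iff.2 hv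
    rw [norm_smul, Real.norm_of_nonneg (by positivity)]
    field_simp
    rfl
  refine ContinuousLinearMap.opNorm_le_bound _ (by positivity) fun v => ?_
  refine ContinuousLinearMap.opNorm_le_bound _ (by positivity) fun w => ?_
  by_cases hv : v = 0
  · subst hv; simp
  by_cases hw : w = 0
  · subst hw; simp
  have hv' : 0 < ‖v‖ := norm_pos_iff.2 hv
  have hw' : 0 < ‖w‖ := norm_pos_iff.2 hw
  have := H1 _ _ (scale v hv) (scale w hw)
  simp only [map_smul, smul_apply, smul_eq_mul, abs_mul] at this
  rw [abs_of_pos (by positivity : 0 < h / ‖v‖), abs_of_pos (by positivity : 0 < h / ‖w‖)] at this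
  rw [Real.norm_eq_abs]
  have e : |H v w| = (h / ‖w‖ * (h / ‖v‖ * |H v w|)) * (‖v‖ * ‖w‖ / h ^ 2) := by
    field_simp
  rw [e]
  calc _ ≤ B * (‖v‖ * ‖w‖ / h ^ 2) := by
        refine mul_le_mul_of_nonneg_right ?_ (by positivity)
        linarith
    _ = _ := by ring

theorem second_difference_sub_le {φ : E → ℝ} (hφ : ContDiff ℝ 2 φ) {x v w : E} {h N : ℝ}
    (hv : ‖v‖ ≤ h) (hw : ‖w‖ ≤ h)
    (hN : ∀ y ∈ closedBall x (2 * h),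
      ‖fderiv ℝ (fderiv ℝ φ) y - fderiv ℝ (fderiv ℝ φ) x‖ ≤ N) :
    |φ (x + v + w) - φ (x + v) - φ (x + w) + φ x - fderiv ℝ (fderiv ℝ φ) x w v|
      ≤ N * ‖w‖ * ‖v‖ := by
  have hd : Differentiable ℝ φ := hφ.differentiable (by norm_num)
  have hd2 : Differentiable ℝ (fderiv ℝ φ) :=
    (hφ.fderiv_right (m := 1) (by norm_num)).differentiable (by norm_num)
  set H := fderiv ℝ (fderiv ℝ φ) x with hH
  have step1 : ∀ z ∈ closedBall x h, ‖fderiv ℝ φ (z + w) - fderiv ℝ φ z - H w‖ ≤ N * ‖w‖ := by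
    intro z hz
    have key := (convex_closedBall x (2 * h)).norm_image_sub_le_of_norm_hasFDerivWithin_le'
      (f := fderiv ℝ φ) (f' := fun y => fderiv ℝ (fderiv ℝ φ) y) (φ := H) (C := N)
      (x := z) (y := z + w)
      (fun y _ => (hd2 y).hasFDerivAt.hasFDerivWithinAt) hN ?_ ?_
    · simpa using key
    · rw [mem_closedBall] at hz ⊢
      linarith [(norm_nonneg v).trans hv]
    · rw [mem_closedBall, dist_eq_norm] at hz ⊢
      calc ‖z + w - x‖ = ‖(z - x) + w‖ := by congr 1; abel
        _ ≤ ‖z - x‖ + ‖w‖ := norm_add_le _ _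
        _ ≤ _ := by linarith
  have h0 : 0 ≤ h := (norm_nonneg v).trans hv
  have key := (convex_closedBall x h).norm_image_sub_le_of_norm_hasFDerivWithin_le
      (f := fun z => φ (z + w) - φ z - H w z)
      (f' := fun z => fderiv ℝ φ (z + w) - fderiv ℝ φ z - H w) (C := N * ‖w‖)
      (x := x) (y := x + v)
      (fun y _ => by
        refine HasFDerivAt.hasFDerivWithinAt ?_
        refine ((HasFDerivAt.sub ?_ (hd y).hasFDerivAt).sub (H w).hasFDerivAt)
        exact (hasFDerivAt_comp_add_right w).2 (hd (y + w)).hasFDerivAt) step1 ?_ ?_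
  · simp only [Real.norm_eq_abs, map_add] at key
    rw [show x + v - x = v by abel] at key
    convert key using 2
    ring
  · simpa using h0
  · simpa [mem_closedBall, dist_eq_norm] using hv

theorem norm_fderiv_fderiv_le {φ : E → ℝ} (hφ : ContDiff ℝ 2 φ) {x : E} {h M N : ℝ} (hh : 0 < h)
    (hN : ∀ y ∈ closedBall x (2 * h),
      ‖fderiv ℝ (fderiv ℝ φ) y - fderiv ℝ (fderiv ℝ φ) x‖ ≤ N)
    (hM : ∀ y ∈ closedBall x (2 * h), |φ y| ≤ M) :
    ‖fderiv ℝ (fderiv ℝ φ) x‖ ≤ 4 * M / h ^ 2 + N := by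
  have hN0 : 0 ≤ N := by
    have := hN x (by simp [hh.le])
    exact (ContinuousLinearMap.opNorm_nonneg _).trans this
  have hM0 : 0 ≤ M := (abs_nonneg _).trans (hM x (by simp [hh.le]))
  have := norm_bilin_le_of_ball (H := fderiv ℝ (fderiv ℝ φ) x) (B := 4 * M + N * h ^ 2) hh
    (by positivity) ?_
  · calc _ ≤ _ := this
      _ = _ := by field_simp
  intro w v hw hv
  have h1 := second_difference_sub_le hφ hv hw hN
  have m1 : |φ (x + v + w)| ≤ M := hM _ (by
    rw [mem_closedBall, dist_eq_norm, show x + v + w - x = v + w by abel]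
    linarith [norm_add_le v w])
  have m2 : |φ (x + v)| ≤ M := hM _ (by
    rw [mem_closedBall, dist_eq_norm, show x + v - x = v by abel]; linarith)
  have m3 : |φ (x + w)| ≤ M := hM _ (by
    rw [mem_closedBall, dist_eq_norm, show x + w - x = w by abel]; linarith)
  have m4 : |φ x| ≤ M := hM _ (by simp [hh.le])
  have h2 : N * ‖w‖ * ‖v‖ ≤ N * h ^ 2 := by
    rw [sq, ← mul_assoc]; gcongr
  rw [abs_le] at *
  constructor <;> linarith [h1.1, h1.2, m1.1, m1.2, m2.1, m2.2, m3.1, m3.2, m4.1, m4.2]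

theorem norm_fderiv_le_of_bounds {φ : E → ℝ} (hφ : ContDiff ℝ 2 φ) {x : E} {h M S : ℝ} (hh : 0 < h)
    (hS : ∀ y ∈ closedBall x h, ‖fderiv ℝ (fderiv ℝ φ) y‖ ≤ S)
    (hM : ∀ y ∈ closedBall x h, |φ y| ≤ M) :
    ‖fderiv ℝ φ x‖ ≤ 2 * M / h + h * S := by
  have hd : Differentiable ℝ φ := hφ.differentiable (by norm_num)
  have hd2 : Differentiable ℝ (fderiv ℝ φ) :=
    (hφ.fderiv_right (m := 1) (by norm_num)).differentiable (by norm_num)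
  have hS0 : 0 ≤ S := by
    have := hS x (by simp [hh.le])
    exact (ContinuousLinearMap.opNorm_nonneg _).trans this
  have hM0 : 0 ≤ M := (abs_nonneg _).trans (hM x (by simp [hh.le]))
  have bound : ∀ v : E, ‖v‖ ≤ h → |fderiv ℝ φ x v| ≤ 2 * M + S * h ^ 2 := by
    intro v hv
    have step : ∀ y ∈ closedBall x h, ‖fderiv ℝ φ y - fderiv ℝ φ x‖ ≤ S * h := by
      intro y hy
      have := (convex_closedBall x h).norm_image_sub_le_of_norm_hasFDerivWithin_le
        (f := fderiv ℝ φ) (fun y _ => (hd2 y).hasFDerivAt.hasFDerivWithinAt) hS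
        (x := x) (y := y) (by simp [hh.le]) hy
      rw [mem_closedBall, dist_eq_norm] at hy
      exact this.trans (by gcongr)
    have := (convex_closedBall x h).norm_image_sub_le_of_norm_hasFDerivWithin_le'
        (f := φ) (φ := fderiv ℝ φ x) (fun y _ => (hd y).hasFDerivAt.hasFDerivWithinAt) step
        (x := x) (y := x + v) (by simp [hh.le])
        (by simpa [mem_closedBall, dist_eq_norm] using hv)
    rw [show x + v - x = v by abel, Real.norm_eq_abs] at this
    have m2 : |φ (x + v)| ≤ M := hM _ (by
      rw [mem_closedBall, dist_eq_norm, show x + v - x = v by abel]; linarith)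
    have m4 : |φ x| ≤ M := hM _ (by simp [hh.le])
    have h2 : S * h * ‖v‖ ≤ S * h ^ 2 := by
      rw [sq, ← mul_assoc]; gcongr
    rw [abs_le] at *
    constructor <;> linarith [this.1, this.2, m2.1, m2.2, m4.1, m4.2]
  refine ContinuousLinearMap.opNorm_le_bound _ (by positivity) fun v => ?_
  by_cases hv : v = 0
  · subst hv; simp
  have hv' : 0 < ‖v‖ := norm_pos_iff.2 hv
  have := bound ((h / ‖v‖) • v) (by
    rw [norm_smul, Real.norm_of_nonneg (by positivity)]; field_simp; rfl)
  rw [map_smul, smul_eq_mul, abs_mul, abs_of_pos (by positivity : 0 < h / ‖v‖)] at this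
  rw [Real.norm_eq_abs]
  have e : |fderiv ℝ φ x v| = (h / ‖v‖ * |fderiv ℝ φ x v|) * (‖v‖ / h) := by field_simp
  rw [e]
  calc _ ≤ (2 * M + S * h ^ 2) * (‖v‖ / h) := by gcongr
    _ = _ := by field_simp

end Calculus

section Ultralimit

open Filter Topology Metric

theorem exists_ultralimit {ι F : Type*} [NormedAddCommGroup F] [ProperSpace F]
    (l : Ultrafilter ι) {g : ι → F} {N : ℝ} (h : ∀ᶠ n in (l : Filter ι), ‖g n‖ ≤ N) :
    ∃ x, Tendsto g l (𝓝 x) := by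
  obtain ⟨x, -, hx⟩ := (isCompact_closedBall (0 : F) N).ultrafilter_le_nhds' (l.map g) (by
    refine Ultrafilter.mem_map.2 (Filter.mem_of_superset h fun n hn => ?_)
    simpa using hn)
  exact ⟨x, hx⟩

variable {E : Type*} [NormedAddCommGroup E] [NormedSpace ℝ E]
  {F : Type*} [NormedAddCommGroup F] [NormedSpace ℝ F]

theorem norm_sub_fderiv_le {f : E → F} (hf : Differentiable ℝ f) {U : Set E} (hU : Convex ℝ U)
    {N κ : ℝ} (hN : 0 ≤ N) (hκ : 0 ≤ κ)
    (h : ∀ x ∈ U, ∀ y ∈ U, ‖fderiv ℝ f x - fderiv ℝ f y‖ ≤ N * ‖x - y‖ ^ κ)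
    {x y : E} (hx : x ∈ U) (hy : y ∈ U) :
    ‖f y - f x - fderiv ℝ f x (y - x)‖ ≤ N * ‖y - x‖ ^ κ * ‖y - x‖ := by
  refine (convex_segment x y).norm_image_sub_le_of_norm_hasFDerivWithin_le'
    (f := f) (φ := fderiv ℝ f x) (fun z _ => (hf z).hasFDerivAt.hasFDerivWithinAt) ?_
    (left_mem_segment ℝ x y) (right_mem_segment ℝ x y)
  intro z hz
  refine (h z (hU.segment_subset hx hy hz) x hx).trans ?_
  have : ‖z - x‖ ≤ ‖y - x‖ := by
    obtain ⟨s, t, hs, ht, hst, rfl⟩ := hz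
    have : s • x + t • y - x = t • (y - x) := by
      rw [eq_sub_of_add_eq hst, sub_smul, one_smul, smul_sub]; abel
    rw [this, norm_smul, Real.norm_of_nonneg ht]
    exact mul_le_of_le_one_left (norm_nonneg _) (by linarith)
  gcongr

theorem hasFDerivAt_of_rpow_bound {f : E → F} {A : E →L[ℝ] F} {x : E} {U : Set E} (hU : U ∈ 𝓝 x)
    {N κ : ℝ} (hκ : 0 < κ) (h : ∀ y ∈ U, ‖f y - f x - A (y - x)‖ ≤ N * ‖y - x‖ ^ κ * ‖y - x‖) :
    HasFDerivAt f A x := by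
  rw [hasFDerivAt_iff_isLittleO, Asymptotics.isLittleO_iff]
  intro c hc
  have hlim : Tendsto (fun y => N * ‖y - x‖ ^ κ) (𝓝 x) (𝓝 0) := by
    have : ContinuousAt (fun y => N * ‖y - x‖ ^ κ) x := by
      refine continuousAt_const.mul (ContinuousAt.rpow_const (by fun_prop) (Or.inr hκ.le))
    simpa [ContinuousAt, Real.zero_rpow hκ.ne'] using this
  filter_upwards [hU, hlim.eventually (gt_mem_nhds hc)] with y hy hy2
  exact (h y hy).trans (by gcongr)

theorem ultralimit_hasFDerivAt {ι : Type*} (l : Ultrafilter ι) {f : ι → E → F} {g : E → F}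
    {g' : E → E →L[ℝ] F} {U : Set E} (hU : IsOpen U) (hUc : Convex ℝ U)
    {N κ : ℝ} (hN : 0 ≤ N) (hκ : 0 < κ)
    (hf : ∀ᶠ n in (l : Filter ι), Differentiable ℝ (f n) ∧
      ∀ x ∈ U, ∀ y ∈ U, ‖fderiv ℝ (f n) x - fderiv ℝ (f n) y‖ ≤ N * ‖x - y‖ ^ κ)
    (hg : ∀ x ∈ U, Tendsto (fun n => f n x) l (𝓝 (g x)))
    (hg' : ∀ x ∈ U, Tendsto (fun n => fderiv ℝ (f n) x) l (𝓝 (g' x)))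
    {x : E} (hx : x ∈ U) : HasFDerivAt g (g' x) x := by
  refine hasFDerivAt_of_rpow_bound (N := N) (hU.mem_nhds hx) hκ fun y hy => ?_
  have lim : Tendsto (fun n => ‖f n y - f n x - fderiv ℝ (f n) x (y - x)‖) l
      (𝓝 ‖g y - g x - g' x (y - x)‖) := by
    refine (((hg y hy).sub (hg x hx)).sub ?_).norm
    exact ((ContinuousLinearMap.apply ℝ F (y - x)).continuous.tendsto _).comp (hg' x hx)
  refine le_of_tendsto lim ?_
  filter_upwards [hf] with n hn
  exact norm_sub_fderiv_le hn.1 hUc hN hκ.le hn.2 hx hy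

theorem ultralimit_contDiffAt [FiniteDimensional ℝ E] {ι : Type*} (l : Ultrafilter ι)
    {φ : ι → E → ℝ} {g : E → ℝ}
    {U : Set E} (hU : IsOpen U) (hUc : Convex ℝ U) {N κ : ℝ} (hN : 0 ≤ N) (hκ : 0 < κ)
    (hf : ∀ᶠ n in (l : Filter ι), ContDiff ℝ 2 (φ n) ∧
      (∀ x ∈ U, ‖fderiv ℝ (φ n) x‖ ≤ N) ∧ (∀ x ∈ U, ‖fderiv ℝ (fderiv ℝ (φ n)) x‖ ≤ N) ∧
      ∀ x ∈ U, ∀ y ∈ U,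
        ‖fderiv ℝ (fderiv ℝ (φ n)) x - fderiv ℝ (fderiv ℝ (φ n)) y‖ ≤ N * ‖x - y‖ ^ κ)
    (hg : ∀ x ∈ U, Tendsto (fun n => φ n x) l (𝓝 (g x))) {x : E} (hx : x ∈ U) :
    ContDiffAt ℝ 2 g x ∧ Tendsto (fun n => fderiv ℝ (φ n) x) l (𝓝 (fderiv ℝ g x)) ∧
      Tendsto (fun n => fderiv ℝ (fderiv ℝ (φ n)) x) l (𝓝 (fderiv ℝ (fderiv ℝ g) x)) := by
  have hp : ∀ x ∈ U, ∃ p, Tendsto (fun n => fderiv ℝ (φ n) x) l (𝓝 p) := fun x hx => by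
    have : ProperSpace (E →L[ℝ] ℝ) := FiniteDimensional.proper ℝ _
    exact exists_ultralimit l (hf.mono fun n hn => hn.2.1 x hx)
  have hH : ∀ x ∈ U, ∃ p, Tendsto (fun n => fderiv ℝ (fderiv ℝ (φ n)) x) l (𝓝 p) := fun x hx => by
    have : ProperSpace (E →L[ℝ] E →L[ℝ] ℝ) :=
      FiniteDimensional.proper ℝ (E →L[ℝ] E →L[ℝ] ℝ)
    exact exists_ultralimit (F := E →L[ℝ] E →L[ℝ] ℝ) (g := fun n => fderiv ℝ (fderiv ℝ (φ n)) x)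
      (N := N) l (hf.mono fun n hn => hn.2.2.1 x hx)
  choose! p hp using hp
  choose! H hH using hH
  have d1 : ∀ x ∈ U, HasFDerivAt g (p x) x := fun x hx => by
    refine ultralimit_hasFDerivAt l hU hUc hN one_pos (hf.mono fun n hn => ?_) hg hp hx
    have hd2 : Differentiable ℝ (fderiv ℝ (φ n)) :=
      (hn.1.fderiv_right (m := 1) (by norm_num)).differentiable (by norm_num)
    refine ⟨hn.1.differentiable (by norm_num), fun a ha b hb => ?_⟩
    rw [Real.rpow_one]
    exact hUc.norm_image_sub_le_of_norm_hasFDerivWithin_le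
      (fun z _ => (hd2 z).hasFDerivAt.hasFDerivWithinAt) hn.2.2.1 hb ha
  have d2 : ∀ x ∈ U, HasFDerivAt p (H x) x := fun x hx => by
    refine ultralimit_hasFDerivAt l hU hUc hN hκ (hf.mono fun n hn => ?_) hp hH hx
    exact ⟨(hn.1.fderiv_right (m := 1) (by norm_num)).differentiable (by norm_num), hn.2.2.2⟩
  have hH' : ∀ x ∈ U, ∀ y ∈ U, ‖H x - H y‖ ≤ N * ‖x - y‖ ^ κ := fun x hx y hy =>
    le_of_tendsto (Tendsto.norm (E := E →L[ℝ] E →L[ℝ] ℝ) ((hH x hx).sub (hH y hy))) (hf.mono fun n hn => hn.2.2.2 x hx y hy)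
  have cH : ContinuousOn H U := by
    intro x hx
    have hlim : Tendsto (fun y => N * ‖y - x‖ ^ κ) (𝓝[U] x) (𝓝 0) := by
      have : ContinuousAt (fun y => N * ‖y - x‖ ^ κ) x :=
        continuousAt_const.mul (ContinuousAt.rpow_const (by fun_prop) (Or.inr hκ.le))
      have h2 : Tendsto (fun y => N * ‖y - x‖ ^ κ) (𝓝 x) (𝓝 0) := by
        simpa [ContinuousAt, Real.zero_rpow hκ.ne'] using this
      exact h2.mono_left nhdsWithin_le_nhds
    refine (tendsto_iff_norm_sub_tendsto_zero (E := E →L[ℝ] E →L[ℝ] ℝ)).2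
      (squeeze_zero' (Eventually.of_forall fun y => norm_nonneg (H y - H x)) ?_ hlim)
    filter_upwards [self_mem_nhdsWithin] with y hy using hH' y hy x hx
  have e1 : ∀ x ∈ U, fderiv ℝ g x = p x := fun x hx => (d1 x hx).fderiv
  have e2 : fderiv ℝ (fderiv ℝ g) x = H x := by
    have : fderiv ℝ g =ᶠ[𝓝 x] p := by
      filter_upwards [hU.mem_nhds hx] with y hy using e1 y hy
    rw [this.fderiv_eq]
    exact (d2 x hx).fderiv
  refine ⟨?_, ?_, ?_⟩
  · have : ContDiffAt ℝ ((1 : ℕ) + 1) g x := by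
      rw [contDiffAt_succ_iff_hasFDerivAt]
      refine ⟨p, ⟨U, hU.mem_nhds hx, d1⟩, ?_⟩
      have : ContDiffAt ℝ ((0 : ℕ) + 1) p x := by
        rw [contDiffAt_succ_iff_hasFDerivAt]
        refine ⟨H, ⟨U, hU.mem_nhds hx, d2⟩, ?_⟩
        exact contDiffAt_zero.2 ⟨U, hU.mem_nhds hx, cH⟩
      simpa using this
    convert this using 1
    norm_num
  · rw [e1 x hx]; exact hp x hx
  · rw [e2]; exact hH x hx

theorem ultralimit_hasDerivWithinAt {ι : Type*} (l : Ultrafilter ι) {u : ι → ℝ → ℝ}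
    {g : ι → ℝ → ℝ} {v : ℝ → ℝ} {c : ℝ} {T t : ℝ} (ht : t ∈ Icc 0 T)
    (hu : ∀ᶠ n in (l : Filter ι), ∀ s ∈ Icc 0 T, HasDerivWithinAt (u n) (g n s) (Icc 0 T) s)
    (hg : ∀ ε > 0, ∃ δ > 0, ∀ᶠ n in (l : Filter ι), ∀ s ∈ Icc 0 T, |s - t| < δ →
      |g n s - g n t| ≤ ε)
    (huv : ∀ s ∈ Icc 0 T, Tendsto (fun n => u n s) l (𝓝 (v s)))
    (hgc : Tendsto (fun n => g n t) l (𝓝 c)) :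
    HasDerivWithinAt v c (Icc 0 T) t := by
  rw [hasDerivWithinAt_iff_isLittleO, Asymptotics.isLittleO_iff]
  intro ε hε
  obtain ⟨δ, hδ, hδ2⟩ := hg ε hε
  filter_upwards [self_mem_nhdsWithin,
    mem_nhdsWithin_of_mem_nhds (Metric.ball_mem_nhds t hδ)] with s hs hsδ
  rw [Metric.mem_ball, Real.dist_eq] at hsδ
  have lim : Tendsto (fun n => ‖u n s - u n t - (s - t) • g n t‖) l
      (𝓝 ‖v s - v t - (s - t) • c‖) :=
    (((huv s hs).sub (huv t ht)).sub (tendsto_const_nhds.smul hgc)).norm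
  refine le_of_tendsto lim ?_
  filter_upwards [hu, hδ2] with n hn hn2
  have sub : uIcc t s ⊆ Icc 0 T := uIcc_subset_Icc ht hs
  have key := (convex_uIcc t s).norm_image_sub_le_of_norm_hasDerivWithin_le
    (f := fun r => u n r - r * g n t) (f' := fun r => g n r - g n t) (C := ε)
    (x := t) (y := s)
    (fun r hr => by
      have h1 := (hn r (sub hr)).mono sub
      simpa using h1.fun_sub ((hasDerivWithinAt_id r _).mul_const (g n t)))
    (fun r hr => hn2 r (sub hr) (by
      refine lt_of_le_of_lt ?_ hsδ
      rcases mem_uIcc.1 hr with h | h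
      · rw [abs_of_nonneg (by linarith), abs_of_nonneg (by linarith)]; linarith
      · rw [abs_of_nonpos (by linarith), abs_of_nonpos (by linarith)]; linarith))
    left_mem_uIcc right_mem_uIcc
  have e : u n s - u n t - (s - t) • g n t = u n s - s * g n t - (u n t - t * g n t) := by
    rw [smul_eq_mul]; ring
  rw [e]
  exact key

end Ultralimit

abbrev Euc (d : ℕ) := EuclideanSpace ℝ (Fin d)

section GaussianFacts

open MeasureTheory ProbabilityTheory Filter Topology

variable {d : ℕ} {F : Type} [NormedAddCommGroup F] [NormedSpace ℝ F]

/-- The standard Gaussian measure on `ℝ^d`. -/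
noncomputable abbrev gam (d : ℕ) : Measure (Euc d) := stdGaussian (Euc d)

theorem integrable_norm_pow_gam (n : ℕ) : Integrable (fun y : Euc d => ‖y‖ ^ n) (gam d) := by
  have := (IsGaussian.memLp_id (gam d) n (by simp)).integrable_norm_pow'
  simpa using this

theorem integral_dual_gam (L : Euc d →L[ℝ] ℝ) : ∫ y, L y ∂(gam d) = 0 :=
  integral_strongDual_stdGaussian L

theorem integral_inner_mul_gam (v w : Euc d) :
    ∫ y, inner ℝ v y * inner ℝ w y ∂(gam d) = inner ℝ v w := by
  have h := covarianceBilin_apply (IsGaussian.memLp_id (gam d) 2 (by simp)) v w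
  rw [covarianceBilin_stdGaussian] at h
  rw [innerSL_apply_apply] at h
  rw [h]
  simp

theorem norm_coord_le (y : Euc d) (i : Fin d) : |y i| ≤ ‖y‖ := by
  simpa using PiLp.norm_apply_le y i

theorem sum_coord_smul_single (y : Euc d) :
    ∑ i, y i • (EuclideanSpace.single i (1 : ℝ) : Euc d) = y := by
  ext j
  simp [Finset.sum_apply, Pi.single_apply]

theorem integral_coord_mul_gam (i j : Fin d) :
    ∫ y : Euc d, y i * y j ∂(gam d) = if i = j then 1 else 0 := by
  have := integral_inner_mul_gam (EuclideanSpace.single i (1 : ℝ) : Euc d)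
    (EuclideanSpace.single j (1 : ℝ))
  simpa [EuclideanSpace.inner_single_left, PiLp.single_apply] using this

theorem integrable_coord_mul_gam (i j : Fin d) :
    Integrable (fun y : Euc d => y i * y j) (gam d) := by
  refine (integrable_norm_pow_gam 2).mono' (by fun_prop) (Eventually.of_forall fun y => ?_)
  rw [norm_mul, sq]
  exact mul_le_mul (norm_coord_le y i) (norm_coord_le y j) (norm_nonneg _) (norm_nonneg _)

theorem integral_bilin_gam (H : Euc d →L[ℝ] Euc d →L[ℝ] ℝ) :
    ∫ y, H y y ∂(gam d) =
      ∑ i, H (EuclideanSpace.single i 1) (EuclideanSpace.single i 1) := by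
  have e : ∀ y : Euc d, H y y = ∑ i, ∑ j, (y i * y j) *
      H (EuclideanSpace.single i 1) (EuclideanSpace.single j 1) := by
    intro y
    conv_lhs => rw [← sum_coord_smul_single y]
    simp only [map_sum, map_smul, sum_apply, smul_apply, smul_eq_mul,
      Finset.mul_sum]
    rw [Finset.sum_comm]
    refine Finset.sum_congr rfl fun i _ => Finset.sum_congr rfl fun j _ => ?_
    ring
  simp_rw [e]
  rw [integral_finsetSum _ fun i _ => integrable_finsetSum _ fun j _ =>
    (integrable_coord_mul_gam i j).mul_const _]
  refine Finset.sum_congr rfl fun i _ => ?_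
  rw [integral_finsetSum _ fun j _ => (integrable_coord_mul_gam i j).mul_const _]
  simp_rw [integral_mul_const, integral_coord_mul_gam]
  simp

theorem map_add_smul_gam (r s : ℝ) (hr : 0 ≤ r) (hs : 0 ≤ s) :
    ((gam d).prod (gam d)).map (fun p : Euc d × Euc d => √r • p.1 + √s • p.2) =
      (gam d).map (fun y => √(r + s) • y) := by
  have h1 : ((gam d).prod (gam d)).map (fun p : Euc d × Euc d => √r • p.1 + √s • p.2) =
      ((gam d).map (fun y => √r • y)) ∗ ((gam d).map (fun y => √s • y)) := by
    rw [Measure.conv, Measure.map_prod_map _ _ (by fun_prop) (by fun_prop),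
      Measure.map_map (by fun_prop) (by fun_prop)]
    rfl
  have : IsProbabilityMeasure ((gam d).map (fun y => √r • y)) :=
    Measure.isProbabilityMeasure_map (by fun_prop)
  have : IsProbabilityMeasure ((gam d).map (fun y => √s • y)) :=
    Measure.isProbabilityMeasure_map (by fun_prop)
  have : IsProbabilityMeasure ((gam d).map (fun y => √(r + s) • y)) :=
    Measure.isProbabilityMeasure_map (by fun_prop)
  rw [h1]
  refine Measure.ext_of_charFun ?_
  ext t
  rw [charFun_conv, charFun_map_smul, charFun_map_smul, charFun_map_smul, charFun_stdGaussian,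
    charFun_stdGaussian, charFun_stdGaussian, ← Complex.exp_add]
  congr 1
  simp only [norm_smul, Real.norm_of_nonneg (Real.sqrt_nonneg _)]
  push_cast
  simp only [mul_pow, ← Complex.ofReal_pow, Real.sq_sqrt hr, Real.sq_sqrt hs,
    Real.sq_sqrt (add_nonneg hr hs)]
  push_cast
  ring

theorem integral_integral_gam {φ : Euc d → F} (hφ : Continuous φ) {M : ℝ} (hM : ∀ y, ‖φ y‖ ≤ M)
    {r s : ℝ} (hr : 0 ≤ r) (hs : 0 ≤ s) :
    ∫ y, ∫ z, φ (√r • y + √s • z) ∂(gam d) ∂(gam d) = ∫ y, φ (√(r + s) • y) ∂(gam d) := by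
  have c2 : Continuous fun p : Euc d × Euc d => φ (√r • p.1 + √s • p.2) := by fun_prop
  have i2 : Integrable (fun p : Euc d × Euc d => φ (√r • p.1 + √s • p.2))
      ((gam d).prod (gam d)) :=
    (integrable_const M).mono' c2.aestronglyMeasurable (Eventually.of_forall fun p => hM _)
  rw [← integral_prod _ i2, ← integral_map (φ := fun p : Euc d × Euc d => √r • p.1 + √s • p.2)
    (f := φ) (by fun_prop) hφ.aestronglyMeasurable, map_add_smul_gam r s hr hs,
    integral_map (by fun_prop) hφ.aestronglyMeasurable]

end GaussianFacts

section GaussianDensity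

open MeasureTheory ProbabilityTheory Filter Topology

variable {d : ℕ} {F : Type} [NormedAddCommGroup F] [NormedSpace ℝ F]

/-- The density of the standard Gaussian measure. -/
noncomputable def gden {d : ℕ} (y : Euc d) : ℝ :=
  (2 * Real.pi) ^ (-(d / 2 : ℝ)) * Real.exp (-(1 / 2) * ‖y‖ ^ 2)

theorem gden_pos (y : Euc d) : 0 < gden y := by unfold gden; positivity

theorem continuous_gden : Continuous (gden (d := d)) := by unfold gden; fun_prop

theorem integrable_exp_neg_sq {b : ℝ} (hb : 0 < b) :
    Integrable (fun y : Euc d => Real.exp (-b * ‖y‖ ^ 2)) := by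
  have h := GaussianFourier.integrable_cexp_neg_mul_sq_norm_add (V := Euc d) (b := (b : ℂ))
    (by simpa using hb) 0 0
  refine h.norm.congr (Eventually.of_forall fun y => ?_)
  simp [Complex.norm_exp, ← Complex.ofReal_pow]

theorem gam_eq_withDensity :
    gam d = (volume : Measure (Euc d)).withDensity (fun y => ENNReal.ofReal (gden y)) := by
  have hden : Integrable (gden (d := d)) := (integrable_exp_neg_sq (by norm_num)).const_mul _
  have : IsFiniteMeasure ((volume : Measure (Euc d)).withDensity
      (fun y => ENNReal.ofReal (gden y))) := by
    refine ⟨?_⟩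
    rw [withDensity_apply _ MeasurableSet.univ, Measure.restrict_univ]
    exact hden.lintegral_lt_top
  refine Measure.ext_of_charFun ?_
  ext t
  rw [charFun_stdGaussian, charFun_apply, integral_withDensity_eq_integral_toReal_smul
    (by unfold gden; fun_prop) (Eventually.of_forall fun _ => ENNReal.ofReal_lt_top)]
  have e : ∀ y : Euc d, (ENNReal.ofReal (gden y)).toReal • Complex.exp (inner ℝ y t * Complex.I) =
      (((2 * Real.pi) ^ (-(d / 2 : ℝ)) : ℝ) : ℂ) *
        Complex.exp (-(1 / 2 : ℂ) * ‖y‖ ^ 2 + Complex.I * inner ℝ t y) := by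
    intro y
    rw [ENNReal.toReal_ofReal (gden_pos y).le, Complex.exp_add, Complex.real_smul, gden,
      real_inner_comm]
    push_cast
    rw [mul_assoc, mul_comm Complex.I]
  simp_rw [e]
  rw [integral_const_mul, GaussianFourier.integral_cexp_neg_mul_sq_norm_add (by norm_num)]
  have h2 : (((2 * Real.pi) ^ (-(d / 2 : ℝ)) : ℝ) : ℂ) *
      ((Real.pi : ℂ) / (1 / 2)) ^ ((Module.finrank ℝ (Euc d) : ℂ) / 2) = 1 := by
    have : ((Real.pi : ℂ) / (1 / 2)) = ((2 * Real.pi : ℝ) : ℂ) := by push_cast; ring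
    rw [this, show ((Module.finrank ℝ (Euc d) : ℂ) / 2) = ((d / 2 : ℝ) : ℂ) by simp,
      ← Complex.ofReal_cpow (by positivity), ← Complex.ofReal_mul, ← Real.rpow_add (by positivity)]
    simp
  rw [← mul_assoc, h2, one_mul]
  congr 1
  rw [Complex.I_sq]
  ring

theorem integral_gam_eq (f : Euc d → F) : ∫ y, f y ∂(gam d) = ∫ y, gden y • f y := by
  rw [gam_eq_withDensity, integral_withDensity_eq_integral_toReal_smul
    (by unfold gden; fun_prop) (Eventually.of_forall fun _ => ENNReal.ofReal_lt_top)]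
  simp_rw [ENNReal.toReal_ofReal (gden_pos _).le]

theorem integral_gam_add_eq (f : Euc d → F) (h : Euc d) :
    ∫ y, f (h + y) ∂(gam d) = ∫ y, gden (y - h) • f y := by
  rw [integral_gam_eq, ← integral_add_left_eq_self (fun y => gden (y - h) • f y) h]
  simp

theorem hasFDerivAt_gden (y : Euc d) : HasFDerivAt gden (-(gden y • innerSL ℝ y)) y := by
  have h1 : HasFDerivAt (fun y : Euc d => ‖y‖ ^ 2) (2 • innerSL ℝ y) y :=
    (hasStrictFDerivAt_norm_sq y).hasFDerivAt
  have := (((h1.const_mul (-(1 / 2) : ℝ)).exp).const_mul ((2 * Real.pi) ^ (-(d / 2 : ℝ))))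
  refine this.congr_fderiv ?_
  ext v
  simp [gden]
  ring

theorem norm_mul_gden_le (y h : Euc d) (hh : ‖h‖ ≤ 1) :
    ‖y - h‖ * gden (y - h) ≤
      (2 * Real.pi) ^ (-(d / 2 : ℝ)) * 3 * Real.exp (-(1 / 8) * ‖y‖ ^ 2) := by
  unfold gden
  set z := y - h
  have h1 : ‖y‖ ≤ ‖z‖ + 1 := by
    calc ‖y‖ = ‖z + h‖ := by simp [z]
      _ ≤ ‖z‖ + ‖h‖ := norm_add_le _ _
      _ ≤ _ := by linarith
  have h2 : ‖y‖ ^ 2 ≤ 2 * ‖z‖ ^ 2 + 2 := by nlinarith [norm_nonneg y, sq_nonneg (‖z‖ - 1)]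
  have h3 : ‖z‖ ≤ Real.exp (1 / 4 * ‖z‖ ^ 2) := by
    have := Real.add_one_le_exp (1 / 4 * ‖z‖ ^ 2)
    nlinarith [sq_nonneg (‖z‖ - 2)]
  have h4 : Real.exp (1 / 4) ≤ 3 := by
    have := Real.exp_one_lt_d9
    have := Real.exp_le_exp.2 (show (1 / 4 : ℝ) ≤ 1 by norm_num)
    linarith
  have h5 : ‖z‖ * Real.exp (-(1 / 2) * ‖z‖ ^ 2) ≤ 3 * Real.exp (-(1 / 8) * ‖y‖ ^ 2) := by
    calc ‖z‖ * Real.exp (-(1 / 2) * ‖z‖ ^ 2)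
        ≤ Real.exp (1 / 4 * ‖z‖ ^ 2) * Real.exp (-(1 / 2) * ‖z‖ ^ 2) := by gcongr
      _ = Real.exp (-(1 / 4) * ‖z‖ ^ 2) := by rw [← Real.exp_add]; congr 1; ring
      _ ≤ Real.exp (1 / 4 + -(1 / 8) * ‖y‖ ^ 2) := Real.exp_le_exp.2 (by linarith)
      _ = Real.exp (1 / 4) * Real.exp (-(1 / 8) * ‖y‖ ^ 2) := Real.exp_add _ _
      _ ≤ _ := by gcongr
  calc _ = (2 * Real.pi) ^ (-(d / 2 : ℝ)) * (‖z‖ * Real.exp (-(1 / 2) * ‖z‖ ^ 2)) := by ring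
    _ ≤ (2 * Real.pi) ^ (-(d / 2 : ℝ)) * (3 * Real.exp (-(1 / 8) * ‖y‖ ^ 2)) := by gcongr
    _ = _ := by ring

/-- The Gaussian average of a bounded continuous function is differentiable. -/
theorem hasFDerivAt_integral_gam {f : Euc d → F} (hf : Continuous f) {M : ℝ}
    (hM : ∀ y, ‖f y‖ ≤ M) (h : Euc d) :
    HasFDerivAt (fun h => ∫ y, f (h + y) ∂(gam d))
      (∫ y, (innerSL ℝ y).smulRight (f (h + y)) ∂(gam d)) h := by
  -- reduce to the origin
  suffices H : ∀ f : Euc d → F, Continuous f → (∀ y, ‖f y‖ ≤ M) →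
      HasFDerivAt (fun h => ∫ y, f (h + y) ∂(gam d))
        (∫ y, (innerSL ℝ y).smulRight (f y) ∂(gam d)) 0 by
    have h0 := H (fun y => f (h + y)) (by fun_prop) (fun y => hM _)
    have h1 := (hasFDerivAt_comp_add_right (f := fun k => ∫ y, f (h + (k + y)) ∂(gam d))
      (x := h) (-h)).2 (by simpa using h0)
    refine h1.congr_of_eventuallyEq (Eventually.of_forall fun k => ?_)
    simp only
    congr 1
    ext y
    congr 1
    abel
  clear hM hf f h
  intro f hf hM
  have hM0 : 0 ≤ M := (norm_nonneg _).trans (hM 0)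
  simp_rw [integral_gam_add_eq]
  rw [integral_gam_eq]
  have key := hasFDerivAt_integral_of_dominated_of_fderiv_le (μ := (volume : Measure (Euc d)))
    (F := fun h y => gden (y - h) • f y)
    (F' := fun h y => (gden (y - h) • innerSL ℝ (y - h)).smulRight (f y)) (x₀ := 0)
    (s := Metric.ball 0 1)
    (bound := fun y => ((2 * Real.pi) ^ (-(d / 2 : ℝ)) * 3 * Real.exp (-(1 / 8) * ‖y‖ ^ 2)) * M)
    (Metric.ball_mem_nhds _ one_pos) ?_ ?_ ?_ ?_ ?_ ?_
  · refine key.congr_fderiv ?_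
    congr 1
    funext y
    refine ContinuousLinearMap.ext fun v => ?_
    simp [smul_smul]
  · refine Eventually.of_forall fun h => Continuous.aestronglyMeasurable ?_
    exact (continuous_gden.comp (by fun_prop)).smul hf
  · have : Integrable (gden (d := d)) := (integrable_exp_neg_sq (by norm_num)).const_mul _
    refine (this.mul_const M).mono' ?_ (Eventually.of_forall fun y => ?_)
    · refine Continuous.aestronglyMeasurable ?_
      exact (continuous_gden.comp (by fun_prop)).smul hf
    · rw [norm_smul, Real.norm_of_nonneg (gden_pos _).le, sub_zero]
      exact mul_le_mul_of_nonneg_left (hM y) (gden_pos y).le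
  · have : SecondCountableTopologyEither (Euc d) (Euc d →L[ℝ] F) := ⟨Or.inl inferInstance⟩
    refine Continuous.aestronglyMeasurable ?_
    have c1 : Continuous fun y : Euc d => gden (y - 0) • innerSL ℝ (y - 0) :=
      (continuous_gden.comp (by fun_prop)).smul
        ((innerSL ℝ : Euc d →L⋆[ℝ] Euc d →L[ℝ] ℝ).continuous.comp (by fun_prop))
    exact ((ContinuousLinearMap.smulRightL ℝ (Euc d) F).continuous.comp c1).clm_apply hf
  · refine Eventually.of_forall fun y h hh => ?_
    rw [ContinuousLinearMap.norm_smulRight_apply, norm_smul, innerSL_apply_norm,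
      Real.norm_of_nonneg (gden_pos _).le, mul_comm (gden _)]
    have := norm_mul_gden_le y h (by simpa using (Metric.mem_ball.1 hh).le)
    exact mul_le_mul this (hM y) (norm_nonneg _) (by positivity)
  · exact ((integrable_exp_neg_sq (by norm_num)).const_mul _).mul_const _
  · refine Eventually.of_forall fun y h _ => ?_
    have h1 : HasFDerivAt (fun h : Euc d => gden (y - h))
        (gden (y - h) • innerSL ℝ (y - h)) h := by
      have := (hasFDerivAt_gden (y - h)).comp h ((hasFDerivAt_id h).const_sub y)
      refine this.congr_fderiv ?_
      ext v; simp
    exact h1.smul_const (f y)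

end GaussianDensity

section HeatSemigroup

open MeasureTheory ProbabilityTheory Filter Topology

variable {d : ℕ} {F : Type} [NormedAddCommGroup F] [NormedSpace ℝ F]

/-- The heat semigroup with diffusion matrix `σσᵀ`. -/
noncomputable def heat (σ : Euc d ≃L[ℝ] Euc d) (s : ℝ) (f : Euc d → F) (x : Euc d) : F :=
  ∫ y, f (x + √s • σ y) ∂(gam d)

variable (σ : Euc d ≃L[ℝ] Euc d)

theorem heat_zero [CompleteSpace F] (f : Euc d → F) : heat σ 0 f = f := by
  ext x; simp [heat]

theorem integrable_heat {f : Euc d → F} (hf : Continuous f) {M : ℝ} (hM : ∀ y, ‖f y‖ ≤ M)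
    (s : ℝ) (x : Euc d) : Integrable (fun y => f (x + √s • σ y)) (gam d) :=
  (integrable_const M).mono' (Continuous.aestronglyMeasurable (by fun_prop))
    (Eventually.of_forall fun _ => hM _)

theorem norm_heat_le {f : Euc d → F} {M : ℝ} (hM : ∀ y, ‖f y‖ ≤ M) (s : ℝ) (x : Euc d) :
    ‖heat σ s f x‖ ≤ M := by
  have := norm_integral_le_of_norm_le_const (μ := gam d)
    (Eventually.of_forall fun y => hM (x + √s • σ y))
  simpa [heat] using this

theorem continuous_heat_param {X : Type*} [TopologicalSpace X] [FirstCountableTopology X]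
    {f : X → Euc d → F} (hf : Continuous fun p : X × Euc d => f p.1 p.2) {M : ℝ}
    (hM : ∀ ξ y, ‖f ξ y‖ ≤ M) :
    Continuous fun p : ℝ × X × Euc d => heat σ p.1 (f p.2.1) p.2.2 := by
  unfold heat
  refine continuous_of_dominated (bound := fun _ => M) ?_ ?_ (integrable_const M) ?_
  · intro p
    exact Continuous.aestronglyMeasurable
      (hf.comp (f := fun y => (p.2.1, p.2.2 + √p.1 • σ y)) (by fun_prop))
  · exact fun p => Eventually.of_forall fun y => hM _ _
  · refine Eventually.of_forall fun y =>
      hf.comp (f := fun p : ℝ × X × Euc d => (p.2.1, p.2.2 + √p.1 • σ y)) ?_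
    have : Continuous fun p : ℝ × X × Euc d => √p.1 := by fun_prop
    fun_prop

theorem continuous_heat {f : Euc d → F} (hf : Continuous f) {M : ℝ} (hM : ∀ y, ‖f y‖ ≤ M)
    (s : ℝ) : Continuous (heat σ s f) := by
  have := continuous_heat_param σ (X := Unit) (f := fun _ => f) (by fun_prop) (fun _ => hM)
  exact this.comp (f := fun x => (s, (), x)) (by fun_prop)

theorem heat_heat {f : Euc d → F} (hf : Continuous f) {M : ℝ} (hM : ∀ y, ‖f y‖ ≤ M)
    {r s : ℝ} (hr : 0 ≤ r) (hs : 0 ≤ s) (x : Euc d) :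
    heat σ r (heat σ s f) x = heat σ (r + s) f x := by
  unfold heat
  have := integral_integral_gam (φ := fun z => f (x + σ z)) (by fun_prop) (fun y => hM _) hr hs
  simpa [add_assoc] using this

theorem heat_clm [CompleteSpace F] {G : Type} [NormedAddCommGroup G] [NormedSpace ℝ G]
    [CompleteSpace G]
    (L : F →L[ℝ] G) {f : Euc d → F} (hf : Continuous f) {M : ℝ} (hM : ∀ y, ‖f y‖ ≤ M)
    (s : ℝ) (x : Euc d) : heat σ s (fun y => L (f y)) x = L (heat σ s f x) :=
  L.integral_comp_comm (integrable_heat σ hf hM s x)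

theorem hasFDerivAt_heat_of_differentiable {f : Euc d → F} (hf : Differentiable ℝ f)
    (hf' : Continuous (fderiv ℝ f)) {M M' : ℝ} (hM : ∀ y, ‖f y‖ ≤ M)
    (hM' : ∀ y, ‖fderiv ℝ f y‖ ≤ M') (s : ℝ) (x : Euc d) :
    HasFDerivAt (heat σ s f) (heat σ s (fderiv ℝ f) x) x := by
  have hfc : Continuous f := hf.continuous
  have : SecondCountableTopologyEither (Euc d) (Euc d →L[ℝ] F) := ⟨Or.inl inferInstance⟩
  refine hasFDerivAt_integral_of_dominated_of_fderiv_le (bound := fun _ => M')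
    (F' := fun z y => fderiv ℝ f (z + √s • σ y)) univ_mem
    (Eventually.of_forall fun x => Continuous.aestronglyMeasurable (by fun_prop))
    (integrable_heat σ hf.continuous hM s x) (Continuous.aestronglyMeasurable (by fun_prop))
    (Eventually.of_forall fun y x _ => hM' _) (integrable_const _) ?_
  refine Eventually.of_forall fun y z _ => ?_
  exact (hasFDerivAt_comp_add_right (f := f) (x := z) (√s • σ y)).2 (hf _).hasFDerivAt

theorem hasFDerivAt_heat {f : Euc d → F} (hf : Continuous f) {M : ℝ} (hM : ∀ y, ‖f y‖ ≤ M)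
    {s : ℝ} (hs : 0 < s) (x : Euc d) :
    HasFDerivAt (heat σ s f) ((∫ y, (innerSL ℝ y).smulRight (f (x + √s • σ y)) ∂(gam d)).comp
      ((√s)⁻¹ • (σ.symm : Euc d →L[ℝ] Euc d))) x := by
  have hs' : √s ≠ 0 := (Real.sqrt_pos.2 hs).ne'
  have h1 := hasFDerivAt_integral_gam (f := fun z => f (√s • σ z)) (by fun_prop)
    (fun y => hM _) (((√s)⁻¹ • (σ.symm : Euc d →L[ℝ] Euc d)) x)
  have h2 := h1.comp x ((√s)⁻¹ • (σ.symm : Euc d →L[ℝ] Euc d)).hasFDerivAt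
  have e : ∀ x y : Euc d, √s • σ (((√s)⁻¹ • (σ.symm : Euc d →L[ℝ] Euc d)) x + y) =
      x + √s • σ y := by
    intro x y
    simp [smul_smul, mul_inv_cancel₀ hs']
  simp only [e] at h2
  refine h2.congr_of_eventuallyEq (Eventually.of_forall fun z => ?_)
  simp only [heat, Function.comp, e]

theorem fderiv_heat_apply [CompleteSpace F] {f : Euc d → F} (hf : Continuous f) {M : ℝ}
    (hM : ∀ y, ‖f y‖ ≤ M) {s : ℝ} (hs : 0 < s) (x v : Euc d) :
    fderiv ℝ (heat σ s f) x v =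
      (√s)⁻¹ • ∫ y, (inner ℝ y (σ.symm v)) • f (x + √s • σ y) ∂(gam d) := by
  have hi : Integrable (fun y => (innerSL ℝ y).smulRight (f (x + √s • σ y))) (gam d) := by
    have : SecondCountableTopologyEither (Euc d) (Euc d →L[ℝ] F) := ⟨Or.inl inferInstance⟩
    refine ((integrable_norm_pow_gam 1).mul_const M).mono' (Continuous.aestronglyMeasurable ?_)
      (Eventually.of_forall fun y => ?_)
    · exact ((ContinuousLinearMap.smulRightL ℝ (Euc d) F).continuous.comp
        (innerSL ℝ : Euc d →L⋆[ℝ] Euc d →L[ℝ] ℝ).continuous).clm_apply (by fun_prop)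
    · rw [ContinuousLinearMap.norm_smulRight_apply, innerSL_apply_norm, pow_one]
      exact mul_le_mul_of_nonneg_left (hM _) (norm_nonneg _)
  rw [(hasFDerivAt_heat σ hf hM hs x).fderiv]
  rw [ContinuousLinearMap.comp_apply, ContinuousLinearMap.integral_apply hi]
  rw [← integral_smul]
  refine integral_congr_ae (Eventually.of_forall fun y => ?_)
  simp only [ContinuousLinearMap.smulRight_apply, smul_apply, innerSL_apply_apply,
    real_inner_smul_right, ContinuousLinearEquiv.coe_coe, mul_smul]

theorem integrable_inner_smul {f : Euc d → F} (hf : Continuous f) {M : ℝ}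
    (hM : ∀ y, ‖f y‖ ≤ M) (w : Euc d) :
    Integrable (fun y => (inner ℝ y w : ℝ) • f y) (gam d) := by
  refine ((integrable_norm_pow_gam 1).mul_const (‖w‖ * M)).mono'
    (Continuous.aestronglyMeasurable (by fun_prop)) (Eventually.of_forall fun y => ?_)
  rw [norm_smul, pow_one]
  calc _ ≤ (‖y‖ * ‖w‖) * M :=
        mul_le_mul (norm_inner_le_norm _ _) (hM _) (norm_nonneg _) (by positivity)
    _ = _ := by ring

/-- The constant in the smoothing estimates for the heat semigroup. -/
noncomputable def heatC (d : ℕ) (S : ℝ) : ℝ :=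
  S * (1 + S) * ((∫ y : Euc d, ‖y‖ ^ 1 ∂(gam d)) + ∫ y : Euc d, ‖y‖ ^ 2 ∂(gam d))

theorem heatC_nonneg (d : ℕ) {S : ℝ} (hS : 0 ≤ S) : 0 ≤ heatC d S := by
  unfold heatC
  have h1 : 0 ≤ ∫ y : Euc d, ‖y‖ ^ 1 ∂(gam d) := integral_nonneg fun y => by positivity
  have h2 : 0 ≤ ∫ y : Euc d, ‖y‖ ^ 2 ∂(gam d) := integral_nonneg fun y => by positivity
  positivity

theorem norm_fderiv_heat_le_holder [CompleteSpace F] {f : Euc d → F} (hf : Continuous f) {M : ℝ}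
    (hM : ∀ y, ‖f y‖ ≤ M) {K κ S : ℝ} (hK0 : 0 ≤ K) (hκ : 0 ≤ κ) (hκ1 : κ ≤ 1)
    (hK : ∀ x y, ‖f x - f y‖ ≤ K * ‖x - y‖ ^ κ)
    (hσ : ‖(σ : Euc d →L[ℝ] Euc d)‖ ≤ S) (hσ' : ‖(σ.symm : Euc d →L[ℝ] Euc d)‖ ≤ S)
    {s : ℝ} (hs : 0 < s) (x : Euc d) :
    ‖fderiv ℝ (heat σ s f) x‖ ≤ heatC d S * K * s ^ ((κ - 1) / 2) := by
  have hS : 0 ≤ S := (norm_nonneg _).trans hσ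
  refine ContinuousLinearMap.opNorm_le_bound _ ?_ fun v => ?_
  · have := heatC_nonneg d hS
    positivity
  rw [fderiv_heat_apply σ hf hM hs]
  set w := σ.symm v
  have hw : ‖w‖ ≤ S * ‖v‖ :=
    ((σ.symm : Euc d →L[ℝ] Euc d).le_opNorm v).trans (by gcongr)
  have z : ∫ y, (inner ℝ y w : ℝ) • f x ∂(gam d) = 0 := by
    rw [integral_smul_const]
    have := integral_dual_gam (innerSL ℝ w)
    simp only [innerSL_apply_apply] at this
    simp_rw [real_inner_comm w] at *
    rw [this, zero_smul]
  have i1 : Integrable (fun y => (inner ℝ y w : ℝ) • f (x + √s • σ y)) (gam d) :=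
    integrable_inner_smul (f := fun y => f (x + √s • σ y)) (by fun_prop) (fun y => hM _) w
  have i2 : Integrable (fun y => (inner ℝ y w : ℝ) • f x) (gam d) :=
    integrable_inner_smul (f := fun y => f x) (by fun_prop) (fun y => hM _) w
  rw [← sub_zero (∫ y, _ ∂(gam d)), ← z, ← integral_sub i1 i2, norm_smul, norm_inv,
    Real.norm_of_nonneg (Real.sqrt_nonneg _)]
  have hb : ‖∫ y, ((inner ℝ y w : ℝ) • f (x + √s • σ y) - (inner ℝ y w : ℝ) • f x) ∂(gam d)‖ ≤
      ∫ y, (‖y‖ ^ 1 + ‖y‖ ^ 2) * (‖w‖ * (K * (√s ^ κ * (1 + S)))) ∂(gam d) := by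
    refine norm_integral_le_of_norm_le
      (((integrable_norm_pow_gam 1).add (integrable_norm_pow_gam 2)).mul_const _)
      (Eventually.of_forall fun y => ?_)
    rw [← smul_sub, norm_smul]
    have h1 := hK (x + √s • σ y) x
    rw [add_sub_cancel_left, norm_smul, Real.norm_of_nonneg (Real.sqrt_nonneg _),
      Real.mul_rpow (Real.sqrt_nonneg _) (norm_nonneg _)] at h1
    have h2 : ‖σ y‖ ^ κ ≤ (1 + S) * (1 + ‖y‖) := by
      have a1 : ‖σ y‖ ≤ S * ‖y‖ :=
        ((σ : Euc d →L[ℝ] Euc d).le_opNorm y).trans (by gcongr)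
      calc ‖σ y‖ ^ κ ≤ ((1 + S) * (1 + ‖y‖)) ^ κ := by
            refine Real.rpow_le_rpow (norm_nonneg _) ?_ hκ
            nlinarith [norm_nonneg y]
        _ ≤ ((1 + S) * (1 + ‖y‖)) ^ (1 : ℝ) := by
            refine Real.rpow_le_rpow_of_exponent_le ?_ hκ1
            nlinarith [norm_nonneg y]
        _ = _ := Real.rpow_one _
    calc _ ≤ (‖y‖ * ‖w‖) * (K * (√s ^ κ * ((1 + S) * (1 + ‖y‖)))) := by
          refine mul_le_mul (norm_inner_le_norm _ _) (h1.trans ?_) (norm_nonneg _) (by positivity)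
          gcongr
      _ = _ := by ring
  rw [integral_mul_const, integral_add (integrable_norm_pow_gam 1) (integrable_norm_pow_gam 2)]
    at hb
  have hsp : (√s)⁻¹ * √s ^ κ = s ^ ((κ - 1) / 2) := by
    rw [Real.sqrt_eq_rpow, ← Real.rpow_neg_one, ← Real.rpow_mul hs.le, ← Real.rpow_mul hs.le,
      ← Real.rpow_add hs]
    congr 1; ring
  have m1 : 0 ≤ ∫ y : Euc d, ‖y‖ ^ 1 ∂(gam d) := integral_nonneg fun y => by positivity
  have m2 : 0 ≤ ∫ y : Euc d, ‖y‖ ^ 2 ∂(gam d) := integral_nonneg fun y => by positivity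
  calc _ ≤ (√s)⁻¹ * (((∫ y : Euc d, ‖y‖ ^ 1 ∂(gam d)) + ∫ y : Euc d, ‖y‖ ^ 2 ∂(gam d)) *
        ((S * ‖v‖) * (K * (√s ^ κ * (1 + S))))) := by
        refine mul_le_mul_of_nonneg_left (hb.trans ?_) (by positivity)
        gcongr
    _ = heatC d S * K * ((√s)⁻¹ * √s ^ κ) * ‖v‖ := by unfold heatC; ring
    _ = _ := by rw [hsp]

theorem norm_fderiv_heat_le [CompleteSpace F] {f : Euc d → F} (hf : Continuous f) {M S : ℝ}
    (hM : ∀ y, ‖f y‖ ≤ M)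
    (hσ : ‖(σ : Euc d →L[ℝ] Euc d)‖ ≤ S) (hσ' : ‖(σ.symm : Euc d →L[ℝ] Euc d)‖ ≤ S)
    {s : ℝ} (hs : 0 < s) (x : Euc d) :
    ‖fderiv ℝ (heat σ s f) x‖ ≤ heatC d S * (2 * M) * s ^ (-(1 / 2) : ℝ) := by
  have hM0 : 0 ≤ M := (norm_nonneg _).trans (hM x)
  have := norm_fderiv_heat_le_holder σ hf hM (K := 2 * M) (κ := 0) (by positivity) le_rfl
    zero_le_one (fun x y => by
      rw [Real.rpow_zero, mul_one]
      exact (norm_sub_le _ _).trans (by linarith [hM x, hM y])) hσ hσ' hs x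
  convert this using 2
  norm_num

theorem continuous_fderiv_heat_param [CompleteSpace F] {X : Type} [TopologicalSpace X]
    [FirstCountableTopology X]
    {f : X → Euc d → F} (hf : Continuous fun p : X × Euc d => f p.1 p.2) {M : ℝ}
    (hM : ∀ ξ y, ‖f ξ y‖ ≤ M) {s : ℝ} (hs : 0 < s) :
    Continuous fun p : X × Euc d => fderiv ℝ (heat σ s (f p.1)) p.2 := by
  have hfc : ∀ ξ, Continuous (f ξ) := fun ξ => hf.comp (by fun_prop : Continuous fun y => (ξ, y))
  have e : (fun p : X × Euc d => fderiv ℝ (heat σ s (f p.1)) p.2) = fun p =>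
      (∫ y, (innerSL ℝ y).smulRight (f p.1 (p.2 + √s • σ y)) ∂(gam d)).comp
      ((√s)⁻¹ • (σ.symm : Euc d →L[ℝ] Euc d)) := by
    ext1 p
    exact (hasFDerivAt_heat σ (hfc p.1) (hM p.1) hs p.2).fderiv
  rw [e]
  refine Continuous.clm_comp ?_ continuous_const
  have : SecondCountableTopologyEither (Euc d) (Euc d →L[ℝ] F) := ⟨Or.inl inferInstance⟩
  have cs : Continuous fun y : Euc d => ContinuousLinearMap.smulRightL ℝ (Euc d) F (innerSL ℝ y) :=
    (ContinuousLinearMap.smulRightL ℝ (Euc d) F).continuous.comp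
        (innerSL ℝ : Euc d →L⋆[ℝ] Euc d →L[ℝ] ℝ).continuous
  refine continuous_of_dominated (bound := fun y => ‖y‖ ^ 1 * M) ?_ ?_
    ((integrable_norm_pow_gam 1).mul_const M) ?_
  · intro p
    have := hfc p.1
    refine Continuous.aestronglyMeasurable ?_
    exact cs.clm_apply (by fun_prop)
  · refine fun p => Eventually.of_forall fun y => ?_
    rw [ContinuousLinearMap.norm_smulRight_apply, innerSL_apply_norm, pow_one]
    exact mul_le_mul_of_nonneg_left (hM _ _) (norm_nonneg _)
  · refine Eventually.of_forall fun y => ?_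
    refine (ContinuousLinearMap.smulRightL ℝ (Euc d) F (innerSL ℝ y)).continuous.comp ?_
    exact hf.comp (f := fun p : X × Euc d => (p.1, p.2 + √s • σ y)) (by fun_prop)

end HeatSemigroup

section HeatDerivatives

open MeasureTheory ProbabilityTheory Filter Topology

variable {d : ℕ} {F : Type} [NormedAddCommGroup F] [NormedSpace ℝ F] [CompleteSpace F]
  (σ : Euc d ≃L[ℝ] Euc d)

theorem fderiv_heat_add {f : Euc d → F} (hf : Continuous f) {M : ℝ} (hM : ∀ y, ‖f y‖ ≤ M)
    {a b : ℝ} (ha : 0 ≤ a) (hb : 0 < b) :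
    fderiv ℝ (heat σ (a + b) f) = heat σ a (fderiv ℝ (heat σ b f)) := by
  ext1 x
  have e : heat σ (a + b) f = heat σ a (heat σ b f) := by
    ext1 y; exact (heat_heat σ hf hM ha hb.le y).symm
  rw [e]
  exact (hasFDerivAt_heat_of_differentiable σ
    (fun y => (hasFDerivAt_heat σ hf hM hb y).differentiableAt)
    ((continuous_fderiv_heat_param σ (X := Unit) (f := fun _ => f) (by fun_prop)
      (fun _ => hM) hb).comp (f := fun x => ((), x)) (by fun_prop))
    (norm_heat_le σ hM b) (norm_fderiv_heat_le σ hf hM (le_max_left _ _) (le_max_right _ _) hb)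
    a x).fderiv

theorem differentiable_heat {f : Euc d → F} (hf : Continuous f) {M : ℝ} (hM : ∀ y, ‖f y‖ ≤ M)
    {b : ℝ} (hb : 0 < b) : Differentiable ℝ (heat σ b f) :=
  fun y => (hasFDerivAt_heat σ hf hM hb y).differentiableAt

theorem continuous_fderiv_heat {f : Euc d → F} (hf : Continuous f) {M : ℝ} (hM : ∀ y, ‖f y‖ ≤ M)
    {b : ℝ} (hb : 0 < b) : Continuous (fderiv ℝ (heat σ b f)) :=
  (continuous_fderiv_heat_param σ (X := Unit) (f := fun _ => f) (by fun_prop)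
      (fun _ => hM) hb).comp (f := fun x => ((), x)) (by fun_prop)

theorem fderiv_heat_eq_heat_half {f : Euc d → F} (hf : Continuous f) {M : ℝ}
    (hM : ∀ y, ‖f y‖ ≤ M) {b : ℝ} (hb : 0 < b) :
    fderiv ℝ (heat σ b f) = heat σ (b / 2) (fderiv ℝ (heat σ (b / 2) f)) := by
  rw [← fderiv_heat_add σ hf hM (by positivity) (by positivity), add_halves]

theorem continuous_fderiv_fderiv_heat_param {X : Type} [TopologicalSpace X]
    [FirstCountableTopology X]
    {f : X → Euc d → F} (hf : Continuous fun p : X × Euc d => f p.1 p.2) {M : ℝ}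
    (hM : ∀ ξ y, ‖f ξ y‖ ≤ M) {b : ℝ} (hb : 0 < b) :
    Continuous fun p : X × Euc d => fderiv ℝ (fderiv ℝ (heat σ b (f p.1))) p.2 := by
  have hfc : ∀ ξ, Continuous (f ξ) := fun ξ => hf.comp (by fun_prop : Continuous fun y => (ξ, y))
  have e : ∀ ξ, fderiv ℝ (heat σ b (f ξ)) = heat σ (b / 2) (fderiv ℝ (heat σ (b / 2) (f ξ))) :=
    fun ξ => fderiv_heat_eq_heat_half σ (hfc ξ) (hM ξ) hb
  simp_rw [e]
  exact continuous_fderiv_heat_param σ (f := fun ξ => fderiv ℝ (heat σ (b / 2) (f ξ)))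
    (continuous_fderiv_heat_param σ hf hM (by positivity))
    (fun ξ => norm_fderiv_heat_le σ (hfc ξ) (hM ξ) (le_max_left _ _) (le_max_right _ _)
      (by positivity)) (by positivity)

theorem norm_fderiv_fderiv_heat_le_of_fderiv {S : ℝ} (hσ : ‖(σ : Euc d →L[ℝ] Euc d)‖ ≤ S)
    (hσ' : ‖(σ.symm : Euc d →L[ℝ] Euc d)‖ ≤ S)
    {f : Euc d → F} (hf : Continuous f) {M : ℝ}
    (hM : ∀ y, ‖f y‖ ≤ M) {b N : ℝ} (hb : 0 < b)
    (hN : ∀ y, ‖fderiv ℝ (heat σ (b / 2) f) y‖ ≤ N) (x : Euc d) :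
    ‖fderiv ℝ (fderiv ℝ (heat σ b f)) x‖ ≤ heatC d S * (2 * N) * (b / 2) ^ (-(1 / 2) : ℝ) := by
  rw [fderiv_heat_eq_heat_half σ hf hM hb]
  exact norm_fderiv_heat_le σ (continuous_fderiv_heat σ hf hM (by positivity)) hN hσ hσ'
    (by positivity) x

theorem differentiable_fderiv_heat {f : Euc d → F} (hf : Continuous f) {M : ℝ}
    (hM : ∀ y, ‖f y‖ ≤ M) {b : ℝ} (hb : 0 < b) : Differentiable ℝ (fderiv ℝ (heat σ b f)) := by
  rw [fderiv_heat_eq_heat_half σ hf hM hb]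
  exact differentiable_heat σ (continuous_fderiv_heat σ hf hM (by positivity))
    (norm_fderiv_heat_le σ hf hM (le_max_left _ _) (le_max_right _ _) (by positivity))
    (by positivity)

theorem continuous_fderiv_fderiv_heat {f : Euc d → F} (hf : Continuous f) {M : ℝ}
    (hM : ∀ y, ‖f y‖ ≤ M) {b : ℝ} (hb : 0 < b) :
    Continuous (fderiv ℝ (fderiv ℝ (heat σ b f))) :=
  (continuous_fderiv_fderiv_heat_param σ (X := Unit) (f := fun _ => f) (by fun_prop)
      (fun _ => hM) hb).comp (f := fun x => ((), x)) (by fun_prop)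

theorem exists_norm_fderiv_fderiv_heat_le (M : ℝ) {b : ℝ} (hb : 0 < b) :
    ∃ N, ∀ f : Euc d → F, Continuous f → (∀ y, ‖f y‖ ≤ M) →
      ∀ x, ‖fderiv ℝ (fderiv ℝ (heat σ b f)) x‖ ≤ N :=
  ⟨_, fun f hf hM => norm_fderiv_fderiv_heat_le_of_fderiv σ (le_max_left _ _) (le_max_right _ _)
    hf hM hb (norm_fderiv_heat_le σ hf hM (le_max_left _ _) (le_max_right _ _) (by positivity))⟩

theorem fderiv_fderiv_heat_add {f : Euc d → F} (hf : Continuous f) {M : ℝ} (hM : ∀ y, ‖f y‖ ≤ M)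
    {a b : ℝ} (ha : 0 ≤ a) (hb : 0 < b) :
    fderiv ℝ (fderiv ℝ (heat σ (a + b) f)) = heat σ a (fderiv ℝ (fderiv ℝ (heat σ b f))) := by
  rw [fderiv_heat_add σ hf hM ha hb]
  ext1 x
  obtain ⟨N, hN⟩ := exists_norm_fderiv_fderiv_heat_le (F := F) σ M hb
  exact (hasFDerivAt_heat_of_differentiable σ (differentiable_fderiv_heat σ hf hM hb)
    (continuous_fderiv_fderiv_heat σ hf hM hb)
    (norm_fderiv_heat_le σ hf hM (le_max_left _ _) (le_max_right _ _) hb)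
    (hN f hf hM) a x).fderiv

theorem norm_fderiv_fderiv_heat_le_holder {S : ℝ} (hσ : ‖(σ : Euc d →L[ℝ] Euc d)‖ ≤ S)
    (hσ' : ‖(σ.symm : Euc d →L[ℝ] Euc d)‖ ≤ S)
    {f : Euc d → F} (hf : Continuous f) {M : ℝ} (hM : ∀ y, ‖f y‖ ≤ M)
    {K κ : ℝ} (hK0 : 0 ≤ K) (hκ : 0 ≤ κ) (hκ1 : κ ≤ 1)
    (hK : ∀ x y, ‖f x - f y‖ ≤ K * ‖x - y‖ ^ κ)
    {b : ℝ} (hb : 0 < b) (x : Euc d) :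
    ‖fderiv ℝ (fderiv ℝ (heat σ b f)) x‖ ≤ 2 * heatC d S ^ 2 * K * (b / 2) ^ (κ / 2 - 1) := by
  refine (norm_fderiv_fderiv_heat_le_of_fderiv σ hσ hσ' hf hM hb
    (norm_fderiv_heat_le_holder σ hf hM hK0 hκ hκ1 hK hσ hσ' (by positivity)) x).trans_eq ?_
  rw [show κ / 2 - 1 = (κ - 1) / 2 + (-(1 / 2)) by ring, Real.rpow_add (by positivity)]
  ring

theorem norm_fderiv_fderiv_heat_sub_le {S : ℝ} (hσ : ‖(σ : Euc d →L[ℝ] Euc d)‖ ≤ S)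
    (hσ' : ‖(σ.symm : Euc d →L[ℝ] Euc d)‖ ≤ S)
    {f : Euc d → F} (hf : Continuous f) {M : ℝ} (hM : ∀ y, ‖f y‖ ≤ M)
    {K κ : ℝ} (hK0 : 0 ≤ K) (hκ : 0 ≤ κ) (hκ1 : κ ≤ 1)
    (hK : ∀ x y, ‖f x - f y‖ ≤ K * ‖x - y‖ ^ κ)
    {b : ℝ} (hb : 0 < b) (x y : Euc d) :
    ‖fderiv ℝ (fderiv ℝ (heat σ b f)) x - fderiv ℝ (fderiv ℝ (heat σ b f)) y‖ ≤
      4 * heatC d S ^ 3 * K * (b / 4) ^ ((κ - 3) / 2) * ‖x - y‖ := by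
  have hS : 0 ≤ S := (norm_nonneg _).trans hσ
  have hC := heatC_nonneg d hS
  have e : fderiv ℝ (fderiv ℝ (heat σ b f)) =
      heat σ (b / 2) (fderiv ℝ (fderiv ℝ (heat σ (b / 2) f))) := by
    rw [← fderiv_fderiv_heat_add σ hf hM (by positivity) (by positivity), add_halves]
  have hc := continuous_fderiv_fderiv_heat σ hf hM (b := b / 2) (by positivity)
  have hb2 := norm_fderiv_fderiv_heat_le_holder σ hσ hσ' hf hM hK0 hκ hκ1 hK (b := b / 2)
    (by positivity)
  rw [e]
  refine (convex_univ.norm_image_sub_le_of_norm_hasFDerivWithin_le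
    (fun z _ => (differentiable_heat σ hc hb2 (by positivity) z).hasFDerivAt.hasFDerivWithinAt)
    (fun z _ => norm_fderiv_heat_le σ hc hb2 hσ hσ' (by positivity) z) (mem_univ y)
    (mem_univ x)).trans ?_
  refine mul_le_mul_of_nonneg_right ?_ (norm_nonneg _)
  have h1 : (b / 2) ^ (-(1 / 2) : ℝ) ≤ (b / 4) ^ (-(1 / 2) : ℝ) :=
    Real.rpow_le_rpow_of_nonpos (by positivity) (by linarith) (by norm_num)
  rw [show (κ - 3) / 2 = (κ / 2 - 1) + (-(1 / 2)) by ring, Real.rpow_add (by positivity)]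
  rw [show b / 2 / 2 = b / 4 by ring]
  calc _ = (4 * heatC d S ^ 3 * K * (b / 4) ^ (κ / 2 - 1)) * (b / 2) ^ (-(1 / 2) : ℝ) := by ring
    _ ≤ (4 * heatC d S ^ 3 * K * (b / 4) ^ (κ / 2 - 1)) * (b / 4) ^ (-(1 / 2) : ℝ) := by gcongr
    _ = _ := by ring

end HeatDerivatives

section ParabolicDefs

open Filter Topology

variable {d : ℕ}

/-- The standard basis vectors. -/
noncomputable abbrev ebas (i : Fin d) : Euc d := EuclideanSpace.single i 1

/-- The spatial gradient. -/
noncomputable abbrev gradx (u : Euc d → ℝ → ℝ) (t : ℝ) : Euc d → Euc d →L[ℝ] ℝ :=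
  fderiv ℝ fun y => u y t

/-- The spatial Hessian. -/
noncomputable abbrev hessx (u : Euc d → ℝ → ℝ) (t : ℝ) : Euc d → Euc d →L[ℝ] Euc d →L[ℝ] ℝ :=
  fderiv ℝ (gradx u t)

/-- The linear functional of the Hessian and the gradient given by a second order operator. -/
noncomputable def opL (A : Fin d → Fin d → ℝ) (B : Fin d → ℝ) (H : Euc d →L[ℝ] Euc d →L[ℝ] ℝ)
    (q : Euc d →L[ℝ] ℝ) : ℝ :=
  (1 / 2) * ∑ i, ∑ j, A i j * H (ebas i) (ebas j) + ∑ i, B i * q (ebas i)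

/-- The second order operator with coefficients `a`, `b`. -/
noncomputable def ell (a : Fin d → Fin d → Euc d → ℝ) (b : Fin d → Euc d → ℝ)
    (u : Euc d → ℝ → ℝ) (x : Euc d) (t : ℝ) : ℝ :=
  opL (fun i j => a i j x) (fun i => b i x) (hessx u t x) (gradx u t x)

theorem norm_ebas (i : Fin d) : ‖ebas i‖ = 1 := by simp [ebas]

theorem abs_bilin_ebas_le (H : Euc d →L[ℝ] Euc d →L[ℝ] ℝ) (i j : Fin d) :
    |H (ebas i) (ebas j)| ≤ ‖H‖ := by
  simpa [norm_ebas] using H.le_opNorm₂ (ebas i) (ebas j)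

theorem abs_lin_ebas_le (q : Euc d →L[ℝ] ℝ) (i : Fin d) : |q (ebas i)| ≤ ‖q‖ := by
  simpa [norm_ebas] using q.le_opNorm (ebas i)

theorem abs_opL_le {A : Fin d → Fin d → ℝ} {B : Fin d → ℝ} {Λ Λ' : ℝ}
    (hA : ∀ i j, |A i j| ≤ Λ) (hB : ∀ i, |B i| ≤ Λ')
    (H : Euc d →L[ℝ] Euc d →L[ℝ] ℝ) (q : Euc d →L[ℝ] ℝ) :
    |opL A B H q| ≤ d ^ 2 * Λ * ‖H‖ + d * Λ' * ‖q‖ := by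
  unfold opL
  have h1 : |∑ i, ∑ j, A i j * H (ebas i) (ebas j)| ≤ ∑ _i : Fin d, ∑ _j : Fin d, Λ * ‖H‖ := by
    refine (Finset.abs_sum_le_sum_abs _ _).trans (Finset.sum_le_sum fun i _ => ?_)
    refine (Finset.abs_sum_le_sum_abs _ _).trans (Finset.sum_le_sum fun j _ => ?_)
    rw [abs_mul]
    exact mul_le_mul (hA i j) (abs_bilin_ebas_le H i j) (abs_nonneg _)
      ((abs_nonneg _).trans (hA i j))
  have h2 : |∑ i, B i * q (ebas i)| ≤ ∑ _i : Fin d, Λ' * ‖q‖ := by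
    refine (Finset.abs_sum_le_sum_abs _ _).trans (Finset.sum_le_sum fun i _ => ?_)
    rw [abs_mul]
    exact mul_le_mul (hB i) (abs_lin_ebas_le q i) (abs_nonneg _) ((abs_nonneg _).trans (hB i))
  simp only [Finset.sum_const, Finset.card_univ, Fintype.card_fin, nsmul_eq_mul] at h1 h2
  refine (abs_add_le _ _).trans ?_
  rw [abs_mul, abs_of_nonneg (by norm_num : (0 : ℝ) ≤ 1 / 2)]
  have := abs_nonneg (∑ i, ∑ j, A i j * H (ebas i) (ebas j))
  nlinarith

theorem opL_sub (A : Fin d → Fin d → ℝ) (B : Fin d → ℝ) (H H' : Euc d →L[ℝ] Euc d →L[ℝ] ℝ)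
    (q q' : Euc d →L[ℝ] ℝ) : opL A B (H - H') (q - q') = opL A B H q - opL A B H' q' := by
  simp only [opL, sub_apply, mul_sub, Finset.sum_sub_distrib]
  ring

theorem opL_add (A : Fin d → Fin d → ℝ) (B : Fin d → ℝ) (H H' : Euc d →L[ℝ] Euc d →L[ℝ] ℝ)
    (q q' : Euc d →L[ℝ] ℝ) : opL A B (H + H') (q + q') = opL A B H q + opL A B H' q' := by
  simp only [opL, add_apply, mul_add, Finset.sum_add_distrib]
  ring

theorem opL_smul (A : Fin d → Fin d → ℝ) (B : Fin d → ℝ) (c : ℝ)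
    (H : Euc d →L[ℝ] Euc d →L[ℝ] ℝ) (q : Euc d →L[ℝ] ℝ) :
    opL A B (c • H) (c • q) = c * opL A B H q := by
  simp only [opL, smul_apply, smul_eq_mul, Finset.mul_sum, mul_add]
  congr 1
  · refine Finset.sum_congr rfl fun i _ => Finset.sum_congr rfl fun j _ => by ring
  · refine Finset.sum_congr rfl fun i _ => by ring

theorem opL_sub_coeff (A A' : Fin d → Fin d → ℝ) (B B' : Fin d → ℝ)
    (H : Euc d →L[ℝ] Euc d →L[ℝ] ℝ) (q : Euc d →L[ℝ] ℝ) :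
    opL (fun i j => A i j - A' i j) (fun i => B i - B' i) H q = opL A B H q - opL A' B' H q := by
  simp only [opL, sub_mul, Finset.sum_sub_distrib]
  ring

theorem tendsto_opL {ι : Type*} {l : Filter ι} (A : Fin d → Fin d → ℝ) (B : Fin d → ℝ)
    {H : ι → Euc d →L[ℝ] Euc d →L[ℝ] ℝ} {q : ι → Euc d →L[ℝ] ℝ}
    {H' : Euc d →L[ℝ] Euc d →L[ℝ] ℝ} {q' : Euc d →L[ℝ] ℝ} (hH : Tendsto H l (𝓝 H'))
    (hq : Tendsto q l (𝓝 q')) : Tendsto (fun n => opL A B (H n) (q n)) l (𝓝 (opL A B H' q')) := by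
  unfold opL
  have h1 : ∀ i, Tendsto (fun n => H n (ebas i)) l (𝓝 (H' (ebas i))) := fun i =>
    ((ContinuousLinearMap.apply ℝ (Euc d →L[ℝ] ℝ) (ebas i)).continuous.tendsto H').comp hH
  have h2 : ∀ i j, Tendsto (fun n => H n (ebas i) (ebas j)) l (𝓝 (H' (ebas i) (ebas j))) :=
    fun i j => ((ContinuousLinearMap.apply ℝ ℝ (ebas j)).continuous.tendsto _).comp (h1 i)
  have h3 : ∀ i, Tendsto (fun n => q n (ebas i)) l (𝓝 (q' (ebas i))) := fun i =>
    ((ContinuousLinearMap.apply ℝ ℝ (ebas i)).continuous.tendsto _).comp hq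
  exact (tendsto_const_nhds.mul (tendsto_finsetSum _ fun i _ => tendsto_finsetSum _ fun j _ =>
    (h2 i j).const_mul _)).add (tendsto_finsetSum _ fun i _ => (h3 i).const_mul _)

/-- Bounded sources, continuous in time and Hölder continuous in space. -/
structure HolderSource (κ T F : ℝ) (f : Euc d → ℝ → ℝ) : Prop where
  cont : ∀ x, ContinuousOn (f x) (Icc 0 T)
  bound : ∀ x, ∀ t ∈ Icc 0 T, |f x t| ≤ F
  holder : ∀ x y, ∀ t ∈ Icc 0 T, |f x t - f y t| ≤ F * ‖x - y‖ ^ κ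

/-- The natural regularity class of solutions on a set of space points. -/
structure HolderSolOn (U : Set (Euc d)) (κ T N : ℝ) (u : Euc d → ℝ → ℝ) : Prop where
  smooth : ∀ t ∈ Icc 0 T, ContDiff ℝ 2 fun x => u x t
  bound : ∀ x ∈ U, ∀ t ∈ Icc 0 T, |u x t| ≤ N
  bound1 : ∀ x ∈ U, ∀ t ∈ Icc 0 T, ‖gradx u t x‖ ≤ N
  bound2 : ∀ x ∈ U, ∀ t ∈ Icc 0 T, ‖hessx u t x‖ ≤ N
  holder2 : ∀ x ∈ U, ∀ y ∈ U, ∀ t ∈ Icc 0 T, ‖hessx u t x - hessx u t y‖ ≤ N * ‖x - y‖ ^ κ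
  lip : ∀ x ∈ U, ∀ s ∈ Icc 0 T, ∀ t ∈ Icc 0 T, |u x s - u x t| ≤ N * |s - t|

/-- `u` solves the inhomogeneous equation on `U` for times in `[0, T]`. -/
def SolvesOn (U : Set (Euc d)) (T : ℝ) (a : Fin d → Fin d → Euc d → ℝ) (b : Fin d → Euc d → ℝ)
    (f u : Euc d → ℝ → ℝ) : Prop :=
  ∀ x ∈ U, ∀ t ∈ Icc 0 T, HasDerivWithinAt (u x) (ell a b u x t + f x t) (Icc 0 T) t

variable {U : Set (Euc d)} {κ T N : ℝ} {u : Euc d → ℝ → ℝ}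

theorem HolderSolOn.mono (hu : HolderSolOn U κ T N u) {V : Set (Euc d)} (h : V ⊆ U) {N' : ℝ}
    (hN : N ≤ N') : HolderSolOn V κ T N' u where
  smooth := hu.smooth
  bound x hx t ht := (hu.bound x (h hx) t ht).trans hN
  bound1 x hx t ht := (hu.bound1 x (h hx) t ht).trans hN
  bound2 x hx t ht := (hu.bound2 x (h hx) t ht).trans hN
  holder2 x hx y hy t ht := (hu.holder2 x (h hx) y (h hy) t ht).trans (by gcongr)
  lip x hx s hs t ht := (hu.lip x (h hx) s hs t ht).trans (by gcongr)

theorem gradx_sub (u v : Euc d → ℝ → ℝ) {t : ℝ} (hu : Differentiable ℝ fun y => u y t)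
    (hv : Differentiable ℝ fun y => v y t) :
    gradx (fun x t => u x t - v x t) t = fun x => gradx u t x - gradx v t x := by
  ext1 x
  exact fderiv_fun_sub (hu x) (hv x)

theorem differentiable_gradx {t : ℝ} (hu : ContDiff ℝ 2 fun y => u y t) :
    Differentiable ℝ (gradx u t) :=
  (hu.fderiv_right (m := 1) (by norm_num)).differentiable (by norm_num)

theorem hessx_sub (u v : Euc d → ℝ → ℝ) {t : ℝ} (hu : ContDiff ℝ 2 fun y => u y t)
    (hv : ContDiff ℝ 2 fun y => v y t) :
    hessx (fun x t => u x t - v x t) t = fun x => hessx u t x - hessx v t x := by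
  ext1 x
  rw [hessx, gradx_sub u v (hu.differentiable (by norm_num)) (hv.differentiable (by norm_num))]
  exact fderiv_fun_sub (differentiable_gradx hu x) (differentiable_gradx hv x)

/-- Uniform modulus of continuity in time of the Hessian. -/
theorem HolderSolOn.norm_hessx_sub_le (hu : HolderSolOn U κ T N u) {x : Euc d} {h : ℝ} (hh : 0 < h)
    (hU : Metric.closedBall x (2 * h) ⊆ U) (hκ : 0 ≤ κ) (hN : 0 ≤ N) {s t : ℝ} (hs : s ∈ Icc 0 T)
    (ht : t ∈ Icc 0 T) :
    ‖hessx u s x - hessx u t x‖ ≤ 4 * (N * |s - t|) / h ^ 2 + 2 * N * (2 * h) ^ κ := by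
  have hs2 := hu.smooth s hs
  have ht2 := hu.smooth t ht
  have key := norm_fderiv_fderiv_le (φ := fun y => u y s - u y t) (hs2.sub ht2) (x := x)
    (N := 2 * N * (2 * h) ^ κ) (M := N * |s - t|) hh
  have e : fderiv ℝ (fderiv ℝ fun y => u y s - u y t) = fun x => hessx u s x - hessx u t x :=
    hessx_sub (fun x _ => u x s) (fun x _ => u x t) (t := 0) hs2 ht2
  rw [e] at key
  have hx : x ∈ U := hU (by simp [hh.le])
  refine key (fun y hy => ?_) fun y hy => hu.lip y (hU hy) s hs t ht
  have hyx : ‖y - x‖ ≤ 2 * h := by simpa [dist_eq_norm] using hy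
  have h1 := hu.holder2 y (hU hy) x hx s hs
  have h2 := hu.holder2 y (hU hy) x hx t ht
  have h3 : N * ‖y - x‖ ^ κ ≤ N * (2 * h) ^ κ := by gcongr
  have e2 : hessx u s y - hessx u t y - (hessx u s x - hessx u t x) =
      (hessx u s y - hessx u s x) - (hessx u t y - hessx u t x) := by abel
  simp only [e2]
  refine (norm_sub_le (hessx u s y - hessx u s x) (hessx u t y - hessx u t x)).trans ?_
  linarith

/-- Uniform modulus of continuity in time of the gradient. -/
theorem HolderSolOn.norm_gradx_sub_le (hu : HolderSolOn U κ T N u) {x : Euc d} {h : ℝ} (hh : 0 < h)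
    (hU : Metric.closedBall x h ⊆ U) {s t : ℝ} (hs : s ∈ Icc 0 T)
    (ht : t ∈ Icc 0 T) :
    ‖gradx u s x - gradx u t x‖ ≤ 2 * (N * |s - t|) / h + h * (2 * N) := by
  have hs2 := hu.smooth s hs
  have ht2 := hu.smooth t ht
  have key := norm_fderiv_le_of_bounds (φ := fun y => u y s - u y t) (hs2.sub ht2) (x := x)
    (S := 2 * N) (M := N * |s - t|) hh
  have e : fderiv ℝ (fderiv ℝ fun y => u y s - u y t) = fun x => hessx u s x - hessx u t x :=
    hessx_sub (fun x _ => u x s) (fun x _ => u x t) (t := 0) hs2 ht2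
  have e1 : fderiv ℝ (fun y => u y s - u y t) = fun x => gradx u s x - gradx u t x :=
    gradx_sub (fun x _ => u x s) (fun x _ => u x t) (t := 0) (hs2.differentiable (by norm_num))
      (ht2.differentiable (by norm_num))
  rw [e, e1] at key
  refine key (fun y hy => ?_) fun y hy => hu.lip y (hU hy) s hs t ht
  refine (norm_sub_le (hessx u s y) (hessx u t y)).trans ?_
  linarith [hu.bound2 y (hU hy) s hs, hu.bound2 y (hU hy) t ht]

/-- Equicontinuity in time of the second order derivatives in a bounded class. -/
theorem exists_delta_ell (hU : IsOpen U) (hκ : 0 < κ) (a : Fin d → Fin d → Euc d → ℝ)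
    (b : Fin d → Euc d → ℝ) {x : Euc d} (hx : x ∈ U) (hN : 0 ≤ N) {ε : ℝ} (hε : 0 < ε) :
    ∃ δ > 0, ∀ u : Euc d → ℝ → ℝ, HolderSolOn U κ T N u → ∀ s ∈ Icc 0 T, ∀ t ∈ Icc 0 T,
      |s - t| < δ → |ell a b u x s - ell a b u x t| ≤ ε := by
  obtain ⟨Λ, hΛ⟩ : ∃ Λ, (∀ i j, |a i j x| ≤ Λ) ∧ ∀ i, |b i x| ≤ Λ := by
    refine ⟨∑ i, ∑ j, |a i j x| + ∑ i, |b i x|, fun i j => ?_, fun i => ?_⟩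
    · have h1 := Finset.single_le_sum (f := fun j => |a i j x|) (fun j _ => abs_nonneg _)
        (Finset.mem_univ j)
      have h2 := Finset.single_le_sum (f := fun i => ∑ j, |a i j x|)
        (fun j _ => Finset.sum_nonneg fun _ _ => abs_nonneg _) (Finset.mem_univ i)
      have h3 : 0 ≤ ∑ i, |b i x| := Finset.sum_nonneg fun _ _ => abs_nonneg _
      linarith
    · have h1 := Finset.single_le_sum (f := fun j => |b j x|) (fun j _ => abs_nonneg _)
        (Finset.mem_univ i)
      have h3 : 0 ≤ ∑ i, ∑ j, |a i j x| :=
        Finset.sum_nonneg fun _ _ => Finset.sum_nonneg fun _ _ => abs_nonneg _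
      linarith
  obtain ⟨r, hr, hrU⟩ := Metric.isOpen_iff.1 hU x hx
  have lim1 : Tendsto (fun h : ℝ => d ^ 2 * Λ * (2 * N * (2 * h) ^ κ) + d * Λ * (h * (2 * N)))
      (𝓝[>] 0) (𝓝 0) := by
    have : ContinuousAt
        (fun h : ℝ => d ^ 2 * Λ * (2 * N * (2 * h) ^ κ) + d * Λ * (h * (2 * N))) 0 := by
      have : ContinuousAt (fun h : ℝ => (2 * h) ^ κ) 0 :=
        ContinuousAt.rpow_const (by fun_prop) (Or.inr hκ.le)
      fun_prop
    have h0 := this.tendsto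
    simp only [mul_zero, Real.zero_rpow hκ.ne', zero_mul, add_zero] at h0
    exact h0.mono_left nhdsWithin_le_nhds
  obtain ⟨h, ⟨hh1, hh2⟩, hh0⟩ := ((lim1.eventually (gt_mem_nhds (half_pos hε))).and
    ((gt_mem_nhds (by positivity : (0 : ℝ) < r / 4)).filter_mono
      (nhdsWithin_le_nhds (s := Ioi 0)))).and self_mem_nhdsWithin |>.exists
  have lim2 : Tendsto (fun τ : ℝ => d ^ 2 * Λ * (4 * (N * τ) / h ^ 2) +
      d * Λ * (2 * (N * τ) / h)) (𝓝[>] 0) (𝓝 0) := by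
    have : Continuous (fun τ : ℝ => d ^ 2 * Λ * (4 * (N * τ) / h ^ 2) +
      d * Λ * (2 * (N * τ) / h)) := by fun_prop
    have h0 := this.tendsto 0
    simp only [mul_zero, zero_div, add_zero] at h0
    exact h0.mono_left nhdsWithin_le_nhds
  obtain ⟨δ, hδ, hδ0⟩ := ((lim2.eventually (gt_mem_nhds (half_pos hε))).and
    self_mem_nhdsWithin).exists
  refine ⟨δ, hδ0, fun u hu s hs t ht hst => ?_⟩
  have b1 := hu.norm_hessx_sub_le hh0 (x := x) ((Metric.closedBall_subset_ball (by linarith)).trans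
    hrU) hκ.le hN hs ht
  have b2 := hu.norm_gradx_sub_le hh0 (x := x) ((Metric.closedBall_subset_ball (by linarith)).trans
    hrU) hs ht
  unfold ell
  rw [← opL_sub]
  refine (abs_opL_le hΛ.1 hΛ.2 _ _).trans ?_
  rcases Nat.eq_zero_or_pos d with rfl | hd
  · simp [hε.le]
  have hΛ0 : 0 ≤ Λ := (abs_nonneg _).trans (hΛ.2 ⟨0, hd⟩)
  calc _ ≤ d ^ 2 * Λ * (4 * (N * δ) / h ^ 2 + 2 * N * (2 * h) ^ κ) +
        d * Λ * (2 * (N * δ) / h + h * (2 * N)) := by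
        gcongr
        · exact b1.trans (by gcongr)
        · exact b2.trans (by gcongr)
    _ ≤ ε := by linarith

/-- Stability of solutions under pointwise limits along an ultrafilter. -/
theorem ultralimit_solves {ι : Type*} (l : Ultrafilter ι) {v : ι → Euc d → ℝ → ℝ}
    {f : ι → Euc d → ℝ → ℝ} {u g : Euc d → ℝ → ℝ} (hU : IsOpen U) (hUc : Convex ℝ U)
    (hκ : 0 < κ) (hN : 0 ≤ N)
    {a : Fin d → Fin d → Euc d → ℝ} {b : Fin d → Euc d → ℝ}
    (hv : ∀ᶠ n in (l : Filter ι), HolderSolOn U κ T N (v n) ∧ SolvesOn U T a b (f n) (v n))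
    (hvu : ∀ x ∈ U, ∀ t ∈ Icc 0 T, Tendsto (fun n => v n x t) l (𝓝 (u x t)))
    (hfg : ∀ x ∈ U, ∀ t ∈ Icc 0 T, Tendsto (fun n => f n x t) l (𝓝 (g x t)))
    (hf : ∀ x ∈ U, ∀ t ∈ Icc 0 T, ∀ ε > 0, ∃ δ > 0, ∀ᶠ n in (l : Filter ι),
      ∀ s ∈ Icc 0 T, |s - t| < δ → |f n x s - f n x t| ≤ ε) :
    (∀ x ∈ U, ∀ t ∈ Icc 0 T, ContDiffAt ℝ 2 (fun y => u y t) x ∧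
      Tendsto (fun n => gradx (v n) t x) l (𝓝 (gradx u t x)) ∧
      Tendsto (fun n => hessx (v n) t x) l (𝓝 (hessx u t x))) ∧
    SolvesOn U T a b g u := by
  have h1 : ∀ x ∈ U, ∀ t ∈ Icc 0 T, ContDiffAt ℝ 2 (fun y => u y t) x ∧
      Tendsto (fun n => gradx (v n) t x) l (𝓝 (gradx u t x)) ∧
      Tendsto (fun n => hessx (v n) t x) l (𝓝 (hessx u t x)) := fun x hx t ht =>
    ultralimit_contDiffAt l hU hUc hN hκ (φ := fun n y => v n y t)
      (hv.mono fun n hn => ⟨hn.1.smooth t ht, fun x hx => hn.1.bound1 x hx t ht,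
        fun x hx => hn.1.bound2 x hx t ht, fun x hx y hy => hn.1.holder2 x hx y hy t ht⟩)
      (fun x hx => hvu x hx t ht) hx
  refine ⟨h1, fun x hx t ht => ?_⟩
  refine ultralimit_hasDerivWithinAt l (u := fun n => v n x)
    (g := fun n t => ell a b (v n) x t + f n x t) ht (hv.mono fun n hn => hn.2 x hx) ?_
    (hvu x hx) ?_
  · intro ε hε
    obtain ⟨δ, hδ, h2⟩ := exists_delta_ell (T := T) hU hκ a b hx hN (half_pos hε)
    obtain ⟨δ', hδ', h3⟩ := hf x hx t ht _ (half_pos hε)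
    refine ⟨min δ δ', lt_min hδ hδ', ?_⟩
    filter_upwards [hv, h3] with n hn hn3 s hs hst
    have := h2 _ hn.1 s hs t ht (hst.trans_le (min_le_left _ _))
    have := hn3 s hs (hst.trans_le (min_le_right _ _))
    rw [abs_le] at *
    constructor <;> linarith
  · refine Tendsto.add ?_ (hfg x hx t ht)
    unfold ell
    exact tendsto_opL _ _ (h1 x hx t ht).2.2 (h1 x hx t ht).2.1

end ParabolicDefs

section Duhamel

open MeasureTheory ProbabilityTheory Filter Topology

variable {d : ℕ} {F : Type} [NormedAddCommGroup F] [NormedSpace ℝ F] [CompleteSpace F]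

/-- The Duhamel integral of the heat semigroup. -/
noncomputable def duh (σ : Euc d ≃L[ℝ] Euc d) (h : ℝ → Euc d → F) (t : ℝ) (x : Euc d) : F :=
  ∫ s in (0 : ℝ)..t, heat σ (t - s) (h s) x

variable (σ : Euc d ≃L[ℝ] Euc d) {h : ℝ → Euc d → F}

theorem continuous_heat_sub_param
    (hc : Continuous fun p : ℝ × Euc d => h p.1 p.2) {M : ℝ} (hM : ∀ s y, ‖h s y‖ ≤ M) :
    Continuous fun p : ℝ × ℝ × Euc d => heat σ (p.1 - p.2.1) (h p.2.1) p.2.2 :=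
  (continuous_heat_param σ hc hM).comp
    (f := fun p : ℝ × ℝ × Euc d => (p.1 - p.2.1, p.2.1, p.2.2)) (by fun_prop)

theorem continuous_duh
    (hc : Continuous fun p : ℝ × Euc d => h p.1 p.2) {M : ℝ} (hM : ∀ s y, ‖h s y‖ ≤ M) : Continuous fun p : ℝ × Euc d => duh σ h p.1 p.2 := by
  have := intervalIntegral.continuous_parametric_intervalIntegral_of_continuous (μ := volume)
    (f := fun (p : ℝ × Euc d) s => heat σ (p.1 - s) (h s) p.2)
    (s := fun p : ℝ × Euc d => p.1) (a₀ := 0)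
    ((continuous_heat_sub_param σ hc hM).comp
      (f := fun p : (ℝ × Euc d) × ℝ => (p.1.1, p.2, p.1.2)) (by fun_prop)) continuous_fst
  exact this

theorem intervalIntegrable_duh
    (hc : Continuous fun p : ℝ × Euc d => h p.1 p.2) {M : ℝ} (hM : ∀ s y, ‖h s y‖ ≤ M)
    (r t : ℝ) (x : Euc d) (a b : ℝ) :
    IntervalIntegrable (fun s => heat σ (t + r - s) (h s) x) volume a b :=
  ((continuous_heat_sub_param σ hc hM).comp
    (f := fun s : ℝ => (t + r, s, x)) (by fun_prop)).intervalIntegrable _ _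

theorem hasFDerivAt_duh
    (hc : Continuous fun p : ℝ × Euc d => h p.1 p.2) {M : ℝ} (hM : ∀ s y, ‖h s y‖ ≤ M)
    (hd : ∀ s, Differentiable ℝ (h s))
    (hdc : Continuous fun p : ℝ × Euc d => fderiv ℝ (h p.1) p.2) {M' : ℝ}
    (hM' : ∀ s y, ‖fderiv ℝ (h s) y‖ ≤ M') (t : ℝ) (x : Euc d) :
    HasFDerivAt (duh σ h t) (duh σ (fun s => fderiv ℝ (h s)) t x) x := by
  have hcs : ∀ s, Continuous (fderiv ℝ (h s)) := fun s =>
    hdc.comp (by fun_prop : Continuous fun y : Euc d => (s, y))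
  have cd := continuous_heat_sub_param σ hdc hM'
  have c0 := continuous_heat_sub_param σ hc hM
  exact intervalIntegral.hasFDerivAt_integral_of_dominated_of_fderiv_le (μ := volume)
    (F := fun z s => heat σ (t - s) (h s) z)
    (F' := fun z s => heat σ (t - s) (fderiv ℝ (h s)) z) (bound := fun _ => M') (s := univ)
    univ_mem
    (Eventually.of_forall fun z =>
      (c0.comp (f := fun s : ℝ => (t, s, z)) (by fun_prop)).aestronglyMeasurable)
    ((c0.comp (f := fun s : ℝ => (t, s, x)) (by fun_prop)).intervalIntegrable _ _)
    (cd.comp (f := fun s : ℝ => (t, s, x)) (by fun_prop)).aestronglyMeasurable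
    (Eventually.of_forall fun s _ z _ => norm_heat_le σ (hM' s) _ _)
    intervalIntegrable_const
    (Eventually.of_forall fun s _ z _ =>
      hasFDerivAt_heat_of_differentiable σ (hd s) (hcs s) (hM s) (hM' s) _ _)

theorem duh_clm
    (hc : Continuous fun p : ℝ × Euc d => h p.1 p.2) {M : ℝ} (hM : ∀ s y, ‖h s y‖ ≤ M)
    {G : Type} [NormedAddCommGroup G] [NormedSpace ℝ G] [CompleteSpace G]
    (L : F →L[ℝ] G) (t : ℝ) (x : Euc d) :
    duh σ (fun s y => L (h s y)) t x = L (duh σ h t x) := by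
  unfold duh
  have hi := intervalIntegrable_duh σ hc hM 0 t x 0 t
  simp only [add_zero] at hi
  rw [← L.intervalIntegral_comp_comm hi]
  refine intervalIntegral.integral_congr fun s _ => ?_
  exact heat_clm σ L (hc.comp (by fun_prop : Continuous fun y : Euc d => (s, y))) (hM s) _ _

end Duhamel

section Generator

open MeasureTheory ProbabilityTheory Filter Topology

variable {d : ℕ} (σ : Euc d ≃L[ℝ] Euc d)

/-- The generator of the heat semigroup, as a functional of the Hessian. -/
noncomputable def gen : (Euc d →L[ℝ] Euc d →L[ℝ] ℝ) →L[ℝ] ℝ :=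
  (1 / 2 : ℝ) • ∑ i, (ContinuousLinearMap.apply ℝ ℝ (σ (ebas i))).comp
    (ContinuousLinearMap.apply ℝ (Euc d →L[ℝ] ℝ) (σ (ebas i)))

theorem gen_apply (H : Euc d →L[ℝ] Euc d →L[ℝ] ℝ) :
    gen σ H = (1 / 2) * ∑ i, H (σ (ebas i)) (σ (ebas i)) := by
  simp [gen, sum_apply]

theorem abs_taylor_le {E : Type*} [NormedAddCommGroup E] [NormedSpace ℝ E] {φ : E → ℝ}
    (hφ : ContDiff ℝ 2 φ) {K : ℝ} (hK0 : 0 ≤ K)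
    (hK : ∀ x y, ‖fderiv ℝ (fderiv ℝ φ) x - fderiv ℝ (fderiv ℝ φ) y‖ ≤ K * ‖x - y‖) (x v : E) :
    |φ (x + v) - φ x - fderiv ℝ φ x v - (1 / 2) * fderiv ℝ (fderiv ℝ φ) x v v| ≤ K * ‖v‖ ^ 3 := by
  have hd : Differentiable ℝ φ := hφ.differentiable (by norm_num)
  have hd2 : Differentiable ℝ (fderiv ℝ φ) :=
    (hφ.fderiv_right (m := 1) (by norm_num)).differentiable (by norm_num)
  have h1 : ∀ τ ∈ Icc (0 : ℝ) 1, HasDerivWithinAt (fun τ : ℝ => φ (x + τ • v) - τ * fderiv ℝ φ x v -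
      (τ ^ 2 / 2) * fderiv ℝ (fderiv ℝ φ) x v v)
      (fderiv ℝ φ (x + τ • v) v - fderiv ℝ φ x v - τ * fderiv ℝ (fderiv ℝ φ) x v v) (Icc 0 1) τ := by
    intro τ _
    have e1 : HasDerivAt (fun τ : ℝ => x + τ • v) v τ := by
      simpa using ((hasDerivAt_id τ).smul_const v).const_add x
    have e2 := (hd (x + τ • v)).hasFDerivAt.comp_hasDerivAt τ e1
    have e3 := (e2.fun_sub ((hasDerivAt_id τ).mul_const (fderiv ℝ φ x v))).fun_sub
      (((hasDerivAt_pow 2 τ).div_const 2).mul_const (fderiv ℝ (fderiv ℝ φ) x v v))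
    refine (e3.congr_deriv ?_).hasDerivWithinAt
    simp
  have key := norm_image_sub_le_of_norm_deriv_le_segment_01' h1 (C := K * ‖v‖ ^ 3) (fun τ hτ => ?_)
  · simp only [one_smul, zero_smul, add_zero, Real.norm_eq_abs] at key
    convert key using 2
    ring
  · have hK' : ∀ a ∈ (univ : Set E), ∀ b ∈ (univ : Set E),
        ‖fderiv ℝ (fderiv ℝ φ) a - fderiv ℝ (fderiv ℝ φ) b‖ ≤ K * ‖a - b‖ ^ (1 : ℝ) :=
      fun a _ b _ => by simpa using hK a b
    have := norm_sub_fderiv_le hd2 convex_univ hK0 zero_le_one hK' (mem_univ x)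
      (mem_univ (x + τ • v))
    simp only [add_sub_cancel_left, Real.rpow_one, norm_smul, Real.norm_of_nonneg hτ.1] at this
    have h2 := ContinuousLinearMap.le_opNorm
      (fderiv ℝ φ (x + τ • v) - fderiv ℝ φ x - fderiv ℝ (fderiv ℝ φ) x (τ • v)) v
    simp only [map_smul, sub_apply, smul_apply, smul_eq_mul] at h2
    refine h2.trans ?_
    have h3 : K * (τ * ‖v‖) * (τ * ‖v‖) ≤ K * (1 * ‖v‖) * (1 * ‖v‖) := by
      have := hτ.1
      have := hτ.2.le
      gcongr
    have h4 : ‖fderiv ℝ φ (x + τ • v) - fderiv ℝ φ x - τ • fderiv ℝ (fderiv ℝ φ) x v‖ ≤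
      K * (1 * ‖v‖) * (1 * ‖v‖) := by
      rw [map_smul] at this
      exact this.trans h3
    calc _ ≤ K * (1 * ‖v‖) * (1 * ‖v‖) * ‖v‖ := by gcongr
      _ = _ := by ring

theorem integral_gen (H : Euc d →L[ℝ] Euc d →L[ℝ] ℝ) (s : ℝ) (hs : 0 ≤ s) :
    ∫ y, (1 / 2) * H (√s • σ y) (√s • σ y) ∂(gam d) = s * gen σ H := by
  have e := integral_bilin_gam (H.bilinearComp (σ : Euc d →L[ℝ] Euc d) (σ : Euc d →L[ℝ] Euc d))
  simp only [ContinuousLinearMap.bilinearComp_apply, ContinuousLinearEquiv.coe_coe] at e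
  rw [gen_apply, ← e, ← integral_const_mul, ← integral_const_mul]
  refine integral_congr_ae (Eventually.of_forall fun y => ?_)
  simp only [map_smul, smul_apply, smul_eq_mul]
  have : s = √s * √s := (Real.mul_self_sqrt hs).symm
  nth_rewrite 3 [this]
  ring

theorem exists_abs_heat_sub_le {K : ℝ} (hK0 : 0 ≤ K) : ∃ C, 0 ≤ C ∧ ∀ φ : Euc d → ℝ,
    ContDiff ℝ 2 φ → (∃ M, ∀ y, ‖φ y‖ ≤ M) →
    (∀ x y, ‖fderiv ℝ (fderiv ℝ φ) x - fderiv ℝ (fderiv ℝ φ) y‖ ≤ K * ‖x - y‖) →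
    ∀ s, 0 ≤ s → ∀ x,
      |heat σ s φ x - φ x - s * gen σ (fderiv ℝ (fderiv ℝ φ) x)| ≤ C * (s * √s) := by
  refine ⟨∫ y : Euc d, K * ‖(σ : Euc d →L[ℝ] Euc d)‖ ^ 3 * ‖y‖ ^ 3 ∂(gam d),
    integral_nonneg fun y => by positivity, ?_⟩
  rintro φ hφ ⟨M, hM⟩ hK s hs x
  have hc : Continuous φ := hφ.continuous
  have i1 := integrable_heat σ hc hM s x
  have i2 : Integrable (fun y => (fderiv ℝ φ x) (√s • σ y)) (gam d) := by
    refine ((integrable_norm_pow_gam 1).const_mul (‖fderiv ℝ φ x‖ * (√s *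
      ‖(σ : Euc d →L[ℝ] Euc d)‖))).mono' (Continuous.aestronglyMeasurable (by fun_prop))
      (Eventually.of_forall fun y => ?_)
    refine (ContinuousLinearMap.le_opNorm _ _).trans ?_
    rw [norm_smul, Real.norm_of_nonneg (Real.sqrt_nonneg s), pow_one]
    have := (σ : Euc d →L[ℝ] Euc d).le_opNorm y
    calc _ ≤ ‖fderiv ℝ φ x‖ * (√s * (‖(σ : Euc d →L[ℝ] Euc d)‖ * ‖y‖)) := by
          gcongr
          exact this
      _ = _ := by ring
  have i3 : Integrable (fun y => (1 / 2) * (fderiv ℝ (fderiv ℝ φ) x) (√s • σ y) (√s • σ y))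
      (gam d) := by
    refine ((integrable_norm_pow_gam 2).const_mul ((1 / 2) * (‖fderiv ℝ (fderiv ℝ φ) x‖ * (√s *
      ‖(σ : Euc d →L[ℝ] Euc d)‖) ^ 2))).mono' (Continuous.aestronglyMeasurable ?_)
      (Eventually.of_forall fun y => ?_)
    · have h0 : Continuous fun y : Euc d => √s • σ y := by fun_prop
      exact continuous_const.mul (((fderiv ℝ (fderiv ℝ φ) x).continuous.comp h0).clm_apply h0)
    · rw [norm_mul, Real.norm_of_nonneg (by norm_num : (0 : ℝ) ≤ 1 / 2), mul_assoc]
      refine mul_le_mul_of_nonneg_left ?_ (by norm_num)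
      refine ((fderiv ℝ (fderiv ℝ φ) x).le_opNorm₂ _ _).trans ?_
      have : ‖√s • σ y‖ ≤ √s * ‖(σ : Euc d →L[ℝ] Euc d)‖ * ‖y‖ := by
        rw [norm_smul, Real.norm_of_nonneg (Real.sqrt_nonneg s), mul_assoc]
        gcongr
        exact (σ : Euc d →L[ℝ] Euc d).le_opNorm y
      have h0 := ContinuousLinearMap.opNorm_nonneg (fderiv ℝ (fderiv ℝ φ) x)
      calc _ ≤ ‖fderiv ℝ (fderiv ℝ φ) x‖ * (√s * ‖(σ : Euc d →L[ℝ] Euc d)‖ * ‖y‖) *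
            (√s * ‖(σ : Euc d →L[ℝ] Euc d)‖ * ‖y‖) := by gcongr
        _ = _ := by ring
  have e2 : ∫ y, (fderiv ℝ φ x) (√s • σ y) ∂(gam d) = 0 := by
    have := integral_dual_gam ((fderiv ℝ φ x).comp (√s • (σ : Euc d →L[ℝ] Euc d)))
    simpa using this
  have e3 := integral_gen σ (fderiv ℝ (fderiv ℝ φ) x) s hs
  have e : heat σ s φ x - φ x - s * gen σ (fderiv ℝ (fderiv ℝ φ) x) =
      ∫ y, (φ (x + √s • σ y) - φ x - fderiv ℝ φ x (√s • σ y) -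
        (1 / 2) * fderiv ℝ (fderiv ℝ φ) x (√s • σ y) (√s • σ y)) ∂(gam d) := by
    have j1 : Integrable (fun y => φ (x + √s • σ y) - φ x) (gam d) := i1.sub (integrable_const _)
    have j2 : Integrable (fun y => φ (x + √s • σ y) - φ x - fderiv ℝ φ x (√s • σ y)) (gam d) :=
      j1.sub i2
    rw [integral_sub j2 i3, e3, integral_sub j1 i2, e2, integral_sub i1 (integrable_const _)]
    simp [heat]
  rw [e, ← integral_mul_const, ← Real.norm_eq_abs]
  refine norm_integral_le_of_norm_le (((integrable_norm_pow_gam 3).const_mul _).mul_const _)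
    (Eventually.of_forall fun y => ?_)
  have key := abs_taylor_le hφ hK0 hK x (√s • σ y)
  rw [Real.norm_eq_abs]
  refine key.trans ?_
  have : ‖√s • σ y‖ ≤ √s * (‖(σ : Euc d →L[ℝ] Euc d)‖ * ‖y‖) := by
    rw [norm_smul, Real.norm_of_nonneg (Real.sqrt_nonneg s)]
    gcongr
    exact (σ : Euc d →L[ℝ] Euc d).le_opNorm y
  calc _ ≤ K * (√s * (‖(σ : Euc d →L[ℝ] Euc d)‖ * ‖y‖)) ^ 3 := by gcongr
    _ = K * ‖(σ : Euc d →L[ℝ] Euc d)‖ ^ 3 * ‖y‖ ^ 3 * (√s ^ 2 * √s) := by ring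
    _ = _ := by rw [Real.sq_sqrt hs]

end Generator

section DuhamelTime

open MeasureTheory ProbabilityTheory Filter Topology

variable {d : ℕ} (σ : Euc d ≃L[ℝ] Euc d)

theorem abs_gen_le {S : ℝ} (hσ : ‖(σ : Euc d →L[ℝ] Euc d)‖ ≤ S)
    (H : Euc d →L[ℝ] Euc d →L[ℝ] ℝ) : |gen σ H| ≤ d * S ^ 2 * ‖H‖ := by
  have hS : 0 ≤ S := (norm_nonneg _).trans hσ
  have hH : 0 ≤ ‖H‖ := ContinuousLinearMap.opNorm_nonneg H
  have h1 : |∑ i, H (σ (ebas i)) (σ (ebas i))| ≤ ∑ _i : Fin d, S ^ 2 * ‖H‖ := by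
    refine (Finset.abs_sum_le_sum_abs _ _).trans (Finset.sum_le_sum fun i _ => ?_)
    have h2 : ‖σ (ebas i)‖ ≤ S := by
      have := (σ : Euc d →L[ℝ] Euc d).le_opNorm (ebas i)
      rw [norm_ebas, mul_one] at this
      exact this.trans hσ
    calc _ ≤ ‖H‖ * ‖σ (ebas i)‖ * ‖σ (ebas i)‖ := H.le_opNorm₂ _ _
      _ ≤ ‖H‖ * S * S := by gcongr
      _ = _ := by ring
  simp only [Finset.sum_const, Finset.card_univ, Fintype.card_fin, nsmul_eq_mul] at h1
  rw [gen_apply, abs_mul, abs_of_nonneg (by norm_num : (0 : ℝ) ≤ 1 / 2)]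
  nlinarith [abs_nonneg (∑ i, H (σ (ebas i)) (σ (ebas i)))]

theorem abs_heat_comb_le {f g k : Euc d → ℝ} (hf : Continuous f) (hg : Continuous g)
    (hk : Continuous k) {M : ℝ} (hfM : ∀ y, ‖f y‖ ≤ M) (hgM : ∀ y, ‖g y‖ ≤ M) {M' : ℝ}
    (hkM : ∀ y, ‖k y‖ ≤ M') {c B : ℝ} (hB : ∀ y, |f y - g y - c * k y| ≤ B) (s : ℝ) (x : Euc d) :
    |heat σ s f x - heat σ s g x - c * heat σ s k x| ≤ B := by
  have i1 := integrable_heat σ hf hfM s x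
  have i2 := integrable_heat σ hg hgM s x
  have i3 := integrable_heat σ hk hkM s x
  have e : heat σ s f x - heat σ s g x - c * heat σ s k x =
      heat σ s (fun y => f y - g y - c * k y) x := by
    unfold heat
    have i4 : Integrable (fun y => f (x + √s • σ y) - g (x + √s • σ y)) (gam d) := i1.sub i2
    rw [integral_sub i4 (i3.const_mul c), integral_sub i1 i2, integral_const_mul]
  rw [e]
  exact norm_heat_le (F := ℝ) σ hB s x

theorem hasDerivWithinAt_of_right {U V : ℝ → ℝ} {T : ℝ} (hU : Continuous U) (hV : Continuous V)
    (h : ∀ t ∈ Ico 0 T, HasDerivWithinAt U (V t) (Ici t) t) {t : ℝ} (ht : t ∈ Icc 0 T) :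
    HasDerivWithinAt U (V t) (Icc 0 T) t := by
  have hW : ∀ t, HasDerivAt (fun t => ∫ s in (0 : ℝ)..t, V s) (V t) t := fun t =>
    intervalIntegral.integral_hasDerivAt_right (hV.intervalIntegrable _ _)
      (hV.stronglyMeasurableAtFilter _ _) hV.continuousAt
  have hWc : Continuous fun t => ∫ s in (0 : ℝ)..t, V s :=
    continuous_iff_continuousAt.2 fun t => (hW t).continuousAt
  have key : ∀ r ∈ Icc 0 T, U r - ∫ s in (0 : ℝ)..r, V s = U 0 - ∫ s in (0 : ℝ)..0, V s :=
    constant_of_has_deriv_right_zero (f := fun r => U r - ∫ s in (0 : ℝ)..r, V s)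
      (hU.sub hWc).continuousOn fun r hr => by
        simpa using (h r hr).fun_sub (hW r).hasDerivWithinAt
  have h2 : HasDerivWithinAt (fun r => U 0 + ∫ s in (0 : ℝ)..r, V s) (V t) (Icc 0 T) t :=
    ((hW t).const_add (U 0)).hasDerivWithinAt
  refine h2.congr (fun r hr => ?_) ?_
  · have := key r hr
    simp only [intervalIntegral.integral_same] at this
    linarith
  · have := key t ht
    simp only [intervalIntegral.integral_same] at this
    linarith

theorem hasDerivWithinAt_duh_right {h : ℝ → Euc d → ℝ}
    (hc : Continuous fun p : ℝ × Euc d => h p.1 p.2) {M : ℝ} (hM : ∀ s y, ‖h s y‖ ≤ M)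
    (hd : ∀ s, ContDiff ℝ 2 (h s))
    (hd2c : Continuous fun p : ℝ × Euc d => fderiv ℝ (fderiv ℝ (h p.1)) p.2) {M2 : ℝ}
    (hM2 : ∀ s y, ‖fderiv ℝ (fderiv ℝ (h s)) y‖ ≤ M2) {K : ℝ} (hK0 : 0 ≤ K)
    (hK : ∀ s x y, ‖fderiv ℝ (fderiv ℝ (h s)) x - fderiv ℝ (fderiv ℝ (h s)) y‖ ≤ K * ‖x - y‖)
    {t : ℝ} (ht : 0 ≤ t) (x : Euc d) :
    HasDerivWithinAt (fun t => duh σ h t x)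
      (gen σ (duh σ (fun s => fderiv ℝ (fderiv ℝ (h s))) t x) + h t x) (Ici t) t := by
  obtain ⟨C, hC0, hC⟩ := exists_abs_heat_sub_le σ hK0
  have hcs : ∀ s, Continuous (h s) := fun s => (hd s).continuous
  have hgc : Continuous fun p : ℝ × Euc d => gen σ (fderiv ℝ (fderiv ℝ (h p.1)) p.2) :=
    (gen σ).continuous.comp hd2c
  have hgM : ∀ s y, ‖gen σ (fderiv ℝ (fderiv ℝ (h s)) y)‖ ≤
      d * ‖(σ : Euc d →L[ℝ] Euc d)‖ ^ 2 * M2 := fun s y =>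
    (abs_gen_le σ le_rfl (fderiv ℝ (fderiv ℝ (h s)) y)).trans
      (mul_le_mul_of_nonneg_left (hM2 s y) (by positivity))
  have e0 : duh σ (fun s y => gen σ (fderiv ℝ (fderiv ℝ (h s)) y)) t x =
      gen σ (duh σ (fun s => fderiv ℝ (fderiv ℝ (h s))) t x) :=
    duh_clm (F := Euc d →L[ℝ] Euc d →L[ℝ] ℝ) σ hd2c hM2 (gen σ) t x
  rw [← e0]
  set k : ℝ → Euc d → ℝ := fun s y => gen σ (fderiv ℝ (fderiv ℝ (h s)) y) with hk
  have c0 := continuous_heat_sub_param σ hc hM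
  have ck := continuous_heat_sub_param σ hgc hgM
  have ii : ∀ r a b, IntervalIntegrable (fun s => heat σ (r - s) (h s) x) volume a b :=
    fun r a b => (c0.comp (f := fun s : ℝ => (r, s, x)) (by fun_prop)).intervalIntegrable _ _
  have ik : ∀ r a b, IntervalIntegrable (fun s => heat σ (r - s) (k s) x) volume a b :=
    fun r a b => (ck.comp (f := fun s : ℝ => (r, s, x)) (by fun_prop)).intervalIntegrable _ _
  rw [hasDerivWithinAt_iff_isLittleO, Asymptotics.isLittleO_iff]
  intro ε hε
  have lim1 : Tendsto (fun r => t * (C * √(r - t))) (𝓝 t) (𝓝 0) := by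
    have : Continuous fun r => t * (C * √(r - t)) := by fun_prop
    simpa using this.tendsto t
  have ct : ContinuousAt (fun p : ℝ × ℝ => heat σ (p.1 - p.2) (h p.2) x) (t, t) :=
    (c0.comp (f := fun p : ℝ × ℝ => (p.1, p.2, x)) (by fun_prop)).continuousAt
  obtain ⟨δ, hδ, hδ2⟩ := Metric.continuousAt_iff.1 ct _ (half_pos hε)
  simp only [sub_self, heat_zero] at hδ2
  filter_upwards [self_mem_nhdsWithin, nhdsWithin_le_nhds (lim1.eventually
    (gt_mem_nhds (half_pos hε))), nhdsWithin_le_nhds (Metric.ball_mem_nhds t hδ)] with r hr h1 h2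
  rw [mem_Ici] at hr
  have hrt : 0 ≤ r - t := by linarith
  rw [Metric.mem_ball, Real.dist_eq] at h2
  have p1 : ‖∫ s in (0 : ℝ)..t, (heat σ (r - s) (h s) x - heat σ (t - s) (h s) x -
      (r - t) * heat σ (t - s) (k s) x)‖ ≤ C * ((r - t) * √(r - t)) * |t - 0| := by
    refine intervalIntegral.norm_integral_le_of_norm_le_const fun s hs => ?_
    rw [uIoc_of_le ht] at hs
    have e : heat σ (r - s) (h s) x = heat σ (t - s) (heat σ (r - t) (h s)) x := by
      rw [heat_heat σ (hcs s) (hM s) (by linarith [hs.2]) hrt]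
      congr 1; ring
    rw [e]
    exact abs_heat_comb_le σ (continuous_heat σ (hcs s) (hM s) _) (hcs s)
      (hgc.comp (by fun_prop : Continuous fun y : Euc d => (s, y)))
      (norm_heat_le σ (hM s) _) (hM s) (hgM s)
      (hC (h s) (hd s) ⟨M, hM s⟩ (hK s) (r - t) hrt) _ _
  have p2 : ‖∫ s in t..r, (heat σ (r - s) (h s) x - h t x)‖ ≤ ε / 2 * |r - t| := by
    refine intervalIntegral.norm_integral_le_of_norm_le_const fun s hs => ?_
    rw [uIoc_of_le hr] at hs
    have := @hδ2 (r, s) (by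
      rw [Prod.dist_eq, max_lt_iff, Real.dist_eq, Real.dist_eq]
      refine ⟨h2, lt_of_le_of_lt ?_ h2⟩
      simp only
      rw [abs_of_nonneg hrt, abs_of_nonneg (by linarith [hs.1])]
      linarith [hs.2])
    exact this.le
  rw [intervalIntegral.integral_sub ((ii _ _ _).sub (ii _ _ _)) ((ik _ _ _).const_mul _),
    intervalIntegral.integral_sub (ii _ _ _) (ii _ _ _), intervalIntegral.integral_const_mul] at p1
  rw [intervalIntegral.integral_sub (ii _ _ _) (by simp), intervalIntegral.integral_const] at p2
  have e : duh σ h r x = (∫ s in (0 : ℝ)..t, heat σ (r - s) (h s) x) +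
      ∫ s in t..r, heat σ (r - s) (h s) x :=
    (intervalIntegral.integral_add_adjacent_intervals (ii _ _ _) (ii _ _ _)).symm
  rw [e]
  have p3 : C * ((r - t) * √(r - t)) * |t - 0| ≤ ε / 2 * (r - t) := by
    rw [sub_zero, abs_of_nonneg ht]
    calc _ = (t * (C * √(r - t))) * (r - t) := by ring
      _ ≤ _ := by gcongr
  rw [Real.norm_eq_abs, Real.norm_eq_abs, abs_of_nonneg hrt] at *
  rw [smul_eq_mul] at *
  unfold duh
  rw [abs_le] at *
  constructor <;> linarith [p1.1, p1.2, p2.1, p2.2]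

theorem hasDerivWithinAt_duh {h : ℝ → Euc d → ℝ}
    (hc : Continuous fun p : ℝ × Euc d => h p.1 p.2) {M : ℝ} (hM : ∀ s y, ‖h s y‖ ≤ M)
    (hd : ∀ s, ContDiff ℝ 2 (h s))
    (hd2c : Continuous fun p : ℝ × Euc d => fderiv ℝ (fderiv ℝ (h p.1)) p.2) {M2 : ℝ}
    (hM2 : ∀ s y, ‖fderiv ℝ (fderiv ℝ (h s)) y‖ ≤ M2) {K : ℝ} (hK0 : 0 ≤ K)
    (hK : ∀ s x y, ‖fderiv ℝ (fderiv ℝ (h s)) x - fderiv ℝ (fderiv ℝ (h s)) y‖ ≤ K * ‖x - y‖)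
    {t T : ℝ} (ht : t ∈ Icc 0 T) (x : Euc d) :
    HasDerivWithinAt (fun t => duh σ h t x)
      (gen σ (duh σ (fun s => fderiv ℝ (fderiv ℝ (h s))) t x) + h t x) (Icc 0 T) t := by
  refine hasDerivWithinAt_of_right
    (V := fun t => gen σ (duh σ (fun s => fderiv ℝ (fderiv ℝ (h s))) t x) + h t x) ?_ ?_
    (fun t ht => hasDerivWithinAt_duh_right σ hc hM hd hd2c hM2 hK0 hK ht.1 x) ht
  · exact (continuous_duh σ hc hM).comp (f := fun t : ℝ => (t, x)) (by fun_prop)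
  · refine Continuous.add ((gen σ).continuous.comp ?_) (hc.comp (f := fun t : ℝ => (t, x))
      (by fun_prop))
    exact (continuous_duh σ hd2c hM2).comp (f := fun t : ℝ => (t, x)) (by fun_prop)

end DuhamelTime

section HeatEstimates

open MeasureTheory ProbabilityTheory Filter Topology

variable {d : ℕ}

theorem norm_integral_le_rpow {G : Type} [NormedAddCommGroup G] [NormedSpace ℝ G] {g : ℝ → G}
    {c t A q : ℝ} (hct : c ≤ t) (hq : -1 < q)
    (hg : ∀ s, c < s → s < t → ‖g s‖ ≤ A * (t - s) ^ q) :
    ‖∫ s in c..t, g s‖ ≤ A * ((t - c) ^ (q + 1) / (q + 1)) := by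
  have hi : IntervalIntegrable (fun s => A * (t - s) ^ q) volume c t := by
    have h0 : IntervalIntegrable (fun s : ℝ => s ^ q) volume (t - c) (t - t) :=
      intervalIntegral.intervalIntegrable_rpow' hq
    have := (h0.comp_sub_left t).const_mul A
    simpa using this
  refine (intervalIntegral.norm_integral_le_of_norm_le hct ?_ hi).trans_eq ?_
  · filter_upwards [compl_mem_ae_iff.2 (measure_singleton (μ := volume) t)] with s hs hs2
    exact hg s hs2.1 (lt_of_le_of_ne hs2.2 hs)
  · rw [intervalIntegral.integral_const_mul,
      intervalIntegral.integral_comp_sub_left (fun s => s ^ q), integral_rpow (Or.inl hq), sub_self,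
      Real.zero_rpow (by linarith), sub_zero]

theorem norm_integral_le_rpow' {G : Type} [NormedAddCommGroup G] [NormedSpace ℝ G] {g : ℝ → G}
    {c t A q : ℝ} (hc : 0 ≤ c) (hct : c < t) (hq : q < -1) (hA : 0 ≤ A)
    (hg : ∀ s, 0 < s → s ≤ c → ‖g s‖ ≤ A * (t - s) ^ q) :
    ‖∫ s in (0 : ℝ)..c, g s‖ ≤ A * ((t - c) ^ (q + 1) / (-(q + 1))) := by
  have h0' : (0 : ℝ) ∉ uIcc (t - 0) (t - c) := by
    rw [uIcc_of_ge (by linarith), mem_Icc]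
    intro h
    linarith [h.1]
  have hi : IntervalIntegrable (fun s => A * (t - s) ^ q) volume 0 c := by
    have h0 : IntervalIntegrable (fun s : ℝ => s ^ q) volume (t - 0) (t - c) :=
      intervalIntegral.intervalIntegrable_rpow (Or.inr h0')
    have := (h0.comp_sub_left t).const_mul A
    simpa using this
  refine (intervalIntegral.norm_integral_le_of_norm_le hc ?_ hi).trans ?_
  · exact Eventually.of_forall fun s hs => hg s hs.1 hs.2
  · rw [intervalIntegral.integral_const_mul,
      intervalIntegral.integral_comp_sub_left (fun s => s ^ q),
      integral_rpow (Or.inr ⟨by linarith, by rwa [uIcc_comm]⟩)]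
    refine mul_le_mul_of_nonneg_left ?_ hA
    rw [div_neg, ← neg_div]
    have h1 : q + 1 < 0 := by linarith
    rw [div_le_div_right_of_neg h1]
    have : 0 ≤ (t - 0) ^ (q + 1) := Real.rpow_nonneg (by linarith) _
    linarith

/-- The splitting argument behind the Schauder estimate. -/
theorem norm_integral_le_split {G : Type} [NormedAddCommGroup G] [NormedSpace ℝ G] {g : ℝ → G}
    (hgc : Continuous g) {t A B ρ κ : ℝ} (ht : 0 ≤ t) (hκ : 0 < κ) (hκ1 : κ < 1) (hρ : 0 < ρ)
    (hA : 0 ≤ A) (hB : 0 ≤ B)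
    (h1 : ∀ s, 0 ≤ s → s < t → ‖g s‖ ≤ A * (t - s) ^ (κ / 2 - 1))
    (h2 : ∀ s, 0 ≤ s → s < t → ‖g s‖ ≤ B * ρ * (t - s) ^ ((κ - 3) / 2)) :
    ‖∫ s in (0 : ℝ)..t, g s‖ ≤ (2 * A / κ + 2 * B / (1 - κ)) * ρ ^ κ := by
  have hκ' : 0 < 1 - κ := by linarith
  have hB' : 0 ≤ 2 * B / (1 - κ) * ρ ^ κ := by positivity
  have near : ∀ c, 0 ≤ c → c ≤ t → t - c ≤ ρ ^ 2 → ‖∫ s in c..t, g s‖ ≤ 2 * A / κ * ρ ^ κ := by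
    intro c hc hct hcρ
    have := norm_integral_le_rpow hct (by linarith : -1 < κ / 2 - 1)
      fun s hs hst => h1 s (hc.trans hs.le) hst
    refine this.trans ?_
    rw [sub_add_cancel]
    have e : (t - c) ^ (κ / 2) ≤ ρ ^ κ := by
      calc (t - c) ^ (κ / 2) ≤ (ρ ^ 2) ^ (κ / 2) :=
            Real.rpow_le_rpow (by linarith) hcρ (by linarith)
        _ = ρ ^ κ := by
            rw [← Real.rpow_natCast, ← Real.rpow_mul hρ.le]
            congr 1; push_cast; ring
    calc A * ((t - c) ^ (κ / 2) / (κ / 2)) ≤ A * (ρ ^ κ / (κ / 2)) := by gcongr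
      _ = _ := by field_simp
  rcases le_or_gt t (ρ ^ 2) with h | h
  · have := near 0 le_rfl ht (by linarith)
    linarith
  · have hc : 0 ≤ t - ρ ^ 2 := by linarith
    have hρ2 : 0 < ρ ^ 2 := by positivity
    rw [← intervalIntegral.integral_add_adjacent_intervals (b := t - ρ ^ 2)
      (hgc.intervalIntegrable _ _) (hgc.intervalIntegrable _ _)]
    have n1 := near (t - ρ ^ 2) hc (by linarith) (by linarith)
    have n2 := norm_integral_le_rpow' (g := g) hc (by linarith : t - ρ ^ 2 < t)
      (by linarith : (κ - 3) / 2 < -1) (by positivity : 0 ≤ B * ρ)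
      fun s hs hsc => h2 s hs.le (by linarith)
    have e : ρ * (ρ ^ 2) ^ ((κ - 3) / 2 + 1) = ρ ^ κ := by
      rw [← Real.rpow_natCast, ← Real.rpow_mul hρ.le, mul_comm, ← Real.rpow_add_one hρ.ne']
      congr 1; push_cast; ring
    have n3 : B * ρ * ((t - (t - ρ ^ 2)) ^ ((κ - 3) / 2 + 1) / (-((κ - 3) / 2 + 1))) =
        2 * B / (1 - κ) * ρ ^ κ := by
      rw [sub_sub_cancel, ← e, show -((κ - 3) / 2 + 1) = (1 - κ) / 2 by ring]
      field_simp
    rw [n3] at n2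
    refine (norm_add_le _ _).trans ?_
    linarith

theorem continuous_of_holder_param {f : ℝ → Euc d → ℝ} (hf : ∀ x, Continuous fun s => f s x)
    {K κ : ℝ} (hκ : 0 < κ) (hK : ∀ s x y, |f s x - f s y| ≤ K * ‖x - y‖ ^ κ) :
    Continuous fun p : ℝ × Euc d => f p.1 p.2 := by
  rw [continuous_iff_continuousAt]
  rintro ⟨s, x⟩
  have h1 : Tendsto (fun p : ℝ × Euc d => f p.1 p.2 - f p.1 x) (𝓝 (s, x)) (𝓝 0) := by
    have : Continuous fun p : ℝ × Euc d => K * ‖p.2 - x‖ ^ κ := by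
      have : Continuous fun p : ℝ × Euc d => ‖p.2 - x‖ := by fun_prop
      exact continuous_const.mul (this.rpow_const fun _ => Or.inr hκ.le)
    have h0 := this.tendsto (s, x)
    simp only [sub_self, norm_zero, Real.zero_rpow hκ.ne', mul_zero] at h0
    exact squeeze_zero_norm (fun p => hK p.1 p.2 x) h0
  have h2 : Tendsto (fun p : ℝ × Euc d => f p.1 x) (𝓝 (s, x)) (𝓝 (f s x)) :=
    ((hf x).comp continuous_fst).tendsto (s, x)
  simpa [ContinuousAt] using h1.add h2

/-- The diffusion matrix `σσᵀ`. -/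
noncomputable def covM (σ : Euc d ≃L[ℝ] Euc d) (i j : Fin d) : ℝ :=
  ∑ k, σ (ebas k) i * σ (ebas k) j

theorem opL_covM (σ : Euc d ≃L[ℝ] Euc d) (H : Euc d →L[ℝ] Euc d →L[ℝ] ℝ) (q : Euc d →L[ℝ] ℝ) :
    opL (covM σ) 0 H q = gen σ H := by
  rw [gen_apply]
  simp only [opL, covM, Pi.zero_apply, zero_mul, Finset.sum_const_zero, add_zero]
  congr 1
  have e : ∀ k, H (σ (ebas k)) (σ (ebas k)) =
      ∑ i, ∑ j, (σ (ebas k) i * σ (ebas k) j) * H (ebas i) (ebas j) := by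
    intro k
    conv_lhs => rw [← sum_coord_smul_single (σ (ebas k))]
    simp only [map_sum, map_smul, sum_apply, smul_apply, smul_eq_mul, Finset.mul_sum]
    rw [Finset.sum_comm]
    refine Finset.sum_congr rfl fun i _ => Finset.sum_congr rfl fun j _ => by ring
  simp only [e, Finset.sum_mul]
  exact (Finset.sum_congr rfl fun i _ => Finset.sum_comm).trans Finset.sum_comm

theorem tendsto_norm_sub_of_tendsto {ι G : Type*} [NormedAddCommGroup G] {l : Filter ι}
    {v w : ι → G} {a b : G} (hv : Tendsto v l (𝓝 a)) (hw : Tendsto w l (𝓝 b)) :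
    Tendsto (fun n => ‖v n - w n‖) l (𝓝 ‖a - b‖) := (hv.sub hw).norm

theorem HolderSolOn.of_ultralimit_on {ι : Type*} (l : Ultrafilter ι) {v : ι → Euc d → ℝ → ℝ}
    {u : Euc d → ℝ → ℝ} {κ T N : ℝ} {U : Set (Euc d)}
    (hv : ∀ᶠ n in (l : Filter ι), HolderSolOn U κ T N (v n))
    (hvu : ∀ x ∈ U, ∀ t ∈ Icc 0 T, Tendsto (fun n => v n x t) l (𝓝 (u x t)))
    (hu : ∀ t ∈ Icc 0 T, ContDiff ℝ 2 fun x => u x t)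
    (h : ∀ x ∈ U, ∀ t ∈ Icc 0 T, Tendsto (fun n => gradx (v n) t x) l (𝓝 (gradx u t x)) ∧
      Tendsto (fun n => hessx (v n) t x) l (𝓝 (hessx u t x))) : HolderSolOn U κ T N u where
  smooth := hu
  bound x hx t ht := le_of_tendsto (hvu x hx t ht).abs (hv.mono fun n hn => hn.bound x hx t ht)
  bound1 x hx t ht := le_of_tendsto (h x hx t ht).1.norm
    (hv.mono fun n hn => hn.bound1 x hx t ht)
  bound2 x hx t ht := le_of_tendsto
    (Tendsto.norm (E := Euc d →L[ℝ] Euc d →L[ℝ] ℝ) (h x hx t ht).2)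
    (hv.mono fun n hn => hn.bound2 x hx t ht)
  holder2 x hx y hy t ht := le_of_tendsto
    (tendsto_norm_sub_of_tendsto (G := Euc d →L[ℝ] Euc d →L[ℝ] ℝ) (h x hx t ht).2
      (h y hy t ht).2) (hv.mono fun n hn => hn.holder2 x hx y hy t ht)
  lip x hx s hs t ht := le_of_tendsto ((hvu x hx s hs).sub (hvu x hx t ht)).abs
    (hv.mono fun n hn => hn.lip x hx s hs t ht)

/-- Pointwise limits along an ultrafilter stay in the regularity class. -/
theorem HolderSolOn.of_ultralimit {ι : Type*} (l : Ultrafilter ι) {v : ι → Euc d → ℝ → ℝ}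
    {u : Euc d → ℝ → ℝ} {κ T N : ℝ}
    (hv : ∀ᶠ n in (l : Filter ι), HolderSolOn univ κ T N (v n))
    (hvu : ∀ x, ∀ t ∈ Icc 0 T, Tendsto (fun n => v n x t) l (𝓝 (u x t)))
    (h : ∀ x, ∀ t ∈ Icc 0 T, ContDiffAt ℝ 2 (fun y => u y t) x ∧
      Tendsto (fun n => gradx (v n) t x) l (𝓝 (gradx u t x)) ∧
      Tendsto (fun n => hessx (v n) t x) l (𝓝 (hessx u t x))) : HolderSolOn univ κ T N u :=
  of_ultralimit_on l hv (fun x _ => hvu x)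
    (fun t ht => contDiff_iff_contDiffAt.2 fun x => (h x t ht).1) fun x _ t ht => (h x t ht).2

end HeatEstimates

section HeatSolver

open MeasureTheory ProbabilityTheory Filter Topology

variable {d : ℕ}

/-- The constant in the Schauder estimate for the heat equation. -/
noncomputable def heatN (d : ℕ) (S κ T : ℝ) : ℝ :=
  T + heatC d S * 2 * (T ^ (-(1 / 2) + 1 : ℝ) / (-(1 / 2) + 1)) +
    (1 + d * S ^ 2) * (4 * heatC d S ^ 2 * (T ^ (κ / 2 - 1 + 1) / (κ / 2 - 1 + 1))) +
    (2 * (8 * heatC d S ^ 2) / κ + 2 * (32 * heatC d S ^ 3) / (1 - κ)) + 1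

theorem heatN_bounds {S κ T : ℝ} (hS : 0 ≤ S) (hκ : 0 < κ) (hκ1 : κ < 1) (hT : 0 ≤ T) :
    T ≤ heatN d S κ T ∧
    heatC d S * 2 * (T ^ (-(1 / 2) + 1 : ℝ) / (-(1 / 2) + 1)) ≤ heatN d S κ T ∧
    4 * heatC d S ^ 2 * (T ^ (κ / 2 - 1 + 1) / (κ / 2 - 1 + 1)) ≤ heatN d S κ T ∧
    2 * (8 * heatC d S ^ 2) / κ + 2 * (32 * heatC d S ^ 3) / (1 - κ) ≤ heatN d S κ T ∧
    d * S ^ 2 * (4 * heatC d S ^ 2 * (T ^ (κ / 2 - 1 + 1) / (κ / 2 - 1 + 1))) + 1 ≤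
      heatN d S κ T := by
  have hC := heatC_nonneg d hS
  have hκ' : 0 < 1 - κ := by linarith
  have h1 : 0 ≤ heatC d S * 2 * (T ^ (-(1 / 2) + 1 : ℝ) / (-(1 / 2) + 1)) := by
    have : (0 : ℝ) ≤ -(1 / 2) + 1 := by norm_num
    positivity
  have h2 : 0 ≤ 4 * heatC d S ^ 2 * (T ^ (κ / 2 - 1 + 1) / (κ / 2 - 1 + 1)) := by
    have : (0 : ℝ) ≤ κ / 2 - 1 + 1 := by linarith
    positivity
  have h3 : 0 ≤ 2 * (8 * heatC d S ^ 2) / κ + 2 * (32 * heatC d S ^ 3) / (1 - κ) := by positivity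
  have h4 : 0 ≤ d * S ^ 2 * (4 * heatC d S ^ 2 * (T ^ (κ / 2 - 1 + 1) / (κ / 2 - 1 + 1))) := by
    positivity
  unfold heatN
  refine ⟨?_, ?_, ?_, ?_, ?_⟩ <;> linarith

theorem norm_duh_sub_le_of_bounds {F : Type} [NormedAddCommGroup F] [NormedSpace ℝ F]
    [CompleteSpace F] (σ : Euc d ≃L[ℝ] Euc d) {G : ℝ → Euc d → F}
    (hct : ∀ t x, Continuous fun s => heat σ (t - s) (G s) x) {A B κ : ℝ} (hκ : 0 < κ)
    (hκ1 : κ < 1) (hA : 0 ≤ A) (hB : 0 ≤ B)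
    (b2 : ∀ (s r : ℝ) x, 0 < r → ‖heat σ r (G s) x‖ ≤ A * r ^ (κ / 2 - 1))
    (b3 : ∀ (s r : ℝ) x y, 0 < r → ‖heat σ r (G s) x - heat σ r (G s) y‖ ≤
      B * ‖x - y‖ * r ^ ((κ - 3) / 2)) {t : ℝ} (ht : 0 ≤ t) (x y : Euc d) :
    ‖duh σ G t x - duh σ G t y‖ ≤ (2 * (2 * A) / κ + 2 * B / (1 - κ)) * ‖x - y‖ ^ κ := by
  rcases eq_or_ne x y with rfl | hxy
  · simp [Real.zero_rpow hκ.ne']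
  have hρ : 0 < ‖x - y‖ := norm_pos_iff.2 (sub_ne_zero.2 hxy)
  unfold duh
  rw [← intervalIntegral.integral_sub ((hct t x).intervalIntegrable _ _)
    ((hct t y).intervalIntegrable _ _)]
  refine norm_integral_le_split ((hct t x).sub (hct t y)) ht hκ hκ1 hρ
    (A := 2 * A) (B := B) (by positivity) (by positivity)
    (fun s _ hst => ?_) (fun s _ hst => b3 s (t - s) x y (by linarith))
  refine (norm_sub_le _ _).trans ?_
  linarith [b2 s (t - s) x (by linarith), b2 s (t - s) y (by linarith)]

variable (σ : Euc d ≃L[ℝ] Euc d)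

theorem regularized_heat_solution {S : ℝ} (hσ : ‖(σ : Euc d →L[ℝ] Euc d)‖ ≤ S)
    (hσ' : ‖(σ.symm : Euc d →L[ℝ] Euc d)‖ ≤ S)
    {κ T F : ℝ} (hκ : 0 < κ) (hκ1 : κ < 1) (hT : 0 ≤ T)
    {f : ℝ → Euc d → ℝ} (hfc : Continuous fun p : ℝ × Euc d => f p.1 p.2)
    (hM : ∀ s y, ‖f s y‖ ≤ F) (hK : ∀ s x y, ‖f s x - f s y‖ ≤ F * ‖x - y‖ ^ κ) {ε : ℝ}
    (hε : 0 < ε) :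
    HolderSolOn univ κ T (heatN d S κ T * F) (fun x t => duh σ (fun s => heat σ ε (f s)) t x) ∧
    SolvesOn univ T (fun i j _ => covM σ i j) (fun _ _ => 0) (fun x t => heat σ ε (f t) x)
      (fun x t => duh σ (fun s => heat σ ε (f s)) t x) := by
  have hS : 0 ≤ S := (norm_nonneg _).trans hσ
  have hC := heatC_nonneg d hS
  have hF : 0 ≤ F := (norm_nonneg _).trans (hM 0 0)
  have hcs : ∀ s, Continuous (f s) := fun s => hfc.comp (by fun_prop : Continuous fun y => (s, y))
  set h : ℝ → Euc d → ℝ := fun s => heat σ ε (f s) with hh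
  have hc : Continuous fun p : ℝ × Euc d => h p.1 p.2 :=
    (continuous_heat_param σ hfc hM).comp (f := fun p : ℝ × Euc d => (ε, p.1, p.2)) (by fun_prop)
  have hhM : ∀ s y, ‖h s y‖ ≤ F := fun s y => norm_heat_le σ (hM s) ε y
  have hd1c : Continuous fun p : ℝ × Euc d => fderiv ℝ (h p.1) p.2 :=
    continuous_fderiv_heat_param σ hfc hM hε
  have hd1M : ∀ s y, ‖fderiv ℝ (h s) y‖ ≤ heatC d S * (2 * F) * ε ^ (-(1 / 2) : ℝ) := fun s y =>
    norm_fderiv_heat_le σ (hcs s) (hM s) hσ hσ' hε y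
  have hd2c : Continuous fun p : ℝ × Euc d => fderiv ℝ (fderiv ℝ (h p.1)) p.2 :=
    continuous_fderiv_fderiv_heat_param σ hfc hM hε
  have hd2M : ∀ s y, ‖fderiv ℝ (fderiv ℝ (h s)) y‖ ≤
      2 * heatC d S ^ 2 * F * (ε / 2) ^ (κ / 2 - 1) := fun s y =>
    norm_fderiv_fderiv_heat_le_holder σ hσ hσ' (hcs s) (hM s) hF hκ.le hκ1.le (hK s) hε y
  have hd : ∀ s, Differentiable ℝ (h s) := fun s => differentiable_heat σ (hcs s) (hM s) hε
  have hd2 : ∀ s, Differentiable ℝ (fderiv ℝ (h s)) := fun s =>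
    differentiable_fderiv_heat σ (hcs s) (hM s) hε
  have hcd : ∀ s, ContDiff ℝ 2 (h s) := fun s => by
    rw [show (2 : WithTop ℕ∞) = 1 + 1 by norm_num, contDiff_succ_iff_fderiv]
    refine ⟨hd s, by simp, contDiff_one_iff_fderiv.2 ⟨hd2 s,
      continuous_fderiv_fderiv_heat σ (hcs s) (hM s) hε⟩⟩
  have f1 : ∀ t, fderiv ℝ (duh σ h t) = duh σ (fun s => fderiv ℝ (h s)) t := fun t => by
    ext1 x
    exact (hasFDerivAt_duh σ hc hhM hd hd1c hd1M t x).fderiv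
  have f2 : ∀ t x, HasFDerivAt (fderiv ℝ (duh σ h t))
      (duh σ (fun s => fderiv ℝ (fderiv ℝ (h s))) t x) x := fun t x => by
    rw [f1]
    exact hasFDerivAt_duh σ hd1c hd1M hd2 hd2c hd2M t x
  have f2' : ∀ t, fderiv ℝ (fderiv ℝ (duh σ h t)) =
      duh σ (fun s => fderiv ℝ (fderiv ℝ (h s))) t := fun t => by
    ext1 x
    exact (f2 t x).fderiv
  have kC := heatN_bounds (d := d) hS hκ hκ1 hT
  have q1 : ∀ x, ∀ t ∈ Icc 0 T, |duh σ h t x| ≤ heatN d S κ T * F := fun x t ht => by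
    have := intervalIntegral.norm_integral_le_of_norm_le_const (a := 0) (b := t) (C := F)
      (f := fun s => heat σ (t - s) (h s) x) fun s _ => norm_heat_le σ (hhM s) _ x
    refine this.trans ?_
    rw [sub_zero, abs_of_nonneg ht.1, mul_comm]
    exact mul_le_mul_of_nonneg_right (ht.2.trans kC.1) hF
  have q2 : ∀ x, ∀ t ∈ Icc 0 T, ‖fderiv ℝ (duh σ h t) x‖ ≤ heatN d S κ T * F := fun x t ht => by
    rw [f1]
    refine (norm_integral_le_rpow (A := heatC d S * (2 * F)) (q := -(1 / 2)) ht.1 (by norm_num)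
      fun s _ hst => ?_).trans ?_
    · rw [← fderiv_heat_add σ (hcs s) (hM s) (by linarith) hε]
      refine (norm_fderiv_heat_le σ (hcs s) (hM s) hσ hσ' (by linarith) x).trans ?_
      refine mul_le_mul_of_nonneg_left ?_ (by positivity)
      exact Real.rpow_le_rpow_of_nonpos (by linarith) (by linarith) (by norm_num)
    · have : (t - 0) ^ (-(1 / 2) + 1 : ℝ) ≤ T ^ (-(1 / 2) + 1 : ℝ) :=
        Real.rpow_le_rpow (by linarith [ht.1]) (by linarith [ht.2]) (by norm_num)
      calc _ ≤ heatC d S * (2 * F) * (T ^ (-(1 / 2) + 1 : ℝ) / (-(1 / 2) + 1)) := by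
            have : (0 : ℝ) ≤ -(1 / 2) + 1 := by norm_num
            gcongr
        _ = heatC d S * 2 * (T ^ (-(1 / 2) + 1 : ℝ) / (-(1 / 2) + 1)) * F := by ring
        _ ≤ _ := mul_le_mul_of_nonneg_right kC.2.1 hF
  have b2 : ∀ s r x, 0 < r → ‖heat σ r (fderiv ℝ (fderiv ℝ (h s))) x‖ ≤
      4 * heatC d S ^ 2 * F * r ^ (κ / 2 - 1) := fun s r x hr => by
    rw [← fderiv_fderiv_heat_add σ (hcs s) (hM s) hr.le hε]
    refine (norm_fderiv_fderiv_heat_le_holder σ hσ hσ' (hcs s) (hM s) hF hκ.le hκ1.le (hK s)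
      (by linarith) x).trans ?_
    have e1 : ((r + ε) / 2) ^ (κ / 2 - 1) ≤ (r / 2) ^ (κ / 2 - 1) :=
      Real.rpow_le_rpow_of_nonpos (by linarith) (by linarith) (by linarith)
    have e2 : (r / 2) ^ (κ / 2 - 1) ≤ 2 * r ^ (κ / 2 - 1) := by
      rw [div_eq_mul_inv, Real.mul_rpow hr.le (by norm_num), mul_comm, Real.inv_rpow (by norm_num),
        ← Real.rpow_neg (by norm_num)]
      refine mul_le_mul_of_nonneg_right ?_ (by positivity)
      calc (2 : ℝ) ^ (-(κ / 2 - 1)) ≤ 2 ^ (1 : ℝ) :=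
            Real.rpow_le_rpow_of_exponent_le (by norm_num) (by linarith)
        _ = 2 := by norm_num
    calc _ ≤ 2 * heatC d S ^ 2 * F * (2 * r ^ (κ / 2 - 1)) := by
          gcongr
          exact e1.trans e2
      _ = _ := by ring
  have b3 : ∀ s r x y, 0 < r → ‖heat σ r (fderiv ℝ (fderiv ℝ (h s))) x -
      heat σ r (fderiv ℝ (fderiv ℝ (h s))) y‖ ≤
      (32 * heatC d S ^ 3 * F) * ‖x - y‖ * r ^ ((κ - 3) / 2) := fun s r x y hr => by
    rw [← fderiv_fderiv_heat_add σ (hcs s) (hM s) hr.le hε]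
    refine (norm_fderiv_fderiv_heat_sub_le σ hσ hσ' (hcs s) (hM s) hF hκ.le hκ1.le (hK s)
      (by linarith) x y).trans ?_
    have e1 : ((r + ε) / 4) ^ ((κ - 3) / 2) ≤ (r / 4) ^ ((κ - 3) / 2) :=
      Real.rpow_le_rpow_of_nonpos (by linarith) (by linarith) (by linarith)
    have e2 : (r / 4) ^ ((κ - 3) / 2) ≤ 8 * r ^ ((κ - 3) / 2) := by
      rw [div_eq_mul_inv, Real.mul_rpow hr.le (by norm_num), mul_comm, Real.inv_rpow (by norm_num),
        ← Real.rpow_neg (by norm_num)]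
      refine mul_le_mul_of_nonneg_right ?_ (by positivity)
      calc (4 : ℝ) ^ (-((κ - 3) / 2)) ≤ 4 ^ (3 / 2 : ℝ) :=
            Real.rpow_le_rpow_of_exponent_le (by norm_num) (by linarith)
        _ = (2 ^ (2 : ℝ)) ^ (3 / 2 : ℝ) := by norm_num
        _ = 8 := by
          rw [← Real.rpow_mul (by norm_num)]
          norm_num
    calc _ ≤ 4 * heatC d S ^ 3 * F * (8 * r ^ ((κ - 3) / 2)) * ‖x - y‖ := by
          gcongr
          exact e1.trans e2
      _ = _ := by ring
  have q3 : ∀ x, ∀ t ∈ Icc 0 T, ‖fderiv ℝ (fderiv ℝ (duh σ h t)) x‖ ≤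
      4 * heatC d S ^ 2 * (T ^ (κ / 2 - 1 + 1) / (κ / 2 - 1 + 1)) * F := fun x t ht => by
    rw [f2']
    refine (norm_integral_le_rpow (A := 4 * heatC d S ^ 2 * F) (q := κ / 2 - 1) ht.1 (by linarith)
      fun s _ hst => b2 s (t - s) x (by linarith)).trans ?_
    have e1 : (t - 0) ^ (κ / 2 - 1 + 1) ≤ T ^ (κ / 2 - 1 + 1) :=
      Real.rpow_le_rpow (by linarith [ht.1]) (by linarith [ht.2]) (by linarith)
    have e2 : 0 ≤ κ / 2 - 1 + 1 := by linarith
    calc _ ≤ 4 * heatC d S ^ 2 * F * (T ^ (κ / 2 - 1 + 1) / (κ / 2 - 1 + 1)) := by gcongr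
      _ = _ := by ring
  have e0 : Continuous fun p : ℝ × ℝ × Euc d =>
      heat σ (p.1 - p.2.1) (fderiv ℝ (fderiv ℝ (h p.2.1))) p.2.2 :=
    continuous_heat_sub_param (F := Euc d →L[ℝ] Euc d →L[ℝ] ℝ)
      (h := fun s => fderiv ℝ (fderiv ℝ (h s))) σ hd2c hd2M
  have hct : ∀ t x, Continuous fun s => heat σ (t - s) (fderiv ℝ (fderiv ℝ (h s))) x :=
    fun t x => e0.comp (f := fun s : ℝ => (t, s, x)) (by fun_prop)
  have q4 : ∀ x y, ∀ t ∈ Icc 0 T, ‖fderiv ℝ (fderiv ℝ (duh σ h t)) x -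
      fderiv ℝ (fderiv ℝ (duh σ h t)) y‖ ≤ heatN d S κ T * F * ‖x - y‖ ^ κ := fun x y t ht => by
    rw [f2']
    refine (norm_duh_sub_le_of_bounds (F := Euc d →L[ℝ] Euc d →L[ℝ] ℝ) σ hct hκ hκ1
      (A := 4 * heatC d S ^ 2 * F) (B := 32 * heatC d S ^ 3 * F) (by positivity) (by positivity)
      b2 b3 ht.1 x y).trans ?_
    refine mul_le_mul_of_nonneg_right ?_ (by positivity)
    calc _ = (2 * (8 * heatC d S ^ 2) / κ + 2 * (32 * heatC d S ^ 3) / (1 - κ)) * F := by ring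
      _ ≤ _ := mul_le_mul_of_nonneg_right kC.2.2.2.1 hF
  have hder : ∀ x, ∀ t ∈ Icc 0 T, HasDerivWithinAt (fun t => duh σ h t x)
      (gen σ (fderiv ℝ (fderiv ℝ (duh σ h t)) x) + h t x) (Icc 0 T) t := fun x t ht => by
    rw [f2']
    refine hasDerivWithinAt_duh σ hc hhM hcd hd2c hd2M (K := 4 * heatC d S ^ 3 * F *
      (ε / 4) ^ ((κ - 3) / 2)) (by positivity) (fun s x y => ?_) ht x
    exact norm_fderiv_fderiv_heat_sub_le σ hσ hσ' (hcs s) (hM s) hF hκ.le hκ1.le (hK s) hε x y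
  refine ⟨⟨fun t ht => ?_, fun x _ => q1 x, fun x _ => q2 x, fun x _ t ht => (q3 x t ht).trans
    (mul_le_mul_of_nonneg_right kC.2.2.1 hF), fun x _ y _ => q4 x y, fun x _ s hs t ht => ?_⟩,
    fun x _ t ht => ?_⟩
  · rw [show (2 : WithTop ℕ∞) = 1 + 1 by norm_num, contDiff_succ_iff_fderiv]
    refine ⟨fun x => (hasFDerivAt_duh σ hc hhM hd hd1c hd1M t x).differentiableAt, by simp,
      contDiff_one_iff_fderiv.2 ⟨fun x => (f2 t x).differentiableAt, ?_⟩⟩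
    have e : fderiv ℝ (fderiv ℝ fun x => duh σ h t x) =
      duh σ (fun s => fderiv ℝ (fderiv ℝ (h s))) t := f2' t
    rw [e]
    exact (continuous_duh σ hd2c hd2M).comp (f := fun x => (t, x)) (by fun_prop)
  · refine (convex_Icc 0 T).norm_image_sub_le_of_norm_hasDerivWithin_le (hder x) (fun r hr => ?_)
      ht hs
    refine (abs_add_le _ _).trans ?_
    have g1 := abs_gen_le σ hσ (fderiv ℝ (fderiv ℝ (duh σ h r)) x)
    have g2 : |h r x| ≤ F := hhM r x
    calc _ ≤ d * S ^ 2 * (4 * heatC d S ^ 2 * (T ^ (κ / 2 - 1 + 1) / (κ / 2 - 1 + 1)) * F) + F :=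
          add_le_add (g1.trans (mul_le_mul_of_nonneg_left (q3 x r hr) (by positivity))) g2
      _ = (d * S ^ 2 * (4 * heatC d S ^ 2 * (T ^ (κ / 2 - 1 + 1) / (κ / 2 - 1 + 1))) + 1) * F := by
          ring
      _ ≤ _ := mul_le_mul_of_nonneg_right kC.2.2.2.2 hF
  · have := hder x t ht
    have e : ell (fun i j _ => covM σ i j) (fun _ _ => 0) (fun x t => duh σ h t x) x t =
        gen σ (fderiv ℝ (fderiv ℝ (duh σ h t)) x) := opL_covM σ _ _
    rw [e]
    exact this

/-- Solvability of the heat equation with Schauder estimates. -/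
theorem exists_heat_solution {S : ℝ} (hσ : ‖(σ : Euc d →L[ℝ] Euc d)‖ ≤ S)
    (hσ' : ‖(σ.symm : Euc d →L[ℝ] Euc d)‖ ≤ S)
    {κ T F : ℝ} (hκ : 0 < κ) (hκ1 : κ < 1) (hT : 0 ≤ T)
    {f : Euc d → ℝ → ℝ} (hf : HolderSource κ T F f) :
    ∃ u, HolderSolOn univ κ T (heatN d S κ T * F) u ∧
      SolvesOn univ T (fun i j _ => covM σ i j) (fun _ _ => 0) f u ∧ ∀ x, u x 0 = 0 := by
  have hS : 0 ≤ S := (norm_nonneg _).trans hσ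
  have hF : 0 ≤ F := (abs_nonneg _).trans (hf.bound 0 0 ⟨le_rfl, hT⟩)
  set g : ℝ → Euc d → ℝ := fun s x => f x (projIcc 0 T hT s) with hg
  have hK : ∀ s x y, ‖g s x - g s y‖ ≤ F * ‖x - y‖ ^ κ := fun s x y =>
    hf.holder x y _ (projIcc 0 T hT s).2
  have hM : ∀ s y, ‖g s y‖ ≤ F := fun s y => hf.bound y _ (projIcc 0 T hT s).2
  have hgc : Continuous fun p : ℝ × Euc d => g p.1 p.2 :=
    continuous_of_holder_param (fun x => (hf.cont x).comp_continuous (by fun_prop)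
      fun s => (projIcc 0 T hT s).2) hκ hK
  have hge : ∀ x, ∀ t ∈ Icc 0 T, g t x = f x t := fun x t ht => by
    simp only [hg, projIcc_of_mem hT ht]
  set e : ℕ → ℝ := fun n => 1 / ((n : ℝ) + 1) with he
  have he0 : ∀ n, 0 < e n := fun n => by positivity
  have helim : Tendsto e atTop (𝓝 0) := tendsto_one_div_add_atTop_nhds_zero_nat
  have key := fun n => regularized_heat_solution σ hσ hσ' hκ hκ1 hT hgc hM hK (he0 n)
  set v : ℕ → Euc d → ℝ → ℝ := fun n x t => duh σ (fun s => heat σ (e n) (g s)) t x with hv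
  set l : Ultrafilter ℕ := hyperfilter ℕ with hl
  have hl' : (l : Filter ℕ) ≤ atTop := Nat.hyperfilter_le_atTop
  have hlim : ∀ x, ∀ t ∈ Icc 0 T, ∃ z, Tendsto (fun n => v n x t) l (𝓝 z) := fun x t ht =>
    exists_ultralimit l (Eventually.of_forall fun n => (key n).1.bound x trivial t ht)
  choose! u hu using hlim
  have cont : Continuous fun p : ℝ × ℝ × Euc d => heat σ p.1 (g p.2.1) p.2.2 :=
    continuous_heat_param σ hgc hM
  have main := ultralimit_solves l (v := v) (f := fun n x t => heat σ (e n) (g t) x) (u := u)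
    (g := f) (κ := κ) (T := T) isOpen_univ convex_univ hκ
    (by have := (heatN_bounds (d := d) hS hκ hκ1 hT).1
        positivity [hT.trans this] : 0 ≤ heatN d S κ T * F)
    (a := fun i j _ => covM σ i j) (b := fun _ _ => 0)
    (Eventually.of_forall key) (fun x _ t ht => hu x t ht) (fun x _ t ht => ?_)
    (fun x _ t ht ε hε => ?_)
  · refine ⟨u, HolderSolOn.of_ultralimit l (Eventually.of_forall fun n => (key n).1) hu
      fun x t ht => main.1 x trivial t ht, main.2, fun x => ?_⟩
    refine tendsto_nhds_unique (hu x 0 ⟨le_rfl, hT⟩) ?_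
    simp [hv, duh]
  · have h1 : Tendsto (fun n => heat σ (e n) (g t) x) atTop (𝓝 (heat σ 0 (g t) x)) :=
      ((cont.comp (f := fun s : ℝ => (s, t, x)) (by fun_prop)).tendsto 0).comp helim
    rw [heat_zero, hge x t ht] at h1
    exact h1.mono_left hl'
  · have h1 : ContinuousAt (fun p : ℝ × ℝ => heat σ p.1 (g p.2) x) (0, t) :=
      (cont.comp (f := fun p : ℝ × ℝ => (p.1, p.2, x)) (by fun_prop)).continuousAt
    obtain ⟨δ, hδ, h2⟩ := Metric.continuousAt_iff.1 h1 _ (half_pos hε)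
    refine ⟨δ, hδ, ?_⟩
    filter_upwards [hl' (helim (Metric.ball_mem_nhds 0 hδ))] with n hn s hs hst
    have h3 := @h2 (e n, s) (by
      rw [Prod.dist_eq, max_lt_iff]
      exact ⟨hn, by simpa [Real.dist_eq] using hst⟩)
    have h4 := @h2 (e n, t) (by
      rw [Prod.dist_eq, max_lt_iff]
      exact ⟨hn, by simpa using hδ⟩)
    rw [Real.dist_eq] at h3 h4
    simp only at h3 h4
    rw [abs_lt] at h3 h4
    rw [abs_le]
    constructor <;> linarith [h3.1, h3.2, h4.1, h4.2]

end HeatSolver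

section MaximumPrinciple

open Filter Topology

variable {d : ℕ}

theorem tendsto_norm_sub_self_of_continuous {X G : Type*} [TopologicalSpace X]
    [NormedAddCommGroup G] {v : X → G} (hv : Continuous v) (x : X) :
    Tendsto (fun y => ‖v y - v x‖) (𝓝 x) (𝓝 0) :=
  tendsto_iff_norm_sub_tendsto_zero.1 (hv.tendsto x)

theorem fderiv_fderiv_apply_nonpos {φ : Euc d → ℝ} (hφ : ContDiff ℝ 2 φ) {x : Euc d}
    (hx : IsLocalMax φ x) (v : Euc d) : fderiv ℝ (fderiv ℝ φ) x v v ≤ 0 := by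
  have hcont : Continuous (fderiv ℝ (fderiv ℝ φ)) :=
    ((hφ.fderiv_right (m := 1) (by norm_num)).continuous_fderiv (by norm_num))
  refine le_of_forall_pos_le_add fun ε hε => ?_
  rcases eq_or_ne v 0 with rfl | hv
  · simp [hε.le]
  have hv' : 0 < ‖v‖ := norm_pos_iff.2 hv
  set η := ε / ‖v‖ ^ 2 with hη
  have hη0 : 0 < η := by positivity
  have hlim := tendsto_norm_sub_self_of_continuous (G := Euc d →L[ℝ] Euc d →L[ℝ] ℝ) hcont x
  obtain ⟨r, hr, hball⟩ := Metric.eventually_nhds_iff.1 (hlim.eventually (gt_mem_nhds hη0))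
  obtain ⟨r', hr', hmax⟩ := Metric.eventually_nhds_iff.1 hx
  have hm : 0 < min r r' := lt_min hr hr'
  set s := min r r' / (3 * ‖v‖) with hs
  have hs0 : 0 < s := by positivity
  have hsv : ‖s • v‖ = min r r' / 3 := by
    rw [norm_smul, Real.norm_of_nonneg hs0.le, hs]
    field_simp
  have hsv' : ‖-(s • v)‖ = min r r' / 3 := by rw [norm_neg, hsv]
  have key := second_difference_sub_le hφ (x := x) (v := s • v) (w := -(s • v)) (N := η)
    hsv.le hsv'.le fun y hy => (hball (by
      have h1 := Metric.mem_closedBall.1 hy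
      have := min_le_left r r'
      linarith)).le
  have h1 : φ (x + s • v) ≤ φ x := hmax (by
    rw [dist_eq_norm, add_sub_cancel_left, hsv]
    linarith [min_le_right r r'])
  have h2 : φ (x + -(s • v)) ≤ φ x := hmax (by
    rw [dist_eq_norm, add_sub_cancel_left, hsv']
    linarith [min_le_right r r'])
  rw [add_neg_cancel_right, norm_neg, norm_smul, Real.norm_of_nonneg hs0.le] at key
  simp only [map_neg, map_smul, neg_apply, smul_apply, smul_eq_mul] at key
  have h3 := (abs_le.1 key).2
  have h4 : η * ‖v‖ ^ 2 = ε := by rw [hη]; field_simp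
  have h5 : s ^ 2 * fderiv ℝ (fderiv ℝ φ) x v v ≤ s ^ 2 * ε := by
    rw [← h4]
    linarith
  linarith [le_of_mul_le_mul_left h5 (by positivity)]

open scoped MatrixOrder Matrix.Norms.L2Operator in
theorem exists_square_root_matrix {A : Fin d → Fin d → ℝ} (hsym : ∀ i j, A i j = A j i)
    (hA : ∀ ν : Euc d, 0 ≤ ∑ i, ∑ j, A i j * ν i * ν j) :
    ∃ B : Matrix (Fin d) (Fin d) ℝ, ∀ i j, A i j = ∑ k, B k i * B k j := by
  have hP : (Matrix.of A).PosSemidef := by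
    refine Matrix.PosSemidef.of_dotProduct_mulVec_nonneg ?_ fun x => ?_
    · ext i j
      simp [hsym i j]
    · refine (hA (WithLp.toLp 2 x)).trans_eq ?_
      simp only [dotProduct, Matrix.mulVec, Pi.star_apply, star_trivial, Matrix.of_apply,
        Finset.mul_sum]
      refine Finset.sum_congr rfl fun i _ => Finset.sum_congr rfl fun j _ => by ring
  obtain ⟨B, hB⟩ := CStarAlgebra.nonneg_iff_eq_star_mul_self.mp hP.nonneg
  refine ⟨B, fun i j => ?_⟩
  have := congrFun (congrFun hB i) j
  simpa [Matrix.mul_apply, Matrix.star_apply] using this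

theorem sum_mul_bilin_nonpos {A : Fin d → Fin d → ℝ} (hsym : ∀ i j, A i j = A j i)
    (hA : ∀ ν : Euc d, 0 ≤ ∑ i, ∑ j, A i j * ν i * ν j) {H : Euc d →L[ℝ] Euc d →L[ℝ] ℝ}
    (hH : ∀ v, H v v ≤ 0) : ∑ i, ∑ j, A i j * H (ebas i) (ebas j) ≤ 0 := by
  obtain ⟨B, hAB⟩ := exists_square_root_matrix hsym hA
  have e : ∑ i, ∑ j, A i j * H (ebas i) (ebas j) =
      ∑ k, H (∑ i, B k i • ebas i) (∑ i, B k i • ebas i) := by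
    simp only [map_sum, map_smul, sum_apply, smul_apply, smul_eq_mul, hAB, Finset.sum_mul,
      Finset.mul_sum]
    conv_lhs => enter [2, i]; rw [Finset.sum_comm]
    rw [Finset.sum_comm]
    refine Finset.sum_congr rfl fun k _ => ?_
    rw [Finset.sum_comm]
    refine Finset.sum_congr rfl fun i _ => Finset.sum_congr rfl fun j _ => by ring
  rw [e]
  exact Finset.sum_nonpos fun k _ => hH _

theorem opL_nonpos_of_isLocalMax {A : Fin d → Fin d → ℝ} (hsym : ∀ i j, A i j = A j i)
    (hA : ∀ ν : Euc d, 0 ≤ ∑ i, ∑ j, A i j * ν i * ν j) (B : Fin d → ℝ) {φ : Euc d → ℝ}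
    (hφ : ContDiff ℝ 2 φ) {x : Euc d} (hx : IsLocalMax φ x) :
    opL A B (fderiv ℝ (fderiv ℝ φ) x) (fderiv ℝ φ x) ≤ 0 := by
  rw [hx.fderiv_eq_zero, opL]
  have := sum_mul_bilin_nonpos hsym hA (fderiv_fderiv_apply_nonpos hφ hx)
  simp only [zero_apply, mul_zero, Finset.sum_const_zero, add_zero]
  linarith

theorem opL_le_of_isLocalMax_sub {A : Fin d → Fin d → ℝ} (hsym : ∀ i j, A i j = A j i)
    (hA : ∀ ν : Euc d, 0 ≤ ∑ i, ∑ j, A i j * ν i * ν j) (B : Fin d → ℝ) {φ ψ : Euc d → ℝ}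
    (hφ : ContDiff ℝ 2 φ) (hψ : ContDiff ℝ 2 ψ) {x : Euc d}
    (hx : IsLocalMax (fun y => φ y - ψ y) x) :
    opL A B (fderiv ℝ (fderiv ℝ φ) x) (fderiv ℝ φ x) ≤
      opL A B (fderiv ℝ (fderiv ℝ ψ) x) (fderiv ℝ ψ x) := by
  have h := opL_nonpos_of_isLocalMax hsym hA B (hφ.sub hψ) hx
  have e1 := gradx_sub (fun y _ => φ y) (fun y _ => ψ y) (t := 0) (hφ.differentiable (by norm_num))
    (hψ.differentiable (by norm_num))
  have e2 := hessx_sub (fun y _ => φ y) (fun y _ => ψ y) (t := 0) hφ hψ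
  have h' : opL A B (hessx (fun y (_ : ℝ) => φ y - ψ y) 0 x)
    (gradx (fun y (_ : ℝ) => φ y - ψ y) 0 x) ≤ 0 := h
  rw [e1, e2] at h'
  have := opL_sub A B (fderiv ℝ (fderiv ℝ φ) x) (fderiv ℝ (fderiv ℝ ψ) x) (fderiv ℝ φ x)
    (fderiv ℝ ψ x)
  have h'' := this.symm.trans_le h'
  linarith

/-- A function which is nonpositive on the parabolic boundary and has no positive interior
space-time maximum is nonpositive. -/
theorem nonpos_of_no_interior_max {g : Euc d → ℝ → ℝ} {R T : ℝ}
    (hc : ContinuousOn (fun q : Euc d × ℝ => g q.1 q.2) (Metric.closedBall 0 R ×ˢ Icc 0 T))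
    (h0 : ∀ x ∈ Metric.closedBall (0 : Euc d) R, g x 0 ≤ 0)
    (hlat : ∀ x : Euc d, ‖x‖ = R → ∀ t ∈ Icc 0 T, g x t ≤ 0)
    (hmax : ∀ x ∈ Metric.ball (0 : Euc d) R, ∀ t ∈ Ioc 0 T, 0 < g x t →
      IsLocalMax (fun y => g y t) x → (∀ s ∈ Icc 0 t, g x s ≤ g x t) → False) :
    ∀ x ∈ Metric.closedBall (0 : Euc d) R, ∀ t ∈ Icc 0 T, g x t ≤ 0 := by
  intro x hx t ht
  by_contra! hpos
  obtain ⟨⟨y, s⟩, hys, hm⟩ := ((isCompact_closedBall (0 : Euc d) R).prod isCompact_Icc).exists_isMaxOn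
    ⟨(x, t), hx, ht⟩ hc
  have hm' : ∀ z ∈ Metric.closedBall (0 : Euc d) R, ∀ r ∈ Icc 0 T, g z r ≤ g y s :=
    fun z hz r hr => hm (show (z, r) ∈ _ from ⟨hz, hr⟩)
  have hy : y ∈ Metric.closedBall (0 : Euc d) R := hys.1
  have hs : s ∈ Icc 0 T := hys.2
  have hgp : 0 < g y s := hpos.trans_le (hm' x hx t ht)
  have hs0 : 0 < s := lt_of_le_of_ne hs.1 fun h => by
    subst h
    exact (h0 y hy).not_gt hgp
  have hyR : ‖y‖ < R := lt_of_le_of_ne (mem_closedBall_zero_iff.1 hy) fun h =>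
    (hlat y h s hs).not_gt hgp
  refine hmax y (mem_ball_zero_iff.2 hyR) s ⟨hs0, hs.2⟩ hgp ?_ fun r hr =>
    hm' y hy r ⟨hr.1, hr.2.trans hs.2⟩
  filter_upwards [Metric.isOpen_ball.mem_nhds (mem_ball_zero_iff.2 hyR)] with z hz
  exact hm' z (Metric.ball_subset_closedBall hz) s hs

theorem deriv_nonneg_of_left_max {g : ℝ → ℝ} {T t g' : ℝ} (ht : t ∈ Ioc 0 T)
    (h : HasDerivWithinAt g g' (Icc 0 T) t) (hmax : ∀ s ∈ Icc 0 t, g s ≤ g t) : 0 ≤ g' := by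
  have h1 : HasDerivWithinAt g g' (Ioo 0 t) t :=
    h.mono fun s hs => ⟨hs.1.le, hs.2.le.trans ht.2⟩
  have h2 := (hasDerivWithinAt_iff_tendsto_slope' (by simp)).1 h1
  have : (𝓝[Ioo 0 t] t).NeBot := by
    rw [nhdsWithin_Ioo_eq_nhdsLT ht.1]; infer_instance
  refine ge_of_tendsto h2 ?_
  filter_upwards [self_mem_nhdsWithin] with s hs
  rw [slope_def_field]
  exact div_nonneg_of_nonpos (by linarith [hmax s ⟨hs.1.le, hs.2.le⟩]) (by linarith [hs.2])

/-- Coefficients which are uniformly elliptic, bounded and Hölder continuous on a set. -/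
structure EllipticOn (U : Set (Euc d)) (κ lam Λ : ℝ) (a : Fin d → Fin d → Euc d → ℝ)
    (b : Fin d → Euc d → ℝ) : Prop where
  symm : ∀ i j, ∀ x ∈ U, a i j x = a j i x
  elliptic : ∀ x ∈ U, ∀ ν : Euc d, lam * ‖ν‖ ^ 2 ≤ ∑ i, ∑ j, a i j x * ν i * ν j
  bound_a : ∀ i j, ∀ x ∈ U, |a i j x| ≤ Λ
  bound_b : ∀ i, ∀ x ∈ U, |b i x| ≤ Λ
  holder_a : ∀ i j, ∀ x ∈ U, ∀ y ∈ U, |a i j x - a i j y| ≤ Λ * ‖x - y‖ ^ κ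
  holder_b : ∀ i, ∀ x ∈ U, ∀ y ∈ U, |b i x - b i y| ≤ Λ * ‖x - y‖ ^ κ

variable {κ lam Λ T : ℝ} {a : Fin d → Fin d → Euc d → ℝ} {b : Fin d → Euc d → ℝ}

theorem EllipticOn.psd {U : Set (Euc d)} (hE : EllipticOn U κ lam Λ a b) (hl : 0 ≤ lam) {x : Euc d}
    (hx : x ∈ U) (ν : Euc d) : 0 ≤ ∑ i, ∑ j, a i j x * ν i * ν j :=
  le_trans (by positivity) (hE.elliptic x hx ν)

theorem EllipticOn.opL_le {U : Set (Euc d)} (hE : EllipticOn U κ lam Λ a b) (hl : 0 ≤ lam)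
    {x : Euc d} (hx : x ∈ U) {φ ψ : Euc d → ℝ}
    (hφ : ContDiff ℝ 2 φ) (hψ : ContDiff ℝ 2 ψ) 
    (hm : IsLocalMax (fun y => φ y - ψ y) x) :
    opL (fun i j => a i j x) (fun i => b i x) (fderiv ℝ (fderiv ℝ φ) x) (fderiv ℝ φ x) ≤
      opL (fun i j => a i j x) (fun i => b i x) (fderiv ℝ (fderiv ℝ ψ) x) (fderiv ℝ ψ x) :=
  opL_le_of_isLocalMax_sub (fun i j => hE.symm i j x hx) (hE.psd hl hx) _ hφ hψ hm

theorem fderiv_smul_fun {G : Type*} [NormedAddCommGroup G] [NormedSpace ℝ G] {φ : Euc d → G}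
    (k : ℝ) : fderiv ℝ (fun y => k • φ y) = fun y => k • fderiv ℝ φ y := by
  ext1 y
  rcases eq_or_ne k 0 with rfl | hk
  · simp
  · let := invertibleOfNonzero hk
    exact fderiv_const_smul_of_invertible (f := φ) (x := y) k

theorem opL_const_mul {A : Fin d → Fin d → ℝ} {B : Fin d → ℝ} {φ : Euc d → ℝ} (k : ℝ)
    (x : Euc d) :
    opL A B (fderiv ℝ (fderiv ℝ fun y => k * φ y) x) (fderiv ℝ (fun y => k * φ y) x) =
      k * opL A B (fderiv ℝ (fderiv ℝ φ) x) (fderiv ℝ φ x) := by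
  have e1 : fderiv ℝ (fun y => k * φ y) = fun y => k • fderiv ℝ φ y := fderiv_smul_fun k
  have e2 : fderiv ℝ (fun y => k • fderiv ℝ φ y) = fun y => k • fderiv ℝ (fderiv ℝ φ) y :=
    fderiv_smul_fun (G := Euc d →L[ℝ] ℝ) k
  rw [e1, e2]
  exact opL_smul A B k _ _

theorem fderiv_one_add_norm_sq :
    fderiv ℝ (fun y : Euc d => 1 + ‖y‖ ^ 2) = fun y => 2 • innerSL ℝ y := by
  ext1 y
  rw [fderiv_const_add, fderiv_norm_sq]
  rfl

theorem fderiv_fderiv_one_add_norm_sq (x : Euc d) :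
    fderiv ℝ (fderiv ℝ (fun y : Euc d => 1 + ‖y‖ ^ 2)) x = 2 • innerSL ℝ := by
  rw [fderiv_one_add_norm_sq]
  exact (ContinuousLinearMap.fderiv (2 • innerSL ℝ : Euc d →L[ℝ] Euc d →L[ℝ] ℝ))

theorem EllipticOn.abs_opL_one_add_norm_sq_le {U : Set (Euc d)} (hE : EllipticOn U κ lam Λ a b)
    (hΛ : 0 ≤ Λ) {x : Euc d} (hx : x ∈ U) :
    |opL (fun i j => a i j x) (fun i => b i x) (fderiv ℝ (fderiv ℝ fun y => 1 + ‖y‖ ^ 2) x)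
      (fderiv ℝ (fun y => 1 + ‖y‖ ^ 2) x)| ≤ (2 * d ^ 2 * Λ + d * Λ) * (1 + ‖x‖ ^ 2) := by
  refine (abs_opL_le (fun i j => hE.bound_a i j x hx) (fun i => hE.bound_b i x hx) _ _).trans ?_
  rw [fderiv_fderiv_one_add_norm_sq, fderiv_one_add_norm_sq]
  have h1 : ‖(2 • innerSL ℝ : Euc d →L[ℝ] Euc d →L[ℝ] ℝ)‖ ≤ 2 := by
    refine ContinuousLinearMap.opNorm_le_bound₂ _ (by norm_num) fun v w => ?_
    simp only [smul_apply, innerSL_apply_apply, nsmul_eq_mul, Nat.cast_ofNat, norm_mul]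
    have := norm_inner_le_norm (𝕜 := ℝ) v w
    rw [Real.norm_ofNat, mul_assoc]
    exact mul_le_mul_of_nonneg_left this (by norm_num)
  have h2 : ‖(2 • innerSL ℝ x : Euc d →L[ℝ] ℝ)‖ ≤ 2 * ‖x‖ := by
    refine ContinuousLinearMap.opNorm_le_bound _ (by positivity) fun w => ?_
    simp only [smul_apply, innerSL_apply_apply, nsmul_eq_mul, Nat.cast_ofNat, norm_mul]
    have := norm_inner_le_norm (𝕜 := ℝ) x w
    rw [Real.norm_ofNat, mul_assoc]
    exact mul_le_mul_of_nonneg_left this (by norm_num)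
  have h3 : 2 * ‖x‖ ≤ 1 + ‖x‖ ^ 2 := by nlinarith [sq_nonneg (‖x‖ - 1)]
  have h4 : 2 ≤ 2 * (1 + ‖x‖ ^ 2) := by nlinarith [sq_nonneg ‖x‖]
  calc _ ≤ d ^ 2 * Λ * (2 * (1 + ‖x‖ ^ 2)) + d * Λ * (1 + ‖x‖ ^ 2) := by
        gcongr
        · exact h1.trans h4
        · exact h2.trans h3
    _ = _ := by ring

/-- The maximum principle on the whole space for bounded subsolutions. -/
theorem EllipticOn.nonpos_of_subsolution (hE : EllipticOn univ κ lam Λ a b) (hl : 0 ≤ lam)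
    (hΛ : 0 ≤ Λ) {c K : ℝ} {u : Euc d → ℝ → ℝ}
    (hc : ContinuousOn (fun q : Euc d × ℝ => u q.1 q.2) (univ ×ˢ Icc 0 T))
    (hs : ∀ t ∈ Ioc 0 T, ContDiff ℝ 2 fun x => u x t)
    (hK : ∀ x, ∀ t ∈ Icc 0 T, u x t ≤ K) (h0 : ∀ x, u x 0 ≤ 0)
    (hd : ∀ x, ∀ t ∈ Ioc 0 T, 0 < u x t → ∃ u', HasDerivWithinAt (u x) u' (Icc 0 T) t ∧
      u' ≤ ell a b u x t + c * u x t) : ∀ x, ∀ t ∈ Icc 0 T, u x t ≤ 0 := by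
  intro x t ht
  set μ := 2 * d ^ 2 * Λ + d * Λ + 1 with hμ
  have hμ0 : 0 < μ := by positivity
  have main : ∀ δ > 0, Real.exp (-(c * t)) * u x t - δ * Real.exp (μ * t) * (1 + ‖x‖ ^ 2) ≤ 0 := by
    intro δ hδ
    set K' := Real.exp (|c| * T) * |K| with hK'
    have hK'0 : 0 ≤ K' := by positivity
    have hbd : ∀ y, ∀ s ∈ Icc 0 T, Real.exp (-(c * s)) * u y s ≤ K' := fun y s hs => by
      have h1 : -(c * s) ≤ |c| * T := by
        have : -(c * s) ≤ |c| * s := by nlinarith [neg_abs_le c, hs.1]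
        nlinarith [hs.2, abs_nonneg c]
      calc _ ≤ Real.exp (-(c * s)) * |K| := by
            exact mul_le_mul_of_nonneg_left ((hK y s hs).trans (le_abs_self K)) (Real.exp_pos _).le
        _ ≤ _ := mul_le_mul_of_nonneg_right (Real.exp_le_exp.2 h1) (abs_nonneg K)
    set R := ‖x‖ + 1 + K' / δ with hR
    have hR1 : 1 ≤ R := by
      have : 0 ≤ K' / δ := by positivity
      linarith [norm_nonneg x]
    refine nonpos_of_no_interior_max (R := R) (T := T)
      (g := fun y s => Real.exp (-(c * s)) * u y s - δ * Real.exp (μ * s) * (1 + ‖y‖ ^ 2))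
      ?_ (fun y _ => ?_) (fun y hy s hs' => ?_) (fun y hy s hs' hpos hmax htmax => ?_) x ?_ t ht
    · refine ContinuousOn.sub (ContinuousOn.mul (Continuous.continuousOn (by fun_prop))
        (hc.mono (prod_mono (subset_univ _) subset_rfl))) (Continuous.continuousOn (by fun_prop))
    · have : 0 ≤ δ * Real.exp (μ * 0) * (1 + ‖y‖ ^ 2) := by positivity
      have h1 := h0 y
      simp only [mul_zero, neg_zero, Real.exp_zero, one_mul] at this ⊢
      linarith
    · have h1 := hbd y s hs'
      have h2 : 1 ≤ Real.exp (μ * s) := Real.one_le_exp (by nlinarith [hs'.1])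
      have h3 : K' ≤ δ * (1 + ‖y‖ ^ 2) := by
        rw [hy]
        have : K' / δ ≤ 1 + R ^ 2 := by nlinarith [norm_nonneg x]
        rwa [div_le_iff₀ hδ, mul_comm] at this
      have h4 : δ * (1 + ‖y‖ ^ 2) ≤ δ * Real.exp (μ * s) * (1 + ‖y‖ ^ 2) := by
        gcongr
        nlinarith
      linarith
    · have hu : 0 < u y s := by
        have : 0 ≤ δ * Real.exp (μ * s) * (1 + ‖y‖ ^ 2) := by positivity
        exact pos_of_mul_pos_right (by linarith : 0 < Real.exp (-(c * s)) * u y s)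
          (Real.exp_pos _).le
      obtain ⟨u', hu', hle⟩ := hd y s hs' hu
      have e1 : HasDerivAt (fun s : ℝ => Real.exp (-(c * s))) (Real.exp (-(c * s)) * (-(c * 1))) s :=
        (((hasDerivAt_id s).const_mul c).fun_neg).exp
      have e2 : HasDerivAt (fun s : ℝ => δ * Real.exp (μ * s) * (1 + ‖y‖ ^ 2))
          (δ * (Real.exp (μ * s) * (μ * 1)) * (1 + ‖y‖ ^ 2)) s :=
        ((((hasDerivAt_id s).const_mul μ).exp).const_mul δ).mul_const _
      have e3 := deriv_nonneg_of_left_max hs'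
        ((e1.hasDerivWithinAt.fun_mul hu').fun_sub e2.hasDerivWithinAt) htmax
      have e4 := hE.opL_le hl (mem_univ y) (φ := fun y => Real.exp (-(c * s)) * u y s)
        (ψ := fun y => δ * Real.exp (μ * s) * (1 + ‖y‖ ^ 2)) (contDiff_const.mul (hs s hs'))
        (contDiff_const.mul (contDiff_const.add (contDiff_norm_sq ℝ))) hmax
      rw [opL_const_mul, opL_const_mul] at e4
      have e5 := (abs_le.1 (hE.abs_opL_one_add_norm_sq_le hΛ (mem_univ y))).2
      have e6 : Real.exp (-(c * s)) * u' ≤ Real.exp (-(c * s)) * (ell a b u y s + c * u y s) := by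
        gcongr
      have e7 : 0 < δ * Real.exp (μ * s) := by positivity
      have e8 := mul_le_mul_of_nonneg_left e5 e7.le
      have e9 : 0 < δ * Real.exp (μ * s) * (1 + ‖y‖ ^ 2) := by positivity
      have e10 : Real.exp (-(c * s)) * ell a b u y s ≤
        δ * Real.exp (μ * s) * ((μ - 1) * (1 + ‖y‖ ^ 2)) := by
        refine (e4.trans e8).trans_eq ?_
        rw [hμ]
        ring
      nlinarith
    · rw [mem_closedBall_zero_iff]
      have : 0 ≤ K' / δ := by positivity
      linarith
  have h2 : Real.exp (-(c * t)) * u x t ≤ 0 := by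
    refine le_of_forall_pos_le_add fun ε hε => ?_
    have h3 : 0 < Real.exp (μ * t) * (1 + ‖x‖ ^ 2) := by positivity
    have := main (ε / (Real.exp (μ * t) * (1 + ‖x‖ ^ 2))) (by positivity)
    rw [mul_assoc, div_mul_cancel₀ _ h3.ne'] at this
    linarith
  by_contra! h3
  exact h2.not_gt (by positivity)

end MaximumPrinciple

section Comparison

open Filter Topology

variable {d : ℕ} {κ lam Λ T : ℝ} {a : Fin d → Fin d → Euc d → ℝ} {b : Fin d → Euc d → ℝ}

/-- Bounded functions, continuous and twice continuously differentiable in space. -/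
structure BddSmooth (T : ℝ) (u : Euc d → ℝ → ℝ) : Prop where
  cont : ContinuousOn (fun q : Euc d × ℝ => u q.1 q.2) (univ ×ˢ Icc 0 T)
  smooth : ∀ t ∈ Icc 0 T, ContDiff ℝ 2 fun x => u x t
  bdd : ∃ K, ∀ x, ∀ t ∈ Icc 0 T, |u x t| ≤ K

theorem BddSmooth.sub {u v : Euc d → ℝ → ℝ} (hu : BddSmooth T u) (hv : BddSmooth T v) :
    BddSmooth T (fun x t => u x t - v x t) where
  cont := hu.cont.sub hv.cont
  smooth t ht := (hu.smooth t ht).sub (hv.smooth t ht)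
  bdd := by
    obtain ⟨K, hK⟩ := hu.bdd
    obtain ⟨K', hK'⟩ := hv.bdd
    exact ⟨K + K', fun x t ht => (abs_sub _ _).trans (add_le_add (hK x t ht) (hK' x t ht))⟩

theorem BddSmooth.const_mul {u : Euc d → ℝ → ℝ} (hu : BddSmooth T u) (k : ℝ) :
    BddSmooth T (fun x t => k * u x t) where
  cont := continuousOn_const.mul hu.cont
  smooth t ht := contDiff_const.mul (hu.smooth t ht)
  bdd := by
    obtain ⟨K, hK⟩ := hu.bdd
    refine ⟨|k| * K, fun x t ht => ?_⟩
    rw [abs_mul]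
    exact mul_le_mul_of_nonneg_left (hK x t ht) (abs_nonneg k)

theorem HolderSolOn.abs_sub_le {N : ℝ} {u : Euc d → ℝ → ℝ} (hu : HolderSolOn univ κ T N u)
    (x y : Euc d) {t : ℝ} (ht : t ∈ Icc 0 T) : |u x t - u y t| ≤ N * ‖x - y‖ :=
  convex_univ.norm_image_sub_le_of_norm_fderiv_le (𝕜 := ℝ) (f := fun x => u x t)
    (fun z _ => ((hu.smooth t ht).differentiable (by norm_num)) z)
    (fun z _ => hu.bound1 z trivial t ht) trivial trivial

theorem HolderSolOn.bddSmooth {N : ℝ} {u : Euc d → ℝ → ℝ} (hu : HolderSolOn univ κ T N u) :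
    BddSmooth T u where
  cont := by
    rintro ⟨x, t⟩ ⟨-, ht⟩
    have h0 : Tendsto (fun q : Euc d × ℝ => N * ‖q.1 - x‖ + N * |q.2 - t|) (𝓝 (x, t)) (𝓝 0) := by
      have : Continuous (fun q : Euc d × ℝ => N * ‖q.1 - x‖ + N * |q.2 - t|) := by fun_prop
      simpa using this.tendsto (x, t)
    refine tendsto_iff_norm_sub_tendsto_zero.2 (squeeze_zero' (Eventually.of_forall fun _ =>
      norm_nonneg _) ?_ (h0.mono_left nhdsWithin_le_nhds))
    filter_upwards [self_mem_nhdsWithin] with q hq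
    have h1 := hu.abs_sub_le q.1 x hq.2
    have h2 := hu.lip x trivial q.2 hq.2 t ht
    calc ‖u q.1 q.2 - u x t‖ ≤ |u q.1 q.2 - u x q.2| + |u x q.2 - u x t| :=
        _root_.abs_sub_le _ _ _
      _ ≤ _ := add_le_add h1 h2
  smooth := hu.smooth
  bdd := ⟨N, fun x => hu.bound x trivial⟩

theorem SolvesOn.sub {U : Set (Euc d)} {f g u v : Euc d → ℝ → ℝ} (hu : SolvesOn U T a b f u)
    (hv : SolvesOn U T a b g v) (hus : ∀ t ∈ Icc 0 T, ContDiff ℝ 2 fun x => u x t)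
    (hvs : ∀ t ∈ Icc 0 T, ContDiff ℝ 2 fun x => v x t) :
    SolvesOn U T a b (fun x t => f x t - g x t) (fun x t => u x t - v x t) := fun x hx t ht => by
  refine ((hu x hx t ht).fun_sub (hv x hx t ht)).congr_deriv ?_
  unfold ell
  rw [gradx_sub u v ((hus t ht).differentiable (by norm_num))
    ((hvs t ht).differentiable (by norm_num)), hessx_sub u v (hus t ht) (hvs t ht), opL_sub]
  ring

theorem SolvesOn.const_mul {U : Set (Euc d)} {f u : Euc d → ℝ → ℝ} (hu : SolvesOn U T a b f u)
    (k : ℝ) : SolvesOn U T a b (fun x t => k * f x t) (fun x t => k * u x t) := fun x hx t ht => by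
  refine ((hu x hx t ht).const_mul k).congr_deriv ?_
  have : ell a b (fun x t => k * u x t) x t = k * ell a b u x t := opL_const_mul k x
  rw [this]
  ring

theorem EllipticOn.le_of_source_le (hE : EllipticOn univ κ lam Λ a b) (hl : 0 ≤ lam) (hΛ : 0 ≤ Λ)
    {f u : Euc d → ℝ → ℝ} (hu : BddSmooth T u) (hs : SolvesOn univ T a b f u) {ψ ψ' : ℝ → ℝ}
    (hψ : ∀ t ∈ Icc 0 T, HasDerivWithinAt ψ (ψ' t) (Icc 0 T) t)
    (h0 : ∀ x, u x 0 ≤ ψ 0) (hf : ∀ x, ∀ t ∈ Icc 0 T, f x t ≤ ψ' t) :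
    ∀ x, ∀ t ∈ Icc 0 T, u x t ≤ ψ t := by
  have hψc : ContinuousOn ψ (Icc 0 T) := fun t ht => (hψ t ht).continuousWithinAt
  obtain ⟨K, hK⟩ := hu.bdd
  obtain ⟨K', hK'⟩ := isCompact_Icc.exists_bound_of_continuousOn hψc
  intro x t ht
  refine sub_nonpos.1 (hE.nonpos_of_subsolution hl hΛ (c := 0) (K := K + K')
    (u := fun x t => u x t - ψ t)
    (hu.cont.sub (hψc.comp continuousOn_snd fun q hq => hq.2))
    (fun t ht => (hu.smooth t (Ioc_subset_Icc_self ht)).sub contDiff_const)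
    (fun x t ht => ?_) (fun x => sub_nonpos.2 (h0 x)) (fun x t ht _ => ?_) x t ht)
  · have h1 := (abs_le.1 (hK x t ht)).2
    have h2 := (abs_le.1 (hK' t ht)).1
    linarith
  · have ht' := Ioc_subset_Icc_self ht
    refine ⟨_, (hs x trivial t ht').fun_sub (hψ t ht'), ?_⟩
    have e : ell a b (fun x t => u x t - ψ t) x t = ell a b u x t := by
      have e1 : gradx (fun x t => u x t - ψ t) t = gradx u t := by
        ext1 y
        exact fderiv_sub_const _
      unfold ell hessx
      rw [e1]
    rw [e]
    linarith [hf x t ht']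

theorem EllipticOn.abs_le_of_source_le (hE : EllipticOn univ κ lam Λ a b) (hl : 0 ≤ lam)
    (hΛ : 0 ≤ Λ) {f u : Euc d → ℝ → ℝ} (hu : BddSmooth T u) (hs : SolvesOn univ T a b f u)
    {ψ ψ' : ℝ → ℝ} (hψ : ∀ t ∈ Icc 0 T, HasDerivWithinAt ψ (ψ' t) (Icc 0 T) t)
    (h0 : ∀ x, |u x 0| ≤ ψ 0) (hf : ∀ x, ∀ t ∈ Icc 0 T, |f x t| ≤ ψ' t) :
    ∀ x, ∀ t ∈ Icc 0 T, |u x t| ≤ ψ t := fun x t ht => by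
  have h1 := hE.le_of_source_le hl hΛ hu hs hψ (fun x => (le_abs_self _).trans (h0 x))
    (fun x t ht => (le_abs_self _).trans (hf x t ht)) x t ht
  have h2 := hE.le_of_source_le hl hΛ (hu.const_mul (-1)) (hs.const_mul (-1)) hψ
    (fun x => by linarith [neg_abs_le (u x 0), h0 x])
    (fun x t ht => by linarith [neg_abs_le (f x t), hf x t ht]) x t ht
  exact abs_le.2 ⟨by linarith, h1⟩

theorem EllipticOn.abs_le_mul (hE : EllipticOn univ κ lam Λ a b) (hl : 0 ≤ lam)
    (hΛ : 0 ≤ Λ) {f u : Euc d → ℝ → ℝ} (hu : BddSmooth T u) (hs : SolvesOn univ T a b f u) {F : ℝ}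
    (h0 : ∀ x, u x 0 = 0) (hf : ∀ x, ∀ t ∈ Icc 0 T, |f x t| ≤ F) :
    ∀ x, ∀ t ∈ Icc 0 T, |u x t| ≤ F * t :=
  hE.abs_le_of_source_le hl hΛ hu hs (ψ := fun t => F * t) (ψ' := fun _ => F)
    (fun t _ => by simpa using ((hasDerivAt_id t).const_mul F).hasDerivWithinAt)
    (fun x => by simp [h0]) hf

theorem EllipticOn.abs_le_exp (hE : EllipticOn univ κ lam Λ a b) (hl : 0 ≤ lam)
    (hΛ : 0 ≤ Λ) {f u : Euc d → ℝ → ℝ} (hu : BddSmooth T u) (hs : SolvesOn univ T a b f u)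
    {F μ : ℝ} (hF : 0 ≤ F) (hμ : 0 < μ) (h0 : ∀ x, u x 0 = 0)
    (hf : ∀ x, ∀ t ∈ Icc 0 T, |f x t| ≤ F * Real.exp (μ * t)) :
    ∀ x, ∀ t ∈ Icc 0 T, |u x t| ≤ F / μ * Real.exp (μ * t) :=
  hE.abs_le_of_source_le hl hΛ hu hs (ψ := fun t => F / μ * Real.exp (μ * t))
    (ψ' := fun t => F * Real.exp (μ * t))
    (fun t _ => by
      have := ((((hasDerivAt_id t).const_mul μ).exp).const_mul (F / μ)).hasDerivWithinAt
        (s := Icc 0 T)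
      refine this.congr_deriv ?_
      field_simp
      rfl)
    (fun x => by rw [h0, abs_zero]; positivity) hf

theorem EllipticOn.eq_of_solves (hE : EllipticOn univ κ lam Λ a b) (hl : 0 ≤ lam)
    (hΛ : 0 ≤ Λ) {f u v : Euc d → ℝ → ℝ} (hu : BddSmooth T u) (hv : BddSmooth T v)
    (hus : SolvesOn univ T a b f u) (hvs : SolvesOn univ T a b f v) (h0 : ∀ x, u x 0 = v x 0) :
    ∀ x, ∀ t ∈ Icc 0 T, u x t = v x t := fun x t ht => by
  have := hE.abs_le_mul hl hΛ (hu.sub hv) (hus.sub hvs hu.smooth hv.smooth) (F := 0)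
    (fun x => sub_eq_zero.2 (h0 x)) (fun x t _ => by simp) x t ht
  rw [zero_mul] at this
  exact sub_eq_zero.1 (abs_nonpos_iff.1 this)

end Comparison

section Perturbation

open Filter Topology

variable {d : ℕ} {κ lam Λ T : ℝ} {a : Fin d → Fin d → Euc d → ℝ} {b : Fin d → Euc d → ℝ}
  {U : Set (Euc d)}

/-- The Cauchy problem with zero initial data is solvable in the Hölder class, with bound `N`. -/
def Solvable (κ T N : ℝ) (a : Fin d → Fin d → Euc d → ℝ) (b : Fin d → Euc d → ℝ) : Prop :=
  ∀ F f, HolderSource κ T F f → ∃ u, HolderSolOn univ κ T (N * F) u ∧ SolvesOn univ T a b f u ∧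
    ∀ x, u x 0 = 0

theorem gradx_add (u v : Euc d → ℝ → ℝ) {t : ℝ} (hu : Differentiable ℝ fun y => u y t)
    (hv : Differentiable ℝ fun y => v y t) :
    gradx (fun x t => u x t + v x t) t = fun x => gradx u t x + gradx v t x := by
  ext1 x
  exact fderiv_fun_add (hu x) (hv x)

theorem hessx_add (u v : Euc d → ℝ → ℝ) {t : ℝ} (hu : ContDiff ℝ 2 fun y => u y t)
    (hv : ContDiff ℝ 2 fun y => v y t) :
    hessx (fun x t => u x t + v x t) t = fun x => hessx u t x + hessx v t x := by
  ext1 x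
  rw [hessx, gradx_add u v (hu.differentiable (by norm_num)) (hv.differentiable (by norm_num))]
  exact fderiv_fun_add (differentiable_gradx hu x) (differentiable_gradx hv x)

theorem HolderSolOn.add {N N' : ℝ} {u v : Euc d → ℝ → ℝ} (hu : HolderSolOn U κ T N u)
    (hv : HolderSolOn U κ T N' v) : HolderSolOn U κ T (N + N') (fun x t => u x t + v x t) where
  smooth t ht := (hu.smooth t ht).add (hv.smooth t ht)
  bound x hx t ht := (abs_add_le _ _).trans (add_le_add (hu.bound x hx t ht) (hv.bound x hx t ht))
  bound1 x hx t ht := by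
    rw [gradx_add u v ((hu.smooth t ht).differentiable (by norm_num))
      ((hv.smooth t ht).differentiable (by norm_num))]
    exact (norm_add_le _ _).trans (add_le_add (hu.bound1 x hx t ht) (hv.bound1 x hx t ht))
  bound2 x hx t ht := by
    rw [hessx_add u v (hu.smooth t ht) (hv.smooth t ht)]
    exact (norm_add_le (hessx u t x) (hessx v t x)).trans
      (add_le_add (hu.bound2 x hx t ht) (hv.bound2 x hx t ht))
  holder2 x hx y hy t ht := by
    rw [hessx_add u v (hu.smooth t ht) (hv.smooth t ht), add_mul]
    have e : hessx u t x + hessx v t x - (hessx u t y + hessx v t y) =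
      (hessx u t x - hessx u t y) + (hessx v t x - hessx v t y) := by abel
    simp only [e]
    exact (norm_add_le (hessx u t x - hessx u t y) (hessx v t x - hessx v t y)).trans
      (add_le_add (hu.holder2 x hx y hy t ht) (hv.holder2 x hx y hy t ht))
  lip x hx s hs t ht := by
    have h1 := abs_le.1 (hu.lip x hx s hs t ht)
    have h2 := abs_le.1 (hv.lip x hx s hs t ht)
    rw [add_mul, abs_le]
    constructor <;> linarith

theorem ell_add {u v : Euc d → ℝ → ℝ} {t : ℝ} (hu : ContDiff ℝ 2 fun y => u y t)
    (hv : ContDiff ℝ 2 fun y => v y t) (x : Euc d) :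
    ell a b (fun x t => u x t + v x t) x t = ell a b u x t + ell a b v x t := by
  unfold ell
  rw [gradx_add u v (hu.differentiable (by norm_num)) (hv.differentiable (by norm_num)),
    hessx_add u v hu hv, opL_add]

theorem gradx_zero (t : ℝ) : gradx (fun (_ : Euc d) (_ : ℝ) => (0 : ℝ)) t = fun _ => 0 := by
  ext1 x
  exact fderiv_const_apply _

theorem hessx_zero (t : ℝ) : hessx (fun (_ : Euc d) (_ : ℝ) => (0 : ℝ)) t = fun _ => 0 := by
  ext1 x
  rw [hessx, gradx_zero]
  exact fderiv_const_apply _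

theorem HolderSolOn.zero : HolderSolOn U κ T 0 (fun _ _ => 0) where
  smooth _ _ := contDiff_const
  bound x hx t ht := by simp
  bound1 x hx t ht := by rw [gradx_zero]; simp
  bound2 x hx t ht := by rw [hessx_zero]; exact (norm_zero (E := Euc d →L[ℝ] Euc d →L[ℝ] ℝ)).le
  holder2 x hx y hy t ht := by
    rw [hessx_zero, zero_mul]
    have e : (0 : Euc d →L[ℝ] Euc d →L[ℝ] ℝ) - 0 = 0 := by ext; simp
    simp only [e]
    exact (norm_zero (E := Euc d →L[ℝ] Euc d →L[ℝ] ℝ)).le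
  lip x hx s hs t ht := by simp

theorem ell_zero (x : Euc d) (t : ℝ) : ell a b (fun _ _ => 0) x t = 0 := by
  unfold ell opL
  rw [gradx_zero, hessx_zero]
  simp

theorem le_mul_rpow_of_le {X N r : ℝ} (hN : 0 ≤ N) (hr : 0 ≤ r) (hκ : 0 ≤ κ) (hκ1 : κ ≤ 1)
    (h1 : X ≤ N * r) (h2 : X ≤ N) : X ≤ N * r ^ κ := by
  rcases le_total r 1 with h | h
  · refine h1.trans (mul_le_mul_of_nonneg_left ?_ hN)
    simpa using Real.rpow_le_rpow_of_exponent_ge_of_imp hr h hκ1 (by intro h h'; simp_all)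
  · exact h2.trans (le_mul_of_one_le_right hN (Real.one_le_rpow h hκ))

theorem HolderSolOn.norm_gradx_sub_space_le {N : ℝ} {u : Euc d → ℝ → ℝ}
    (hu : HolderSolOn U κ T N u) (hU : Convex ℝ U) {x y : Euc d} (hx : x ∈ U) (hy : y ∈ U) {t : ℝ}
    (ht : t ∈ Icc 0 T) : ‖gradx u t x - gradx u t y‖ ≤ N * ‖x - y‖ :=
  hU.norm_image_sub_le_of_norm_fderiv_le (𝕜 := ℝ) (f := gradx u t)
    (fun z _ => differentiable_gradx (hu.smooth t ht) z)
    (fun z hz => hu.bound2 z hz t ht) hy hx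

theorem HolderSolOn.norm_gradx_sub_rpow_le {N : ℝ} {u : Euc d → ℝ → ℝ}
    (hu : HolderSolOn U κ T N u) (hU : Convex ℝ U) (hκ : 0 ≤ κ) (hκ1 : κ ≤ 1) (hN : 0 ≤ N)
    {x y : Euc d} (hx : x ∈ U) (hy : y ∈ U) {t : ℝ}
    (ht : t ∈ Icc 0 T) : ‖gradx u t x - gradx u t y‖ ≤ 2 * N * ‖x - y‖ ^ κ := by
  refine le_mul_rpow_of_le (by positivity) (norm_nonneg _) hκ hκ1 ?_ ?_
  · have := hu.norm_gradx_sub_space_le hU hx hy ht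
    have h2 : 0 ≤ N * ‖x - y‖ := by positivity
    linarith
  · refine (norm_sub_le _ _).trans ?_
    linarith [hu.bound1 x hx t ht, hu.bound1 y hy t ht]

theorem HolderSolOn.continuousOn_ell {N : ℝ} {u : Euc d → ℝ → ℝ}
    (hu : HolderSolOn U κ T N u) (hU : IsOpen U) (hκ : 0 < κ) (hN : 0 ≤ N) {x : Euc d}
    (hx : x ∈ U) : ContinuousOn (ell a b u x) (Icc 0 T) := by
  intro t ht
  refine Metric.continuousWithinAt_iff.2 fun ε hε => ?_
  obtain ⟨δ, hδ, h⟩ := exists_delta_ell (T := T) hU hκ a b hx hN (half_pos hε)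
  refine ⟨δ, hδ, fun {s} hs hst => ?_⟩
  have := h u hu s hs t ht hst
  rw [Real.dist_eq]
  linarith

/-- The source produced by a small second order operator. -/
theorem HolderSolOn.holderSource_ell {N δ : ℝ} {u : Euc d → ℝ → ℝ}
    (hu : HolderSolOn univ κ T N u) (hκ : 0 < κ) (hκ1 : κ ≤ 1) (hN : 0 ≤ N)
    (ha : ∀ i j x, |a i j x| ≤ δ) (hb : ∀ i x, |b i x| ≤ δ)
    (ha' : ∀ i j x y, |a i j x - a i j y| ≤ δ * ‖x - y‖ ^ κ)
    (hb' : ∀ i x y, |b i x - b i y| ≤ δ * ‖x - y‖ ^ κ) (hδ : 0 ≤ δ) :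
    HolderSource κ T ((2 * d ^ 2 + 3 * d) * δ * N) (ell a b u) where
  cont x := hu.continuousOn_ell isOpen_univ hκ hN trivial
  bound x t ht := by
    refine (abs_opL_le (fun i j => ha i j x) (fun i => hb i x) _ _).trans ?_
    calc _ ≤ d ^ 2 * δ * N + d * δ * N := by
          gcongr
          · exact hu.bound2 x trivial t ht
          · exact hu.bound1 x trivial t ht
      _ ≤ _ := by
        have : 0 ≤ d ^ 2 * δ * N := by positivity
        have : 0 ≤ d * δ * N := by positivity
        linarith
  holder x y t ht := by
    have hr : 0 ≤ ‖x - y‖ ^ κ := by positivity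
    have e : ell a b u x t - ell a b u y t =
        opL (fun i j => a i j x - a i j y) (fun i => b i x - b i y) (hessx u t x) (gradx u t x) +
        opL (fun i j => a i j y) (fun i => b i y) (hessx u t x - hessx u t y)
          (gradx u t x - gradx u t y) := by
      rw [opL_sub_coeff, opL_sub]
      unfold ell
      ring
    rw [e]
    have h1 := abs_opL_le (fun i j => ha' i j x y) (fun i => hb' i x y) (hessx u t x) (gradx u t x)
    have h2 := abs_opL_le (fun i j => ha i j y) (fun i => hb i y) (hessx u t x - hessx u t y)
      (gradx u t x - gradx u t y)
    have h3 := hu.norm_gradx_sub_rpow_le convex_univ hκ.le hκ1 hN (mem_univ x) (mem_univ y) ht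
    have h4 := hu.holder2 x trivial y trivial t ht
    have h5 := hu.bound2 x trivial t ht
    have h6 := hu.bound1 x trivial t ht
    calc _ ≤ (d ^ 2 * (δ * ‖x - y‖ ^ κ) * N + d * (δ * ‖x - y‖ ^ κ) * N) +
          (d ^ 2 * δ * (N * ‖x - y‖ ^ κ) + d * δ * (2 * N * ‖x - y‖ ^ κ)) := by
          refine (abs_add_le _ _).trans (add_le_add (h1.trans ?_) (h2.trans ?_))
          · gcongr
          · gcongr
      _ = _ := by ring

/-- Solvability is stable under small perturbations of the operator. -/
theorem Solvable.perturb {N δ : ℝ} (h : Solvable κ T N a b) (hT : 0 ≤ T) (hκ : 0 < κ)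
    (hκ1 : κ ≤ 1) (hN : 0 ≤ N)
    {a' : Fin d → Fin d → Euc d → ℝ} {b' : Fin d → Euc d → ℝ}
    (ha : ∀ i j x, |a' i j x - a i j x| ≤ δ) (hb : ∀ i x, |b' i x - b i x| ≤ δ)
    (ha' : ∀ i j x y, |(a' i j x - a i j x) - (a' i j y - a i j y)| ≤ δ * ‖x - y‖ ^ κ)
    (hb' : ∀ i x y, |(b' i x - b i x) - (b' i y - b i y)| ≤ δ * ‖x - y‖ ^ κ) (hδ : 0 ≤ δ)
    (hδN : (2 * d ^ 2 + 3 * d) * δ * N ≤ 1 / 2) : Solvable κ T (2 * N) a' b' := by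
  intro F f hf
  have hF : 0 ≤ F := (abs_nonneg _).trans (hf.bound 0 0 ⟨le_rfl, hT⟩)
  choose! S hS using h
  set c : Fin d → Fin d → Euc d → ℝ := fun i j x => a' i j x - a i j x with hc
  set e : Fin d → Euc d → ℝ := fun i x => b' i x - b i x with he
  let src : ℕ → Euc d → ℝ → ℝ := fun n => Nat.rec f (fun n g => ell c e (S (F / 2 ^ n) g)) n
  let w : ℕ → Euc d → ℝ → ℝ := fun n => S (F / 2 ^ n) (src n)
  have hsrc1 : ∀ n, src (n + 1) = ell c e (w n) := fun n => rfl
  have hsrc : ∀ n, HolderSource κ T (F / 2 ^ n) (src n) := by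
    intro n
    induction n with
    | zero =>
      rw [pow_zero, div_one]
      exact hf
    | succ n ih =>
      rw [hsrc1]
      have h1 := (hS _ _ ih).1.holderSource_ell hκ hκ1 (by positivity) ha hb ha' hb' hδ
      have h2 : (2 * d ^ 2 + 3 * d) * δ * (N * (F / 2 ^ n)) ≤ F / 2 ^ (n + 1) := by
        have := mul_le_mul_of_nonneg_right hδN (by positivity : 0 ≤ F / 2 ^ n)
        calc _ = (2 * d ^ 2 + 3 * d) * δ * N * (F / 2 ^ n) := by ring
          _ ≤ _ := this
          _ = _ := by rw [pow_succ]; field_simp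
      exact ⟨h1.cont, fun x t ht => (h1.bound x t ht).trans h2,
        fun x y t ht => (h1.holder x y t ht).trans (by gcongr)⟩
  have hw : ∀ n, HolderSolOn univ κ T (N * (F / 2 ^ n)) (w n) ∧
      SolvesOn univ T a b (src n) (w n) ∧ ∀ x, w n x 0 = 0 := fun n => hS _ _ (hsrc n)
  let V : ℕ → Euc d → ℝ → ℝ := fun n => Nat.rec (fun _ _ => 0) (fun n v x t => v x t + w n x t) n
  have hV1 : ∀ n, V (n + 1) = fun x t => V n x t + w n x t := fun n => rfl
  have hV : ∀ n, HolderSolOn univ κ T (N * F * (2 - 2 / 2 ^ n)) (V n) ∧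
      SolvesOn univ T a' b' (fun x t => f x t - src n x t) (V n) ∧ ∀ x, V n x 0 = 0 := by
    intro n
    induction n with
    | zero =>
      refine ⟨?_, fun x _ t ht => ?_, fun x => rfl⟩
      · have : N * F * (2 - 2 / 2 ^ 0) = 0 := by norm_num
        rw [this]
        exact HolderSolOn.zero
      have h1 : ell a' b' (V 0) x t = 0 := ell_zero x t
      have h2 : f x t - src 0 x t = 0 := sub_self _
      refine (hasDerivWithinAt_const (c := (0 : ℝ)) t _).congr_deriv ?_
      change 0 = ell a' b' (V 0) x t + (f x t - src 0 x t)
      rw [h1, h2, add_zero]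
    | succ n ih =>
      obtain ⟨i1, i2, i3⟩ := ih
      obtain ⟨w1, w2, w3⟩ := hw n
      rw [hV1]
      refine ⟨?_, fun x hx t ht => ?_, fun x => by simp [i3, w3]⟩
      · have : N * F * (2 - 2 / 2 ^ (n + 1)) = N * F * (2 - 2 / 2 ^ n) + N * (F / 2 ^ n) := by
          rw [pow_succ]; field_simp; ring
        rw [this]
        exact i1.add w1
      · refine ((i2 x hx t ht).fun_add (w2 x hx t ht)).congr_deriv ?_
        rw [ell_add (i1.smooth t ht) (w1.smooth t ht), hsrc1]
        have h3 : ell c e (w n) x t = ell a' b' (w n) x t - ell a b (w n) x t :=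
          opL_sub_coeff _ _ _ _ _ _
        simp only [h3]
        ring
  set l : Ultrafilter ℕ := hyperfilter ℕ
  have hl : (l : Filter ℕ) ≤ atTop := by
    rw [← Nat.cofinite_eq_atTop]; exact hyperfilter_le_cofinite
  have hV2 : ∀ n, HolderSolOn univ κ T (2 * N * F) (V n) := fun n =>
    (hV n).1.mono subset_rfl (by
      have : 0 ≤ N * F * (2 / 2 ^ n) := by positivity
      nlinarith)
  have hlim : ∀ x t, ∃ L, t ∈ Icc 0 T → Tendsto (fun n => V n x t) l (𝓝 L) := fun x t => by
    by_cases ht : t ∈ Icc 0 T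
    · obtain ⟨L, hL⟩ := exists_ultralimit l (g := fun n => V n x t)
        (Eventually.of_forall fun n => (hV2 n).bound x trivial t ht)
      exact ⟨L, fun _ => hL⟩
    · exact ⟨0, fun h => absurd h ht⟩
  choose u hu using hlim
  have hsmall : Tendsto (fun n : ℕ => F / 2 ^ n) l (𝓝 0) := by
    have : Tendsto (fun n : ℕ => F * (1 / 2) ^ n) atTop (𝓝 (F * 0)) :=
      (tendsto_pow_atTop_nhds_zero_of_lt_one (by norm_num) (by norm_num)).const_mul F
    rw [mul_zero] at this
    refine (this.congr fun n => ?_).mono_left hl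
    rw [one_div, inv_pow]
    rfl
  have hsol := ultralimit_solves l (κ := κ) (T := T) (N := 2 * N * F) (v := V) (u := u)
    (f := fun n x t => f x t - src n x t) (g := f) (a := a') (b := b') isOpen_univ convex_univ hκ
    (by positivity) (Eventually.of_forall fun n => ⟨hV2 n, (hV n).2.1⟩)
    (fun x _ t ht => hu x t ht) (fun x _ t ht => ?_) (fun x _ t ht ε hε => ?_)
  · obtain ⟨k1, k2⟩ := hsol
    refine ⟨u, HolderSolOn.of_ultralimit l (Eventually.of_forall hV2)
      (fun x t ht => hu x t ht) fun x t ht => k1 x trivial t ht, k2, fun x => ?_⟩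
    refine tendsto_nhds_unique (hu x 0 ⟨le_rfl, hT⟩) ?_
    simp only [(hV _).2.2]
    exact tendsto_const_nhds
  · have h0 : Tendsto (fun n => src n x t) l (𝓝 0) :=
      squeeze_zero_norm (fun n => (hsrc n).bound x t ht) hsmall
    have h1 := (tendsto_const_nhds (x := f x t)).sub h0
    rwa [sub_zero] at h1
  · obtain ⟨δ, hδ, h1⟩ := Metric.continuousWithinAt_iff.1 (hf.cont x t ht) (ε / 2) (half_pos hε)
    refine ⟨δ, hδ, ?_⟩
    filter_upwards [hsmall.eventually (gt_mem_nhds (by positivity : 0 < ε / 4))] with n hn s hs hst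
    have e1 := abs_lt.1 (h1 hs (by rwa [Real.dist_eq]))
    have e2 := abs_le.1 ((hsrc n).bound x s hs)
    have e3 := abs_le.1 ((hsrc n).bound x t ht)
    rw [abs_le]
    constructor <;> linarith [e1.1, e1.2]

end Perturbation

section ConstantCoefficients

open Filter Topology

variable {d : ℕ} {κ lam Λ T : ℝ}

theorem exists_equiv_covM {A : Fin d → Fin d → ℝ} (hsym : ∀ i j, A i j = A j i) (hl : 0 < lam)
    (hΛ : 0 ≤ Λ)
    (hA : ∀ ν : Euc d, lam * ‖ν‖ ^ 2 ≤ ∑ i, ∑ j, A i j * ν i * ν j) (hb : ∀ i j, |A i j| ≤ Λ) :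
    ∃ σ : Euc d ≃L[ℝ] Euc d, (∀ i j, covM σ i j = A i j) ∧
      ‖(σ : Euc d →L[ℝ] Euc d)‖ ≤ d * √Λ + 1 / √lam ∧
      ‖(σ.symm : Euc d →L[ℝ] Euc d)‖ ≤ d * √Λ + 1 / √lam := by
  obtain ⟨B, hB⟩ := exists_square_root_matrix hsym fun ν => le_trans (by positivity) (hA ν)
  set τ : Euc d →L[ℝ] Euc d := LinearMap.toContinuousLinearMap (Matrix.toEuclideanLin B) with hτ
  have hτk : ∀ x k, τ x k = ∑ i, B k i * x i := fun x k => by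
    simp [hτ, Matrix.toEuclideanLin, Matrix.toLpLin_apply, Matrix.mulVec, dotProduct]
  have hn : ∀ x, ‖τ x‖ ^ 2 = ∑ i, ∑ j, A i j * x i * x j := fun x => by
    rw [EuclideanSpace.norm_sq_eq]
    simp only [Real.norm_eq_abs, sq_abs, hτk, hB]
    simp only [sq, Finset.sum_mul, Finset.mul_sum]
    rw [Finset.sum_comm]
    refine (Finset.sum_comm.trans ?_)
    calc _ = ∑ k, ∑ i, ∑ j, B k i * B k j * x i * x j := ?_
      _ = _ := by
        rw [Finset.sum_comm]
        exact Finset.sum_congr rfl fun i _ => Finset.sum_comm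
    refine Finset.sum_congr rfl fun k _ => Finset.sum_congr rfl fun i _ =>
      Finset.sum_congr rfl fun j _ => by ring
  have hlow : ∀ x, √lam * ‖x‖ ≤ ‖τ x‖ := fun x => by
    refine abs_le_of_sq_le_sq' ?_ (norm_nonneg _) |>.2
    rw [mul_pow, Real.sq_sqrt hl.le, hn]
    exact hA x
  have hup : ∀ x, ‖τ x‖ ≤ d * √Λ * ‖x‖ := fun x => by
    refine abs_le_of_sq_le_sq' ?_ (by positivity) |>.2
    rw [hn, mul_pow, mul_pow, Real.sq_sqrt hΛ]
    calc _ ≤ ∑ _i : Fin d, ∑ _j : Fin d, Λ * ‖x‖ * ‖x‖ := by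
          refine Finset.sum_le_sum fun i _ => Finset.sum_le_sum fun j _ => ?_
          refine (le_abs_self _).trans ?_
          rw [abs_mul, abs_mul]
          gcongr
          · exact hb i j
          · exact norm_coord_le x i
          · exact norm_coord_le x j
      _ = _ := by simp; ring
  have hsl : 0 < √lam := Real.sqrt_pos.2 hl
  have hinj : Function.Injective (τ : Euc d →ₗ[ℝ] Euc d) := by
    refine (injective_iff_map_eq_zero _).2 fun x hx => ?_
    have h1 := hlow x
    have h2 : τ x = 0 := hx
    rw [h2, norm_zero] at h1
    exact norm_le_zero_iff.1 (nonpos_of_mul_nonpos_right h1 hsl)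
  set e : Euc d ≃L[ℝ] Euc d := (LinearEquiv.ofInjectiveEndo _ hinj).toContinuousLinearEquiv with he
  have heτ : (e : Euc d →L[ℝ] Euc d) = τ := by ext x; rfl
  have hsymm : ‖(e.symm : Euc d →L[ℝ] Euc d)‖ ≤ 1 / √lam := by
    refine ContinuousLinearMap.opNorm_le_bound _ (by positivity) fun x => ?_
    have h1 := hlow (e.symm x)
    have h2 : τ (e.symm x) = x := by rw [← heτ]; exact e.apply_symm_apply x
    rw [h2] at h1
    rw [div_mul_eq_mul_div, one_mul, le_div_iff₀ hsl, mul_comm]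
    exact h1
  have hfwd : ‖(e : Euc d →L[ℝ] Euc d)‖ ≤ d * √Λ := by
    rw [heτ]
    exact ContinuousLinearMap.opNorm_le_bound _ (by positivity) hup
  have hadj : ∀ x y, inner ℝ (ContinuousLinearMap.adjoint (e : Euc d →L[ℝ] Euc d) x) y =
      inner ℝ x (e y) := fun x y => ContinuousLinearMap.adjoint_inner_left _ y x
  have hadj' : ∀ x y, inner ℝ (ContinuousLinearMap.adjoint (e.symm : Euc d →L[ℝ] Euc d) x) y =
      inner ℝ x (e.symm y) := fun x y => ContinuousLinearMap.adjoint_inner_left _ y x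
  set σ : Euc d ≃L[ℝ] Euc d := ContinuousLinearEquiv.equivOfInverse
    (ContinuousLinearMap.adjoint (e : Euc d →L[ℝ] Euc d))
    (ContinuousLinearMap.adjoint (e.symm : Euc d →L[ℝ] Euc d))
    (fun x => ext_inner_right ℝ fun y => by rw [hadj', hadj, e.apply_symm_apply])
    (fun x => ext_inner_right ℝ fun y => by rw [hadj, hadj', e.symm_apply_apply]) with hσ
  refine ⟨σ, fun i j => ?_, ?_, ?_⟩
  · have h1 : ∀ k i, σ (ebas k) i = B k i := fun k i => by
      have h2 := hadj (ebas k) (ebas i)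
      have h3 : e (ebas i) = τ (ebas i) := rfl
      rw [h3] at h2
      simp only [ebas, EuclideanSpace.inner_single_left, EuclideanSpace.inner_single_right] at h2
      rw [hτk] at h2
      have h4 : σ (ebas k) = ContinuousLinearMap.adjoint (e : Euc d →L[ℝ] Euc d)
        (EuclideanSpace.single k 1) := rfl
      rw [h4]
      simpa [PiLp.single_apply] using h2
    simp only [covM, h1, hB]
  · have : ‖(σ : Euc d →L[ℝ] Euc d)‖ = ‖(e : Euc d →L[ℝ] Euc d)‖ :=
      LinearIsometryEquiv.norm_map ContinuousLinearMap.adjoint _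
    rw [this]
    exact hfwd.trans (le_add_of_nonneg_right (by positivity))
  · have : ‖(σ.symm : Euc d →L[ℝ] Euc d)‖ = ‖(e.symm : Euc d →L[ℝ] Euc d)‖ :=
      LinearIsometryEquiv.norm_map ContinuousLinearMap.adjoint _
    rw [this]
    exact hsymm.trans (le_add_of_nonneg_left (by positivity))

/-- Uniform solvability for constant coefficients. -/
theorem exists_solvable_const (d : ℕ) (hl : 0 < lam) (hΛ : 0 ≤ Λ) (hκ : 0 < κ) (hκ1 : κ < 1)
    (hT : 0 ≤ T) : ∃ N : ℝ, 0 ≤ N ∧ ∀ A : Fin d → Fin d → ℝ, (∀ i j, A i j = A j i) →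
      (∀ ν : Euc d, lam * ‖ν‖ ^ 2 ≤ ∑ i, ∑ j, A i j * ν i * ν j) → (∀ i j, |A i j| ≤ Λ) →
      Solvable κ T N (fun i j (_ : Euc d) => A i j) (fun _ _ => 0) := by
  have hS : 0 ≤ d * √Λ + 1 / √lam := by positivity
  refine ⟨heatN d (d * √Λ + 1 / √lam) κ T, hT.trans (heatN_bounds hS hκ hκ1 hT).1, ?_⟩
  intro A hsym hA hb F f hf
  obtain ⟨σ, h1, h2, h3⟩ := exists_equiv_covM hsym hl hΛ hA hb
  obtain ⟨u, hu⟩ := exists_heat_solution σ h2 h3 hκ hκ1 hT hf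
  simp only [h1] at hu
  exact ⟨u, hu⟩

end ConstantCoefficients

section Retraction

open Filter Topology

/-- The metric projection onto a closed ball of a Hilbert space. -/
theorem exists_retraction {E : Type*} [NormedAddCommGroup E] [InnerProductSpace ℝ E]
    [CompleteSpace E] (c : E) {r : ℝ} (hr : 0 ≤ r) :
    ∃ P : E → E, (∀ x, P x ∈ Metric.closedBall c r) ∧ (∀ x ∈ Metric.closedBall c r, P x = x) ∧
      ∀ x y, ‖P x - P y‖ ≤ ‖x - y‖ := by
  have hne : (Metric.closedBall c r).Nonempty := ⟨c, Metric.mem_closedBall_self hr⟩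
  have hcv : Convex ℝ (Metric.closedBall c r) := convex_closedBall c r
  choose P hP using fun x => exists_norm_eq_iInf_of_complete_convex hne
    Metric.isClosed_closedBall.isComplete hcv x
  have hin : ∀ x, ∀ w ∈ Metric.closedBall c r, inner ℝ (x - P x) (w - P x) ≤ 0 := fun x =>
    (norm_eq_iInf_iff_real_inner_le_zero hcv (hP x).1).1 (hP x).2
  refine ⟨P, fun x => (hP x).1, fun x hx => ?_, fun x y => ?_⟩
  · have h1 := hin x x hx
    rw [real_inner_self_eq_norm_sq] at h1
    have h2 : ‖x - P x‖ = 0 := by nlinarith [norm_nonneg (x - P x)]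
    exact (sub_eq_zero.1 (norm_eq_zero.1 h2)).symm
  · have h1 := hin x (P y) (hP y).1
    have h2 := hin y (P x) (hP x).1
    have h3 : ‖P x - P y‖ ^ 2 ≤ inner ℝ (x - y) (P x - P y) := by
      rw [← real_inner_self_eq_norm_sq]
      have e : (inner ℝ (x - y) (P x - P y) : ℝ) - inner ℝ (P x - P y) (P x - P y) =
          -(inner ℝ (x - P x) (P y - P x)) - inner ℝ (y - P y) (P x - P y) := by
        simp only [inner_sub_left, inner_sub_right, real_inner_comm]
        ring
      linarith
    have h4 := real_inner_le_norm (x - y) (P x - P y)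
    by_contra! h
    nlinarith [norm_nonneg (P x - P y), norm_nonneg (x - y)]

variable {d : ℕ} {κ κ0 lam Λ T : ℝ} {a : Fin d → Fin d → Euc d → ℝ} {b : Fin d → Euc d → ℝ}

theorem EllipticOn.comp {U : Set (Euc d)} (hE : EllipticOn U κ lam Λ a b) (hκ : 0 ≤ κ)
    (hΛ : 0 ≤ Λ) {P : Euc d → Euc d} (hPU : ∀ x, P x ∈ U)
    (hP : ∀ x y, ‖P x - P y‖ ≤ ‖x - y‖) :
    EllipticOn univ κ lam Λ (fun i j x => a i j (P x)) (fun i x => b i (P x)) where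
  symm i j x _ := hE.symm i j _ (hPU x)
  elliptic x _ ν := hE.elliptic _ (hPU x) ν
  bound_a i j x _ := hE.bound_a i j _ (hPU x)
  bound_b i x _ := hE.bound_b i _ (hPU x)
  holder_a i j x _ y _ := (hE.holder_a i j _ (hPU x) _ (hPU y)).trans (by
    gcongr
    exact hP x y)
  holder_b i x _ y _ := (hE.holder_b i _ (hPU x) _ (hPU y)).trans (by
    gcongr
    exact hP x y)

theorem rpow_le_rpow_of_le_one {r : ℝ} (hr : 0 ≤ r) (hr1 : r ≤ 1) (hκ : 0 < κ) (hκ0 : κ ≤ κ0) :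
    r ^ κ0 ≤ r ^ κ :=
  Real.rpow_le_rpow_of_exponent_ge_of_imp hr hr1 hκ0 fun _ h => absurd h (hκ.trans_le hκ0).ne'

theorem EllipticOn.lower_exponent {U : Set (Euc d)} (hE : EllipticOn U κ0 lam Λ a b) (hκ : 0 < κ)
    (hκ0 : κ ≤ κ0) (hΛ : 0 ≤ Λ) (hU : ∀ x ∈ U, ∀ y ∈ U, ‖x - y‖ ≤ 1) :
    EllipticOn U κ lam Λ a b where
  symm := hE.symm
  elliptic := hE.elliptic
  bound_a := hE.bound_a
  bound_b := hE.bound_b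
  holder_a i j x hx y hy := (hE.holder_a i j x hx y hy).trans
    (mul_le_mul_of_nonneg_left (rpow_le_rpow_of_le_one (norm_nonneg _) (hU x hx y hy) hκ hκ0) hΛ)
  holder_b i x hx y hy := (hE.holder_b i x hx y hy).trans
    (mul_le_mul_of_nonneg_left (rpow_le_rpow_of_le_one (norm_nonneg _) (hU x hx y hy) hκ hκ0) hΛ)

theorem EllipticOn.mono {U V : Set (Euc d)} (hE : EllipticOn U κ lam Λ a b) (h : V ⊆ U) :
    EllipticOn V κ lam Λ a b where
  symm i j x hx := hE.symm i j x (h hx)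
  elliptic x hx := hE.elliptic x (h hx)
  bound_a i j x hx := hE.bound_a i j x (h hx)
  bound_b i x hx := hE.bound_b i x (h hx)
  holder_a i j x hx y hy := hE.holder_a i j x (h hx) y (h hy)
  holder_b i x hx y hy := hE.holder_b i x (h hx) y (h hy)

/-- Solvability, on a uniform small scale, for coefficients extended from a small ball. -/
theorem exists_solvable_small (d : ℕ) (hl : 0 < lam) (hΛ : 0 ≤ Λ) (hκ : 0 < κ) (hκ0 : κ < κ0)
    (hκ1 : κ0 ≤ 1) (hT : 0 ≤ T) : ∃ N s₀ : ℝ, 0 ≤ N ∧ 0 < s₀ ∧ ∀ (c : Euc d) (r : ℝ), 0 < r →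
      r ≤ s₀ → ∀ (a : Fin d → Fin d → Euc d → ℝ) (b : Fin d → Euc d → ℝ),
      EllipticOn (Metric.closedBall c r) κ0 lam Λ a b → ∀ P : Euc d → Euc d,
      (∀ x, P x ∈ Metric.closedBall c r) → (∀ x y, ‖P x - P y‖ ≤ ‖x - y‖) →
      Solvable κ T N (fun i j x => a i j (P x)) (fun _ _ => 0) := by
  obtain ⟨N, hN, hS⟩ := exists_solvable_const (lam := lam) (Λ := Λ) (κ := κ) (T := T) d hl hΛ hκ
    (hκ0.trans_le hκ1) hT
  have hκ00 : 0 < κ0 := hκ.trans hκ0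
  have hc : Tendsto (fun r : ℝ => (2 * d ^ 2 + 3 * d) * (Λ * (r ^ κ0 + (2 * r) ^ (κ0 - κ))) * N)
      (𝓝 0) (𝓝 ((2 * d ^ 2 + 3 * d) *
        (Λ * ((0 : ℝ) ^ κ0 + (2 * (0 : ℝ)) ^ (κ0 - κ))) * N)) := by
    have h1 : ContinuousAt (fun r : ℝ => r ^ κ0) 0 :=
      Real.continuousAt_rpow_const _ _ (Or.inr hκ00.le)
    have h2 : ContinuousAt (fun r : ℝ => (2 * r) ^ (κ0 - κ)) 0 :=
      (Real.continuousAt_rpow_const (2 * 0) _ (Or.inr (sub_pos.2 hκ0).le)).comp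
        (f := fun r : ℝ => 2 * r) (continuous_const.mul continuous_id).continuousAt
    exact (((h1.add h2).const_mul Λ).const_mul _).mul_const N
  rw [mul_zero, Real.zero_rpow hκ00.ne', Real.zero_rpow (sub_pos.2 hκ0).ne', add_zero, mul_zero,
    mul_zero, zero_mul] at hc
  obtain ⟨ε, hε, hlt⟩ := Metric.eventually_nhds_iff.1
    (hc.eventually (gt_mem_nhds (by norm_num : (0 : ℝ) < 1 / 2)))
  refine ⟨2 * N, ε / 2, by positivity, half_pos hε, fun c r hr hrs a b hE P hP hP1 => ?_⟩
  have hc' : c ∈ Metric.closedBall c r := Metric.mem_closedBall_self hr.le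
  have h := hS (fun i j => a i j c) (fun i j => hE.symm i j c hc') (hE.elliptic c hc')
    fun i j => hE.bound_a i j c hc'
  have hP2 : ∀ x y, ‖P x - P y‖ ≤ 2 * r := fun x y => by
    have h1 := hP x
    have h2 := hP y
    rw [mem_closedBall_iff_norm] at h1 h2
    have : P x - P y = (P x - c) - (P y - c) := by abel
    rw [this]
    exact (norm_sub_le _ _).trans (by linarith)
  have h0 : 0 ≤ r ^ κ0 := by positivity
  have h0' : 0 ≤ (2 * r) ^ (κ0 - κ) := by positivity
  refine h.perturb hT hκ (hκ0.le.trans hκ1) hN (δ := Λ * (r ^ κ0 + (2 * r) ^ (κ0 - κ)))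
    (fun i j x => ?_) (fun i x => ?_) (fun i j x y => ?_) (fun i x y => ?_) (by positivity) ?_
  · refine (hE.holder_a i j _ (hP x) c hc').trans (mul_le_mul_of_nonneg_left ?_ hΛ)
    refine le_trans ?_ (le_add_of_nonneg_right h0')
    exact Real.rpow_le_rpow (norm_nonneg _) (mem_closedBall_iff_norm.1 (hP x)) hκ00.le
  · simp only [sub_zero, abs_zero]
    positivity
  · have e : a i j (P x) - a i j c - (a i j (P y) - a i j c) = a i j (P x) - a i j (P y) := by ring
    rw [e]
    refine (hE.holder_a i j _ (hP x) _ (hP y)).trans ?_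
    rw [mul_assoc]
    refine mul_le_mul_of_nonneg_left ?_ hΛ
    have e2 : ‖P x - P y‖ ^ κ0 = ‖P x - P y‖ ^ (κ0 - κ) * ‖P x - P y‖ ^ κ := by
      rw [← Real.rpow_add_of_nonneg (norm_nonneg _) (sub_pos.2 hκ0).le hκ.le]
      congr 1
      ring
    rw [e2]
    refine mul_le_mul ?_ ?_ (by positivity) (by positivity)
    · exact (Real.rpow_le_rpow (norm_nonneg _) (hP2 x y) (sub_pos.2 hκ0).le).trans
        (le_add_of_nonneg_left h0)
    · exact Real.rpow_le_rpow (norm_nonneg _) (hP1 x y) hκ.le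
  · simp only [sub_self, abs_zero]
    positivity
  · refine (hlt ?_).le
    rw [Real.dist_eq, sub_zero, abs_of_pos hr]
    linarith

end Retraction

section Cutoff

open Filter Topology

variable {d : ℕ} {κ T H K : ℝ}

theorem HolderSource.add {F F' : ℝ} {f g : Euc d → ℝ → ℝ} (hf : HolderSource κ T F f)
    (hg : HolderSource κ T F' g) : HolderSource κ T (F + F') (fun x t => f x t + g x t) where
  cont x := (hf.cont x).add (hg.cont x)
  bound x t ht := (abs_add_le _ _).trans (add_le_add (hf.bound x t ht) (hg.bound x t ht))
  holder x y t ht := by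
    rw [add_sub_add_comm, add_mul]
    exact (abs_add_le _ _).trans (add_le_add (hf.holder x y t ht) (hg.holder x y t ht))

theorem HolderSource.const_mul {F : ℝ} {f : Euc d → ℝ → ℝ} (hf : HolderSource κ T F f) (k : ℝ) :
    HolderSource κ T (|k| * F) (fun x t => k * f x t) where
  cont x := continuousOn_const.mul (hf.cont x)
  bound x t ht := by
    rw [abs_mul]
    exact mul_le_mul_of_nonneg_left (hf.bound x t ht) (abs_nonneg _)
  holder x y t ht := by
    rw [← mul_sub, abs_mul, mul_assoc]
    exact mul_le_mul_of_nonneg_left (hf.holder x y t ht) (abs_nonneg _)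

theorem HolderSource.sum {ι : Type*} (s : Finset ι) {F : ι → ℝ} {f : ι → Euc d → ℝ → ℝ}
    (hf : ∀ i ∈ s, HolderSource κ T (F i) (f i)) :
    HolderSource κ T (∑ i ∈ s, F i) (fun x t => ∑ i ∈ s, f i x t) where
  cont x := continuousOn_finsetSum s fun i hi => (hf i hi).cont x
  bound x t ht := (Finset.abs_sum_le_sum_abs _ _).trans
    (Finset.sum_le_sum fun i hi => (hf i hi).bound x t ht)
  holder x y t ht := by
    rw [← Finset.sum_sub_distrib, Finset.sum_mul]
    exact (Finset.abs_sum_le_sum_abs _ _).trans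
      (Finset.sum_le_sum fun i hi => (hf i hi).holder x y t ht)

/-- A function which is bounded and Hölder continuous in space on a set of space points. -/
structure HolderOn (B : Set (Euc d)) (κ T H : ℝ) (h : Euc d → ℝ → ℝ) : Prop where
  cont : ∀ x ∈ B, ContinuousOn (h x) (Icc 0 T)
  bound : ∀ x ∈ B, ∀ t ∈ Icc 0 T, |h x t| ≤ H
  holder : ∀ x ∈ B, ∀ y ∈ B, ∀ t ∈ Icc 0 T, |h x t - h y t| ≤ H * ‖x - y‖ ^ κ

/-- A Hölder continuous function vanishing outside `B`. -/
structure CutoffOn (B : Set (Euc d)) (κ K : ℝ) (θ : Euc d → ℝ) : Prop where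
  bound : ∀ x, |θ x| ≤ K
  holder : ∀ x y, |θ x - θ y| ≤ K * ‖x - y‖ ^ κ
  zero : ∀ x ∉ B, θ x = 0

theorem HolderOn.mul_bounded {B : Set (Euc d)} {h k : Euc d → ℝ → ℝ} (hh : HolderOn B κ T H h)
    (hk : HolderOn B κ T K k) (hH : 0 ≤ H) :
    HolderOn B κ T (2 * H * K) (fun x t => h x t * k x t) where
  cont x hx := (hh.cont x hx).mul (hk.cont x hx)
  bound x hx t ht := by
    have h1 := hh.bound x hx t ht
    have h2 := hk.bound x hx t ht
    rw [abs_mul]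
    have := mul_le_mul h1 h2 (abs_nonneg _) hH
    have := mul_nonneg hH ((abs_nonneg _).trans h2)
    linarith
  holder x hx y hy t ht := by
    have e : h x t * k x t - h y t * k y t = (h x t - h y t) * k x t + h y t * (k x t - k y t) := by
      ring
    have hr : 0 ≤ ‖x - y‖ ^ κ := by positivity
    rw [e]
    refine (abs_add_le _ _).trans ?_
    rw [abs_mul, abs_mul]
    have h1 := mul_le_mul (hh.holder x hx y hy t ht) (hk.bound x hx t ht) (abs_nonneg _)
      (by positivity)
    have h2 := mul_le_mul (hh.bound y hy t ht) (hk.holder x hx y hy t ht) (abs_nonneg _) hH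
    linarith

theorem HolderOn.cutoff {B : Set (Euc d)} {h : Euc d → ℝ → ℝ} (hh : HolderOn B κ T H h)
    {θ : Euc d → ℝ} (hθ : CutoffOn B κ K θ) (hH : 0 ≤ H) (hK : 0 ≤ K) :
    HolderSource κ T (2 * K * H) (fun x t => θ x * h x t) where
  cont x := by
    by_cases hx : x ∈ B
    · exact continuousOn_const.mul (hh.cont x hx)
    · simp only [hθ.zero x hx, zero_mul]
      exact continuousOn_const
  bound x t ht := by
    by_cases hx : x ∈ B
    · rw [abs_mul]
      have := mul_le_mul (hθ.bound x) (hh.bound x hx t ht) (abs_nonneg _) hK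
      have : 0 ≤ K * H := by positivity
      linarith
    · rw [hθ.zero x hx, zero_mul, abs_zero]
      positivity
  holder x y t ht := by
    have hr : 0 ≤ ‖x - y‖ ^ κ := by positivity
    have key : ∀ x y, x ∈ B → |θ x - θ y| * |h x t| ≤ K * H * ‖x - y‖ ^ κ := fun x y hx => by
      have := mul_le_mul (hθ.holder x y) (hh.bound x hx t ht) (abs_nonneg _)
        (by positivity)
      linarith
    have hKH : 0 ≤ K * H * ‖x - y‖ ^ κ := by positivity
    by_cases hx : x ∈ B
    · by_cases hy : y ∈ B
      · have e : θ x * h x t - θ y * h y t = (θ x - θ y) * h x t + θ y * (h x t - h y t) := by ring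
        rw [e]
        refine (abs_add_le _ _).trans ?_
        rw [abs_mul, abs_mul]
        have h1 := key x y hx
        have h2 := mul_le_mul (hθ.bound y) (hh.holder x hx y hy t ht) (abs_nonneg _) hK
        linarith
      · have h1 := key x y hx
        rw [hθ.zero y hy, sub_zero, ← abs_mul] at h1
        rw [hθ.zero y hy, zero_mul, sub_zero]
        linarith
    · by_cases hy : y ∈ B
      · have h1 := key y x hy
        rw [hθ.zero x hx, sub_zero, ← abs_mul] at h1
        rw [hθ.zero x hx, zero_mul, zero_sub, abs_neg]
        rw [norm_sub_rev] at h1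
        linarith
      · rw [hθ.zero x hx, hθ.zero y hy, zero_mul, zero_mul, sub_zero, abs_zero]
        positivity

theorem cutoffOn_scale {g : Euc d → ℝ} {C : ℝ} (hC : 0 ≤ C) (hb : ∀ x, |g x| ≤ C)
    (hL : ∀ x y, |g x - g y| ≤ C * ‖x - y‖) (h0 : ∀ x ∉ Metric.ball (0 : Euc d) 2, g x = 0)
    (hκ : 0 ≤ κ) (hκ1 : κ ≤ 1) (c : Euc d) {s : ℝ} (hs : 0 < s) (hs1 : s ≤ 1) {k : ℕ} (hk : k ≤ 2) :
    CutoffOn (Metric.ball c (2 * s)) κ (2 * C * s⁻¹ ^ 3) (fun x => s⁻¹ ^ k * g (s⁻¹ • (x - c))) := by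
  have hi : 1 ≤ s⁻¹ := (one_le_inv₀ hs).2 hs1
  have hk3 : s⁻¹ ^ k ≤ s⁻¹ ^ 3 := pow_le_pow_right₀ hi (by omega)
  have hk3' : s⁻¹ ^ k * s⁻¹ ≤ s⁻¹ ^ 3 := by
    rw [← pow_succ]
    exact pow_le_pow_right₀ hi (by omega)
  have hsp : 0 < s⁻¹ := by positivity
  refine ⟨fun x => ?_, fun x y => ?_, fun x hx => ?_⟩
  · rw [abs_mul, abs_of_nonneg (by positivity)]
    have := mul_le_mul hk3 (hb (s⁻¹ • (x - c))) (abs_nonneg _) (by positivity)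
    have : 0 ≤ s⁻¹ ^ 3 * C := by positivity
    linarith
  · refine le_mul_rpow_of_le (by positivity) (norm_nonneg _) hκ hκ1 ?_ ?_
    · rw [← mul_sub, abs_mul, abs_of_nonneg (a := s⁻¹ ^ k) (by positivity)]
      have h1 := hL (s⁻¹ • (x - c)) (s⁻¹ • (y - c))
      have e : s⁻¹ • (x - c) - s⁻¹ • (y - c) = s⁻¹ • (x - y) := by
        rw [← smul_sub]
        congr 1
        abel
      rw [e, norm_smul, Real.norm_eq_abs, abs_of_pos hsp] at h1
      have h2 := mul_le_mul_of_nonneg_left h1 (by positivity : 0 ≤ s⁻¹ ^ k)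
      have h3 := mul_le_mul_of_nonneg_right hk3' (by positivity : 0 ≤ C * ‖x - y‖)
      have : 0 ≤ s⁻¹ ^ 3 * (C * ‖x - y‖) := by positivity
      linarith
    · rw [← mul_sub, abs_mul, abs_of_nonneg (a := s⁻¹ ^ k) (by positivity)]
      have h1 := (abs_sub (g (s⁻¹ • (x - c))) (g (s⁻¹ • (y - c)))).trans
        (add_le_add (hb _) (hb _))
      have := mul_le_mul hk3 h1 (abs_nonneg _) (by positivity)
      linarith
  · rw [h0, mul_zero]
    rw [Metric.mem_ball, dist_eq_norm] at hx
    rw [Metric.mem_ball, dist_zero_right, norm_smul, Real.norm_eq_abs, abs_of_pos hsp]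
    intro h
    refine hx ?_
    have := mul_lt_mul_of_pos_left h hs
    rwa [← mul_assoc, mul_inv_cancel₀ hs.ne', one_mul, mul_comm] at this

theorem fderiv_scale {F : Type*} [NormedAddCommGroup F] [NormedSpace ℝ F] {g : Euc d → F} (hg : Differentiable ℝ g) (c : Euc d) (r : ℝ) (x : Euc d) :
    fderiv ℝ (fun x => g (r • (x - c))) x = r • fderiv ℝ g (r • (x - c)) := by
  have h1 : HasFDerivAt (fun x : Euc d => r • (x - c)) (r • ContinuousLinearMap.id ℝ (Euc d)) x :=
    ((hasFDerivAt_id x).sub_const c).const_smul r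
  have h2 := (hg (r • (x - c))).hasFDerivAt.comp x h1
  rw [show (fun x => g (r • (x - c))) = g ∘ fun x : Euc d => r • (x - c) from rfl, h2.fderiv]
  ext v
  simp

/-- Cutoff functions with scaling bounds. -/
theorem exists_cutoff (d : ℕ) : ∃ C : ℝ, 0 ≤ C ∧ ∀ κ : ℝ, 0 ≤ κ → κ ≤ 1 → ∀ (c : Euc d) (s : ℝ),
    0 < s → s ≤ 1 → ∃ ζ : Euc d → ℝ, ContDiff ℝ 2 ζ ∧ (∀ x ∈ Metric.ball c s, ζ x = 1) ∧
      CutoffOn (Metric.ball c (2 * s)) κ (C * s⁻¹ ^ 3) ζ ∧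
      (∀ i, CutoffOn (Metric.ball c (2 * s)) κ (C * s⁻¹ ^ 3) fun x => fderiv ℝ ζ x (ebas i)) ∧
      ∀ i j, CutoffOn (Metric.ball c (2 * s)) κ (C * s⁻¹ ^ 3)
        fun x => fderiv ℝ (fderiv ℝ ζ) x (ebas i) (ebas j) := by
  let η : ContDiffBump (0 : Euc d) := ⟨1, 3 / 2, by norm_num, by norm_num⟩
  have hη : ContDiff ℝ 3 η := η.contDiff
  have hη1 : ContDiff ℝ 2 (fderiv ℝ η) := hη.fderiv_right (by norm_num)
  have hη2 : ContDiff ℝ 1 (fderiv ℝ (fderiv ℝ η)) := hη1.fderiv_right (by norm_num)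
  have hs0 : HasCompactSupport (η : Euc d → ℝ) := η.hasCompactSupport
  have hout : ∀ x ∉ Metric.ball (0 : Euc d) 2, x ∉ tsupport (η : Euc d → ℝ) := fun x hx h => by
    rw [η.tsupport_eq, Metric.mem_closedBall] at h
    exact hx (Metric.mem_ball.2 (h.trans_lt (by norm_num [η])))
  have hz0 : ∀ x ∉ Metric.ball (0 : Euc d) 2, η x = 0 := fun x hx => image_eq_zero_of_notMem_tsupport (hout x hx)
  have hz1 : ∀ x ∉ Metric.ball (0 : Euc d) 2, fderiv ℝ η x = 0 := fun x hx =>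
    image_eq_zero_of_notMem_tsupport fun h => hout x hx (tsupport_fderiv_subset ℝ h)
  have hz2 : ∀ x ∉ Metric.ball (0 : Euc d) 2, fderiv ℝ (fderiv ℝ η) x = 0 := fun x hx =>
    image_eq_zero_of_notMem_tsupport fun h => hout x hx
      (tsupport_fderiv_subset ℝ (tsupport_fderiv_subset ℝ h))
  have key : ∀ g : Euc d → ℝ, ContDiff ℝ 1 g → HasCompactSupport g →
      ∃ C : ℝ, 0 ≤ C ∧ (∀ x, |g x| ≤ C) ∧ ∀ x y, |g x - g y| ≤ C * ‖x - y‖ := fun g hg hc => by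
    obtain ⟨C1, h1⟩ := hc.exists_bound_of_continuous hg.continuous
    obtain ⟨C2, h2⟩ := hg.lipschitzWith_of_hasCompactSupport hc (by norm_num)
    refine ⟨max C1 C2, le_max_of_le_right C2.2, fun x => (h1 x).trans (le_max_left _ _),
      fun x y => ?_⟩
    have := h2.dist_le_mul x y
    rw [Real.dist_eq, dist_eq_norm] at this
    exact this.trans (mul_le_mul_of_nonneg_right (le_max_right _ _) (norm_nonneg _))
  obtain ⟨C0, hC0, k0, k0'⟩ := key η (hη.of_le (by norm_num)) hs0
  have hd1 : ∀ i, ContDiff ℝ 1 fun x => fderiv ℝ η x (ebas i) := fun i =>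
    (hη1.of_le (by norm_num)).clm_apply contDiff_const
  have hd2 : ∀ i j, ContDiff ℝ 1 fun x => fderiv ℝ (fderiv ℝ η) x (ebas i) (ebas j) := fun i j =>
    (hη2.clm_apply contDiff_const).clm_apply contDiff_const
  have k1 := fun i => key _ (hd1 i) ((hs0.fderiv (𝕜 := ℝ)).comp_left
    (g := fun q : Euc d →L[ℝ] ℝ => q (ebas i)) (by simp))
  have k2 := fun i j => key _ (hd2 i j) (((hs0.fderiv (𝕜 := ℝ)).fderiv (𝕜 := ℝ)).comp_left
    (g := fun q : Euc d →L[ℝ] Euc d →L[ℝ] ℝ => q (ebas i) (ebas j)) (by simp))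
  choose C1 hC1 k1 k1' using k1
  choose C2 hC2 k2 k2' using k2
  set C := C0 + ∑ i, C1 i + ∑ i, ∑ j, C2 i j with hC
  have hS1 : 0 ≤ ∑ i, C1 i := Finset.sum_nonneg fun i _ => hC1 i
  have hS2 : 0 ≤ ∑ i, ∑ j, C2 i j := Finset.sum_nonneg fun i _ => Finset.sum_nonneg fun j _ => hC2 i j
  have l0 : C0 ≤ C := by linarith
  have l1 : ∀ i, C1 i ≤ C := fun i => by
    have := Finset.single_le_sum (fun i _ => hC1 i) (Finset.mem_univ i)
    linarith
  have l2 : ∀ i j, C2 i j ≤ C := fun i j => by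
    have h1 := Finset.single_le_sum (fun j _ => hC2 i j) (Finset.mem_univ j)
    have h2 := Finset.single_le_sum (f := fun i => ∑ j, C2 i j)
      (fun i _ => Finset.sum_nonneg fun j _ => hC2 i j) (Finset.mem_univ i)
    linarith
  have hCnn : 0 ≤ C := by positivity
  refine ⟨2 * C, by positivity, fun κ hκ hκ1 c s hs hs1 => ?_⟩
  have f1 : ∀ x, fderiv ℝ (fun x => η (s⁻¹ • (x - c))) x = s⁻¹ • fderiv ℝ η (s⁻¹ • (x - c)) :=
    fderiv_scale (hη.differentiable (by norm_num)) c s⁻¹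
  have f2 : ∀ x, fderiv ℝ (fderiv ℝ (fun x => η (s⁻¹ • (x - c)))) x =
      s⁻¹ ^ 2 • fderiv ℝ (fderiv ℝ η) (s⁻¹ • (x - c)) := fun x => by
    have e : fderiv ℝ (fun x => η (s⁻¹ • (x - c))) = fun x => s⁻¹ • fderiv ℝ η (s⁻¹ • (x - c)) :=
      funext f1
    have e2 := congrFun (fderiv_smul_fun (G := Euc d →L[ℝ] ℝ)
      (φ := fun x => fderiv ℝ η (s⁻¹ • (x - c))) s⁻¹) x
    have e3 := fderiv_scale (hη1.differentiable (by norm_num)) c s⁻¹ x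
    rw [e]
    refine e2.trans ?_
    simp only [e3]
    rw [smul_smul, sq]
  refine ⟨fun x => η (s⁻¹ • (x - c)), (hη.of_le (by norm_num)).comp (by fun_prop),
    fun x hx => ?_, ?_, fun i => ?_, fun i j => ?_⟩
  · refine η.one_of_mem_closedBall ?_
    rw [Metric.mem_ball, dist_eq_norm] at hx
    rw [Metric.mem_closedBall, dist_zero_right, norm_smul, Real.norm_eq_abs,
      abs_of_pos (by positivity), inv_mul_le_iff₀ hs]
    change ‖x - c‖ ≤ s * 1
    linarith
  · have := cutoffOn_scale hCnn (fun x => (k0 x).trans l0) (fun x y => (k0' x y).trans (by gcongr))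
      hz0 hκ hκ1 c hs hs1 (k := 0) (by norm_num)
    simpa only [pow_zero, one_mul] using this
  · have := cutoffOn_scale hCnn (fun x => (k1 i x).trans (l1 i))
      (fun x y => (k1' i x y).trans (mul_le_mul_of_nonneg_right (l1 i) (norm_nonneg _)))
      (fun x hx => by rw [hz1 x hx]; rfl) hκ hκ1 c hs hs1 (k := 1) (by norm_num)
    simp only [f1]
    rw [pow_one] at this
    exact this
  · have := cutoffOn_scale hCnn (fun x => (k2 i j x).trans (l2 i j))
      (fun x y => (k2' i j x y).trans (mul_le_mul_of_nonneg_right (l2 i j) (norm_nonneg _)))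
      (fun x hx => by rw [hz2 x hx]; rfl) hκ hκ1 c hs hs1 (k := 2) (by norm_num)
    simp only [f2]
    exact this

end Cutoff

section Localization

open Filter Topology

variable {d : ℕ} {κ lam Λ T N : ℝ} {a : Fin d → Fin d → Euc d → ℝ} {b : Fin d → Euc d → ℝ}

theorem gradx_mul {ζ : Euc d → ℝ} {u : Euc d → ℝ → ℝ} {t : ℝ} (hζ : Differentiable ℝ ζ)
    (hu : Differentiable ℝ fun y => u y t) :
    gradx (fun x t => ζ x * u x t) t = fun x => ζ x • gradx u t x + u x t • fderiv ℝ ζ x := by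
  ext1 x
  exact fderiv_fun_mul (hζ x) (hu x)

theorem hessx_mul_apply {ζ : Euc d → ℝ} {u : Euc d → ℝ → ℝ} {t : ℝ} (hζ : ContDiff ℝ 2 ζ)
    (hu : ContDiff ℝ 2 fun y => u y t) (x v w : Euc d) :
    hessx (fun x t => ζ x * u x t) t x v w = ζ x * hessx u t x v w +
      fderiv ℝ ζ x v * gradx u t x w + fderiv ℝ ζ x w * gradx u t x v +
      fderiv ℝ (fderiv ℝ ζ) x v w * u x t := by
  have hζ1 : Differentiable ℝ ζ := hζ.differentiable (by norm_num)
  have hu1 : Differentiable ℝ fun y => u y t := hu.differentiable (by norm_num)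
  have hζ2 : Differentiable ℝ (fderiv ℝ ζ) :=
    (hζ.fderiv_right (m := 1) (by norm_num)).differentiable (by norm_num)
  have hu2 : Differentiable ℝ (gradx u t) := differentiable_gradx hu
  have h := ((hζ1 x).hasFDerivAt.smul (hu2 x).hasFDerivAt).add
    ((hu1 x).hasFDerivAt.smul (hζ2 x).hasFDerivAt)
  have e : hessx (fun x t => ζ x * u x t) t x =
      fderiv ℝ (ζ • gradx u t + (fun y => u y t) • fderiv ℝ ζ) x := by
    unfold hessx
    rw [gradx_mul hζ1 hu1]
    rfl
  rw [e, h.fderiv]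
  change ζ x * hessx u t x v w + fderiv ℝ ζ x v * gradx u t x w +
    (u x t * fderiv ℝ (fderiv ℝ ζ) x v w + gradx u t x v * fderiv ℝ ζ x w) = _
  ring

/-- The source term produced by cutting off a solution. -/
noncomputable def cutSource (a : Fin d → Fin d → Euc d → ℝ) (b : Fin d → Euc d → ℝ)
    (f : Euc d → ℝ → ℝ) (ζ : Euc d → ℝ) (u : Euc d → ℝ → ℝ) (x : Euc d) (t : ℝ) : ℝ :=
  ζ x * f x t + ∑ i, ζ x * (b i x * gradx u t x (ebas i)) +
    (-(1 / 2)) * (∑ i, ∑ j, fderiv ℝ ζ x (ebas i) * (a i j x * gradx u t x (ebas j)) +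
      ∑ i, ∑ j, fderiv ℝ ζ x (ebas j) * (a i j x * gradx u t x (ebas i)) +
      ∑ i, ∑ j, fderiv ℝ (fderiv ℝ ζ) x (ebas i) (ebas j) * (a i j x * u x t))

theorem ell_mul_add_cutSource {f : Euc d → ℝ → ℝ} {ζ : Euc d → ℝ} {u : Euc d → ℝ → ℝ} {t : ℝ}
    (hζ : ContDiff ℝ 2 ζ) (hu : ContDiff ℝ 2 fun y => u y t) (x : Euc d) :
    ell a (fun _ _ => 0) (fun x t => ζ x * u x t) x t + cutSource a b f ζ u x t =
      ζ x * (ell a b u x t + f x t) := by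
  unfold ell opL cutSource
  simp only [hessx_mul_apply hζ hu, mul_add, Finset.sum_add_distrib, Finset.mul_sum, zero_mul,
    Finset.sum_const_zero, mul_zero, add_zero]
  have e1 : ∀ i j, 1 / 2 * (a i j x * (ζ x * hessx u t x (ebas i) (ebas j))) =
      ζ x * (1 / 2 * (a i j x * hessx u t x (ebas i) (ebas j))) := fun i j => by ring
  have e2 : ∀ i j, 1 / 2 * (a i j x * (fderiv ℝ ζ x (ebas i) * gradx u t x (ebas j))) =
      -(-(1 / 2) * (fderiv ℝ ζ x (ebas i) * (a i j x * gradx u t x (ebas j)))) := fun i j => by ring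
  have e3 : ∀ i j, 1 / 2 * (a i j x * (fderiv ℝ ζ x (ebas j) * gradx u t x (ebas i))) =
      -(-(1 / 2) * (fderiv ℝ ζ x (ebas j) * (a i j x * gradx u t x (ebas i)))) := fun i j => by ring
  have e4 : ∀ i j, 1 / 2 * (a i j x * (fderiv ℝ (fderiv ℝ ζ) x (ebas i) (ebas j) * u x t)) =
      -(-(1 / 2) * (fderiv ℝ (fderiv ℝ ζ) x (ebas i) (ebas j) * (a i j x * u x t))) :=
    fun i j => by ring
  simp only [e1, e2, e3, e4, Finset.sum_neg_distrib]
  ring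

theorem HolderSolOn.continuousOn_gradx_apply {U : Set (Euc d)} (hU : IsOpen U) (hκ : 0 < κ)
    {u : Euc d → ℝ → ℝ} (hN : 0 ≤ N)
    (hu : HolderSolOn U κ T N u) {x : Euc d} (hx : x ∈ U) (i : Fin d) :
    ContinuousOn (fun t => gradx u t x (ebas i)) (Icc 0 T) := by
  have h := hu.continuousOn_ell (a := fun _ _ _ => 0) (b := fun j _ => if j = i then 1 else 0)
    hU hκ hN hx
  refine h.congr fun t _ => ?_
  simp [ell, opL]

/-- Bounds on a solution, its derivatives and the source in a ball. -/
structure LocalBound (B : Set (Euc d)) (κ T H : ℝ) (f u : Euc d → ℝ → ℝ) : Prop where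
  source : HolderOn B κ T H f
  bound : ∀ x ∈ B, ∀ t ∈ Icc 0 T, |u x t| ≤ H
  bound1 : ∀ x ∈ B, ∀ t ∈ Icc 0 T, ‖gradx u t x‖ ≤ H
  bound2 : ∀ x ∈ B, ∀ t ∈ Icc 0 T, ‖hessx u t x‖ ≤ H

theorem LocalBound.holderSource_cutSource {B : Set (Euc d)} {κ' H K N' : ℝ} {f u : Euc d → ℝ → ℝ}
    (h : LocalBound B κ T H f u) (hκ' : 0 < κ') (hu : HolderSolOn univ κ' T N' u)
    (hE : EllipticOn univ κ lam Λ a b) (hκ : 0 < κ) (hκ1 : κ ≤ 1) (hB : Convex ℝ B)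
    (hd : ∀ x ∈ B, ∀ y ∈ B, ‖x - y‖ ≤ 1) (hH : 0 ≤ H) (hK : 0 ≤ K) (hΛ : 0 ≤ Λ) (hN' : 0 ≤ N')
    {ζ : Euc d → ℝ} (h0 : CutoffOn B κ K ζ)
    (h1 : ∀ i, CutoffOn B κ K fun x => fderiv ℝ ζ x (ebas i))
    (h2 : ∀ i j, CutoffOn B κ K fun x => fderiv ℝ (fderiv ℝ ζ) x (ebas i) (ebas j)) :
    HolderSource κ T ((2 + 4 * d * Λ + 6 * d ^ 2 * Λ) * K * H) (cutSource a b f ζ u) := by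
  have hpow : ∀ x ∈ B, ∀ y ∈ B, ‖x - y‖ ≤ ‖x - y‖ ^ κ := fun x hx y hy => by
    have := le_mul_rpow_of_le (X := ‖x - y‖) (N := 1) (κ := κ) zero_le_one (norm_nonneg (x - y))
      hκ.le hκ1 (by rw [one_mul]) (hd x hx y hy)
    rwa [one_mul] at this
  have cu : HolderOn B κ T H u := ⟨fun x _ => fun t ht =>
      ((hu.bddSmooth.cont (x, t) ⟨trivial, ht⟩).comp (f := fun s => (x, s)) (s := Icc 0 T)
        (by fun_prop) fun s hs => ⟨trivial, hs⟩), h.bound,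
    fun x hx y hy t ht => by
      have := hB.norm_image_sub_le_of_norm_fderiv_le (𝕜 := ℝ) (f := fun x => u x t)
        (fun z _ => (hu.smooth t ht).differentiable (by norm_num) z)
        (fun z hz => h.bound1 z hz t ht) hy hx
      exact this.trans (mul_le_mul_of_nonneg_left (hpow x hx y hy) hH)⟩
  have cg : ∀ i, HolderOn B κ T H fun x t => gradx u t x (ebas i) := fun i =>
    ⟨fun x _ => hu.continuousOn_gradx_apply isOpen_univ hκ' hN' trivial i,
    fun x hx t ht => (abs_lin_ebas_le _ i).trans (h.bound1 x hx t ht), fun x hx y hy t ht => by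
      have := hB.norm_image_sub_le_of_norm_fderiv_le (𝕜 := ℝ) (f := gradx u t)
        (fun z _ => differentiable_gradx (hu.smooth t ht) z)
        (fun z hz => h.bound2 z hz t ht) hy hx
      have e : gradx u t x (ebas i) - gradx u t y (ebas i) = (gradx u t x - gradx u t y) (ebas i) :=
        rfl
      rw [e]
      exact (abs_lin_ebas_le _ i).trans
        (this.trans (mul_le_mul_of_nonneg_left (hpow x hx y hy) hH))⟩
  have ca : ∀ i j, HolderOn B κ T Λ fun x _ => a i j x := fun i j =>
    ⟨fun x _ => continuousOn_const, fun x _ t _ => hE.bound_a i j x trivial,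
      fun x _ y _ t _ => hE.holder_a i j x trivial y trivial⟩
  have cb : ∀ i, HolderOn B κ T Λ fun x _ => b i x := fun i =>
    ⟨fun x _ => continuousOn_const, fun x _ t _ => hE.bound_b i x trivial,
      fun x _ y _ t _ => hE.holder_b i x trivial y trivial⟩
  have hΛH : 0 ≤ 2 * Λ * H := by positivity
  have key := ((h.source.cutoff h0 hH hK).add (HolderSource.sum Finset.univ fun i _ =>
    ((cb i).mul_bounded (cg i) hΛ).cutoff h0 hΛH hK)).add
    ((((HolderSource.sum Finset.univ fun i _ => HolderSource.sum Finset.univ fun j _ =>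
      ((ca i j).mul_bounded (cg j) hΛ).cutoff (h1 i) hΛH hK).add
    (HolderSource.sum Finset.univ fun i _ => HolderSource.sum Finset.univ fun j _ =>
      ((ca i j).mul_bounded (cg i) hΛ).cutoff (h1 j) hΛH hK)).add
    (HolderSource.sum Finset.univ fun i _ => HolderSource.sum Finset.univ fun j _ =>
      ((ca i j).mul_bounded cu hΛ).cutoff (h2 i j) hΛH hK)).const_mul (-(1 / 2)))
  convert key using 1
  · simp only [Finset.sum_const, Finset.card_univ, Fintype.card_fin, nsmul_eq_mul, abs_neg]
    rw [abs_of_pos (by norm_num : (0 : ℝ) < 1 / 2)]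
    ring
  · rfl

theorem exists_hessx_holder_le (d : ℕ) (hl : 0 ≤ lam) (hΛ : 0 ≤ Λ) (hκ : 0 < κ) (hκ1 : κ ≤ 1)
    (hN : 0 ≤ N) : ∃ C : ℝ, 0 ≤ C ∧ ∀ (a : Fin d → Fin d → Euc d → ℝ) (b : Fin d → Euc d → ℝ),
      EllipticOn univ κ lam Λ a b → Solvable κ T N a (fun _ _ => 0) → ∀ (c : Euc d) (s : ℝ), 0 < s →
      s ≤ 1 / 4 → ∀ (f u : Euc d → ℝ → ℝ) (κ' N' H : ℝ), 0 < κ' → 0 ≤ N' → HolderSolOn univ κ' T N' u →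
      SolvesOn (Metric.ball c (2 * s)) T a b f u → (∀ x, u x 0 = 0) → 0 ≤ H →
      LocalBound (Metric.ball c (2 * s)) κ T H f u →
      ∀ x ∈ Metric.ball c s, ∀ y ∈ Metric.ball c s, ∀ t ∈ Icc 0 T,
        ‖hessx u t x - hessx u t y‖ ≤ C * s⁻¹ ^ 3 * H * ‖x - y‖ ^ κ := by
  obtain ⟨C, hC, hcut⟩ := exists_cutoff d
  refine ⟨N * ((2 + 4 * d * Λ + 6 * d ^ 2 * Λ) * C), by positivity, ?_⟩
  intro a b hE hS c s hs hs4 f u κ' N' H hκ' hN' hu hus hu0 hH hLB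
  obtain ⟨ζ, z0, z1, z2, z3, z4⟩ := hcut κ hκ.le hκ1 c s hs (by linarith)
  have hdiam : ∀ x ∈ Metric.ball c (2 * s), ∀ y ∈ Metric.ball c (2 * s), ‖x - y‖ ≤ 1 :=
    fun x hx y hy => by
      rw [← dist_eq_norm]
      have := dist_triangle_right x y c
      have h1 := Metric.mem_ball.1 hx
      have h2 := Metric.mem_ball.1 hy
      linarith
  have hsrc := hLB.holderSource_cutSource hκ' hu hE hκ hκ1 (convex_ball c (2 * s)) hdiam hH
    (by positivity) hΛ hN' z2 z3 z4
  obtain ⟨v, v1, v2, v3⟩ := hS _ _ hsrc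
  obtain ⟨Kζ, hKζ⟩ : ∃ K, ∀ x, |ζ x| ≤ K := ⟨_, z2.bound⟩
  have hE0 : EllipticOn univ κ lam Λ a (fun _ _ => 0) :=
    ⟨hE.symm, hE.elliptic, hE.bound_a, fun i x _ => by simpa using hΛ, hE.holder_a,
      fun i x _ y _ => by simp only [sub_self, abs_zero]; positivity⟩
  have hy : BddSmooth T fun x t => ζ x * u x t := by
    refine ⟨(z0.continuous.comp_continuousOn continuousOn_fst).mul hu.bddSmooth.cont,
      fun t ht => z0.mul (hu.smooth t ht), Kζ * N', fun x t ht => ?_⟩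
    rw [abs_mul]
    exact mul_le_mul (hKζ x) (hu.bound x trivial t ht) (abs_nonneg _)
      ((abs_nonneg _).trans (hKζ x))
  have hys : SolvesOn univ T a (fun _ _ => 0) (cutSource a b f ζ u) fun x t => ζ x * u x t := by
    intro x _ t ht
    rw [ell_mul_add_cutSource z0 (hu.smooth t ht)]
    by_cases hx : x ∈ Metric.ball c (2 * s)
    · exact (hus x hx t ht).const_mul _
    · simp only [z2.zero x hx, zero_mul]
      exact hasDerivWithinAt_const _ _ _
  have heq := hE0.eq_of_solves hl hΛ v1.bddSmooth hy v2 hys fun x => by rw [v3, hu0, mul_zero]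
  have hess : ∀ x ∈ Metric.ball c s, ∀ t ∈ Icc 0 T, hessx u t x = hessx v t x := fun x hx t ht => by
    have e : (fun y => v y t) =ᶠ[𝓝 x] fun y => u y t := by
      filter_upwards [Metric.isOpen_ball.mem_nhds hx] with y hy
      rw [heq y t ht, z1 y hy, one_mul]
    exact (e.fderiv (𝕜 := ℝ)).fderiv_eq.symm
  intro x hx y hy t ht
  rw [hess x hx t ht, hess y hy t ht]
  refine (v1.holder2 x trivial y trivial t ht).trans (le_of_eq ?_)
  ring

end Localization

section Interior

open Filter Topology

variable {d : ℕ} {κ κ0 lam Λ T N : ℝ} {a : Fin d → Fin d → Euc d → ℝ} {b : Fin d → Euc d → ℝ}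

/-- A source which is Hölder continuous up to a Lipschitz dependence on `u`. -/
structure SemiSource (B : Set (Euc d)) (κ T F Λ : ℝ) (f u : Euc d → ℝ → ℝ) : Prop where
  cont : ∀ x ∈ B, ContinuousOn (f x) (Icc 0 T)
  bound : ∀ x ∈ B, ∀ t ∈ Icc 0 T, |f x t| ≤ F
  holder : ∀ x ∈ B, ∀ y ∈ B, ∀ t ∈ Icc 0 T,
    |f x t - f y t| ≤ F * ‖x - y‖ ^ κ + Λ * |u x t - u y t|

theorem SemiSource.mono {B V : Set (Euc d)} {F : ℝ} {f u : Euc d → ℝ → ℝ}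
    (h : SemiSource B κ T F Λ f u) (hV : V ⊆ B) : SemiSource V κ T F Λ f u :=
  ⟨fun x hx => h.cont x (hV hx), fun x hx => h.bound x (hV hx),
    fun x hx y hy => h.holder x (hV hx) y (hV hy)⟩

theorem SemiSource.localBound {c : Euc d} {κ' s F M S N' : ℝ} {f u : Euc d → ℝ → ℝ}
    (h : SemiSource (Metric.ball c (3 * s)) κ T F Λ f u) (hκ : 0 < κ) (hκ1 : κ ≤ 1) (hΛ : 0 ≤ Λ)
    (hs : 0 < s) (hs4 : s ≤ 1 / 4) (hu : HolderSolOn univ κ' T N' u) (hF : 0 ≤ F) (hM : 0 ≤ M)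
    (hS : 0 ≤ S) (hub : ∀ x ∈ Metric.ball c (3 * s), ∀ t ∈ Icc 0 T, |u x t| ≤ M)
    (hb2 : ∀ x ∈ Metric.ball c (3 * s), ∀ t ∈ Icc 0 T, ‖hessx u t x‖ ≤ S) :
    LocalBound (Metric.ball c (2 * s)) κ T ((5 + 4 * Λ) * (F + M + M / s + S)) f u := by
  have hsub : Metric.ball c (2 * s) ⊆ Metric.ball c (3 * s) :=
    Metric.ball_subset_ball (by linarith)
  have hMs : 0 ≤ M / s := by positivity
  have hsub2 : ∀ x ∈ Metric.ball c (2 * s), Metric.closedBall x (s / 2) ⊆ Metric.ball c (3 * s) :=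
    fun x hx y hy => by
      rw [Metric.mem_ball] at hx ⊢
      rw [Metric.mem_closedBall] at hy
      linarith [dist_triangle y x c]
  have hb1 : ∀ x ∈ Metric.ball c (2 * s), ∀ t ∈ Icc 0 T, ‖gradx u t x‖ ≤ 4 * (M / s) + S :=
    fun x hx t ht => by
      refine (norm_fderiv_le_of_bounds (hu.smooth t ht) (half_pos hs)
        (fun y hy => hb2 y (hsub2 x hx hy) t ht) fun y hy => hub y (hsub2 x hx hy) t ht).trans ?_
      have e : 2 * M / (s / 2) = 4 * (M / s) := by field_simp; ring
      rw [e]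
      nlinarith
  have hle : ∀ X, X ≤ F + M + M / s + S → X ≤ (5 + 4 * Λ) * (F + M + M / s + S) := fun X hX => by
    have : 0 ≤ (4 + 4 * Λ) * (F + M + M / s + S) := by positivity
    linarith
  refine ⟨⟨fun x hx => h.cont x (hsub hx), fun x hx t ht => (h.bound x (hsub hx) t ht).trans
    (hle _ (by linarith)), fun x hx y hy t ht => ?_⟩,
    fun x hx t ht => (hub x (hsub hx) t ht).trans (hle _ (by linarith)),
    fun x hx t ht => (hb1 x hx t ht).trans ?_,
    fun x hx t ht => (hb2 x (hsub hx) t ht).trans (hle _ (by linarith))⟩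
  · have hd : ‖x - y‖ ≤ 1 := by
      rw [← dist_eq_norm]
      have := dist_triangle_right x y c
      have h1 := Metric.mem_ball.1 hx
      have h2 := Metric.mem_ball.1 hy
      linarith
    have hp : ‖x - y‖ ≤ ‖x - y‖ ^ κ := by
      have := le_mul_rpow_of_le (X := ‖x - y‖) (N := 1) (κ := κ) zero_le_one (norm_nonneg (x - y))
        hκ.le hκ1 (by rw [one_mul]) hd
      rwa [one_mul] at this
    have hg : |u x t - u y t| ≤ (4 * (M / s) + S) * ‖x - y‖ :=
      (convex_ball c (2 * s)).norm_image_sub_le_of_norm_fderiv_le (𝕜 := ℝ) (f := fun x => u x t)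
        (fun z _ => (hu.smooth t ht).differentiable (by norm_num) z)
        (fun z hz => hb1 z hz t ht) hy hx
    have hp0 : 0 ≤ ‖x - y‖ ^ κ := by positivity
    calc _ ≤ F * ‖x - y‖ ^ κ + Λ * |u x t - u y t| := h.holder x (hsub hx) y (hsub hy) t ht
      _ ≤ F * ‖x - y‖ ^ κ + Λ * ((4 * (M / s) + S) * ‖x - y‖ ^ κ) := by
        gcongr
        exact hg.trans (by gcongr)
      _ = (F + Λ * (4 * (M / s) + S)) * ‖x - y‖ ^ κ := by ring
      _ ≤ _ := by
        refine mul_le_mul_of_nonneg_right ?_ hp0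
        have : 0 ≤ Λ * F := by positivity
        have : 0 ≤ Λ * M := by positivity
        have : 0 ≤ Λ * S := by positivity
        nlinarith
  · have : 0 ≤ Λ * (F + M + M / s + S) := by positivity
    nlinarith

theorem exists_hessx_holder_small (d : ℕ) (hl : 0 < lam) (hΛ : 0 ≤ Λ) (hκ : 0 < κ) (hκ0 : κ < κ0)
    (hκ1 : κ0 ≤ 1) (hT : 0 ≤ T) : ∃ C s₁ : ℝ, 0 ≤ C ∧ 0 < s₁ ∧ s₁ ≤ 1 / 24 ∧
      ∀ (c : Euc d) (s : ℝ), 0 < s → s ≤ s₁ →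
      ∀ (a : Fin d → Fin d → Euc d → ℝ) (b : Fin d → Euc d → ℝ),
      EllipticOn (Metric.ball c (3 * s)) κ0 lam Λ a b → ∀ (f u : Euc d → ℝ → ℝ) (κ' N' F M S : ℝ),
      0 < κ' → 0 ≤ N' → HolderSolOn univ κ' T N' u → SolvesOn (Metric.ball c (3 * s)) T a b f u →
      (∀ x, u x 0 = 0) → 0 ≤ F → 0 ≤ M → 0 ≤ S →
      (∀ x ∈ Metric.ball c (3 * s), ∀ t ∈ Icc 0 T, |u x t| ≤ M) →
      (∀ x ∈ Metric.ball c (3 * s), ∀ t ∈ Icc 0 T, ‖hessx u t x‖ ≤ S) →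
      SemiSource (Metric.ball c (3 * s)) κ T F Λ f u →
      ∀ x ∈ Metric.ball c s, ∀ y ∈ Metric.ball c s, ∀ t ∈ Icc 0 T,
        ‖hessx u t x - hessx u t y‖ ≤ C * s⁻¹ ^ 3 * (F + M + M / s + S) * ‖x - y‖ ^ κ := by
  obtain ⟨N, s₀, hN, hs₀, hS⟩ := exists_solvable_small (T := T) d hl hΛ hκ hκ0 hκ1 hT
  obtain ⟨C, hC, hH⟩ := exists_hessx_holder_le (T := T) d hl.le hΛ hκ (hκ0.le.trans hκ1) hN
  refine ⟨C * (5 + 4 * Λ), min (s₀ / 2) (1 / 24), by positivity, by positivity, min_le_right _ _, ?_⟩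
  intro c s hs hs1 a b hE f u κ' N' F M S hκ' hN' hu hus hu0 hF hM hS0 hub hub2 hsrc x hx y hy t ht
  have hs2 : s ≤ s₀ / 2 := hs1.trans (min_le_left _ _)
  have hs3 : s ≤ 1 / 24 := hs1.trans (min_le_right _ _)
  have hs4 : s ≤ 1 / 4 := hs3.trans (by norm_num)
  obtain ⟨P, hP1, hP2, hP3⟩ := exists_retraction c (by positivity : 0 ≤ 2 * s)
  have hsub : Metric.closedBall c (2 * s) ⊆ Metric.ball c (3 * s) :=
    Metric.closedBall_subset_ball (by linarith)
  have hE2 := hE.mono hsub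
  have hE3 := (hE2.lower_exponent hκ hκ0.le hΛ fun x hx y hy => by
    rw [← dist_eq_norm]
    have := dist_triangle_right x y c
    have h1 := Metric.mem_closedBall.1 hx
    have h2 := Metric.mem_closedBall.1 hy
    linarith).comp hκ.le hΛ hP1 hP3
  have hLB := hsrc.localBound hκ (hκ0.le.trans hκ1) hΛ hs hs4 hu hF hM hS0 hub hub2
  have hMs : 0 ≤ M / s := by positivity
  refine (hH _ _ hE3 (hS c (2 * s) (by positivity) (by linarith) a b hE2 P hP1 hP3) c s hs hs4 f u
    κ' N' _ hκ' hN' hu (fun z hz t ht => ?_) hu0 (by positivity) hLB x hx y hy t ht).trans (le_of_eq ?_)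
  · have hz' := hus z (hsub (Metric.ball_subset_closedBall hz)) t ht
    have e := hP2 z (Metric.ball_subset_closedBall hz)
    unfold ell at hz' ⊢
    simp only [e]
    exact hz'
  · ring

theorem le_two_mul_of_forall_half {X : Set ℝ} (hX : BddAbove X) {K : ℝ}
    (h : ∀ P, (∀ x ∈ X, x ≤ P) → ∀ x ∈ X, x ≤ K + P / 2) {x : ℝ} (hx : x ∈ X) : x ≤ 2 * K := by
  have h1 : sSup X ≤ K + sSup X / 2 := csSup_le ⟨x, hx⟩ (h _ fun y hy => le_csSup hX hy)
  have h2 := le_csSup hX hx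
  linarith

/-- Weighted interior bound of the Hessian. -/
theorem exists_hessx_weighted_bound (d : ℕ) (hl : 0 < lam) (hΛ : 0 ≤ Λ) (hκ : 0 < κ)
    (hκ0 : κ < κ0) (hκ1 : κ0 ≤ 1) (hT : 0 ≤ T) : ∃ K : ℝ, 0 ≤ K ∧
      ∀ (x₀ : Euc d) (a : Fin d → Fin d → Euc d → ℝ) (b : Fin d → Euc d → ℝ),
      EllipticOn (Metric.ball x₀ 1) κ0 lam Λ a b → ∀ (f u : Euc d → ℝ → ℝ) (κ' N' F M : ℝ),
      0 < κ' → 0 ≤ N' → HolderSolOn univ κ' T N' u → SolvesOn (Metric.ball x₀ 1) T a b f u →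
      (∀ x, u x 0 = 0) → 0 ≤ F → 0 ≤ M →
      (∀ x ∈ Metric.ball x₀ 1, ∀ t ∈ Icc 0 T, |u x t| ≤ M) →
      SemiSource (Metric.ball x₀ 1) κ T F Λ f u →
      ∀ x ∈ Metric.ball x₀ 1, ∀ t ∈ Icc 0 T,
        ((1 - dist x x₀) ^ 3) ^ (2 / κ) * ‖hessx u t x‖ ≤ K * (F + M) := by
  obtain ⟨C, s₁, hC, hs₁, hs₁', hH⟩ := exists_hessx_holder_small (T := T) d hl hΛ hκ hκ0 hκ1 hT
  have hκ1' : κ ≤ 1 := hκ0.le.trans hκ1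
  set m : ℝ := 2 / κ with hm
  have hm1 : 1 ≤ m := by rw [hm, le_div_iff₀ hκ]; linarith
  set ε : ℝ := 1 / (2 * C * 8 ^ m + 1) with hε
  have h8 : 0 < (8 : ℝ) ^ m := by positivity
  have hε0 : 0 < ε := by positivity
  have hε1 : ε ≤ 1 := by
    rw [hε, div_le_one (by positivity)]
    have : 0 ≤ C * 8 ^ m := by positivity
    linarith
  have hεC : C * ε * 8 ^ m ≤ 1 / 2 := by
    have e : C * ε * 8 ^ m = C * 8 ^ m / (2 * C * 8 ^ m + 1) := by rw [hε]; ring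
    rw [e, div_le_iff₀ (by positivity)]
    linarith
  set K : ℝ := 16 / (ε * s₁ ^ 3) ^ m + C * ε * (1 + 1 / s₁) with hK
  have hK0 : 0 ≤ K := by positivity
  refine ⟨2 * K, by positivity, ?_⟩
  intro x₀ a b hE f u κ' N' F M hκ' hN' hu hus hu0 hF hM hub hsrc
  set X : Set ℝ := {r | ∃ x ∈ Metric.ball x₀ 1, ∃ t ∈ Icc 0 T,
    r = ((1 - dist x x₀) ^ 3) ^ m * ‖hessx u t x‖} with hX
  have hw : ∀ x ∈ Metric.ball x₀ 1, 0 < 1 - dist x x₀ ∧ ((1 - dist x x₀) ^ 3) ^ m ≤ 1 - dist x x₀ ∧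
      1 - dist x x₀ ≤ 1 := fun x hx => by
    have h1 : 0 < 1 - dist x x₀ := sub_pos.2 hx
    have h2 : 1 - dist x x₀ ≤ 1 := by linarith [dist_nonneg (x := x) (y := x₀)]
    refine ⟨h1, ?_, h2⟩
    have h3 : (1 - dist x x₀) ^ 3 ≤ 1 := pow_le_one₀ h1.le h2
    calc _ ≤ (1 - dist x x₀) ^ 3 := Real.rpow_le_self_of_le_one (by positivity) h3 hm1
      _ ≤ _ := pow_le_of_le_one h1.le h2 (by norm_num)
  have hbdd : BddAbove X := by
    refine ⟨N', ?_⟩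
    rintro _ ⟨x, hx, t, ht, rfl⟩
    obtain ⟨h1, h2, h3⟩ := hw x hx
    calc _ ≤ 1 * N' := mul_le_mul (h2.trans h3) (hu.bound2 x trivial t ht) (norm_nonneg (hessx u t x))
          zero_le_one
      _ = N' := one_mul _
  intro x hx t ht
  rw [mul_assoc]
  refine le_two_mul_of_forall_half hbdd (fun P hP => ?_) ⟨x, hx, t, ht, rfl⟩
  rintro _ ⟨c, hc, t, ht, rfl⟩
  obtain ⟨hδ, hwδ, hδ1⟩ := hw c hc
  set δ := 1 - dist c x₀ with hδdef
  set w := (δ ^ 3) ^ m with hwdef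
  have hw0 : 0 < w := by positivity
  have hP0 : 0 ≤ P := le_trans (by positivity) (hP _ ⟨c, hc, t, ht, rfl⟩)
  set s := s₁ * δ with hs
  have hs0 : 0 < s := by positivity
  have hss : s ≤ s₁ := mul_le_of_le_one_right hs₁.le hδ1
  have hsub : ∀ y ∈ Metric.ball c (3 * s), δ / 2 ≤ 1 - dist y x₀ := fun y hy => by
    have h1 := dist_triangle y c x₀
    have h2 := Metric.mem_ball.1 hy
    have h3 : s ≤ 1 / 24 * δ := mul_le_mul_of_nonneg_right hs₁' hδ.le
    linarith
  have hsub' : Metric.ball c (3 * s) ⊆ Metric.ball x₀ 1 := fun y hy => by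
    have := hsub y hy
    rw [Metric.mem_ball]
    linarith
  set S := 8 ^ m * P / w with hS
  have hS0 : 0 ≤ S := by positivity
  have hD2 : ∀ y ∈ Metric.ball c (3 * s), ∀ t ∈ Icc 0 T, ‖hessx u t y‖ ≤ S := fun y hy t ht => by
    have h1 := hP _ ⟨y, hsub' hy, t, ht, rfl⟩
    have h2 : w / 8 ^ m ≤ ((1 - dist y x₀) ^ 3) ^ m := by
      rw [hwdef, ← Real.div_rpow (by positivity) (by norm_num)]
      refine Real.rpow_le_rpow (by positivity) ?_ (by linarith)
      calc δ ^ 3 / 8 = (δ / 2) ^ 3 := by ring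
        _ ≤ _ := pow_le_pow_left₀ (by positivity) (hsub y hy) 3
    have h3 := (mul_le_mul_of_nonneg_right h2 (norm_nonneg (hessx u t y))).trans h1
    rw [hS, le_div_iff₀ hw0]
    rw [div_mul_eq_mul_div, div_le_iff₀ h8] at h3
    linarith
  have hloc := hH c s hs0 hss a b (hE.mono hsub') f u κ' N' F M S hκ' hN' hu
    (fun y hy => hus y (hsub' hy)) hu0 hF hM hS0 (fun y hy => hub y (hsub' hy)) hD2
    (hsrc.mono hsub')
  set ρ := (ε * s ^ 3) ^ (1 / κ) with hρ
  have hρ0 : 0 < ρ := by positivity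
  have hs1 : s < 1 := by linarith
  have hρs : ρ < s := by
    have h1 : ε * s ^ 3 ≤ s ^ 3 := mul_le_of_le_one_left (by positivity) hε1
    have h2 : s ^ 3 < s := pow_lt_self_of_lt_one₀ hs0 hs1 (by norm_num)
    refine lt_of_le_of_lt ?_ (h1.trans_lt h2)
    exact Real.rpow_le_self_of_le_one (by positivity) (by linarith)
      (by rw [le_div_iff₀ hκ]; linarith)
  have hρκ : ρ ^ κ = ε * s ^ 3 := by
    rw [hρ, ← Real.rpow_mul (by positivity), one_div_mul_cancel hκ.ne', Real.rpow_one]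
  have hρ2 : ρ ^ 2 = (ε * s₁ ^ 3) ^ m * w := by
    rw [hwdef, ← Real.mul_rpow (by positivity) (by positivity), hρ, ← Real.rpow_natCast,
      ← Real.rpow_mul (by positivity)]
    congr 1
    · rw [hs]; ring
    · rw [hm]; push_cast; ring
  have hMs : 0 ≤ M / s := by positivity
  have hmain := norm_fderiv_fderiv_le (hu.smooth t ht) (half_pos hρ0) (x := c) (M := M)
    (N := C * ε * (F + M + M / s + S)) (fun y hy => ?_) (fun y hy => ?_)
  · have e1 : 4 * M / (ρ / 2) ^ 2 = 16 * M / ((ε * s₁ ^ 3) ^ m * w) := by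
      rw [← hρ2]
      field_simp
      ring
    rw [e1] at hmain
    have h1 := mul_le_mul_of_nonneg_left hmain hw0.le
    refine h1.trans ?_
    have e2 : w * (16 * M / ((ε * s₁ ^ 3) ^ m * w) + C * ε * (F + M + M / s + S)) =
        16 / (ε * s₁ ^ 3) ^ m * M + C * ε * (w * (F + M) + w * M / s) + C * ε * 8 ^ m * P := by
      rw [hS]
      field_simp
      ring
    rw [e2]
    have h2 : w * M / s ≤ 1 / s₁ * M := by
      rw [hs, div_le_iff₀ (by positivity)]
      have : 1 / s₁ * M * (s₁ * δ) = δ * M := by field_simp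
      rw [this]
      exact mul_le_mul_of_nonneg_right hwδ hM
    have h3 : w * (F + M) ≤ F + M := mul_le_of_le_one_left (by positivity) (hwδ.trans hδ1)
    have h4 : 0 ≤ 1 / s₁ * F := by positivity
    have h5 : C * ε * (w * (F + M) + w * M / s) ≤ C * ε * ((1 + 1 / s₁) * (F + M)) :=
      mul_le_mul_of_nonneg_left (by linarith) (by positivity)
    have h6 : C * ε * 8 ^ m * P ≤ 1 / 2 * P := mul_le_mul_of_nonneg_right hεC hP0
    have h7 : 0 ≤ 16 / (ε * s₁ ^ 3) ^ m * F := by positivity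
    rw [hK]
    linarith
  · have hy' : y ∈ Metric.ball c s := by
      rw [mem_closedBall_iff_norm] at hy
      rw [mem_ball_iff_norm]
      linarith
    refine (hloc y hy' c (Metric.mem_ball_self hs0) t ht).trans ?_
    have h1 : ‖y - c‖ ^ κ ≤ ε * s ^ 3 := by
      rw [← hρκ]
      refine Real.rpow_le_rpow (norm_nonneg _) ?_ hκ.le
      rw [mem_closedBall_iff_norm] at hy
      linarith
    calc _ ≤ C * s⁻¹ ^ 3 * (F + M + M / s + S) * (ε * s ^ 3) := by gcongr
      _ = _ := by field_simp
  · refine hub y (hsub' ?_) t ht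
    rw [Metric.mem_closedBall] at hy
    rw [Metric.mem_ball]
    linarith

end Interior

section Interior

open Filter Topology

variable {d : ℕ} {κ κ0 lam Λ T N : ℝ} {a : Fin d → Fin d → Euc d → ℝ} {b : Fin d → Euc d → ℝ}

/-- Interior estimate for solutions with zero initial data. -/
theorem exists_interior_estimate (d : ℕ) (hl : 0 < lam) (hΛ : 0 ≤ Λ) (hκ : 0 < κ)
    (hκ0 : κ < κ0) (hκ1 : κ0 ≤ 1) (hT : 0 ≤ T) : ∃ C : ℝ, 0 ≤ C ∧
      ∀ (x₀ : Euc d) (a : Fin d → Fin d → Euc d → ℝ) (b : Fin d → Euc d → ℝ),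
      EllipticOn (Metric.ball x₀ 1) κ0 lam Λ a b → ∀ (f u : Euc d → ℝ → ℝ) (κ' N' F M : ℝ),
      0 < κ' → 0 ≤ N' → HolderSolOn univ κ' T N' u → SolvesOn (Metric.ball x₀ 1) T a b f u →
      (∀ x, u x 0 = 0) → 0 ≤ F → 0 ≤ M →
      (∀ x ∈ Metric.ball x₀ 1, ∀ t ∈ Icc 0 T, |u x t| ≤ M) →
      SemiSource (Metric.ball x₀ 1) κ T F Λ f u →
      HolderSolOn (Metric.ball x₀ (1 / 2)) κ T (C * (F + M)) u := by
  obtain ⟨C, s, hC, hs, hs', hH⟩ := exists_hessx_holder_small (T := T) d hl hΛ hκ hκ0 hκ1 hT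
  obtain ⟨K, hK, hW⟩ := exists_hessx_weighted_bound (T := T) d hl hΛ hκ hκ0 hκ1 hT
  set A : ℝ := K / ((1 / 4) ^ 3) ^ (2 / κ) with hA
  have hw0 : 0 < (((1 : ℝ) / 4) ^ 3) ^ (2 / κ) := by positivity
  have hA0 : 0 ≤ A := by positivity
  set H : ℝ := C * s⁻¹ ^ 3 * (1 + 1 / s + A) + 2 * A / s ^ κ with hHdef
  have hH0 : 0 ≤ H := by positivity
  set R : ℝ := 1 + (16 + A) + H + ((d : ℝ) ^ 2 * Λ * A + d * Λ * (16 + A) + 1) with hR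
  have hL0 : 0 ≤ (d : ℝ) ^ 2 * Λ * A + d * Λ * (16 + A) + 1 := by positivity
  refine ⟨R, by positivity, ?_⟩
  intro x₀ a b hE f u κ' N' F M hκ' hN' hu hus hu0 hF hM hub hsrc
  have hG : 0 ≤ F + M := by positivity
  have hsub : Metric.ball x₀ (1 / 2) ⊆ Metric.ball x₀ 1 := Metric.ball_subset_ball (by norm_num)
  have hD : ∀ x ∈ Metric.ball x₀ (3 / 4), ∀ t ∈ Icc 0 T, ‖hessx u t x‖ ≤ A * (F + M) :=
    fun x hx t ht => by
      have hx' := Metric.mem_ball.1 hx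
      have h1 := hW x₀ a b hE f u κ' N' F M hκ' hN' hu hus hu0 hF hM hub hsrc x
        (Metric.ball_subset_ball (by norm_num) hx) t ht
      have h2 : (((1 : ℝ) / 4) ^ 3) ^ (2 / κ) ≤ ((1 - dist x x₀) ^ 3) ^ (2 / κ) :=
        Real.rpow_le_rpow (by positivity) (pow_le_pow_left₀ (by norm_num) (by linarith) 3)
          (by positivity)
      have h3 := (mul_le_mul_of_nonneg_right h2 (norm_nonneg (hessx u t x))).trans h1
      rw [hA, div_mul_eq_mul_div, le_div_iff₀ hw0]
      linarith
  have hD1 : ∀ x ∈ Metric.ball x₀ (1 / 2), ∀ t ∈ Icc 0 T, ‖gradx u t x‖ ≤ (16 + A) * (F + M) :=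
    fun x hx t ht => by
      have hx' := Metric.mem_ball.1 hx
      have hin : ∀ y ∈ Metric.closedBall x (1 / 8), dist y x₀ < 3 / 4 := fun y hy => by
        have := dist_triangle y x x₀
        rw [Metric.mem_closedBall] at hy
        linarith
      have h1 := norm_fderiv_le_of_bounds (hu.smooth t ht) (h := 1 / 8) (by norm_num)
        (fun y hy => hD y (hin y hy) t ht)
        (fun y hy => hub y (Metric.mem_ball.2 ((hin y hy).trans (by norm_num))) t ht)
      refine h1.trans ?_
      have : 0 ≤ A * (F + M) := by positivity
      nlinarith
  have hle : ∀ X c : ℝ, X ≤ c * (F + M) → c ≤ R → X ≤ R * (F + M) := fun X c h1 h2 =>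
    h1.trans (mul_le_mul_of_nonneg_right h2 hG)
  refine ⟨hu.smooth, fun x hx t ht => hle _ 1 ?_ (by linarith),
    fun x hx t ht => hle _ _ (hD1 x hx t ht) (by linarith),
    fun x hx t ht => hle _ _ (hD x (Metric.ball_subset_ball (by norm_num) hx) t ht)
      (by linarith), fun x hx y hy t ht => ?_, fun x hx s hs t ht => ?_⟩
  · linarith [hub x (hsub hx) t ht]
  · have hx' := Metric.mem_ball.1 hx
    have hS0 : 0 ≤ A * (F + M) := by positivity
    suffices h : ‖hessx u t x - hessx u t y‖ ≤ H * (F + M) * ‖x - y‖ ^ κ by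
      refine h.trans (mul_le_mul_of_nonneg_right (mul_le_mul_of_nonneg_right ?_ hG) ?_)
      · linarith
      · exact Real.rpow_nonneg (norm_nonneg _) κ
    by_cases hxy : ‖x - y‖ < s
    · have hin : ∀ z ∈ Metric.ball x (3 * s), dist z x₀ < 3 / 4 := fun z hz => by
        have := dist_triangle z x x₀
        rw [Metric.mem_ball] at hz
        linarith
      have hin' : Metric.ball x (3 * s) ⊆ Metric.ball x₀ 1 := fun z hz =>
        Metric.mem_ball.2 ((hin z hz).trans (by norm_num))
      have h1 := hH x s hs le_rfl a b (hE.mono hin') f u κ' N' F M (A * (F + M)) hκ' hN' hu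
        (fun z hz => hus z (hin' hz)) hu0 hF hM hS0 (fun z hz => hub z (hin' hz))
        (fun z hz t ht => hD z (hin z hz) t ht) (hsrc.mono hin') x (Metric.mem_ball_self hs) y
        (by rw [Metric.mem_ball, dist_comm, dist_eq_norm]; exact hxy) t ht
      refine h1.trans (mul_le_mul_of_nonneg_right ?_ (Real.rpow_nonneg (norm_nonneg _) κ))
      have h2 : F + M + M / s + A * (F + M) ≤ (1 + 1 / s + A) * (F + M) := by
        have : 0 ≤ F / s := by positivity
        have e : (1 + 1 / s + A) * (F + M) = F + M + (F / s + M / s) + A * (F + M) := by ring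
        linarith
      have h3 : C * s⁻¹ ^ 3 * (F + M + M / s + A * (F + M)) ≤
          C * s⁻¹ ^ 3 * ((1 + 1 / s + A) * (F + M)) :=
        mul_le_mul_of_nonneg_left h2 (by positivity)
      have h4 : 0 ≤ 2 * A / s ^ κ * (F + M) := by positivity
      rw [hHdef]
      linarith
    · have h1 : ‖hessx u t x - hessx u t y‖ ≤ 2 * A * (F + M) := by
        have e1 := hD x (Metric.ball_subset_ball (by norm_num) hx) t ht
        have e2 := hD y (Metric.ball_subset_ball (by norm_num) hy) t ht
        linarith [norm_sub_le (hessx u t x) (hessx u t y)]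
      have h2 : s ^ κ ≤ ‖x - y‖ ^ κ := Real.rpow_le_rpow hs.le (not_lt.1 hxy) hκ.le
      have hsκ : 0 < s ^ κ := by positivity
      have h3 : 2 * A * (F + M) = 2 * A / s ^ κ * (F + M) * s ^ κ := by field_simp
      refine h1.trans ?_
      rw [h3]
      have h4 : 2 * A / s ^ κ ≤ H := by
        have : 0 ≤ C * s⁻¹ ^ 3 * (1 + 1 / s + A) := by positivity
        linarith
      gcongr
  · have hbd : ∀ r ∈ Icc 0 T, ‖ell a b u x r + f x r‖ ≤ R * (F + M) := fun r hr => by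
      refine hle _ ((d : ℝ) ^ 2 * Λ * A + d * Λ * (16 + A) + 1) ?_ (by linarith)
      have h1 := abs_opL_le (fun i j => hE.bound_a i j x (hsub hx))
        (fun i => hE.bound_b i x (hsub hx)) (hessx u r x) (gradx u r x)
      have h2 := hsrc.bound x (hsub hx) r hr
      have h3 : (d : ℝ) ^ 2 * Λ * ‖hessx u r x‖ ≤ (d : ℝ) ^ 2 * Λ * (A * (F + M)) :=
        mul_le_mul_of_nonneg_left
          (hD x (Metric.ball_subset_ball (by norm_num) hx) r hr) (by positivity)
      have h4 : (d : ℝ) * Λ * ‖gradx u r x‖ ≤ (d : ℝ) * Λ * ((16 + A) * (F + M)) :=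
        mul_le_mul_of_nonneg_left (hD1 x hx r hr) (by positivity)
      have h5 := abs_add_le (ell a b u x r) (f x r)
      rw [Real.norm_eq_abs]
      have h6 : |ell a b u x r| ≤ (d : ℝ) ^ 2 * Λ * ‖hessx u r x‖ + d * Λ * ‖gradx u r x‖ := h1
      linarith
    have := (convex_Icc 0 T).norm_image_sub_le_of_norm_hasDerivWithin_le
      (fun r hr => hus x (hsub hx) r hr) hbd ht hs
    simpa [Real.norm_eq_abs] using this

end Interior

section Existence

open Filter Topology

variable {d : ℕ} {κ κ0 lam Λ T N : ℝ} {a : Fin d → Fin d → Euc d → ℝ} {b : Fin d → Euc d → ℝ}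

theorem one_half_le_rpow {r κ : ℝ} (hr : 1 / 2 ≤ r) (hκ : 0 < κ) (hκ1 : κ ≤ 1) :
    1 / 2 ≤ r ^ κ :=
  calc (1 : ℝ) / 2 = (1 / 2) ^ (1 : ℝ) := by rw [Real.rpow_one]
    _ ≤ (1 / 2) ^ κ := Real.rpow_le_rpow_of_exponent_ge (by norm_num) (by norm_num) hκ1
    _ ≤ r ^ κ := Real.rpow_le_rpow (by norm_num) hr hκ.le

theorem HolderSolOn.of_local {R : ℝ} {u : Euc d → ℝ → ℝ} (hκ : 0 < κ) (hκ1 : κ ≤ 1) (hR : 0 ≤ R)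
    (h : ∀ x₀, HolderSolOn (Metric.ball x₀ (1 / 2)) κ T R u) : HolderSolOn univ κ T (4 * R) u := by
  have hm : ∀ x : Euc d, x ∈ Metric.ball x (1 / 2) := fun x => Metric.mem_ball_self (by norm_num)
  refine ⟨(h 0).smooth, fun x _ t ht => ((h x).bound x (hm x) t ht).trans (by linarith),
    fun x _ t ht => ((h x).bound1 x (hm x) t ht).trans (by linarith),
    fun x _ t ht => ((h x).bound2 x (hm x) t ht).trans (by linarith), fun x _ y _ t ht => ?_,
    fun x _ s hs t ht => ((h x).lip x (hm x) s hs t ht).trans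
      (mul_le_mul_of_nonneg_right (by linarith) (abs_nonneg _))⟩
  have hp : 0 ≤ ‖x - y‖ ^ κ := Real.rpow_nonneg (norm_nonneg _) κ
  by_cases hxy : ‖x - y‖ < 1 / 2
  · refine ((h x).holder2 x (hm x) y ?_ t ht).trans
      (mul_le_mul_of_nonneg_right (by linarith) hp)
    rw [Metric.mem_ball, dist_comm, dist_eq_norm]
    exact hxy
  · have h1 := (h x).bound2 x (hm x) t ht
    have h2 := (h y).bound2 y (hm y) t ht
    have h3 := one_half_le_rpow (not_lt.1 hxy) hκ hκ1
    have h4 := mul_le_mul_of_nonneg_left h3 hR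
    linarith [norm_sub_le (hessx u t x) (hessx u t y)]

/-- Global a priori estimate. -/
theorem exists_global_estimate (d : ℕ) (hl : 0 < lam) (hΛ : 0 ≤ Λ) (hκ : 0 < κ)
    (hκ0 : κ < κ0) (hκ1 : κ0 ≤ 1) (hT : 0 ≤ T) : ∃ C : ℝ, 0 ≤ C ∧
      ∀ (a : Fin d → Fin d → Euc d → ℝ) (b : Fin d → Euc d → ℝ), EllipticOn univ κ0 lam Λ a b →
      ∀ N, 0 ≤ N → Solvable κ T N a b → Solvable κ T C a b := by
  obtain ⟨C, hC, h⟩ := exists_interior_estimate (T := T) d hl hΛ hκ hκ0 hκ1 hT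
  refine ⟨4 * (C * (1 + T)), by positivity, fun a b hE N hN hS F f hf => ?_⟩
  have hF : 0 ≤ F := (abs_nonneg _).trans (hf.bound 0 0 ⟨le_rfl, hT⟩)
  obtain ⟨u, hu, hus, hu0⟩ := hS F f hf
  refine ⟨u, ?_, hus, hu0⟩
  have hub := hE.abs_le_mul hl.le hΛ hu.bddSmooth hus hu0 hf.bound
  have := HolderSolOn.of_local hκ (hκ0.le.trans hκ1) (R := C * (F + F * T)) (by positivity)
    fun x₀ => h x₀ a b (hE.mono (subset_univ _)) f u κ (N * F) F (F * T) hκ (by positivity) hu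
      (fun x _ => hus x trivial) hu0 hF (by positivity)
      (fun x _ t ht => (hub x t ht).trans (mul_le_mul_of_nonneg_left ht.2 hF))
      ⟨fun x _ => hf.cont x, fun x _ => hf.bound x, fun x _ y _ t ht =>
        (hf.holder x y t ht).trans (le_add_of_nonneg_right (by positivity))⟩
  convert this using 1
  ring

theorem EllipticOn.lower_exponent_univ (hE : EllipticOn univ κ0 lam Λ a b) (hκ : 0 < κ)
    (hκ0 : κ ≤ κ0) (hΛ : 0 ≤ Λ) : EllipticOn univ κ lam (2 * Λ) a b := by
  have key : ∀ (X : ℝ) (x y : Euc d), X ≤ Λ * ‖x - y‖ ^ κ0 → X ≤ 2 * Λ →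
      X ≤ 2 * Λ * ‖x - y‖ ^ κ := fun X x y h1 h2 => by
    have hp : 0 ≤ Λ * ‖x - y‖ ^ κ := mul_nonneg hΛ (Real.rpow_nonneg (norm_nonneg _) κ)
    by_cases h : ‖x - y‖ ≤ 1
    · have := mul_le_mul_of_nonneg_left (rpow_le_rpow_of_le_one (norm_nonneg _) h hκ hκ0) hΛ
      linarith
    · have := mul_le_mul_of_nonneg_left (Real.one_le_rpow (not_le.1 h).le hκ.le) hΛ
      linarith
  exact ⟨hE.symm, hE.elliptic, fun i j x hx => (hE.bound_a i j x hx).trans (by linarith),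
    fun i x hx => (hE.bound_b i x hx).trans (by linarith),
    fun i j x hx y hy => key _ x y (hE.holder_a i j x hx y hy) (by
      linarith [abs_sub (a i j x) (a i j y), hE.bound_a i j x hx, hE.bound_a i j y hy]),
    fun i x hx y hy => key _ x y (hE.holder_b i x hx y hy) (by
      linarith [abs_sub (b i x) (b i y), hE.bound_b i x hx, hE.bound_b i y hy])⟩

theorem sum_ite_mul_mul (ν : Euc d) :
    ∑ i, ∑ j, (if i = j then (1 : ℝ) else 0) * ν i * ν j = ‖ν‖ ^ 2 := by
  rw [EuclideanSpace.real_norm_sq_eq]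
  simp [ite_mul, Finset.sum_ite_eq, sq]

/-- The convex path from the Laplacian to the given operator stays uniformly elliptic. -/
theorem EllipticOn.path (hE : EllipticOn univ κ lam Λ a b) (hΛ : 1 ≤ Λ) (hl : lam ≤ 1)
    {τ : ℝ} (hτ : τ ∈ Icc (0 : ℝ) 1) :
    EllipticOn univ κ lam Λ (fun i j x => (1 - τ) * (if i = j then 1 else 0) + τ * a i j x)
      (fun i x => τ * b i x) := by
  have h1 : 0 ≤ 1 - τ := sub_nonneg.2 hτ.2
  have hp : ∀ (X : ℝ) (x y : Euc d), X ≤ Λ * ‖x - y‖ ^ κ → τ * X ≤ Λ * ‖x - y‖ ^ κ :=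
    fun X x y h => by
      have : 0 ≤ Λ * ‖x - y‖ ^ κ := mul_nonneg (by linarith) (Real.rpow_nonneg (norm_nonneg _) κ)
      nlinarith [mul_le_mul_of_nonneg_left h hτ.1, hτ.2]
  refine ⟨fun i j x hx => ?_, fun x hx ν => ?_, fun i j x hx => ?_, fun i x hx => ?_,
    fun i j x hx y hy => ?_, fun i x hx y hy => ?_⟩
  · rw [hE.symm i j x hx]
    simp [eq_comm]
  · have e : ∑ i, ∑ j, ((1 - τ) * (if i = j then 1 else 0) + τ * a i j x) * ν i * ν j =
        (1 - τ) * ∑ i, ∑ j, (if i = j then (1 : ℝ) else 0) * ν i * ν j +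
          τ * ∑ i, ∑ j, a i j x * ν i * ν j := by
      simp only [Finset.mul_sum, ← Finset.sum_add_distrib]
      refine Finset.sum_congr rfl fun i _ => Finset.sum_congr rfl fun j _ => ?_
      ring
    rw [e, sum_ite_mul_mul]
    have h2 := mul_le_mul_of_nonneg_left (hE.elliptic x hx ν) hτ.1
    have h3 : lam * ‖ν‖ ^ 2 ≤ ‖ν‖ ^ 2 := mul_le_of_le_one_left (by positivity) hl
    have h4 := mul_le_mul_of_nonneg_left h3 h1
    linarith
  · have h2 : |(if i = j then (1 : ℝ) else 0)| ≤ Λ := by split_ifs <;> simp <;> linarith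
    have h3 := mul_le_mul_of_nonneg_left (hE.bound_a i j x hx) hτ.1
    have h4 := mul_le_mul_of_nonneg_left h2 h1
    refine (abs_add_le _ _).trans ?_
    rw [abs_mul, abs_mul, abs_of_nonneg h1, abs_of_nonneg hτ.1]
    linarith
  · rw [abs_mul, abs_of_nonneg hτ.1]
    have := mul_le_mul_of_nonneg_left (hE.bound_b i x hx) hτ.1
    nlinarith [hτ.2]
  · rw [add_sub_add_left_eq_sub, ← mul_sub, abs_mul, abs_of_nonneg hτ.1]
    exact hp _ x y (hE.holder_a i j x hx y hy)
  · rw [← mul_sub, abs_mul, abs_of_nonneg hτ.1]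
    exact hp _ x y (hE.holder_b i x hx y hy)

theorem EllipticOn.weaken {U : Set (Euc d)} {lam' Λ' : ℝ} (hE : EllipticOn U κ lam Λ a b)
    (hl : lam' ≤ lam) (hΛ : Λ ≤ Λ') : EllipticOn U κ lam' Λ' a b where
  symm := hE.symm
  elliptic x hx ν := (mul_le_mul_of_nonneg_right hl (by positivity)).trans (hE.elliptic x hx ν)
  bound_a i j x hx := (hE.bound_a i j x hx).trans hΛ
  bound_b i x hx := (hE.bound_b i x hx).trans hΛ
  holder_a i j x hx y hy := (hE.holder_a i j x hx y hy).trans (by gcongr)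
  holder_b i x hx y hy := (hE.holder_b i x hx y hy).trans (by gcongr)

/-- Existence for the linear Cauchy problem by the method of continuity. -/
theorem exists_solvable (d : ℕ) (hl : 0 < lam) (hΛ : 0 ≤ Λ) (hκ : 0 < κ)
    (hκ0 : κ < κ0) (hκ1 : κ0 ≤ 1) (hT : 0 ≤ T) : ∃ C : ℝ, 0 ≤ C ∧
      ∀ (a : Fin d → Fin d → Euc d → ℝ) (b : Fin d → Euc d → ℝ), EllipticOn univ κ0 lam Λ a b →
      Solvable κ T C a b := by
  have hl' : 0 < min lam 1 := lt_min hl one_pos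
  have hΛ' : 0 ≤ max Λ 1 := hΛ.trans (le_max_left _ _)
  have hκ1' : κ < 1 := hκ0.trans_le hκ1
  obtain ⟨C, hC, hap⟩ := exists_global_estimate (T := T) d hl' hΛ' hκ hκ0 hκ1 hT
  obtain ⟨N₁, hN₁, hconst⟩ := exists_solvable_const (T := T) d hl' hΛ' hκ hκ1' hT
  refine ⟨C, hC, fun a b hE' => ?_⟩
  have hE := hE'.weaken (min_le_left lam 1) (le_max_left Λ 1)
  set Λ₁ := max Λ 1
  have hpath := fun τ hτ => hE.path (le_max_right Λ 1) (min_le_right lam 1) (τ := τ) hτ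
  set D : ℝ := 4 * Λ₁ with hD
  have hD0 : 0 ≤ D := by positivity
  obtain ⟨n, hn⟩ := exists_nat_gt (2 * ((2 * d ^ 2 + 3 * d) * D * C))
  have hn0 : (0 : ℝ) < n := lt_of_le_of_lt (by positivity) hn
  have hmem : ∀ k : ℕ, k ≤ n → (k / n : ℝ) ∈ Icc (0 : ℝ) 1 := fun k hk =>
    ⟨by positivity, (div_le_one hn0).2 (by exact_mod_cast hk)⟩
  have hE2 := hE.lower_exponent_univ hκ hκ0.le hΛ'
  have hΛ1 : 1 ≤ Λ₁ := le_max_right _ _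
  have main : ∀ k : ℕ, k ≤ n → Solvable κ T C
      (fun i j x => (1 - (k / n : ℝ)) * (if i = j then 1 else 0) + (k / n : ℝ) * a i j x)
      (fun i x => (k / n : ℝ) * b i x) := by
    intro k
    induction k with
    | zero =>
      intro hk
      refine hap _ _ (hpath _ (hmem 0 hk)) N₁ hN₁ ?_
      have := hconst (fun i j => if i = j then 1 else 0) (fun i j => by simp [eq_comm])
        (fun ν => by
          rw [sum_ite_mul_mul]
          exact mul_le_of_le_one_left (by positivity) (min_le_right _ _))
        (fun i j => by split_ifs <;> simp <;> linarith)
      simpa using this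
    | succ k ih =>
      intro hk
      refine hap _ _ (hpath _ (hmem (k + 1) hk)) (2 * C) (by positivity) ?_
      have hδ : ((k + 1 : ℕ) / n : ℝ) = k / n + 1 / n := by push_cast; ring
      have h1n : (0 : ℝ) ≤ 1 / n := by positivity
      have ed : ∀ x y : ℝ, (1 - ((k + 1 : ℕ) / n : ℝ)) * y + ((k + 1 : ℕ) / n : ℝ) * x -
          ((1 - (k / n : ℝ)) * y + (k / n : ℝ) * x) = 1 / n * (x - y) := fun x y => by
        rw [hδ]; ring
      have eb : ∀ x : ℝ, ((k + 1 : ℕ) / n : ℝ) * x - (k / n : ℝ) * x = 1 / n * x := fun x => by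
        rw [hδ]; ring
      refine (ih (by omega)).perturb (δ := 1 / n * D) hT hκ hκ1'.le hC (fun i j x => ?_)
        (fun i x => ?_) (fun i j x y => ?_) (fun i x y => ?_) (by positivity) ?_
      · rw [ed, abs_mul, abs_of_nonneg h1n]
        refine mul_le_mul_of_nonneg_left ?_ h1n
        have h2 : |(if i = j then (1 : ℝ) else 0)| ≤ 1 := by split_ifs <;> simp
        linarith [abs_sub (a i j x) (if i = j then (1 : ℝ) else 0), hE.bound_a i j x trivial]
      · rw [eb, abs_mul, abs_of_nonneg h1n]
        refine mul_le_mul_of_nonneg_left ?_ h1n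
        linarith [hE.bound_b i x trivial]
      · rw [ed, ed, ← mul_sub, sub_sub_sub_cancel_right, abs_mul, abs_of_nonneg h1n, mul_assoc]
        refine mul_le_mul_of_nonneg_left ((hE2.holder_a i j x trivial y trivial).trans ?_) h1n
        exact mul_le_mul_of_nonneg_right (by linarith) (Real.rpow_nonneg (norm_nonneg _) κ)
      · rw [eb, eb, ← mul_sub, abs_mul, abs_of_nonneg h1n, mul_assoc]
        refine mul_le_mul_of_nonneg_left ((hE2.holder_b i x trivial y trivial).trans ?_) h1n
        exact mul_le_mul_of_nonneg_right (by linarith) (Real.rpow_nonneg (norm_nonneg _) κ)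
      · have : (2 * (d : ℝ) ^ 2 + 3 * d) * (1 / n * D) * C =
            (2 * d ^ 2 + 3 * d) * D * C / n := by ring
        rw [this, div_le_iff₀ hn0]
        linarith
  have := main n le_rfl
  rw [div_self hn0.ne'] at this
  simpa using this

end Existence

section Semilinear

open Filter Topology

variable {d : ℕ} {κ κ0 lam Λ T N : ℝ} {a : Fin d → Fin d → Euc d → ℝ} {b : Fin d → Euc d → ℝ}

/-- A nonlinear source term which is globally Lipschitz in the unknown. -/
structure LipschitzSource (κ T Λ : ℝ) (G : Euc d → ℝ → ℝ → ℝ) : Prop where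
  cont : ∀ x z, ContinuousOn (fun t => G x t z) (Icc 0 T)
  zero : ∀ x, ∀ t ∈ Icc 0 T, |G x t 0| ≤ Λ
  lip : ∀ x, ∀ t ∈ Icc 0 T, ∀ z z', |G x t z - G x t z'| ≤ Λ * |z - z'|
  holder : ∀ x y, ∀ t ∈ Icc 0 T, ∀ z, |G x t z - G y t z| ≤ Λ * (1 + |z|) * ‖x - y‖ ^ κ

theorem LipschitzSource.abs_le {G : Euc d → ℝ → ℝ → ℝ} (hG : LipschitzSource κ T Λ G) (x : Euc d)
    {t : ℝ} (ht : t ∈ Icc 0 T) (z : ℝ) : |G x t z| ≤ Λ * (1 + |z|) := by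
  have h1 := hG.lip x t ht z 0
  have h2 := hG.zero x t ht
  have h3 := abs_add_le (G x t z - G x t 0) (G x t 0)
  rw [sub_add_cancel] at h3
  rw [sub_zero] at h1
  linarith

theorem LipschitzSource.continuousOn {G : Euc d → ℝ → ℝ → ℝ} (hG : LipschitzSource κ T Λ G)
    (x : Euc d) {φ : ℝ → ℝ} (hφ : ContinuousOn φ (Icc 0 T)) :
    ContinuousOn (fun t => G x t (φ t)) (Icc 0 T) := fun t ht => by
  have h1 : Tendsto (fun s => Λ * |φ s - φ t| + |G x s (φ t) - G x t (φ t)|) (𝓝[Icc 0 T] t)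
      (𝓝 0) := by
    have e1 : Tendsto (fun s => Λ * |φ s - φ t|) (𝓝[Icc 0 T] t) (𝓝 (Λ * |φ t - φ t|)) :=
      (((hφ t ht).sub tendsto_const_nhds).abs).const_mul Λ
    have e2 : Tendsto (fun s => |G x s (φ t) - G x t (φ t)|) (𝓝[Icc 0 T] t)
        (𝓝 |G x t (φ t) - G x t (φ t)|) := ((hG.cont x (φ t) t ht).sub tendsto_const_nhds).abs
    simpa using e1.add e2
  refine tendsto_iff_norm_sub_tendsto_zero.2 (squeeze_zero' (Eventually.of_forall fun _ =>
    norm_nonneg _) ?_ h1)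
  filter_upwards [self_mem_nhdsWithin] with s hs
  rw [Real.norm_eq_abs]
  exact (abs_sub_le (G x s (φ s)) (G x s (φ t)) (G x t (φ t))).trans
    (add_le_add_left (hG.lip x s hs _ _) _)

theorem LipschitzSource.holderSource {G : Euc d → ℝ → ℝ → ℝ} (hG : LipschitzSource κ T Λ G)
    (hΛ : 0 ≤ Λ) (hκ : 0 < κ) (hκ1 : κ ≤ 1) {u : Euc d → ℝ → ℝ} {h M : ℝ} (hN : 0 ≤ N)
    (hu : HolderSolOn univ κ T N u) (hM : 0 ≤ M) (hub : ∀ x, ∀ t ∈ Icc 0 T, |u x t| ≤ M)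
    (hh : 0 < h) : HolderSource κ T (Λ * (1 + 3 * M + 2 * M / h) + Λ * h * N)
      (fun x t => G x t (u x t)) := by
  have hMh : 0 ≤ M / h := by positivity
  have hhN : 0 ≤ h * N := by positivity
  have h2 : 2 * M / h = 2 * (M / h) := by ring
  refine ⟨fun x => hG.continuousOn x ?_, fun x t ht => ?_, fun x y t ht => ?_⟩
  · exact hu.bddSmooth.cont.comp (f := fun t : ℝ => (x, t)) (by fun_prop)
      fun t ht => ⟨trivial, ht⟩
  · refine (hG.abs_le x ht _).trans ?_
    have h1 := mul_le_mul_of_nonneg_left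
      (show 1 + |u x t| ≤ 1 + 3 * M + 2 * M / h + h * N by rw [h2]; linarith [hub x t ht]) hΛ
    linarith
  · set r := ‖x - y‖
    have hr : 0 ≤ r := norm_nonneg _
    have hrκ : 0 ≤ r ^ κ := Real.rpow_nonneg hr κ
    have hlip : |u x t - u y t| ≤ (2 * M / h + h * N) * r :=
      convex_univ.norm_image_sub_le_of_norm_fderiv_le (𝕜 := ℝ) (f := fun x => u x t)
        (fun z _ => ((hu.smooth t ht).differentiable (by norm_num)) z)
        (fun z _ => norm_fderiv_le_of_bounds (hu.smooth t ht) hh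
          (fun w _ => hu.bound2 w trivial t ht) fun w _ => hub w t ht) trivial trivial
    have h3 : |u x t - u y t| ≤ (2 * M / h + h * N + 2 * M) * r ^ κ := by
      refine le_mul_rpow_of_le (by rw [h2]; positivity) hr hκ.le hκ1
        (hlip.trans (mul_le_mul_of_nonneg_right (by linarith) hr)) ?_
      rw [h2]
      linarith [abs_sub (u x t) (u y t), hub x t ht, hub y t ht]
    have h4 := hG.holder x y t ht (u x t)
    have h5 := hG.lip y t ht (u x t) (u y t)
    have h6 := _root_.abs_sub_le (G x t (u x t)) (G y t (u x t)) (G y t (u y t))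
    have h7 : Λ * (1 + |u x t|) * r ^ κ ≤ Λ * (1 + M) * r ^ κ :=
      mul_le_mul_of_nonneg_right (mul_le_mul_of_nonneg_left (by linarith [hub x t ht]) hΛ) hrκ
    have h8 := mul_le_mul_of_nonneg_left h3 hΛ
    calc _ ≤ Λ * (1 + M) * r ^ κ + Λ * ((2 * M / h + h * N + 2 * M) * r ^ κ) := by linarith
      _ = _ := by ring

/-- Existence for semilinear equations with globally Lipschitz nonlinearity. -/
theorem exists_semilinear_solution (hE : EllipticOn univ κ0 lam Λ a b) (hl : 0 < lam)
    (hΛ : 0 ≤ Λ) (hκ : 0 < κ) (hκ0 : κ < κ0) (hκ1 : κ0 ≤ 1) (hT : 0 ≤ T) {Γ : ℝ} (hΓ : 0 ≤ Γ)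
    {G : Euc d → ℝ → ℝ → ℝ} (hG : LipschitzSource κ T Γ G) :
    ∃ N : ℝ, 0 ≤ N ∧ ∃ z : Euc d → ℝ → ℝ, HolderSolOn univ κ T N z ∧
      SolvesOn univ T a b (fun x t => G x t (z x t)) z ∧ ∀ x, z x 0 = 0 := by
  obtain ⟨C, hC, hS⟩ := exists_solvable (T := T) d hl hΛ hκ hκ0 hκ1 hT
  have hκ1' : κ ≤ 1 := hκ0.le.trans hκ1
  set μ : ℝ := 2 * Γ + 1 with hμ
  have hμ0 : 0 < μ := by positivity
  set M : ℝ := Real.exp (μ * T) with hM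
  have hM0 : 0 < M := Real.exp_pos _
  set h : ℝ := 1 / (2 * (C * Γ + 1)) with hh
  have hh0 : 0 < h := by positivity
  set A : ℝ := Γ * (1 + 3 * M + 2 * M / h) with hA
  set N : ℝ := 2 * C * A with hN
  have hN0 : 0 ≤ N := by positivity
  have hCN : C * (A + Γ * h * N) ≤ N := by
    have h1 : C * Γ * h ≤ 1 / 2 := by
      rw [hh, mul_one_div, div_le_iff₀ (by positivity)]
      linarith
    have h2 := mul_le_mul_of_nonneg_right h1 hN0
    have h3 : C * (A + Γ * h * N) = N / 2 + C * Γ * h * N := by rw [hN]; ring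
    linarith
  have hexp1 : ∀ t, 0 ≤ t → 1 ≤ Real.exp (μ * t) := fun t ht => Real.one_le_exp (by positivity)
  have hexpM : ∀ t ∈ Icc 0 T, Real.exp (μ * t) ≤ M := fun t ht =>
    Real.exp_le_exp.2 (mul_le_mul_of_nonneg_left ht.2 hμ0.le)
  let X := {z : Euc d → ℝ → ℝ // HolderSolOn univ κ T N z ∧
    (∀ x, ∀ t ∈ Icc 0 T, |z x t| ≤ Real.exp (μ * t)) ∧ ∀ x, z x 0 = 0}
  have hstep : ∀ z : X, ∃ w : X, SolvesOn univ T a b (fun x t => G x t (z.1 x t)) w.1 := by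
    rintro ⟨z, z1, z2, z3⟩
    obtain ⟨w, w1, w2, w3⟩ := hS a b hE _ _ (hG.holderSource hΓ hκ hκ1' hN0 z1 hM0.le
      (fun x t ht => (z2 x t ht).trans (hexpM t ht)) hh0)
    refine ⟨⟨w, w1.mono subset_rfl hCN, fun x t ht => ?_, w3⟩, w2⟩
    refine (hE.abs_le_exp hl.le hΛ w1.bddSmooth w2 (F := 2 * Γ) (by positivity) hμ0 w3
      (fun x t ht => ?_) x t ht).trans ?_
    · refine (hG.abs_le x ht _).trans ?_
      have := mul_le_mul_of_nonneg_left (add_le_add (hexp1 t ht.1) (z2 x t ht)) hΓ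
      linarith
    · exact mul_le_of_le_one_left (Real.exp_pos _).le ((div_le_one hμ0).2 (by linarith))
  choose S hSs using hstep
  let z₀ : X := ⟨fun _ _ => 0, HolderSolOn.zero.mono subset_rfl hN0,
    fun x t _ => by rw [abs_zero]; exact (Real.exp_pos _).le, fun x => rfl⟩
  let Z : ℕ → X := fun n => S^[n] z₀
  have hZ : ∀ n, SolvesOn univ T a b (fun x t => G x t ((Z n).1 x t)) (Z (n + 1)).1 := fun n => by
    have : Z (n + 1) = S (Z n) := Function.iterate_succ_apply' S n z₀
    rw [this]
    exact hSs _
  have hdiff : ∀ n, ∀ x, ∀ t ∈ Icc 0 T,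
      |(Z n).1 x t - (Z (n + 1)).1 x t| ≤ (1 / 2) ^ n * Real.exp (μ * t) := by
    intro n
    induction n with
    | zero =>
      intro x t ht
      have h0 : (Z 0).1 x t = 0 := rfl
      rw [h0, zero_sub, abs_neg, pow_zero, one_mul]
      exact (Z 1).2.2.1 x t ht
    | succ n ih =>
      intro x t ht
      have h1 := hE.abs_le_exp hl.le hΛ ((Z (n + 1)).2.1.bddSmooth.sub (Z (n + 2)).2.1.bddSmooth)
        ((hZ n).sub (hZ (n + 1)) (Z (n + 1)).2.1.smooth (Z (n + 2)).2.1.smooth)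
        (F := Γ * (1 / 2) ^ n) (by positivity) hμ0
        (fun x => by rw [(Z (n + 1)).2.2.2, (Z (n + 2)).2.2.2, sub_zero])
        (fun x t ht => (hG.lip x t ht _ _).trans (by
          rw [mul_assoc]
          exact mul_le_mul_of_nonneg_left (ih x t ht) hΓ)) x t ht
      refine h1.trans (mul_le_mul_of_nonneg_right ?_ (Real.exp_pos _).le)
      rw [div_le_iff₀ hμ0, pow_succ]
      have : (0 : ℝ) < (1 / 2) ^ n := by positivity
      nlinarith
  have hlim : ∀ x t, ∃ L, t ∈ Icc 0 T → Tendsto (fun n => (Z n).1 x t) atTop (𝓝 L) := fun x t => by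
    by_cases ht : t ∈ Icc 0 T
    · have hc : CauchySeq fun n => (Z n).1 x t :=
        cauchySeq_of_le_geometric (1 / 2) (Real.exp (μ * t)) (by norm_num) fun n => by
          rw [Real.dist_eq, mul_comm]
          exact hdiff n x t ht
      obtain ⟨L, hL⟩ := cauchySeq_tendsto_of_complete hc
      exact ⟨L, fun _ => hL⟩
    · exact ⟨0, fun h => absurd h ht⟩
  choose z hz using hlim
  let l : Ultrafilter ℕ := hyperfilter ℕ
  have hl' : (l : Filter ℕ) ≤ atTop := by
    rw [← Nat.cofinite_eq_atTop]; exact hyperfilter_le_cofinite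
  have hz1 : ∀ x, ∀ t ∈ Icc 0 T, Tendsto (fun n => (Z (n + 1)).1 x t) l (𝓝 (z x t)) :=
    fun x t ht => ((tendsto_add_atTop_iff_nat 1).2 (hz x t ht)).mono_left hl'
  have hz0 : ∀ x, ∀ t ∈ Icc 0 T, Tendsto (fun n => (Z n).1 x t) l (𝓝 (z x t)) :=
    fun x t ht => (hz x t ht).mono_left hl'
  have hsol := ultralimit_solves l (κ := κ) (T := T) (N := N) (v := fun n => (Z (n + 1)).1)
    (u := z) (f := fun n x t => G x t ((Z n).1 x t)) (g := fun x t => G x t (z x t)) (a := a)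
    (b := b) isOpen_univ convex_univ hκ hN0
    (Eventually.of_forall fun n => ⟨(Z (n + 1)).2.1, hZ n⟩)
    (fun x _ t ht => hz1 x t ht) (fun x _ t ht => ?_) (fun x _ t ht ε hε => ?_)
  · obtain ⟨k1, k2⟩ := hsol
    refine ⟨N, hN0, z, HolderSolOn.of_ultralimit l
      (Eventually.of_forall fun n => (Z (n + 1)).2.1) hz1 fun x t ht => k1 x trivial t ht, k2,
      fun x => ?_⟩
    refine tendsto_nhds_unique (hz0 x 0 ⟨le_rfl, hT⟩) ?_
    simp only [(Z _).2.2.2]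
    exact tendsto_const_nhds
  · have h1 : Tendsto (fun n => Γ * |(Z n).1 x t - z x t|) l (𝓝 0) := by
      have := ((hz0 x t ht).sub_const (z x t)).abs.const_mul Γ
      simpa using this
    exact tendsto_iff_norm_sub_tendsto_zero.2 (squeeze_zero (fun _ => norm_nonneg _)
      (fun n => hG.lip x t ht _ _) h1)
  · obtain ⟨δ, hδ, h1⟩ := Metric.continuousWithinAt_iff.1 (hG.cont x (z x t) t ht) (ε / 4)
      (by positivity)
    have h2 : Tendsto (fun n => Γ * |(Z n).1 x t - z x t|) l (𝓝 0) := by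
      have := ((hz0 x t ht).sub_const (z x t)).abs.const_mul Γ
      simpa using this
    refine ⟨min δ (ε / (4 * (Γ * N + 1))), lt_min hδ (by positivity), ?_⟩
    filter_upwards [h2.eventually (gt_mem_nhds (by positivity : 0 < ε / 4))] with n hn s hs hst
    have e1 := (h1 hs (by rw [Real.dist_eq]; exact hst.trans_le (min_le_left _ _))).le
    rw [Real.dist_eq] at e1
    have e2 := hG.lip x s hs ((Z n).1 x s) ((Z n).1 x t)
    have e3 := hG.lip x s hs ((Z n).1 x t) (z x t)
    have e4 := hG.lip x t ht ((Z n).1 x t) (z x t)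
    have e5 := mul_le_mul_of_nonneg_left ((Z n).2.1.lip x trivial s hs t ht) hΓ
    have e6 : Γ * (N * |s - t|) ≤ ε / 4 := by
      have h3 := (hst.trans_le (min_le_right _ _)).le
      rw [le_div_iff₀ (by positivity)] at h3
      nlinarith [abs_nonneg (s - t)]
    rw [abs_le] at *
    constructor <;> linarith [e1.1, e1.2, e2.1, e2.2, e3.1, e3.2, e4.1, e4.2]

end Semilinear

section LocalHolder

open Filter Topology

variable {d : ℕ} {κ Λ : ℝ} {f : Euc d → ℝ}

/-- Bounded and Hölder continuous functions on a set. -/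
structure BddHolderOn (U : Set (Euc d)) (κ Λ : ℝ) (f : Euc d → ℝ) : Prop where
  bound : ∀ x ∈ U, |f x| ≤ Λ
  holder : ∀ x ∈ U, ∀ y ∈ U, |f x - f y| ≤ Λ * ‖x - y‖ ^ κ

theorem BddHolderOn.mono {U V : Set (Euc d)} (hf : BddHolderOn U κ Λ f) (h : V ⊆ U) :
    BddHolderOn V κ Λ f where
  bound x hx := hf.bound x (h hx)
  holder x hx y hy := hf.holder x (h hx) y (h hy)

theorem BddHolderOn.comp {U : Set (Euc d)} (hf : BddHolderOn U κ Λ f) (hκ : 0 ≤ κ) (hΛ : 0 ≤ Λ)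
    {P : Euc d → Euc d} (hPU : ∀ x, P x ∈ U) (hP : ∀ x y, ‖P x - P y‖ ≤ ‖x - y‖) :
    BddHolderOn univ κ Λ fun x => f (P x) where
  bound x _ := hf.bound _ (hPU x)
  holder x _ y _ := (hf.holder _ (hPU x) _ (hPU y)).trans (by
    gcongr
    exact hP x y)

theorem LocHolder.continuous (hf : LocHolder f) : Continuous f := by
  refine continuous_iff_continuousAt.2 fun x => ?_
  obtain ⟨κ, C, hκ, -, -, h⟩ := hf (Metric.closedBall x 1) (isCompact_closedBall x 1)
  have h0 : Tendsto (fun y => C * ‖y - x‖ ^ κ) (𝓝 x) (𝓝 0) := by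
    have : Continuous fun y => C * ‖y - x‖ ^ κ :=
      continuous_const.mul (Continuous.rpow_const (by fun_prop) fun _ => Or.inr hκ.le)
    simpa [Real.zero_rpow hκ.ne'] using this.tendsto x
  refine tendsto_iff_norm_sub_tendsto_zero.2 (squeeze_zero' (Eventually.of_forall fun _ =>
    norm_nonneg _) ?_ h0)
  filter_upwards [Metric.closedBall_mem_nhds x one_pos] with y hy
  exact h y hy x (Metric.mem_closedBall_self zero_le_one)

theorem LocHolder.eventually_bddHolderOn (hf : LocHolder f) (R : ℝ) :
    ∀ᶠ κ in 𝓝[>] (0 : ℝ), ∀ᶠ Λ in atTop, BddHolderOn (Metric.closedBall 0 R) κ Λ f := by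
  obtain ⟨κ', C, hκ', hκ1, hC, h⟩ := hf (Metric.closedBall 0 R) (isCompact_closedBall 0 R)
  obtain ⟨M, hM⟩ := (isCompact_closedBall (0 : Euc d) R).exists_bound_of_continuousOn
    hf.continuous.continuousOn
  filter_upwards [Ioo_mem_nhdsGT hκ'] with κ hκ
  filter_upwards [eventually_ge_atTop M, eventually_ge_atTop (C * (1 + 2 * |R|))] with Λ h1 h2
  refine ⟨fun x hx => (hM x hx).trans h1, fun x hx y hy => (h x hx y hy).trans ?_⟩
  have hr : ‖x - y‖ ≤ 2 * |R| := by
    have e1 := mem_closedBall_zero_iff.1 hx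
    have e2 := mem_closedBall_zero_iff.1 hy
    linarith [norm_sub_le x y, le_abs_self R]
  have hr0 : 0 ≤ ‖x - y‖ := norm_nonneg _
  have key : ‖x - y‖ ^ κ' ≤ (1 + 2 * |R|) * ‖x - y‖ ^ κ := by
    rcases le_total ‖x - y‖ 1 with h3 | h3
    · exact (rpow_le_rpow_of_le_one hr0 h3 hκ.1 hκ.2.le).trans
        (le_mul_of_one_le_left (Real.rpow_nonneg hr0 _) (by linarith [abs_nonneg R]))
    · calc ‖x - y‖ ^ κ' ≤ ‖x - y‖ ^ (1 : ℝ) := Real.rpow_le_rpow_of_exponent_le h3 hκ1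
        _ ≤ 1 + 2 * |R| := by rw [Real.rpow_one]; linarith
        _ ≤ _ := le_mul_of_one_le_right (by positivity) (Real.one_le_rpow h3 hκ.1.le)
  calc C * ‖x - y‖ ^ κ' ≤ C * ((1 + 2 * |R|) * ‖x - y‖ ^ κ) := mul_le_mul_of_nonneg_left key hC
    _ = C * (1 + 2 * |R|) * ‖x - y‖ ^ κ := by ring
    _ ≤ _ := mul_le_mul_of_nonneg_right h2 (Real.rpow_nonneg hr0 _)

theorem exists_uniform_ellipticity {a : Fin d → Fin d → Euc d → ℝ}
    (ha : ∀ i j, Continuous (a i j))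
    (hell : ∀ x ν : Euc d, ν ≠ 0 → 0 < ∑ i, ∑ j, a i j x * ν i * ν j) (R : ℝ) :
    ∃ lam > 0, ∀ x ∈ Metric.closedBall (0 : Euc d) R, ∀ ν : Euc d,
      lam * ‖ν‖ ^ 2 ≤ ∑ i, ∑ j, a i j x * ν i * ν j := by
  obtain ⟨lam, hl, h⟩ := ((isCompact_closedBall (0 : Euc d) R).prod
    (isCompact_sphere (0 : Euc d) 1)).exists_forall_le' (a := (0 : ℝ))
    (f := fun q : Euc d × Euc d => ∑ i, ∑ j, a i j q.1 * q.2 i * q.2 j)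
    (by fun_prop)
    fun q hq => hell q.1 q.2 (by
      have := mem_sphere_zero_iff_norm.1 hq.2
      exact norm_ne_zero_iff.1 (by rw [this]; exact one_ne_zero))
  refine ⟨lam, hl, fun x hx ν => ?_⟩
  rcases eq_or_ne ν 0 with rfl | hν
  · simp
  · have hν0 : ‖ν‖ ≠ 0 := norm_ne_zero_iff.2 hν
    have h1 := h (x, ‖ν‖⁻¹ • ν) ⟨hx, by simp [norm_smul, hν0]⟩
    have e : ∑ i, ∑ j, a i j x * (‖ν‖⁻¹ • ν) i * (‖ν‖⁻¹ • ν) j =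
        (‖ν‖⁻¹) ^ 2 * ∑ i, ∑ j, a i j x * ν i * ν j := by
      simp only [PiLp.smul_apply, smul_eq_mul, Finset.mul_sum]
      exact Finset.sum_congr rfl fun i _ => Finset.sum_congr rfl fun j _ => by ring
    simp only [e] at h1
    rw [inv_pow, inv_mul_eq_div, le_div_iff₀ (by positivity)] at h1
    exact h1

theorem exists_local_bounds {a : Fin d → Fin d → Euc d → ℝ} {b : Fin d → Euc d → ℝ}
    {β α : Euc d → ℝ} (ha : ∀ i j, LocHolder (a i j)) (hb : ∀ i, LocHolder (b i))
    (hsymm : ∀ i j x, a i j x = a j i x)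
    (hell : ∀ x ν : Euc d, ν ≠ 0 → 0 < ∑ i, ∑ j, a i j x * ν i * ν j)
    (hβ : LocHolder β) (hα : LocHolder α) (R : ℝ) :
    ∃ κ κ0 lam Λ : ℝ, 0 < κ ∧ κ < κ0 ∧ κ0 ≤ 1 ∧ 0 < lam ∧ 0 ≤ Λ ∧
      EllipticOn (Metric.closedBall 0 R) κ0 lam Λ a b ∧
      BddHolderOn (Metric.closedBall 0 R) κ Λ β ∧ BddHolderOn (Metric.closedBall 0 R) κ Λ α := by
  obtain ⟨lam, hl, h⟩ := exists_uniform_ellipticity (fun i j => (ha i j).continuous) hell R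
  obtain ⟨κ0, h1, h2, h5⟩ := ((eventually_all.2 fun i => eventually_all.2 fun j =>
    (ha i j).eventually_bddHolderOn R).and ((eventually_all.2 fun i =>
    (hb i).eventually_bddHolderOn R).and (Ioo_mem_nhdsGT (one_pos : (0 : ℝ) < 1)))).exists
  obtain ⟨κ, h3, h4, h6⟩ := ((hβ.eventually_bddHolderOn R).and
    ((hα.eventually_bddHolderOn R).and (Ioo_mem_nhdsGT h5.1))).exists
  obtain ⟨Λ, g1, g2, g3, g4, g5⟩ := ((eventually_all.2 fun i => eventually_all.2 fun j =>
    h1 i j).and ((eventually_all.2 fun i => h2 i).and (h3.and (h4.and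
    (eventually_ge_atTop (0 : ℝ)))))).exists
  exact ⟨κ, κ0, lam, Λ, h6.1, h6.2, h5.2.le, hl, g5, ⟨fun i j x _ => hsymm i j x, h,
    fun i j => (g1 i j).bound, fun i => (g2 i).bound, fun i j => (g1 i j).holder,
    fun i => (g2 i).holder⟩, g3, g4⟩

theorem abs_rpow_sub_rpow_le {p M z z' : ℝ} (hp : 1 ≤ p) (hz : z ∈ Icc 0 M)
    (hz' : z' ∈ Icc 0 M) : |z ^ p - z' ^ p| ≤ p * M ^ (p - 1) * |z - z'| := by
  have := Convex.norm_image_sub_le_of_norm_hasDerivWithin_le (f := fun z : ℝ => z ^ p)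
    (f' := fun z => p * z ^ (p - 1)) (s := Icc 0 M) (C := p * M ^ (p - 1)) (x := z') (y := z)
    (fun x _ => (Real.hasDerivAt_rpow_const (Or.inr hp)).hasDerivWithinAt) (fun x hx => ?_)
    (convex_Icc 0 M) hz' hz
  · exact this
  · have := Real.rpow_nonneg hx.1 (p - 1)
    rw [Real.norm_of_nonneg (by positivity)]
    exact mul_le_mul_of_nonneg_left (Real.rpow_le_rpow hx.1 hx.2 (by linarith)) (by linarith)

theorem abs_clamp_sub_le (M z z' : ℝ) : |max 0 (min z M) - max 0 (min z' M)| ≤ |z - z'| := by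
  rw [max_comm 0, max_comm 0]
  exact (abs_max_sub_max_le_abs _ _ _).trans (abs_min_sub_min_le_max _ _ _ _ |>.trans (by simp))

theorem max_min_mem_Icc {M : ℝ} (hM : 0 ≤ M) (z : ℝ) : max 0 (min z M) ∈ Icc 0 M :=
  ⟨le_max_left _ _, max_le hM (min_le_right _ _)⟩

theorem max_min_eq_self {M z : ℝ} (hz : z ∈ Icc 0 M) : max 0 (min z M) = z := by
  rw [min_eq_left hz.2, max_eq_right hz.1]

/-- Uniform approximation of a bounded continuous function on a compact cylinder by functions
which are Lipschitz in space. -/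
theorem exists_lipschitz_approx {w : Euc d → ℝ → ℝ} {R T M ε : ℝ} (hR : 0 ≤ R) (hT : 0 ≤ T)
    (hε : 0 < ε)
    (hw : ContinuousOn (fun q : Euc d × ℝ => w q.1 q.2) (Metric.closedBall 0 R ×ˢ Icc 0 T))
    (hwM : ∀ x ∈ Metric.closedBall 0 R, ∀ t ∈ Icc 0 T, w x t ∈ Icc 0 M) :
    ∃ m : Euc d → ℝ → ℝ, ∃ K : ℝ, 0 ≤ K ∧ (∀ x, ContinuousOn (m x) (Icc 0 T)) ∧
      (∀ x t, m x t ∈ Icc 0 M) ∧ (∀ x y, ∀ t ∈ Icc 0 T, |m x t - m y t| ≤ K * ‖x - y‖) ∧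
      ∀ x ∈ Metric.closedBall 0 R, ∀ t ∈ Icc 0 T, |m x t - w x t| ≤ ε := by
  obtain ⟨P, hP1, hP2, hP3⟩ := exists_retraction (0 : Euc d) hR
  have hM : 0 ≤ M := by
    have := hwM 0 (Metric.mem_closedBall_self hR) 0 ⟨le_rfl, hT⟩
    exact this.1.trans this.2
  have hPc : Continuous P := (LipschitzWith.of_dist_le_mul (K := 1) fun x y => by
    rw [dist_eq_norm, dist_eq_norm]; simpa using hP3 x y).continuous
  set W : Euc d × ℝ → ℝ := fun q => w (P q.1) (projIcc 0 T hT q.2) with hW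
  have hWc : Continuous W := hw.comp_continuous
    (f := fun q : Euc d × ℝ => (P q.1, ((projIcc 0 T hT q.2 : Icc 0 T) : ℝ)))
    (by fun_prop) fun q => ⟨hP1 _, Subtype.coe_prop _⟩
  obtain ⟨g, hg1, hg2, -⟩ := hWc.exists_contDiff_approx 1 (ε := fun _ => ε) continuous_const
    fun _ => hε
  obtain ⟨K, hK⟩ := ContDiffOn.exists_lipschitzOnWith hg1.contDiffOn (by norm_num)
    ((convex_closedBall (0 : Euc d) R).prod (convex_Icc 0 T))
    ((isCompact_closedBall (0 : Euc d) R).prod isCompact_Icc)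
  refine ⟨fun x t => max 0 (min (g (P x, t)) M), K, K.2, fun x => ?_, fun x t =>
    max_min_mem_Icc hM _, fun x y t ht => ?_, fun x hx t ht => ?_⟩
  · have := hg1.continuous
    exact Continuous.continuousOn (by fun_prop)
  · refine (abs_clamp_sub_le M _ _).trans ?_
    have := hK.dist_le_mul (P x, t) ⟨hP1 x, ht⟩ (P y, t) ⟨hP1 y, ht⟩
    rw [Real.dist_eq] at this
    refine this.trans (mul_le_mul_of_nonneg_left ?_ K.2)
    rw [Prod.dist_eq, dist_self, max_eq_left dist_nonneg, dist_eq_norm]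
    exact hP3 x y
  · have h1 := hg2 (x, t)
    rw [hW, Real.dist_eq] at h1
    simp only [projIcc_of_mem hT ht, hP2 x hx] at h1
    simp only [hP2 x hx]
    have h2 := abs_clamp_sub_le M (g (x, t)) (w x t)
    rw [max_min_eq_self (hwM x hx t ht)] at h2
    exact h2.trans h1.le

end LocalHolder

section TruncatedProblem

open Filter Topology

variable {d : ℕ} {κ lam Λ R T C : ℝ} {a : Fin d → Fin d → Euc d → ℝ} {b : Fin d → Euc d → ℝ}

/-- Comparison on a cylinder up to an error `φ`. -/
theorem EllipticOn.le_add_of_strict_subsolution {U : Set (Euc d)} (hE : EllipticOn U κ lam Λ a b)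
    (hl : 0 ≤ lam) (hU : Metric.ball 0 R ⊆ U) {s S : Euc d → ℝ → ℝ} {φ : Euc d → ℝ}
    (hφ : ContDiff ℝ 2 φ)
    (hs : ContinuousOn (fun q : Euc d × ℝ => s q.1 q.2) (Metric.closedBall 0 R ×ˢ Icc 0 T))
    (hS : ContinuousOn (fun q : Euc d × ℝ => S q.1 q.2) (Metric.closedBall 0 R ×ˢ Icc 0 T))
    (hs2 : ∀ t ∈ Ioc 0 T, ContDiff ℝ 2 fun x => s x t)
    (hS2 : ∀ t ∈ Ioc 0 T, ContDiff ℝ 2 fun x => S x t)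
    (h0 : ∀ x ∈ Metric.closedBall (0 : Euc d) R, s x 0 ≤ S x 0 + φ x)
    (hlat : ∀ x : Euc d, ‖x‖ = R → ∀ t ∈ Icc 0 T, s x t ≤ S x t + Real.exp (C * t) * φ x)
    (hd : ∀ x ∈ Metric.ball (0 : Euc d) R, ∀ t ∈ Ioc 0 T,
      S x t + Real.exp (C * t) * φ x < s x t → ∃ s' S' : ℝ,
        HasDerivWithinAt (s x) s' (Icc 0 T) t ∧ HasDerivWithinAt (S x) S' (Icc 0 T) t ∧
        s' - S' + Real.exp (C * t) * ell a b (fun y _ => φ y) x t <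
          ell a b s x t - ell a b S x t + C * (s x t - S x t)) :
    ∀ x ∈ Metric.closedBall (0 : Euc d) R, ∀ t ∈ Icc 0 T,
      s x t ≤ S x t + Real.exp (C * t) * φ x := by
  have hexp : ∀ t, Real.exp (-(C * t)) * Real.exp (C * t) = 1 := fun t => by
    rw [← Real.exp_add, neg_add_cancel, Real.exp_zero]
  have hconv : ∀ x t, Real.exp (-(C * t)) * (s x t - S x t) - φ x ≤ 0 ↔
      s x t ≤ S x t + Real.exp (C * t) * φ x := fun x t => by
    rw [← mul_le_mul_iff_of_pos_left (Real.exp_pos (-(C * t))) (b := s x t), mul_add, ← mul_assoc,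
      hexp, one_mul, mul_sub]
    constructor <;> intro h <;> linarith
  intro x hx t ht
  rw [← hconv]
  refine nonpos_of_no_interior_max (R := R) (T := T)
    (g := fun x t => Real.exp (-(C * t)) * (s x t - S x t) - φ x) ?_ (fun y hy => ?_)
    (fun y hy t ht => (hconv y t).2 (hlat y hy t ht)) (fun y hy t ht hpos hmax htmax => ?_) x hx t ht
  · exact ((Continuous.continuousOn (by fun_prop)).mul (hs.sub hS)).sub
      (hφ.continuous.comp continuous_fst).continuousOn
  · rw [hconv, mul_zero, Real.exp_zero, one_mul]
    exact h0 y hy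
  · obtain ⟨s', S', h1, h2, h3⟩ := hd y hy t ht (by
      by_contra! h
      exact hpos.not_ge ((hconv y t).2 h))
    have e1 : HasDerivAt (fun s : ℝ => Real.exp (-(C * s))) (Real.exp (-(C * t)) * (-(C * 1))) t :=
      (((hasDerivAt_id t).const_mul C).fun_neg).exp
    have e2 := deriv_nonneg_of_left_max ht
      ((e1.hasDerivWithinAt.fun_mul (h1.fun_sub h2)).sub_const (φ y)) htmax
    have e3 := hE.opL_le hl (hU hy) (φ := fun y => Real.exp (-(C * t)) * (s y t - S y t))
      (ψ := φ) (contDiff_const.mul ((hs2 t ht).sub (hS2 t ht))) hφ hmax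
    rw [opL_const_mul] at e3
    have e4 : opL (fun i j => a i j y) (fun i => b i y)
        (fderiv ℝ (fderiv ℝ fun y => s y t - S y t) y) (fderiv ℝ (fun y => s y t - S y t) y) =
        ell a b s y t - ell a b S y t := by
      have g1 := gradx_sub s S ((hs2 t ht).differentiable (by norm_num))
        ((hS2 t ht).differentiable (by norm_num))
      have g2 := hessx_sub s S (hs2 t ht) (hS2 t ht)
      change opL _ _ (hessx (fun y t => s y t - S y t) t y)
        (gradx (fun y t => s y t - S y t) t y) = _
      rw [g1, g2, opL_sub]
      rfl
    rw [e4] at e3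
    change _ ≤ ell a b (fun y _ => φ y) y t at e3
    have h4 := mul_lt_mul_of_pos_left h3 (Real.exp_pos (-(C * t)))
    rw [mul_add, ← mul_assoc, hexp, one_mul] at h4
    linarith

theorem ell_sub_const (u : Euc d → ℝ → ℝ) (ψ : ℝ → ℝ) (x : Euc d) (t : ℝ) :
    ell a b (fun x t => u x t - ψ t) x t = ell a b u x t := by
  have : gradx (fun x t => u x t - ψ t) t = gradx u t := by
    ext1 y
    exact fderiv_sub_const (ψ t)
  unfold ell hessx
  rw [this]

theorem EllipticOn.mem_Icc_of_truncated (hE : EllipticOn univ κ lam Λ a b) (hl : 0 ≤ lam)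
    (hΛ : 0 ≤ Λ) {z m : Euc d → ℝ → ℝ} {B A K : Euc d → ℝ} {c M p : ℝ} (hz : BddSmooth T z)
    (hT : 0 ≤ T)
    (hs : SolvesOn univ T a b (fun x t => B x * z x t - A x * max 0 (min (z x t) M) ^ p +
      K x * (m x t - z x t)) z) (hz0 : ∀ x, z x 0 = 0) (hB : ∀ x, B x ≤ c) (hA : ∀ x, 0 ≤ A x)
    (hK : ∀ x, 0 ≤ K x) (hM : 0 ≤ M) (hm : ∀ x t, m x t ∈ Icc 0 M) (hc : 0 ≤ c) (hp : 0 < p) :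
    ∀ x, ∀ t ∈ Icc 0 T, z x t ∈ Icc 0 (M * Real.exp (c * T)) := by
  obtain ⟨N, hN⟩ := hz.bdd
  intro x t ht
  constructor
  · have := hE.nonpos_of_subsolution hl hΛ (c := c) (K := N) (u := fun x t => -1 * z x t)
      (hz.const_mul (-1)).cont (fun t ht => (hz.const_mul (-1)).smooth t (Ioc_subset_Icc_self ht))
      (fun x t ht => by linarith [neg_abs_le (z x t), hN x t ht])
      (fun x => by rw [hz0, mul_zero]) (fun x t ht hpos => ⟨_, hs.const_mul (-1) x trivial t
        (Ioc_subset_Icc_self ht), ?_⟩) x t ht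
    · linarith
    · have h1 : max 0 (min (z x t) M) = 0 := max_eq_left ((min_le_left _ _).trans (by linarith))
      simp only [h1, Real.zero_rpow hp.ne', mul_zero, sub_zero]
      have h2 := mul_le_mul_of_nonneg_right (hB x) hpos.le
      have h3 := mul_nonneg (hK x) (show 0 ≤ m x t - z x t by linarith [(hm x t).1])
      linarith
  · have hψ : ∀ t, HasDerivAt (fun t => M * Real.exp (c * t)) (M * (Real.exp (c * t) * (c * 1))) t :=
      fun t => (((hasDerivAt_id t).const_mul c).exp).const_mul M
    have := hE.nonpos_of_subsolution hl hΛ (c := c) (K := N)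
      (u := fun x t => z x t - M * Real.exp (c * t))
      (hz.cont.sub (Continuous.continuousOn (by fun_prop)))
      (fun t ht => (hz.smooth t (Ioc_subset_Icc_self ht)).sub contDiff_const)
      (fun x t ht => by
        have : 0 ≤ M * Real.exp (c * t) := by positivity
        linarith [le_abs_self (z x t), hN x t ht])
      (fun x => by rw [hz0, mul_zero, Real.exp_zero]; linarith) (fun x t ht hpos => ⟨_,
        (hs x trivial t (Ioc_subset_Icc_self ht)).fun_sub (hψ t).hasDerivWithinAt, ?_⟩) x t ht
    · have h1 : M * Real.exp (c * t) ≤ M * Real.exp (c * T) := by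
        have := ht.2
        gcongr
      linarith
    · rw [ell_sub_const]
      have h0 : M ≤ M * Real.exp (c * t) :=
        le_mul_of_one_le_right hM (Real.one_le_exp (mul_nonneg hc ht.1.le))
      have h1 := mul_nonneg (hA x) (Real.rpow_nonneg (max_min_mem_Icc hM (z x t)).1 p)
      have h2 := mul_nonneg (hK x) (show 0 ≤ z x t - m x t by linarith [(hm x t).2])
      have h3 := mul_le_mul_of_nonneg_right (hB x) (show 0 ≤ z x t by linarith)
      linarith

theorem BddHolderOn.of_lipschitz {f : Euc d → ℝ} {N K : ℝ} (hκ : 0 ≤ κ) (hκ1 : κ ≤ 1)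
    (hN : ∀ x, |f x| ≤ N) (hK : ∀ x y, |f x - f y| ≤ K * ‖x - y‖) (h1 : 2 * N ≤ Λ) (h2 : K ≤ Λ) :
    BddHolderOn univ κ Λ f := by
  have h0 : 0 ≤ N := (abs_nonneg _).trans (hN 0)
  refine ⟨fun x _ => (hN x).trans (by linarith), fun x _ y _ => ?_⟩
  refine le_mul_rpow_of_le (by linarith) (norm_nonneg _) hκ hκ1
    ((hK x y).trans (mul_le_mul_of_nonneg_right h2 (norm_nonneg _))) ?_
  linarith [abs_sub (f x) (f y), hN x, hN y]

theorem BddHolderOn.weaken {U : Set (Euc d)} {f : Euc d → ℝ} {Λ' : ℝ} (hf : BddHolderOn U κ Λ f)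
    (h : Λ ≤ Λ') : BddHolderOn U κ Λ' f :=
  ⟨fun x hx => (hf.bound x hx).trans h, fun x hx y hy => (hf.holder x hx y hy).trans
    (mul_le_mul_of_nonneg_right h (Real.rpow_nonneg (norm_nonneg _) _))⟩

theorem lipschitzSource_of_bddHolderOn {B A K : Euc d → ℝ} {m : Euc d → ℝ → ℝ} {Φ : ℝ → ℝ}
    (hΛ : 0 ≤ Λ) (hB : BddHolderOn univ κ Λ B) (hA : BddHolderOn univ κ Λ A)
    (hK : BddHolderOn univ κ Λ K) (hmc : ∀ x, ContinuousOn (m x) (Icc 0 T))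
    (hm : ∀ t ∈ Icc 0 T, BddHolderOn univ κ Λ fun x => m x t) (hΦ : ∀ z, |Φ z| ≤ Λ)
    (hΦ' : ∀ z z', |Φ z - Φ z'| ≤ Λ * |z - z'|) :
    LipschitzSource κ T (3 * Λ ^ 2 + 2 * Λ)
      (fun x t z => B x * z - A x * Φ z + K x * (m x t - z)) where
  cont x z := continuousOn_const.add (continuousOn_const.mul ((hmc x).sub continuousOn_const))
  zero x t ht := by
    have h1 := mul_le_mul (hA.bound x trivial) (hΦ 0) (abs_nonneg _) hΛ
    have h2 := mul_le_mul (hK.bound x trivial) ((hm t ht).bound x trivial) (abs_nonneg _) hΛ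
    rw [← abs_mul] at h1 h2
    have h3 := abs_sub (K x * m x t) (A x * Φ 0)
    have e : B x * 0 - A x * Φ 0 + K x * (m x t - 0) = K x * m x t - A x * Φ 0 := by ring
    rw [e]
    nlinarith
  lip x t ht z z' := by
    have h1 := mul_le_mul_of_nonneg_right (hB.bound x trivial) (abs_nonneg (z - z'))
    have h2 := mul_le_mul (hA.bound x trivial) (hΦ' z z') (abs_nonneg _) hΛ
    have h3 := mul_le_mul_of_nonneg_right (hK.bound x trivial) (abs_nonneg (z - z'))
    rw [← abs_mul] at h1 h2 h3
    have e : B x * z - A x * Φ z + K x * (m x t - z) -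
        (B x * z' - A x * Φ z' + K x * (m x t - z')) =
        B x * (z - z') - A x * (Φ z - Φ z') - K x * (z - z') := by ring
    rw [e]
    have h4 := abs_sub (B x * (z - z') - A x * (Φ z - Φ z')) (K x * (z - z'))
    have h5 := abs_sub (B x * (z - z')) (A x * (Φ z - Φ z'))
    have h6 : 0 ≤ Λ ^ 2 * |z - z'| := by positivity
    nlinarith
  holder x y t ht z := by
    set r := ‖x - y‖ ^ κ
    have hr : 0 ≤ r := Real.rpow_nonneg (norm_nonneg _) _
    have h1 := mul_le_mul_of_nonneg_right (hB.holder x trivial y trivial) (abs_nonneg z)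
    have h2 := mul_le_mul (hA.holder x trivial y trivial) (hΦ z) (abs_nonneg _) (by positivity)
    have h3 := mul_le_mul (hK.holder x trivial y trivial)
      ((abs_sub (m x t) z).trans (add_le_add_left ((hm t ht).bound x trivial) _)) (abs_nonneg _)
      (by positivity)
    have h4 := mul_le_mul (hK.bound y trivial) ((hm t ht).holder x trivial y trivial) (abs_nonneg _)
      hΛ
    rw [← abs_mul] at h1 h2 h3 h4
    have e : B x * z - A x * Φ z + K x * (m x t - z) -
        (B y * z - A y * Φ z + K y * (m y t - z)) =
        ((B x - B y) * z - (A x - A y) * Φ z) +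
          ((K x - K y) * (m x t - z) + K y * (m x t - m y t)) := by ring
    rw [e]
    have h5 := abs_add_le ((B x - B y) * z - (A x - A y) * Φ z)
      ((K x - K y) * (m x t - z) + K y * (m x t - m y t))
    have h6 := abs_sub ((B x - B y) * z) ((A x - A y) * Φ z)
    have h7 := abs_add_le ((K x - K y) * (m x t - z)) (K y * (m x t - m y t))
    have h8 : 0 ≤ Λ ^ 2 * |z| * r := by positivity
    have h9 : 0 ≤ Λ * r := by positivity
    nlinarith

end TruncatedProblem

section Sandwich

open Filter Topology

variable {d : ℕ} {κ lam Λ R T C : ℝ} {a : Fin d → Fin d → Euc d → ℝ} {b : Fin d → Euc d → ℝ}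
  {β α : Euc d → ℝ} {p : ℝ}

theorem exists_barrier (hR : 0 < R) (hE : EllipticOn (Metric.closedBall 0 (R + 2)) κ lam Λ a b)
    {ε M : ℝ} (hε : 0 < ε) (hM : 0 ≤ M) :
    ∃ φ K : Euc d → ℝ, ∃ N : ℝ, 0 ≤ N ∧ ContDiff ℝ 2 φ ∧ (∀ x, ε ≤ φ x) ∧
      (∀ x ∈ Metric.ball 0 R, φ x = ε) ∧ (∀ x, ‖x‖ = R + 2 → M ≤ φ x) ∧ (∀ x, 0 ≤ K x) ∧
      (∀ x ∈ Metric.ball 0 R, K x = 0) ∧ (∀ x, |K x| ≤ N) ∧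
      (∀ x y, |K x - K y| ≤ N * ‖x - y‖) ∧
      ∀ x ∈ Metric.ball 0 (R + 2), ∀ t, 2 * ell a b (fun y _ => φ y) x t ≤ K x * φ x := by
  let χ : ContDiffBump (0 : Euc d) := ⟨R, R + 1, hR, by linarith⟩
  let ψ : ContDiffBump (0 : Euc d) := ⟨R + 1, R + 2, by linarith, by linarith⟩
  set φ : Euc d → ℝ := fun x => ε + M * (1 - ψ x) with hφ
  have hφ2 : ContDiff ℝ 2 φ := contDiff_const.add (contDiff_const.mul (contDiff_const.sub ψ.contDiff))
  have hφε : ∀ x, ε ≤ φ x := fun x =>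
    le_add_of_nonneg_right (mul_nonneg hM (sub_nonneg.2 ψ.le_one))
  have hc1 : Continuous (fderiv ℝ φ) := hφ2.continuous_fderiv (by norm_num)
  have hc2 : Continuous (fderiv ℝ (fderiv ℝ φ)) :=
    (hφ2.fderiv_right (m := 1) (by norm_num)).continuous_fderiv (by norm_num)
  obtain ⟨N1, hN1⟩ := (isCompact_closedBall (0 : Euc d) (R + 2)).exists_bound_of_continuousOn
    hc1.continuousOn
  obtain ⟨N2, hN2⟩ := (isCompact_closedBall (0 : Euc d) (R + 2)).exists_bound_of_continuousOn
    (E := Euc d →L[ℝ] Euc d →L[ℝ] ℝ) hc2.continuousOn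
  have h00 : (0 : Euc d) ∈ Metric.closedBall (0 : Euc d) (R + 2) :=
    Metric.mem_closedBall_self (by linarith)
  have hN10 : 0 ≤ N1 := (norm_nonneg _).trans (hN1 0 h00)
  have hN20 : 0 ≤ N2 := (norm_nonneg _).trans (hN2 0 h00)
  set k0 := d ^ 2 * |Λ| * N2 + d * |Λ| * N1 with hk0
  have hk00 : 0 ≤ k0 := by positivity
  have hell : ∀ x ∈ Metric.ball (0 : Euc d) (R + 2), ∀ t, ell a b (fun y _ => φ y) x t ≤ k0 :=
    fun x hx t => by
      have hx' := Metric.ball_subset_closedBall hx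
      refine (le_abs_self _).trans ((abs_opL_le (Λ := |Λ|) (Λ' := |Λ|)
        (fun i j => (hE.bound_a i j x hx').trans (le_abs_self Λ))
        (fun i => (hE.bound_b i x hx').trans (le_abs_self Λ)) _ _).trans ?_)
      exact add_le_add (mul_le_mul_of_nonneg_left (hN2 x hx') (by positivity))
        (mul_le_mul_of_nonneg_left (hN1 x hx') (by positivity))
  obtain ⟨L, hL⟩ := ContDiff.lipschitzWith_of_hasCompactSupport (𝕂 := ℝ) χ.hasCompactSupport
    (χ.contDiff (n := 1)) (by norm_num)
  set k := 2 * k0 / ε with hk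
  have hk1 : 0 ≤ k := by positivity
  refine ⟨φ, fun x => k * (1 - χ x), k * (1 + L), by positivity, hφ2, hφε, fun x hx => ?_,
    fun x hx => ?_, fun x => mul_nonneg hk1 (sub_nonneg.2 χ.le_one), fun x hx => ?_, fun x => ?_,
    fun x y => ?_, fun x hx t => ?_⟩
  · have : ψ x = 1 := ψ.one_of_mem_closedBall (Metric.closedBall_subset_closedBall (by
      change R ≤ R + 1; linarith) (Metric.ball_subset_closedBall hx))
    simp [hφ, this]
  · have : ψ x = 0 := ψ.zero_of_le_dist (by rw [dist_zero_right, hx])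
    simp [hφ, this, hε.le]
  · have : χ x = 1 := χ.one_of_mem_closedBall (Metric.ball_subset_closedBall hx)
    simp [this]
  · rw [abs_of_nonneg (mul_nonneg hk1 (sub_nonneg.2 χ.le_one))]
    refine mul_le_mul_of_nonneg_left ?_ hk1
    linarith [χ.nonneg (x := x), L.2]
  · have e : k * (1 - χ x) - k * (1 - χ y) = -(k * (χ x - χ y)) := by ring
    have h1 := hL.dist_le_mul x y
    rw [Real.dist_eq, dist_eq_norm] at h1
    rw [e, abs_neg, abs_mul, abs_of_nonneg hk1, mul_assoc]
    exact mul_le_mul_of_nonneg_left (h1.trans (by linarith [norm_nonneg (x - y)])) hk1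
  · rcases lt_or_ge ‖x‖ (R + 1) with h | h
    · have hev : φ =ᶠ[𝓝 x] fun _ => ε := by
        filter_upwards [ψ.eventuallyEq_one_of_mem_ball (mem_ball_zero_iff.2 h)] with y hy
        simp only [hφ, hy, Pi.one_apply, sub_self, mul_zero, add_zero]
      have hev' : fderiv ℝ φ =ᶠ[𝓝 x] fun _ => 0 := by
        filter_upwards [hev.eventuallyEq_nhds] with y hy
        rw [hy.fderiv_eq]
        simp
      have e : ell a b (fun y _ => φ y) x t = 0 := by
        have e1 : gradx (fun y (_ : ℝ) => φ y) t x = 0 := hev'.eq_of_nhds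
        have e2 : hessx (fun y (_ : ℝ) => φ y) t x = 0 := by
          refine (hev'.fderiv_eq (𝕜 := ℝ)).trans ?_
          simp
        unfold ell
        rw [e1, e2]
        simp [opL]
      rw [e, mul_zero]
      exact mul_nonneg (mul_nonneg hk1 (sub_nonneg.2 χ.le_one)) (hε.le.trans (hφε x))
    · have : χ x = 0 := χ.zero_of_le_dist (by rw [dist_zero_right]; exact h)
      simp only [this, sub_zero, mul_one]
      have h1 := mul_le_mul_of_nonneg_left (hφε x) hk1
      have h2 : k * ε = 2 * k0 := by rw [hk]; field_simp
      linarith [hell x hx t]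

/-- An ordered pair of a nonnegative subsolution and a supersolution of
`u_t = Lu + βu - αu^p` on the whole space, the former with zero initial values. -/
structure SubSuper (a : Fin d → Fin d → Euc d → ℝ) (b : Fin d → Euc d → ℝ) (β α : Euc d → ℝ)
    (p : ℝ) (w v : Euc d → ℝ → ℝ) : Prop where
  sub_cont : ContinuousOn (fun q : Euc d × ℝ => w q.1 q.2) (univ ×ˢ Ici 0)
  super_cont : ContinuousOn (fun q : Euc d × ℝ => v q.1 q.2) (univ ×ˢ Ici 0)
  sub_smooth : ∀ t, 0 < t → ContDiff ℝ 2 fun x => w x t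
  super_smooth : ∀ t, 0 < t → ContDiff ℝ 2 fun x => v x t
  nonneg : ∀ x t, 0 ≤ t → 0 ≤ w x t
  le : ∀ x t, 0 ≤ t → w x t ≤ v x t
  sub_zero : ∀ x, w x 0 = 0
  sub_deriv : ∀ x t, 0 < t → ∃ w', HasDerivAt (w x) w' t ∧
    w' ≤ ell a b w x t + β x * w x t - α x * w x t ^ p
  super_deriv : ∀ x t, 0 < t → ∃ vt, HasDerivAt (v x) vt t ∧
    ell a b v x t + β x * v x t - α x * v x t ^ p ≤ vt

/-- Solutions on large balls, trapped between the sub- and the supersolution up to a small error. -/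
theorem SubSuper.exists_approx {w v : Euc d → ℝ → ℝ} (h : SubSuper a b β α p w v)
    (ha : ∀ i j, LocHolder (a i j)) (hb : ∀ i, LocHolder (b i))
    (hsymm : ∀ i j x, a i j x = a j i x)
    (hell : ∀ x ν : Euc d, ν ≠ 0 → 0 < ∑ i, ∑ j, a i j x * ν i * ν j)
    (hβ : LocHolder β) (hα : LocHolder α) (hα0 : ∀ x, 0 ≤ α x) {c : ℝ} (hc : 0 ≤ c)
    (hβc : ∀ x, β x ≤ c) (hp : 1 ≤ p) (hR : 0 < R) {ε : ℝ} (hε : 0 < ε) (hε1 : ε ≤ 1) :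
    ∃ κ N : ℝ, ∃ z : Euc d → ℝ → ℝ, 0 < κ ∧ 0 ≤ N ∧ HolderSolOn univ κ R N z ∧
      SolvesOn (Metric.ball 0 R) R a b (fun x t => β x * z x t - α x * z x t ^ p) z ∧
      (∀ x, z x 0 = 0) ∧ ∀ x ∈ Metric.ball 0 R, ∀ t ∈ Icc 0 R,
        0 ≤ z x t ∧ w x t - ε ≤ z x t ∧ z x t ≤ v x t + ε := by
  obtain ⟨κ, κ0, lam, Λ, hκ', hκlt, hκ1, hl, hΛ, hE, hBβ, hBα⟩ :=
    exists_local_bounds ha hb hsymm hell hβ hα (R + 2)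
  obtain ⟨P, hP1, hP2, hP3⟩ := exists_retraction (0 : Euc d) (show 0 ≤ R + 2 by linarith)
  have hκ0 : 0 < κ0 := hκ'.trans hκlt
  have hprod : ∀ {u : Euc d → ℝ → ℝ}, ContinuousOn (fun q : Euc d × ℝ => u q.1 q.2)
      (univ ×ˢ Ici 0) → ContinuousOn (fun q : Euc d × ℝ => u q.1 q.2)
      (Metric.closedBall 0 (R + 2) ×ˢ Icc 0 R) := fun hu =>
    hu.mono (prod_mono (subset_univ _) fun t ht => ht.1)
  obtain ⟨M', hM'⟩ := ((isCompact_closedBall (0 : Euc d) (R + 2)).prod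
    (isCompact_Icc (a := (0 : ℝ)) (b := R))).exists_bound_of_continuousOn (hprod h.super_cont)
  have h00 : (0 : Euc d) ∈ Metric.closedBall (0 : Euc d) (R + 2) :=
    Metric.mem_closedBall_self (by linarith)
  set M := M' + 1 with hM
  have hM1 : 1 ≤ M := by
    have := (norm_nonneg _).trans (hM' (0, 0) ⟨h00, le_rfl, hR.le⟩)
    linarith
  have hM0 : 0 ≤ M := by linarith
  have hvM : ∀ x ∈ Metric.closedBall (0 : Euc d) (R + 2), ∀ t ∈ Icc 0 R, v x t + 1 ≤ M :=
    fun x hx t ht => by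
      have := (le_abs_self _).trans (hM' (x, t) ⟨hx, ht⟩)
      simp only at this
      linarith
  set C := c + 1 with hC
  have hC0 : 0 ≤ C := by linarith
  set ε' := ε * Real.exp (-(C * R)) with hε'
  have hε'0 : 0 < ε' := by positivity
  have hεε' : ∀ t ∈ Icc 0 R, Real.exp (C * t) * ε' ≤ ε := fun t ht => by
    have : Real.exp (C * t) * Real.exp (-(C * R)) ≤ 1 := by
      rw [← Real.exp_add]
      exact Real.exp_le_one_iff.2 (by nlinarith [ht.2])
    rw [hε']
    nlinarith
  obtain ⟨m, Km, hKm, hmc, hmM, hmL, hmw⟩ := exists_lipschitz_approx (w := w) (R := R + 2) (T := R)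
    (M := M) (ε := ε' / 2) (by linarith) hR.le (by positivity) (hprod h.sub_cont)
    fun x hx t ht => ⟨h.nonneg x t ht.1, by linarith [h.le x t ht.1, hvM x hx t ht]⟩
  obtain ⟨φ, K, N, hN, hφ2, hφε, hφR, hφM, hK0, hKR, hKN, hKL, hLφ⟩ := exists_barrier hR hE hε'0
    (M := M * Real.exp (c * R)) (by positivity)
  have hΦ : ∀ z : ℝ, 0 ≤ max 0 (min z M) ^ p ∧ max 0 (min z M) ^ p ≤ M ^ p := fun z =>
    ⟨Real.rpow_nonneg (max_min_mem_Icc hM0 z).1 p, Real.rpow_le_rpow (max_min_mem_Icc hM0 z).1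
      (max_min_mem_Icc hM0 z).2 (by linarith)⟩
  have hMp : 0 ≤ M ^ p := Real.rpow_nonneg hM0 p
  have hMp1 : 0 ≤ p * M ^ (p - 1) := mul_nonneg (by linarith) (Real.rpow_nonneg hM0 _)
  set Γ := Λ + 2 * N + (2 * M + Km) + (M ^ p + p * M ^ (p - 1)) with hΓ
  have hΛΓ : Λ ≤ Γ := by linarith
  have hG := lipschitzSource_of_bddHolderOn (T := R) (Λ := Γ) (κ := κ) (m := m)
    (Φ := fun z => max 0 (min z M) ^ p) (B := fun x => β (P x)) (A := fun x => α (P x)) (K := K)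
    (by positivity) ?_ ?_ ?_ hmc ?_ ?_ ?_
  rotate_left
  · exact (hBβ.comp hκ'.le hΛ hP1 hP3).weaken hΛΓ
  · exact (hBα.comp hκ'.le hΛ hP1 hP3).weaken hΛΓ
  · exact BddHolderOn.of_lipschitz hκ'.le (hκlt.le.trans hκ1) hKN hKL (by linarith) (by linarith)
  · intro t ht
    exact BddHolderOn.of_lipschitz hκ'.le (hκlt.le.trans hκ1) (N := M)
      (fun x => by rw [abs_of_nonneg (hmM x t).1]; exact (hmM x t).2)
      (fun x y => hmL x y t ht) (by linarith) (by linarith)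
  · intro z
    rw [abs_of_nonneg (hΦ z).1]
    linarith [(hΦ z).2]
  · intro z z'
    refine (abs_rpow_sub_rpow_le hp (max_min_mem_Icc hM0 z) (max_min_mem_Icc hM0 z')).trans ?_
    exact mul_le_mul (by linarith) (abs_clamp_sub_le M z z') (abs_nonneg _) (by linarith)
  have hE' := hE.comp hκ0.le hΛ hP1 hP3
  obtain ⟨N', hN', z, hz1, hz2, hz3⟩ := exists_semilinear_solution hE' hl hΛ hκ' hκlt hκ1 hR.le
    (by positivity) hG
  have hz := hz1.bddSmooth
  have hzI := hE'.mem_Icc_of_truncated hl.le hΛ hz hR.le hz2 hz3 (fun x => hβc (P x))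
    (fun x => hα0 (P x)) hK0 hM0 hmM hc (by linarith)
  have hzc : ContinuousOn (fun q : Euc d × ℝ => z q.1 q.2)
      (Metric.closedBall 0 (R + 2) ×ˢ Icc 0 R) := hz.cont.mono (prod_mono (subset_univ _) subset_rfl)
  have hzd : ∀ x ∈ Metric.closedBall (0 : Euc d) (R + 2), ∀ t ∈ Icc 0 R, HasDerivWithinAt (z x)
      (ell a b z x t + (β x * z x t - α x * max 0 (min (z x t) M) ^ p + K x * (m x t - z x t)))
      (Icc 0 R) t := fun x hx t ht => by
    have := hz2 x trivial t ht
    simp only [ell, hP2 x hx] at this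
    exact this
  have hφe : ∀ x, ∀ t ∈ Icc 0 R, φ x ≤ Real.exp (C * t) * φ x := fun x t ht =>
    le_mul_of_one_le_left (hε'0.le.trans (hφε x)) (Real.one_le_exp (mul_nonneg hC0 ht.1))
  have hbar : ∀ x ∈ Metric.ball (0 : Euc d) (R + 2), ∀ t, ∀ X, X ≤ -(Real.exp (C * t) * φ x) / 2 →
      K x * X + Real.exp (C * t) * ell a b (fun y _ => φ y) x t ≤ 0 := fun x hx t X hX => by
    have h1 := mul_le_mul_of_nonneg_left hX (hK0 x)
    have h2 := mul_le_mul_of_nonneg_left (hLφ x hx t) (Real.exp_pos (C * t)).le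
    linarith
  have hzv := hE.le_add_of_strict_subsolution (T := R) (C := C) hl.le Metric.ball_subset_closedBall
    hφ2 hzc (hprod h.super_cont) (fun t ht => hz.smooth t (Ioc_subset_Icc_self ht))
    (fun t ht => h.super_smooth t ht.1) (fun x hx => ?_) (fun x hx t ht => ?_)
    (fun x hx t ht hlt => ?_)
  have hwz := hE.le_add_of_strict_subsolution (T := R) (C := C) hl.le Metric.ball_subset_closedBall
    hφ2 (hprod h.sub_cont) hzc (fun t ht => h.sub_smooth t ht.1)
    (fun t ht => hz.smooth t (Ioc_subset_Icc_self ht)) (fun x hx => ?_) (fun x hx t ht => ?_)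
    (fun x hx t ht hlt => ?_)
  · have hsub : ∀ x ∈ Metric.ball (0 : Euc d) R, x ∈ Metric.closedBall (0 : Euc d) (R + 2) :=
      fun x hx => Metric.ball_subset_closedBall (Metric.ball_subset_ball (by linarith) hx)
    have hfin : ∀ x ∈ Metric.ball 0 R, ∀ t ∈ Icc 0 R,
        0 ≤ z x t ∧ w x t - ε ≤ z x t ∧ z x t ≤ v x t + ε := fun x hx t ht => by
      have h1 := hzv x (hsub x hx) t ht
      have h2 := hwz x (hsub x hx) t ht
      rw [hφR x hx] at h1 h2
      have h3 := hεε' t ht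
      exact ⟨(hzI x t ht).1, by linarith, by linarith⟩
    refine ⟨κ, N', z, hκ', hN', hz1, fun x hx t ht => ?_, hz3, hfin⟩
    refine (hzd x (hsub x hx) t ht).congr_deriv ?_
    rw [max_min_eq_self ⟨(hfin x hx t ht).1, by linarith [hvM x (hsub x hx) t ht,
      (hfin x hx t ht).2.2]⟩, hKR x hx, zero_mul, add_zero]
  · rw [h.sub_zero, hz3, zero_add]
    exact hε'0.le.trans (hφε x)
  · have h1 := hvM x (mem_closedBall_zero_iff.2 hx.le) t ht
    have h2 := h.le x t ht.1
    have h3 : M ≤ M * Real.exp (c * R) :=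
      le_mul_of_one_le_right hM0 (Real.one_le_exp (mul_nonneg hc hR.le))
    linarith [hφM x hx, hφe x t ht, (hzI x t ht).1]
  · have hx' := Metric.ball_subset_closedBall hx
    have ht' := Ioc_subset_Icc_self ht
    obtain ⟨w', hw', hwle⟩ := h.sub_deriv x t ht.1
    refine ⟨w', _, hw'.hasDerivWithinAt, hzd x hx' t ht', ?_⟩
    have e0 := hφe x t ht'
    have e1 := hφε x
    have hz0 := (hzI x t ht').1
    have e2 : z x t < w x t := by linarith
    have e3 : w x t ≤ M := by linarith [h.le x t ht'.1, hvM x hx' t ht']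
    rw [max_min_eq_self ⟨hz0, by linarith⟩]
    have e4 := mul_le_mul_of_nonneg_left (Real.rpow_le_rpow hz0 e2.le (by linarith : 0 ≤ p)) (hα0 x)
    have e5 := mul_le_mul_of_nonneg_right (hβc x) (sub_nonneg.2 e2.le)
    have e6 := (abs_le.1 (hmw x hx' t ht')).1
    have e7 := hbar x hx t (-(m x t - z x t)) (by linarith)
    rw [hC]
    linarith
  · rw [hz3]
    exact add_nonneg ((h.nonneg x 0 le_rfl).trans (h.le x 0 le_rfl)) (hε'0.le.trans (hφε x))
  · have h1 := (h.nonneg x t ht.1).trans (h.le x t ht.1)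
    linarith [hφM x hx, hφe x t ht, (hzI x t ht).2]
  · have hx' := Metric.ball_subset_closedBall hx
    have ht' := Ioc_subset_Icc_self ht
    obtain ⟨v', hv', hvle⟩ := h.super_deriv x t ht.1
    refine ⟨_, v', hzd x hx' t ht', hv'.hasDerivWithinAt, ?_⟩
    have e0 := hφe x t ht'
    have e1 := hφε x
    have hv0 := (h.nonneg x t ht'.1).trans (h.le x t ht'.1)
    have e2 : v x t < z x t := by linarith
    have e3 : v x t ≤ max 0 (min (z x t) M) :=
      le_max_of_le_right (le_min e2.le (by linarith [hvM x hx' t ht']))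
    have e4 := mul_le_mul_of_nonneg_left (Real.rpow_le_rpow hv0 e3 (by linarith : 0 ≤ p)) (hα0 x)
    have e5 := mul_le_mul_of_nonneg_right (hβc x) (sub_nonneg.2 e2.le)
    have e6 := (abs_le.1 (hmw x hx' t ht')).2
    have e7 := hbar x hx t (m x t - z x t) (by linarith [h.le x t ht'.1])
    rw [hC]
    linarith

end Sandwich

section Limit

open Filter Topology

variable {d : ℕ} {κ N R : ℝ} {a : Fin d → Fin d → Euc d → ℝ} {b : Fin d → Euc d → ℝ}
  {β α : Euc d → ℝ} {p : ℝ}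

theorem HolderSolOn.restrict_time {U : Set (Euc d)} {T T' : ℝ} {u : Euc d → ℝ → ℝ}
    (hu : HolderSolOn U κ T N u) (h : T' ≤ T) : HolderSolOn U κ T' N u :=
  have hs : Icc (0 : ℝ) T' ⊆ Icc 0 T := Icc_subset_Icc_right h
  { smooth := fun t ht => hu.smooth t (hs ht)
    bound := fun x hx t ht => hu.bound x hx t (hs ht)
    bound1 := fun x hx t ht => hu.bound1 x hx t (hs ht)
    bound2 := fun x hx t ht => hu.bound2 x hx t (hs ht)
    holder2 := fun x hx y hy t ht => hu.holder2 x hx y hy t (hs ht)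
    lip := fun x hx s hs' t ht => hu.lip x hx s (hs hs') t (hs ht) }

theorem SolvesOn.restrict {U V : Set (Euc d)} {T T' : ℝ} {f u : Euc d → ℝ → ℝ}
    (hu : SolvesOn U T a b f u) (h : T' ≤ T) (hV : V ⊆ U) : SolvesOn V T' a b f u :=
  fun x hx t ht => (hu x (hV hx) t ⟨ht.1, ht.2.trans h⟩).mono (Icc_subset_Icc_right h)

theorem HolderSolOn.abs_sub_le_of_convex {U : Set (Euc d)} {T : ℝ} {u : Euc d → ℝ → ℝ}
    (hu : HolderSolOn U κ T N u) (hU : Convex ℝ U) {x y : Euc d} (hx : x ∈ U) (hy : y ∈ U) {t : ℝ}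
    (ht : t ∈ Icc 0 T) : |u x t - u y t| ≤ N * ‖x - y‖ :=
  hU.norm_image_sub_le_of_norm_fderiv_le (𝕜 := ℝ) (f := fun x => u x t)
    (fun z _ => ((hu.smooth t ht).differentiable (by norm_num)) z)
    (fun z hz => hu.bound1 z hz t ht) hy hx

/-- Nonnegative classical solutions of `u_t = Lu + βu - αu^p` with zero initial values. -/
structure ClassicalSol (a : Fin d → Fin d → Euc d → ℝ) (b : Fin d → Euc d → ℝ) (β α : Euc d → ℝ)
    (p : ℝ) (u : Euc d → ℝ → ℝ) : Prop where
  cont : ContinuousOn (fun q : Euc d × ℝ => u q.1 q.2) (univ ×ˢ Ici 0)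
  nonneg : ∀ x t, 0 ≤ t → 0 ≤ u x t
  smooth : ∀ t, 0 < t → ContDiff ℝ 2 fun x => u x t
  smooth_time : ∀ x, ContDiffOn ℝ 1 (u x) (Ioi 0)
  deriv : ∀ x t, 0 < t → HasDerivAt (u x) (ell a b u x t + β x * u x t - α x * u x t ^ p) t
  init : ∀ x, u x 0 = 0

theorem ell_eq_pd {u : Euc d → ℝ → ℝ} {t : ℝ} (hu : ContDiff ℝ 2 fun x => u x t) (x : Euc d) :
    ell a b u x t = (1 / 2) * ∑ i, ∑ j, a i j x * pd i (pd j fun y => u y t) x +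
      ∑ i, b i x * pd i (fun y => u y t) x := by
  have h : ∀ i j, pd i (pd j fun y => u y t) x = hessx u t x (ebas i) (ebas j) := fun i j => by
    have h1 : HasFDerivAt (gradx u t) (hessx u t x) x :=
      ((hu.fderiv_right (m := 1) (by norm_num)).differentiable (by norm_num) x).hasFDerivAt
    have h2 : HasFDerivAt (fun y => gradx u t y (ebas j))
        ((ContinuousLinearMap.apply ℝ ℝ (ebas j)).comp (hessx u t x)) x :=
      (ContinuousLinearMap.apply ℝ ℝ (ebas j)).hasFDerivAt.comp x h1
    change fderiv ℝ (fun y => gradx u t y (ebas j)) x (ebas i) = _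
    rw [h2.fderiv]
    rfl
  simp only [h]
  rfl

theorem uniqueZeroSol_iff :
    UniqueZeroSol a b β α p ↔ ∀ u, ClassicalSol a b β α p u → ∀ x t, 0 ≤ t → u x t = 0 := by
  refine ⟨fun h u hu => h u hu.cont hu.nonneg hu.smooth hu.smooth_time (fun x t ht => ?_) hu.init,
    fun h u h1 h2 h3 h4 h5 h6 => h u ⟨h1, h2, h3, h4, fun x t ht => ?_, h6⟩⟩
  · rw [← ell_eq_pd (hu.smooth t ht)]
    exact (hu.deriv x t ht).deriv
  · have h7 : DifferentiableAt ℝ (u x) t :=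
      ((h4 x).differentiableOn (by norm_num)).differentiableAt (Ioi_mem_nhds ht)
    rw [ell_eq_pd (h3 t ht), ← h5 x t ht]
    exact h7.hasDerivAt

theorem abs_reaction_sub_le (hp : 1 ≤ p) {M z z' : ℝ} (hz : z ∈ Icc 0 M) (hz' : z' ∈ Icc 0 M)
    (B A : ℝ) : |(B * z - A * z ^ p) - (B * z' - A * z' ^ p)| ≤
      (|B| + |A| * (p * M ^ (p - 1))) * |z - z'| := by
  have e : (B * z - A * z ^ p) - (B * z' - A * z' ^ p) = B * (z - z') - A * (z ^ p - z' ^ p) := by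
    ring
  rw [e]
  refine (abs_sub _ _).trans ?_
  rw [abs_mul, abs_mul, add_mul, mul_assoc |A|]
  exact add_le_add le_rfl (mul_le_mul_of_nonneg_left (abs_rpow_sub_rpow_le hp hz hz')
    (abs_nonneg A))

theorem ClassicalSol.of_ultralimit (l : Ultrafilter ℕ) {v : ℕ → Euc d → ℝ → ℝ}
    {z : Euc d → ℝ → ℝ} (hp : 1 ≤ p) (hv0 : ∀ n x, v n x 0 = 0)
    (hvz : ∀ x t, 0 ≤ t → Tendsto (fun n => v n x t) l (𝓝 (z x t)))
    (key : ∀ R : ℝ, 0 < R → ∃ κ N : ℝ, 0 < κ ∧ 0 ≤ N ∧ ∀ c ∈ Metric.ball (0 : Euc d) R,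
      ∀ᶠ n in (l : Filter ℕ), (∀ x ∈ Metric.ball c (1 / 2), ∀ t ∈ Icc 0 R, 0 ≤ v n x t) ∧
        HolderSolOn (Metric.ball c (1 / 2)) κ R N (v n) ∧
        SolvesOn (Metric.ball c (1 / 2)) R a b
          (fun x t => β x * v n x t - α x * v n x t ^ p) (v n)) :
    ClassicalSol a b β α p z := by
  have main : ∀ R : ℝ, 0 < R → ∃ κ N : ℝ, 0 < κ ∧ 0 ≤ N ∧ ∀ c ∈ Metric.ball (0 : Euc d) R,
      (∀ᶠ n in (l : Filter ℕ), HolderSolOn (Metric.ball c (1 / 2)) κ R N (v n)) ∧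
      (∀ x ∈ Metric.ball c (1 / 2), ∀ t ∈ Icc 0 R, 0 ≤ z x t) ∧
      (∀ x ∈ Metric.ball c (1 / 2), ∀ t ∈ Icc 0 R, ContDiffAt ℝ 2 (fun y => z y t) x ∧
        Tendsto (fun n => gradx (v n) t x) l (𝓝 (gradx z t x)) ∧
        Tendsto (fun n => hessx (v n) t x) l (𝓝 (hessx z t x))) ∧
      SolvesOn (Metric.ball c (1 / 2)) R a b (fun x t => β x * z x t - α x * z x t ^ p) z := by
    intro R hR
    obtain ⟨κ, N, hκ, hN, h⟩ := key R hR
    refine ⟨κ, N, hκ, hN, fun c hc => ?_⟩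
    have hvz' : ∀ x ∈ Metric.ball c (1 / 2), ∀ t ∈ Icc 0 R,
        Tendsto (fun n => v n x t) l (𝓝 (z x t)) := fun x _ t ht => hvz x t ht.1
    have hsol := ultralimit_solves l (κ := κ) (T := R) (N := N) (v := v) (u := z)
      (f := fun n x t => β x * v n x t - α x * v n x t ^ p)
      (g := fun x t => β x * z x t - α x * z x t ^ p) (a := a) (b := b) Metric.isOpen_ball
      (convex_ball c (1 / 2)) hκ hN ((h c hc).mono fun n hn => hn.2) hvz'
      (fun x hx t ht => ((hvz' x hx t ht).const_mul _).sub
        (((hvz' x hx t ht).rpow_const (Or.inr (by linarith))).const_mul _))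
      (fun x hx t ht ε hε => ?_)
    · exact ⟨(h c hc).mono fun n hn => hn.2.1, fun x hx t ht => ge_of_tendsto (hvz' x hx t ht)
        ((h c hc).mono fun n hn => hn.1 x hx t ht), hsol⟩
    · set Γ := (|β x| + |α x| * (p * N ^ (p - 1))) * N with hΓ
      have hΓ0 : 0 ≤ Γ := by
        have := Real.rpow_nonneg hN (p - 1)
        positivity
      refine ⟨ε / (Γ + 1), by positivity, (h c hc).mono fun n hn s hs hst => ?_⟩
      have hI : ∀ s ∈ Icc 0 R, v n x s ∈ Icc 0 N := fun s hs =>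
        ⟨hn.1 x hx s hs, (le_abs_self _).trans (hn.2.1.bound x hx s hs)⟩
      refine (abs_reaction_sub_le hp (hI s hs) (hI t ht) (β x) (α x)).trans ?_
      refine (mul_le_mul_of_nonneg_left (hn.2.1.lip x hx s hs t ht) ?_).trans ?_
      · have := Real.rpow_nonneg hN (p - 1)
        positivity
      · rw [lt_div_iff₀ (by positivity)] at hst
        rw [← mul_assoc, ← hΓ]
        nlinarith [abs_nonneg (s - t)]
  have hpt : ∀ (x : Euc d) (t : ℝ), ∃ R > 0, t < R ∧ x ∈ Metric.ball (0 : Euc d) R := fun x t =>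
    ⟨‖x‖ + |t| + 1, by positivity, by linarith [le_abs_self t, norm_nonneg x],
      mem_ball_zero_iff.2 (by linarith [abs_nonneg t])⟩
  have hself : ∀ x : Euc d, x ∈ Metric.ball x (1 / 2) := fun x =>
    Metric.mem_ball_self (by norm_num)
  have hsmooth : ∀ t, 0 ≤ t → ContDiff ℝ 2 fun x => z x t := fun t ht =>
    contDiff_iff_contDiffAt.2 fun x => by
      obtain ⟨R, hR, htR, hx⟩ := hpt x t
      obtain ⟨κ, N, -, -, h⟩ := main R hR
      exact ((h x hx).2.2.1 x (hself x) t ⟨ht, htR.le⟩).1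
  have hloc : ∀ (x : Euc d) (t : ℝ), ∃ κ N R : ℝ, 0 < κ ∧ 0 ≤ N ∧ t < R ∧
      (∀ t ∈ Icc 0 R, 0 ≤ z x t) ∧ HolderSolOn (Metric.ball x (1 / 2)) κ R N z ∧
      SolvesOn (Metric.ball x (1 / 2)) R a b (fun x t => β x * z x t - α x * z x t ^ p) z := by
    intro x t
    obtain ⟨R, hR, htR, hx⟩ := hpt x t
    obtain ⟨κ, N, hκ, hN, h⟩ := main R hR
    obtain ⟨h1, h2, h3, h4⟩ := h x hx
    exact ⟨κ, N, R, hκ, hN, htR, h2 x (hself x), HolderSolOn.of_ultralimit_on l h1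
      (fun x _ t ht => hvz x t ht.1) (fun t ht => hsmooth t ht.1) (fun x hx t ht => (h3 x hx t ht).2),
      h4⟩
  have hderiv : ∀ x t, 0 < t →
      HasDerivAt (z x) (ell a b z x t + β x * z x t - α x * z x t ^ p) t := fun x t ht => by
    obtain ⟨κ, N, R, -, -, htR, -, -, h⟩ := hloc x t
    rw [add_sub_assoc]
    exact (h x (hself x) t ⟨ht.le, htR.le⟩).hasDerivAt (Icc_mem_nhds ht htR)
  refine ⟨?_, fun x t ht => ?_, fun t ht => hsmooth t ht.le, fun x => ?_, hderiv, fun x => ?_⟩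
  · rintro ⟨x, t⟩ ⟨-, ht⟩
    obtain ⟨κ, N, R, -, -, htR, -, h, -⟩ := hloc x t
    have h0 : Tendsto (fun q : Euc d × ℝ => N * ‖q.1 - x‖ + N * |q.2 - t|) (𝓝 (x, t)) (𝓝 0) := by
      have : Continuous (fun q : Euc d × ℝ => N * ‖q.1 - x‖ + N * |q.2 - t|) := by fun_prop
      simpa using this.tendsto (x, t)
    refine tendsto_iff_norm_sub_tendsto_zero.2 (squeeze_zero' (Eventually.of_forall fun _ =>
      norm_nonneg _) ?_ (h0.mono_left nhdsWithin_le_nhds))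
    filter_upwards [self_mem_nhdsWithin, mem_nhdsWithin_of_mem_nhds (prod_mem_nhds
      (Metric.ball_mem_nhds x (by norm_num : (0 : ℝ) < 1 / 2)) (Iio_mem_nhds htR))] with q hq hq'
    have hq2 : q.2 ∈ Icc 0 R := ⟨hq.2, hq'.2.le⟩
    have h1 := h.abs_sub_le_of_convex (convex_ball x (1 / 2)) hq'.1 (hself x) hq2
    have h2 := h.lip x (hself x) q.2 hq2 t ⟨ht, htR.le⟩
    calc ‖z q.1 q.2 - z x t‖ ≤ |z q.1 q.2 - z x q.2| + |z x q.2 - z x t| :=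
        _root_.abs_sub_le _ _ _
      _ ≤ _ := add_le_add h1 h2
  · obtain ⟨κ, N, R, -, -, htR, h, -⟩ := hloc x t
    exact h t ⟨ht, htR.le⟩
  · have hd : DifferentiableOn ℝ (z x) (Ioi 0) := fun t ht =>
      (hderiv x t ht).differentiableAt.differentiableWithinAt
    refine (contDiffOn_one_iff_derivWithin isOpen_Ioi.uniqueDiffOn).2 ⟨hd, ?_⟩
    refine ContinuousOn.congr (f := fun t => ell a b z x t + β x * z x t - α x * z x t ^ p) ?_
      fun t ht => (derivWithin_of_isOpen isOpen_Ioi ht).trans (hderiv x t ht).deriv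
    have hell : ContinuousOn (ell a b z x) (Ioi 0) := fun t ht => by
      obtain ⟨κ, N, R, hκ, hN, htR, -, h, -⟩ := hloc x t
      exact ((h.continuousOn_ell Metric.isOpen_ball hκ hN (hself x)).continuousAt
        (Icc_mem_nhds ht htR)).continuousWithinAt
    exact (hell.add (continuousOn_const.mul hd.continuousOn)).sub (continuousOn_const.mul
      (hd.continuousOn.rpow_const fun t _ => Or.inr (by linarith)))
  · refine tendsto_nhds_unique (hvz x 0 le_rfl) ?_
    simp only [hv0]
    exact tendsto_const_nhds

end Limit

section Comparison

open Filter Topology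

variable {d : ℕ} {R : ℝ} {a : Fin d → Fin d → Euc d → ℝ} {b : Fin d → Euc d → ℝ}
  {β α : Euc d → ℝ} {p : ℝ}

theorem BddHolderOn.semiSource {B : Set (Euc d)} {κ Λ T M : ℝ} {z : Euc d → ℝ → ℝ}
    (hβ : BddHolderOn B κ Λ β) (hα : BddHolderOn B κ Λ α) (hp : 1 ≤ p) (hM : 0 ≤ M) (hΛ : 0 ≤ Λ)
    (hz : ∀ x ∈ B, ContinuousOn (z x) (Icc 0 T)) (hzM : ∀ x ∈ B, ∀ t ∈ Icc 0 T, z x t ∈ Icc 0 M) :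
    SemiSource B κ T (Λ * M + Λ * M ^ p) (Λ + Λ * (p * M ^ (p - 1)))
      (fun x t => β x * z x t - α x * z x t ^ p) z := by
  have hpow : ∀ x ∈ B, ∀ t ∈ Icc 0 T, |z x t ^ p| ≤ M ^ p := fun x hx t ht => by
    rw [abs_of_nonneg (Real.rpow_nonneg (hzM x hx t ht).1 p)]
    exact Real.rpow_le_rpow (hzM x hx t ht).1 (hzM x hx t ht).2 (by linarith)
  have habs : ∀ x ∈ B, ∀ t ∈ Icc 0 T, |z x t| ≤ M := fun x hx t ht => by
    rw [abs_of_nonneg (hzM x hx t ht).1]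
    exact (hzM x hx t ht).2
  have hM' : 0 ≤ p * M ^ (p - 1) := mul_nonneg (by linarith) (Real.rpow_nonneg hM _)
  refine ⟨fun x hx => ((hz x hx).const_smul (β x)).sub (continuousOn_const.mul
    ((hz x hx).rpow_const fun t _ => Or.inr (by linarith))), fun x hx t ht => ?_,
    fun x hx y hy t ht => ?_⟩
  · refine (abs_sub _ _).trans ?_
    rw [abs_mul, abs_mul]
    exact add_le_add
      (mul_le_mul (hβ.bound x hx) (habs x hx t ht) (abs_nonneg _) hΛ)
      (mul_le_mul (hα.bound x hx) (hpow x hx t ht) (abs_nonneg _) hΛ)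
  · have e : β x * z x t - α x * z x t ^ p - (β y * z y t - α y * z y t ^ p) =
        ((β x - β y) * z x t - (α x - α y) * z x t ^ p) +
        ((β y * z x t - α y * z x t ^ p) - (β y * z y t - α y * z y t ^ p)) := by ring
    rw [e]
    have hr := mul_nonneg hΛ (Real.rpow_nonneg (norm_nonneg (x - y)) κ)
    refine (abs_add_le _ _).trans (add_le_add ((abs_sub _ _).trans ?_)
      ((abs_reaction_sub_le hp (hzM x hx t ht) (hzM y hy t ht) (β y) (α y)).trans ?_))
    · rw [abs_mul, abs_mul]
      have h1 := mul_le_mul (hβ.holder x hx y hy) (habs x hx t ht) (abs_nonneg _) hr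
      have h2 := mul_le_mul (hα.holder x hx y hy) (hpow x hx t ht) (abs_nonneg _) hr
      linarith
    · exact mul_le_mul_of_nonneg_right (add_le_add (hβ.bound y hy)
        (mul_le_mul_of_nonneg_right (hα.bound y hy) hM')) (abs_nonneg _)

/-- A priori bounds for solutions on a large cylinder, on a smaller one. -/
theorem exists_local_estimate (ha : ∀ i j, LocHolder (a i j)) (hb : ∀ i, LocHolder (b i))
    (hsymm : ∀ i j x, a i j x = a j i x)
    (hell : ∀ x ν : Euc d, ν ≠ 0 → 0 < ∑ i, ∑ j, a i j x * ν i * ν j)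
    (hβ : LocHolder β) (hα : LocHolder α) (hp : 1 ≤ p) (hR : 0 ≤ R) {M : ℝ} (hM : 0 ≤ M) :
    ∃ κ N : ℝ, 0 < κ ∧ 0 ≤ N ∧ ∀ (z : Euc d → ℝ → ℝ) (κ' N' : ℝ), 0 < κ' → 0 ≤ N' →
      HolderSolOn univ κ' R N' z →
      SolvesOn (Metric.ball 0 (R + 1)) R a b (fun x t => β x * z x t - α x * z x t ^ p) z →
      (∀ x, z x 0 = 0) → (∀ x ∈ Metric.ball 0 (R + 1), ∀ t ∈ Icc 0 R, z x t ∈ Icc 0 M) →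
      ∀ c ∈ Metric.ball (0 : Euc d) R, HolderSolOn (Metric.ball c (1 / 2)) κ R N z := by
  obtain ⟨κ, κ0, lam, Λ, hκ, hκ0, hκ1, hl, hΛ, hE, hBβ, hBα⟩ :=
    exists_local_bounds ha hb hsymm hell hβ hα (R + 1)
  have hM' : 0 ≤ Λ * (p * M ^ (p - 1)) :=
    mul_nonneg hΛ (mul_nonneg (by linarith) (Real.rpow_nonneg hM _))
  have hF : 0 ≤ Λ * M + Λ * M ^ p :=
    add_nonneg (mul_nonneg hΛ hM) (mul_nonneg hΛ (Real.rpow_nonneg hM _))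
  obtain ⟨C, hC, hest⟩ := exists_interior_estimate (T := R) d hl (add_nonneg hΛ hM') hκ hκ0 hκ1 hR
  refine ⟨κ, C * (Λ * M + Λ * M ^ p + M), hκ, mul_nonneg hC (add_nonneg hF hM),
    fun z κ' N' hκ' hN' hz hsol hz0 hzM c hc => ?_⟩
  have hsub : Metric.ball c 1 ⊆ Metric.ball 0 (R + 1) := Metric.ball_subset_ball' (by
    linarith [Metric.mem_ball.1 hc])
  have hsub' := hsub.trans Metric.ball_subset_closedBall
  have hE' := (hE.mono hsub').weaken le_rfl (le_add_of_nonneg_right hM' : Λ ≤ _)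
  refine hest c a b hE' _ z κ' N' _ M hκ' hN' hz (hsol.restrict le_rfl hsub) hz0 hF hM
    (fun x hx t ht => ?_) ((hBβ.mono hsub').semiSource (hBα.mono hsub') hp hM hΛ
      (fun x hx t ht => (hsol x (hsub hx) t ht).continuousWithinAt)
      fun x hx => hzM x (hsub hx))
  rw [abs_of_nonneg (hzM x (hsub hx) t ht).1]
  exact (hzM x (hsub hx) t ht).2

/-- There is a classical solution above every subsolution dominated by a supersolution. -/
theorem SubSuper.exists_classicalSol {w v : Euc d → ℝ → ℝ} (h : SubSuper a b β α p w v)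
    (ha : ∀ i j, LocHolder (a i j)) (hb : ∀ i, LocHolder (b i))
    (hsymm : ∀ i j x, a i j x = a j i x)
    (hell : ∀ x ν : Euc d, ν ≠ 0 → 0 < ∑ i, ∑ j, a i j x * ν i * ν j)
    (hβ : LocHolder β) (hα : LocHolder α) (hα0 : ∀ x, 0 ≤ α x) {c : ℝ} (hc : 0 ≤ c)
    (hβc : ∀ x, β x ≤ c) (hp : 1 ≤ p) :
    ∃ z, ClassicalSol a b β α p z ∧ ∀ x t, 0 ≤ t → w x t ≤ z x t := by
  have happ := fun n : ℕ => h.exists_approx ha hb hsymm hell hβ hα hα0 hc hβc hp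
    (R := n + 1) (ε := 1 / (n + 1)) (by positivity) (by positivity)
    ((div_le_one (by positivity)).2 (by linarith [n.cast_nonneg (α := ℝ)]))
  choose κ N z hκ hN hz hsol hz0 hzb using happ
  let l : Ultrafilter ℕ := hyperfilter ℕ
  have hl : (l : Filter ℕ) ≤ atTop := by
    rw [← Nat.cofinite_eq_atTop]; exact hyperfilter_le_cofinite
  have hlarge : ∀ R : ℝ, ∀ᶠ n : ℕ in (l : Filter ℕ), R < n + 1 := fun R =>
    hl ((tendsto_natCast_atTop_atTop.eventually_ge_atTop R).mono fun n hn => by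
      linarith)
  have hbd : ∀ (x : Euc d) (t : ℝ), 0 ≤ t → ∀ᶠ n : ℕ in (l : Filter ℕ),
      0 ≤ z n x t ∧ w x t - 1 / (n + 1) ≤ z n x t ∧ z n x t ≤ v x t + 1 := fun x t ht => by
    filter_upwards [hlarge ‖x‖, hlarge t] with n h1 h2
    obtain ⟨g1, g2, g3⟩ := hzb n x (mem_ball_zero_iff.2 h1) t ⟨ht, h2.le⟩
    have : (1 : ℝ) / (n + 1) ≤ 1 :=
      (div_le_one (by positivity)).2 (by linarith [n.cast_nonneg (α := ℝ)])
    exact ⟨g1, g2, by linarith⟩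
  have hlim : ∀ (x : Euc d) (t : ℝ), ∃ L, 0 ≤ t → Tendsto (fun n => z n x t) l (𝓝 L) :=
    fun x t => by
      by_cases ht : 0 ≤ t
      · obtain ⟨L, hL⟩ := exists_ultralimit l (g := fun n => z n x t) (N := v x t + 1)
          ((hbd x t ht).mono fun n hn => by
            rw [Real.norm_of_nonneg hn.1]
            exact hn.2.2)
        exact ⟨L, fun _ => hL⟩
      · exact ⟨0, fun h => absurd h ht⟩
  choose Z hZ using hlim
  refine ⟨Z, ClassicalSol.of_ultralimit l hp hz0 hZ fun R hR => ?_, fun x t ht => ?_⟩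
  · obtain ⟨M', hM'⟩ := ((isCompact_closedBall (0 : Euc d) (R + 1)).prod
      (isCompact_Icc (a := (0 : ℝ)) (b := R))).exists_bound_of_continuousOn
      (h.super_cont.mono (prod_mono (subset_univ _) fun t ht => ht.1))
    have hM0 : 0 ≤ M' := (norm_nonneg _).trans
      (hM' (0, 0) ⟨Metric.mem_closedBall_self (by linarith), le_rfl, hR.le⟩)
    obtain ⟨κ₁, N₁, hκ₁, hN₁, hest⟩ := exists_local_estimate ha hb hsymm hell hβ hα hp hR.le
      (M := M' + 1) (by linarith)
    refine ⟨κ₁, N₁, hκ₁, hN₁, fun c hc => ?_⟩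
    filter_upwards [hlarge (R + 1)] with n hn
    have hsub : Metric.ball (0 : Euc d) (R + 1) ⊆ Metric.ball 0 (n + 1) :=
      Metric.ball_subset_ball hn.le
    have hsubc : Metric.ball c (1 / 2) ⊆ Metric.ball 0 (R + 1) := Metric.ball_subset_ball' (by
      linarith [Metric.mem_ball.1 hc])
    have hI : ∀ x ∈ Metric.ball (0 : Euc d) (R + 1), ∀ t ∈ Icc 0 R, z n x t ∈ Icc 0 (M' + 1) :=
      fun x hx t ht => by
        obtain ⟨g1, -, g3⟩ := hzb n x (hsub hx) t ⟨ht.1, by linarith [ht.2]⟩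
        have e1 : (1 : ℝ) / (n + 1) ≤ 1 :=
          (div_le_one (by positivity)).2 (by linarith [n.cast_nonneg (α := ℝ)])
        have e2 := (le_abs_self _).trans (hM' (x, t) ⟨Metric.ball_subset_closedBall hx, ht⟩)
        simp only at e2
        exact ⟨g1, by linarith⟩
    have hs := (hsol n).restrict (by linarith : R ≤ n + 1) hsub
    exact ⟨fun x hx t ht => (hI x (hsubc hx) t ht).1,
      hest (z n) (κ n) (N n) (hκ n) (hN n) ((hz n).restrict_time (by linarith)) hs (hz0 n) hI c hc,
      hs.restrict le_rfl hsubc⟩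
  · have h0 : Tendsto (fun n : ℕ => w x t - 1 / ((n : ℝ) + 1)) l (𝓝 (w x t)) := by
      simpa using ((tendsto_one_div_add_atTop_nhds_zero_nat (𝕜 := ℝ)).const_sub (w x t)).mono_left
        hl
    exact le_of_tendsto_of_tendsto h0 (hZ x t ht) ((hbd x t ht).mono fun n hn => hn.2.1)

theorem ell_mul_time (g : ℝ → ℝ) (u : Euc d → ℝ → ℝ) (x : Euc d) (t : ℝ) :
    ell a b (fun x t => g t * u x t) x t = g t * ell a b u x t := opL_const_mul (g t) x

theorem ClassicalSol.subSuper {β' : Euc d → ℝ} {u : Euc d → ℝ → ℝ} (hu : ClassicalSol a b β α p u)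
    (hα0 : ∀ x, 0 ≤ α x) (hp : 1 ≤ p) {B : ℝ} (hB : 0 ≤ B) (hββ : ∀ x, |β x - β' x| ≤ B) :
    SubSuper a b β' α p (fun x t => Real.exp (-(B * t)) * u x t)
      (fun x t => Real.exp (B * t) * u x t) := by
  have hle : ∀ t, 0 ≤ t → Real.exp (-(B * t)) ≤ 1 := fun t ht =>
    Real.exp_le_one_iff.2 (neg_nonpos.2 (mul_nonneg hB ht))
  have hge : ∀ t, 0 ≤ t → 1 ≤ Real.exp (B * t) := fun t ht => Real.one_le_exp (mul_nonneg hB ht)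
  refine ⟨ContinuousOn.mul (by fun_prop) hu.cont, ContinuousOn.mul (by fun_prop) hu.cont,
    fun t ht => contDiff_const.mul (hu.smooth t ht), fun t ht => contDiff_const.mul (hu.smooth t ht),
    fun x t ht => mul_nonneg (Real.exp_pos _).le (hu.nonneg x t ht),
    fun x t ht => mul_le_mul_of_nonneg_right ((hle t ht).trans (hge t ht)) (hu.nonneg x t ht),
    fun x => by simp only [hu.init, mul_zero], fun x t ht => ?_, fun x t ht => ?_⟩
  · have h1 : HasDerivAt (fun t => Real.exp (-(B * t))) (Real.exp (-(B * t)) * -(B * 1)) t :=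
      ((hasDerivAt_id t).const_mul B).neg.exp
    refine ⟨_, h1.mul (hu.deriv x t ht), ?_⟩
    rw [ell_mul_time fun t => Real.exp (-(B * t))]
    set e := Real.exp (-(B * t))
    have he : 0 ≤ e := (Real.exp_pos _).le
    have hut := hu.nonneg x t ht.le
    have h2 : (e * u x t) ^ p ≤ e * u x t ^ p := by
      rw [Real.mul_rpow he hut]
      refine mul_le_mul_of_nonneg_right ?_ (Real.rpow_nonneg hut p)
      exact Real.rpow_le_self_of_le_one he (hle t ht.le) hp
    have h3 := mul_le_mul_of_nonneg_left h2 (hα0 x)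
    have h4 := mul_le_mul_of_nonneg_right (abs_le.1 (hββ x)).2 (mul_nonneg he hut)
    linarith
  · have h1 : HasDerivAt (fun t => Real.exp (B * t)) (Real.exp (B * t) * (B * 1)) t :=
      ((hasDerivAt_id t).const_mul B).exp
    refine ⟨_, h1.mul (hu.deriv x t ht), ?_⟩
    rw [ell_mul_time fun t => Real.exp (B * t)]
    set e := Real.exp (B * t)
    have he : 0 ≤ e := (Real.exp_pos _).le
    have hut := hu.nonneg x t ht.le
    have h2 : e * u x t ^ p ≤ (e * u x t) ^ p := by
      rw [Real.mul_rpow he hut]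
      refine mul_le_mul_of_nonneg_right ?_ (Real.rpow_nonneg hut p)
      exact Real.self_le_rpow_of_one_le (hge t ht.le) hp
    have h3 := mul_le_mul_of_nonneg_left h2 (hα0 x)
    have h4 := mul_le_mul_of_nonneg_right (abs_le.1 (hββ x)).1 (mul_nonneg he hut)
    linarith

theorem UniqueZeroSol.of_bounded_change (ha : ∀ i j, LocHolder (a i j))
    (hb : ∀ i, LocHolder (b i)) (hsymm : ∀ i j x, a i j x = a j i x)
    (hell : ∀ x ν : Euc d, ν ≠ 0 → 0 < ∑ i, ∑ j, a i j x * ν i * ν j)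
    (hα : LocHolder α) (hα0 : ∀ x, 0 ≤ α x) (hp : 1 ≤ p) {β' : Euc d → ℝ} (hβ' : LocHolder β')
    (hβ'_bdd : ∃ M, ∀ x, β' x ≤ M) (hdiff : ∃ B, ∀ x, |β x - β' x| ≤ B)
    (h : UniqueZeroSol a b β' α p) : UniqueZeroSol a b β α p := by
  obtain ⟨c, hc⟩ := hβ'_bdd
  obtain ⟨B, hB⟩ := hdiff
  rw [uniqueZeroSol_iff] at h ⊢
  intro u hu x t ht
  have hS := hu.subSuper hα0 hp ((abs_nonneg _).trans (hB 0)) hB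
  obtain ⟨z, hz, hwz⟩ := hS.exists_classicalSol ha hb hsymm hell hβ' hα hα0 (le_max_right c (0 : ℝ))
    (fun x => (hc x).trans (le_max_left c 0)) hp
  have h1 := hwz x t ht
  rw [h z hz x t ht] at h1
  exact le_antisymm (nonpos_of_mul_nonpos_right h1 (Real.exp_pos _)) (hu.nonneg x t ht)

end Comparison

/-- Theorem 2: a bounded change of `β` does not affect uniqueness
for `u_t = Lu + βu − αu^p` with zero initial data. -/
theorem stmt_9 {d : ℕ} (hd : 1 ≤ d) (p : ℝ) (hp1 : 1 < p) (hp2 : p ≤ 2)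
    (a : Fin d → Fin d → EuclideanSpace ℝ (Fin d) → ℝ)
    (b : Fin d → EuclideanSpace ℝ (Fin d) → ℝ)
    (ha_holder : ∀ i j, LocHolder (a i j))
    (hb_holder : ∀ i, LocHolder (b i))
    (ha_symm : ∀ i j x, a i j x = a j i x)
    (ha_ell : ∀ (x ν : EuclideanSpace ℝ (Fin d)), ν ≠ 0 →
      0 < ∑ i, ∑ j, a i j x * ν i * ν j)
    (α β₁ β₂ : EuclideanSpace ℝ (Fin d) → ℝ)
    (hα_holder : LocHolder α) (hα_pos : ∀ x, 0 < α x)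
    (hβ₁_holder : LocHolder β₁) (hβ₂_holder : LocHolder β₂)
    (hβ₁_bdd : ∃ M : ℝ, ∀ x, β₁ x ≤ M)
    (hβ₂_bdd : ∃ M : ℝ, ∀ x, β₂ x ≤ M)
    (hdiff_bdd : ∃ B : ℝ, ∀ x, |β₁ x - β₂ x| ≤ B) :
    UniqueZeroSol a b β₁ α p ↔ UniqueZeroSol a b β₂ α p := by
  obtain ⟨B, hB⟩ := hdiff_bdd
  have hα0 : ∀ x, 0 ≤ α x := fun x => (hα_pos x).le
  exact ⟨UniqueZeroSol.of_bounded_change ha_holder hb_holder ha_symm ha_ell hα_holder hα0 hp1.le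
      hβ₁_holder hβ₁_bdd ⟨B, fun x => by rw [abs_sub_comm]; exact hB x⟩,
    UniqueZeroSol.of_bounded_change ha_holder hb_holder ha_symm ha_ell hα_holder hα0 hp1.le
      hβ₂_holder hβ₂_bdd ⟨B, hB⟩⟩
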